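/- Let ± be a choice of sign, let S be a finite set of primes, and for each p ∈ S let σ_p be a splitting type in {(111),(12),(3),(1²1),(1³)}. Then there are infinitely many cubic fields K, not Galois over ℚ, such that ±Δ(K) > 0, the splitting type of p in K equals σ_p for every p ∈ S, and ζ_K(1/2) < 0. -/

import Mathlib

open scoped Classical
noncomputable section

/-- The Dedekind zeta series of a number field `K`: `∑ N(I)^{-s}` over nonzero ideals `I`
of the ring of integers, convergent for `Re s > 1`. -/
def dedekindSeries (K : Type*) [Field K] [NumberField K] (s : ℂ) : ℂ :=
  ∑' I : {I : Ideal (NumberField.RingOfIntegers K) // I ≠ ⊥},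
    (Ideal.absNorm I.1 : ℂ) ^ (-s)

/-- `g` is (the) analytic continuation of the Dedekind zeta function of `K`. -/
def IsDedekindZeta (K : Type*) [Field K] [NumberField K] (g : ℂ → ℂ) : Prop :=
  DifferentiableOn ℂ g {(1 : ℂ)}ᶜ ∧ ∀ s : ℂ, 1 < s.re → g s = dedekindSeries K s

/-- The five splitting types of a prime in a cubic field. -/
inductive SplitType : Type
  | t111 | t12 | t3 | t121 | t13

/-- `HasSplitType K p τ` : the prime `p` has splitting type `τ` in the cubic field `K`,
expressed through the factorization of `p·O_K` into prime ideals, residue degrees being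
recorded by absolute norms. -/
def HasSplitType (K : Type*) [Field K] [NumberField K] (p : ℕ) : SplitType → Prop
  | SplitType.t111 => ∃ P₁ P₂ P₃ : Ideal (NumberField.RingOfIntegers K),
      P₁.IsPrime ∧ P₂.IsPrime ∧ P₃.IsPrime ∧ P₁ ≠ P₂ ∧ P₁ ≠ P₃ ∧ P₂ ≠ P₃ ∧
      Ideal.absNorm P₁ = p ∧ Ideal.absNorm P₂ = p ∧ Ideal.absNorm P₃ = p ∧
      Ideal.span {(p : NumberField.RingOfIntegers K)} = P₁ * P₂ * P₃
  | SplitType.t12 => ∃ P₁ P₂ : Ideal (NumberField.RingOfIntegers K),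
      P₁.IsPrime ∧ P₂.IsPrime ∧ P₁ ≠ P₂ ∧
      Ideal.absNorm P₁ = p ∧ Ideal.absNorm P₂ = p ^ 2 ∧
      Ideal.span {(p : NumberField.RingOfIntegers K)} = P₁ * P₂
  | SplitType.t3 => ∃ P : Ideal (NumberField.RingOfIntegers K),
      P.IsPrime ∧ Ideal.absNorm P = p ^ 3 ∧
      Ideal.span {(p : NumberField.RingOfIntegers K)} = P
  | SplitType.t121 => ∃ P₁ P₂ : Ideal (NumberField.RingOfIntegers K),
      P₁.IsPrime ∧ P₂.IsPrime ∧ P₁ ≠ P₂ ∧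
      Ideal.absNorm P₁ = p ∧ Ideal.absNorm P₂ = p ∧
      Ideal.span {(p : NumberField.RingOfIntegers K)} = P₁ ^ 2 * P₂
  | SplitType.t13 => ∃ P : Ideal (NumberField.RingOfIntegers K),
      P.IsPrime ∧ Ideal.absNorm P = p ∧
      Ideal.span {(p : NumberField.RingOfIntegers K)} = P ^ 3

set_option linter.unusedSectionVars false
set_option linter.overlappingInstances false

namespace CubicZeta
open scoped Real Complex NumberField
open Real (norm_eq_abs rpow_neg rpow_natCast exp exp_add exp_le_exp pi_pos sqrt exp_pos log exp_log log_pow log_mul log_inv exp_sum exp_nat_mul sqrt_mul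
  sqrt_sq sqrt_pos exp_sub norm_of_nonneg exp_neg sqrt_eq_rpow sq_sqrt smoothTransition exp_mul log_exp rpow_add rpow_mul log_div sqrt_nonneg sqrt_le_sqrt mul_rpow log_nonneg)
open Finset (sum_congr mul_sum)
open Complex (I)
open Function (Injective Surjective)
open ENNReal (ofReal)
open UniqueFactorizationMonoid (normalizedFactors)

section
open MeasureTheory Set UnitAddTorus

/-- Integer vectors as real vectors. -/
def intVec {d : Type*} (n : d → ℤ) : d → ℝ := fun i => (n i : ℝ)

lemma norm_intVec {d : Type*} [Fintype d] (n : d → ℤ) : ‖intVec n‖ = ‖n‖ := by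
  simp only [intVec, Pi.norm_def]
  congr 1

lemma summable_one_add_norm_pow {d : Type*} [Fintype d] (k : ℕ) (hk : Fintype.card d < k) :
    Summable fun n : d → ℤ => ((1 + ‖intVec n‖) ^ k)⁻¹ := by
  set b := Pi.basisFun ℝ d
  let L := Submodule.span ℤ (Set.range b)
  have hfr : Module.finrank ℤ L < k := by
    have := Module.finrank_eq_card_basis (b.restrictScalars ℤ)
    rw [this]; exact hk
  have h := ZLattice.summable_norm_pow_inv (L := L) k hfr
  have hmem : ∀ n : d → ℤ, intVec n ∈ L := by
    intro n
    have : intVec n = ∑ i, n i • b i := by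
      ext j
      simp [intVec, b, Finset.sum_apply, Pi.single_apply]
    rw [this]
    exact Submodule.sum_mem _ fun i _ => Submodule.smul_mem _ _ (Submodule.subset_span ⟨i, rfl⟩)
  have hinj : Injective (fun n : d → ℤ => (⟨intVec n, hmem n⟩ : L)) := by
    intro m n hmn
    have := congrArg Subtype.val hmn
    ext i
    have := congrFun this i
    simpa [intVec] using this
  have h2 := h.comp_injective hinj
  have h3 : Summable fun n : d → ℤ => (‖intVec n‖ ^ k)⁻¹ + (if n = 0 then 1 else 0) := by
    refine Summable.add (by simpa [Function.comp_def] using h2) ?_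
    exact summable_of_ne_finset_zero (s := {0}) (by intro b hb; simp at hb; simp [hb])
  refine Summable.of_nonneg_of_le (fun n => by positivity) (fun n => ?_) h3
  by_cases hn : n = 0
  · subst hn
    have : ‖intVec (0 : d → ℤ)‖ = 0 := by rw [norm_intVec]; simp
    rw [this]; simp
  · have : 0 < ‖intVec n‖ := by rw [norm_intVec]; exact norm_pos_iff.2 hn
    simp only [hn, if_false, add_zero]
    gcongr
    linarith

variable {d : Type*} [Fintype d]

/-- The pointwise periodisation of a function on `ℝ^d`. -/
lemma periodisation_continuous {f : (d → ℝ) → ℂ} (hc : Continuous f)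
    (hb : ∀ R : ℝ, ∃ u : (d → ℤ) → ℝ, Summable u ∧ ∀ n x, ‖x‖ ≤ R → ‖f (x + intVec n)‖ ≤ u n) :
    Continuous fun x => ∑' n, f (x + intVec n) := by
  rw [continuous_iff_continuousAt]
  intro x
  obtain ⟨u, hu, hbd⟩ := hb (‖x‖ + 1)
  have : ContinuousOn (fun x => ∑' n, f (x + intVec n)) (Metric.ball x 1) := by
    refine continuousOn_tsum (fun n => by fun_prop) hu ?_
    intro n y hy
    apply hbd
    have := norm_le_norm_add_norm_sub' y x
    rw [Metric.mem_ball, dist_eq_norm] at hy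
    linarith
  exact this.continuousAt (Metric.ball_mem_nhds x one_pos)

/-- The Fourier kernel. -/
def eKer (m : d → ℤ) (x : d → ℝ) : ℂ := cexp (-2 * π * I * ∑ i, (m i : ℂ) * x i)

lemma mFourier_coe (m : d → ℤ) (x : d → ℝ) :
    mFourier (-m) (fun i => (x i : UnitAddCircle)) = eKer m x := by
  simp only [mFourier, ContinuousMap.coe_mk, eKer, fourier_coe_apply, mul_sum]
  rw [← Complex.exp_sum]
  congr 1
  refine sum_congr rfl fun i _ => ?_
  simp; ring

lemma eKer_add_int (m n : d → ℤ) (x : d → ℝ) : eKer m (x + intVec n) = eKer m x := by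
  rw [← mFourier_coe, ← mFourier_coe]
  congr 1
  ext i
  simp [intVec]

lemma norm_eKer (m : d → ℤ) (x : d → ℝ) : ‖eKer m x‖ = 1 := by
  unfold eKer
  rw [show (-2 * (π:ℂ) * I * ∑ i, (m i : ℂ) * x i) = ((-2 * π * ∑ i, (m i : ℝ) * x i : ℝ) : ℂ) * I by push_cast; ring]
  exact Complex.norm_exp_ofReal_mul_I _

lemma continuous_eKer (m : d → ℤ) : Continuous (eKer m) := by
  unfold eKer; fun_prop

/-- Half-open unit boxes. -/
def box (n : d → ℤ) : Set (d → ℝ) := {x | ∀ i, x i ∈ Ioc (n i : ℝ) (n i + 1)}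

lemma measurableSet_box (n : d → ℤ) : MeasurableSet (box n) :=
  MeasurableSet.univ_pi' (fun _ => measurableSet_Ioc)

lemma iUnion_box : ⋃ n : d → ℤ, box n = univ := by
  ext x
  simp only [mem_iUnion, mem_univ, iff_true]
  refine ⟨fun i => ⌈x i⌉ - 1, fun i => ?_⟩
  have h1 := Int.ceil_lt_add_one (x i)
  have h2 := Int.le_ceil (x i)
  constructor <;> push_cast <;> linarith

lemma pairwise_disjoint_box : Pairwise (Function.onFun Disjoint (box (d := d))) := by
  intro m n hmn
  rw [Function.onFun, Set.disjoint_left]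
  intro x hm hn
  apply hmn
  ext i
  have h1 := hm i
  have h2 := hn i
  have a1 : (m i : ℝ) < n i + 1 := by linarith [h1.1, h2.2]
  have a2 : (n i : ℝ) < m i + 1 := by linarith [h1.2, h2.1]
  have a3 : m i < n i + 1 := by exact_mod_cast a1
  have a4 : n i < m i + 1 := by exact_mod_cast a2
  omega

lemma setIntegral_box (n : d → ℤ) (g : (d → ℝ) → ℂ) :
    ∫ x in box n, g x = ∫ x in box (0 : d → ℤ), g (x + intVec n) := by
  have hp : MeasurePreserving (fun x : d → ℝ => x + intVec n) volume volume :=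
    measurePreserving_add_right _ _
  have he : MeasurableEmbedding (fun x : d → ℝ => x + intVec n) := measurableEmbedding_addRight _
  rw [← hp.setIntegral_preimage_emb he]
  congr 2
  ext x
  simp only [box, mem_preimage, mem_ofPred_eq, Pi.add_apply, intVec, Pi.zero_apply, Int.cast_zero]
  refine forall_congr' fun i => ?_
  simp only [mem_Ioc]
  constructor <;> rintro ⟨h1, h2⟩ <;> constructor <;> linarith

/-- Multi-dimensional Poisson summation. -/
lemma poisson_summation {f : (d → ℝ) → ℂ} (hc : Continuous f) (hi : Integrable f)
    (hb : ∀ R : ℝ, ∃ u : (d → ℤ) → ℝ, Summable u ∧ ∀ n x, ‖x‖ ≤ R → ‖f (x + intVec n)‖ ≤ u n)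
    (hF : Summable fun m : d → ℤ => ∫ x, eKer m x * f x) :
    ∑' n : d → ℤ, f (intVec n) = ∑' m : d → ℤ, ∫ x, eKer m x * f x := by
  set g : (d → ℝ) → ℂ := fun x => ∑' n, f (x + intVec n) with hg
  have gc : Continuous g := periodisation_continuous hc hb
  have gper : ∀ x (k : d → ℤ), g (x + intVec k) = g x := by
    intro x k
    simp only [hg]
    rw [← (Equiv.addLeft k).tsum_eq (fun n => f (x + intVec n))]
    refine tsum_congr fun n => ?_
    congr 1
    ext i; simp [intVec]; ring
  let ρ : (d → ℝ) → UnitAddTorus d := fun x i => (x i : UnitAddCircle)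
  have hρ : IsOpenQuotientMap ρ :=
    IsOpenQuotientMap.piMap (fun i => QuotientAddGroup.isOpenQuotientMap_mk)
  let F0 : UnitAddTorus d → ℂ := fun t => g (fun i => (AddCircle.equivIco 1 0 (t i)).1)
  have hF0 : ∀ x, F0 (ρ x) = g x := by
    intro x
    simp only [F0, ρ]
    have : (fun i => ((AddCircle.equivIco (1:ℝ) 0 (x i : UnitAddCircle)).1 : ℝ)) = x + intVec (fun i => - ⌊x i⌋) := by
      ext i
      rw [AddCircle.coe_equivIco_mk_apply]
      have := Int.self_sub_floor (x i)
      simp only [div_one, mul_one, Pi.add_apply, intVec, Int.cast_neg]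
      linarith
    rw [this, gper]
  have hF0c : Continuous F0 := by
    rw [hρ.isQuotientMap.continuous_iff]
    exact gc.congr fun x => (hF0 x).symm
  let F : C(UnitAddTorus d, ℂ) := ⟨F0, hF0c⟩
  have hcoef : ∀ m, mFourierCoeff F m = ∫ x, eKer m x * f x := by
    intro m
    rw [mFourierCoeff_eq_integral F m 0]
    have e1 : ∀ x : d → ℝ, mFourier (-m) (fun i => (x i : UnitAddCircle)) • F (fun i => (x i : UnitAddCircle))
        = ∑' n, eKer m (x + intVec n) * f (x + intVec n) := by
      intro x
      rw [mFourier_coe, smul_eq_mul]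
      have : F (fun i => (x i : UnitAddCircle)) = g x := hF0 x
      rw [this, hg, ← tsum_mul_left]
      simp only [eKer_add_int]
    simp_rw [e1]
    have e2 : {x : d → ℝ | ∀ i, x i ∈ Ioc ((0 : d → ℝ) i) ((0 : d → ℝ) i + 1)} = box (0 : d → ℤ) := by
      ext x; simp [box]
    rw [e2]
    have hint : Integrable (fun x => eKer m x * f x) := by
      refine hi.bdd_mul (c := 1) (continuous_eKer m).aestronglyMeasurable ?_
      exact .of_forall fun x => (norm_eKer m x).le
    have hvol : volume (box (0 : d → ℤ)) ≠ ⊤ := by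
      have : box (0 : d → ℤ) ⊆ Icc 0 1 := by
        intro x hx
        constructor <;> intro i <;> have := hx i <;> simp at this ⊢ <;> linarith
      exact ((measure_mono this).trans_lt isCompact_Icc.measure_lt_top).ne
    obtain ⟨u, hu, hbd⟩ := hb 1
    have hbd' : ∀ n, ∀ x ∈ box (0 : d → ℤ), ‖eKer m (x + intVec n) * f (x + intVec n)‖ ≤ u n := by
      intro n x hx
      rw [norm_mul, norm_eKer, one_mul]
      apply hbd
      rw [pi_norm_le_iff_of_nonneg zero_le_one]
      intro i
      have := hx i
      simp at this
      rw [norm_eq_abs, abs_le]; constructor <;> linarith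
    rw [← integral_tsum_of_summable_integral_norm]
    · have := hasSum_integral_iUnion (μ := volume) (f := fun x => eKer m x * f x) measurableSet_box pairwise_disjoint_box hint.integrableOn
      rw [iUnion_box, setIntegral_univ] at this
      rw [← this.tsum_eq]
      exact tsum_congr fun n => (setIntegral_box n fun x => eKer m x * f x).symm
    · intro n
      have hcont : Continuous fun x => eKer m (x + intVec n) * f (x + intVec n) := by
        have := continuous_eKer m
        fun_prop
      refine Measure.integrableOn_of_bounded (M := u n) hvol hcont.aestronglyMeasurable ?_
      exact (ae_restrict_iff' (measurableSet_box 0)).2 (.of_forall fun x hx => hbd' n x hx)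
    · refine Summable.of_nonneg_of_le (fun n => integral_nonneg fun x => norm_nonneg _) (fun n => ?_) (hu.mul_right (volume.real (box (0 : d → ℤ))))
      have := norm_setIntegral_le_of_norm_le_const (μ := volume) (s := box (0 : d → ℤ)) (f := fun x => ‖eKer m (x + intVec n) * f (x + intVec n)‖) (C := u n) hvol.lt_top
        (fun x hx => by rw [norm_norm]; exact hbd' n x hx)
      exact (Real.le_norm_self _).trans this
  have hs : Summable (mFourierCoeff F) := by
    simpa [funext hcoef] using hF
  have := hasSum_mFourier_series_apply_of_summable hs 0
  have h0 : F 0 = ∑' n, f (intVec n) := by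
    have : F (ρ 0) = g 0 := hF0 0
    have h1 : ρ 0 = 0 := by ext i; simp [ρ]
    rw [h1] at this
    rw [this]; simp [hg]
  rw [← h0, ← this.tsum_eq]
  refine tsum_congr fun m => ?_
  rw [hcoef]
  simp [mFourier]

end

section
open MeasureTheory Set
open scoped Matrix

variable {d : Type*} [Fintype d]

lemma decay_translate {f : (d → ℝ) → ℂ} {C : ℝ} {k : ℕ} (hk : Fintype.card d < k)
    (hf : ∀ x, ‖f x‖ ≤ C * ((1 + ‖x‖) ^ k)⁻¹) :
    ∀ R : ℝ, ∃ u : (d → ℤ) → ℝ, Summable u ∧ ∀ n x, ‖x‖ ≤ R → ‖f (x + intVec n)‖ ≤ u n := by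
  intro R
  have hC : 0 ≤ C := by
    have := (norm_nonneg _).trans (hf 0)
    simpa using this
  refine ⟨fun n => C * (1 + |R|) ^ k * ((1 + ‖intVec n‖) ^ k)⁻¹, (summable_one_add_norm_pow k hk).mul_left _, ?_⟩
  intro n x hx
  refine (hf _).trans ?_
  beta_reduce
  rw [mul_assoc]
  refine mul_le_mul_of_nonneg_left ?_ hC
  rw [← div_eq_mul_inv, le_div_iff₀ (by positivity), inv_mul_le_iff₀ (by positivity), ← mul_pow]
  refine pow_le_pow_left₀ (by positivity) ?_ k
  have h1 : ‖intVec n‖ ≤ ‖x + intVec n‖ + ‖x‖ := by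
    have := norm_sub_le (x + intVec n) x
    simpa using this
  have h2 : R ≤ |R| := le_abs_self R
  nlinarith [norm_nonneg (x + intVec n), abs_nonneg R]

lemma decay_integrable {f : (d → ℝ) → ℂ} (hc : Continuous f) {C : ℝ} {k : ℕ} (hk : Fintype.card d < k)
    (hf : ∀ x, ‖f x‖ ≤ C * ((1 + ‖x‖) ^ k)⁻¹) : Integrable f := by
  have h := integrable_one_add_norm (E := d → ℝ) (μ := volume) (r := k) (by simpa using hk)
  refine (h.const_mul C).mono' hc.aestronglyMeasurable (.of_forall fun x => ?_)
  refine (hf x).trans (le_of_eq ?_)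
  rw [rpow_neg (by positivity), rpow_natCast]

lemma poisson_of_decay {f : (d → ℝ) → ℂ} (hc : Continuous f) {C : ℝ} {k : ℕ} (hk : Fintype.card d < k)
    (hf : ∀ x, ‖f x‖ ≤ C * ((1 + ‖x‖) ^ k)⁻¹) (hF : Summable fun m : d → ℤ => ∫ x, eKer m x * f x) :
    ∑' n : d → ℤ, f (intVec n) = ∑' m : d → ℤ, ∫ x, eKer m x * f x :=
  poisson_summation hc (decay_integrable hc hk hf) (decay_translate hk hf) hF

lemma exp_neg_sq_le (c : ℝ) (hc : 0 < c) (k : ℕ) :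
    ∃ C : ℝ, ∀ t : ℝ, 0 ≤ t → exp (-c * t ^ 2) ≤ C * ((1 + t) ^ k)⁻¹ := by
  refine ⟨exp (c / 2) * (Nat.factorial k * (exp 1 / 1) * (max 1 (2 / c)) ^ k), fun t ht => ?_⟩
  have h1 : (1 + t) ^ k ≤ (max 1 (2 / c)) ^ k * (Nat.factorial k * exp (1 + c / 2 * t)) := by
    have hm : 1 + t ≤ max 1 (2 / c) * (1 + c / 2 * t) := by
      have a := le_max_left 1 (2 / c)
      have b := le_max_right 1 (2 / c)
      have : t = 2 / c * (c / 2 * t) := by field_simp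
      nlinarith [mul_le_mul_of_nonneg_right b (show 0 ≤ c / 2 * t by positivity)]
    calc (1 + t) ^ k ≤ (max 1 (2 / c) * (1 + c / 2 * t)) ^ k := pow_le_pow_left₀ (by positivity) hm k
      _ = (max 1 (2 / c)) ^ k * (1 + c / 2 * t) ^ k := mul_pow _ _ _
      _ ≤ _ := by
        refine mul_le_mul_of_nonneg_left ?_ (by positivity)
        have := Real.pow_div_factorial_le_exp (1 + c / 2 * t) (by positivity) k
        rw [div_le_iff₀ (by positivity)] at this
        linarith
  rw [← div_eq_mul_inv, le_div_iff₀ (by positivity)]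
  calc exp (-c * t ^ 2) * (1 + t) ^ k
      ≤ exp (-c * t ^ 2) * ((max 1 (2 / c)) ^ k * (Nat.factorial k * exp (1 + c / 2 * t))) := by gcongr
    _ = (max 1 (2 / c)) ^ k * Nat.factorial k * exp (-c * t ^ 2 + (1 + c / 2 * t)) := by
        rw [exp_add (-c * t ^ 2)]; ring
    _ ≤ (max 1 (2 / c)) ^ k * Nat.factorial k * exp (c / 2 + 1) := by
        refine mul_le_mul_of_nonneg_left (exp_le_exp.2 ?_) (by positivity)
        nlinarith [sq_nonneg (t - 1), sq_nonneg t, mul_nonneg hc.le (sq_nonneg (t - 1)), mul_nonneg hc.le (sq_nonneg t)]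
    _ = _ := by rw [exp_add]; ring

lemma integral_comp_mulVec [DecidableEq d] (B : Matrix d d ℝ) (hB : B.det ≠ 0) (g : (d → ℝ) → ℂ) :
    ∫ x, g (B.mulVec x) = |B.det|⁻¹ * ∫ y, g y := by
  have h := Real.map_matrix_volume_pi_eq_smul_volume_pi hB
  let e : (d → ℝ) ≃L[ℝ] (d → ℝ) :=
    (LinearEquiv.ofIsUnitDet (f := Matrix.toLin' B) (v := Pi.basisFun ℝ d) (v' := Pi.basisFun ℝ d)
      (by rw [← Matrix.toLin_eq_toLin', LinearMap.toMatrix_toLin]; exact isUnit_iff_ne_zero.2 hB)).toContinuousLinearEquiv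
  have he : ⇑e = fun x => B.mulVec x := by
    ext x; simp [e, LinearEquiv.ofIsUnitDet]
  have h2 := integral_map_equiv (μ := volume) e.toHomeomorph.toMeasurableEquiv g
  have h3 : Measure.map e.toHomeomorph.toMeasurableEquiv volume = ofReal |(B.det)⁻¹| • (volume : Measure (d → ℝ)) := by
    rw [← h]
    congr 1
  rw [h3, integral_smul_measure] at h2
  rw [ENNReal.toReal_ofReal (abs_nonneg _)] at h2
  have h4 : ∀ x, e.toHomeomorph.toMeasurableEquiv x = B.mulVec x := fun x => congrFun he x
  simp only [h4] at h2
  rw [← h2, abs_inv, Complex.real_smul]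

lemma integral_gaussian_mulVec [DecidableEq d] (B : Matrix d d ℝ) (hB : B.det ≠ 0) (m : d → ℤ) :
    ∫ x, eKer m x * (exp (-π * ∑ i, (B.mulVec x) i ^ 2) : ℂ) =
      |B.det|⁻¹ * exp (-π * ∑ i, ((B⁻¹)ᵀ.mulVec (intVec m)) i ^ 2) := by
  have hBu : IsUnit B.det := isUnit_iff_ne_zero.2 hB
  obtain ⟨w, hw⟩ : ∃ w, w = (B⁻¹)ᵀ.mulVec (intVec m) := ⟨_, rfl⟩
  have h1 : ∀ x, eKer m x * (exp (-π * ∑ i, (B.mulVec x) i ^ 2) : ℂ) =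
      (fun y : d → ℝ => cexp (-(π:ℂ) * ∑ i, (y i : ℂ) ^ 2 + ∑ i, (-2 * π * I * w i) * y i)) (B.mulVec x) := by
    intro x
    simp only [eKer, Complex.ofReal_exp]
    rw [← Complex.exp_add]
    congr 1
    rw [add_comm]
    have : ∑ i, (m i : ℂ) * x i = ∑ i, ((w i : ℝ) : ℂ) * ((B.mulVec x) i : ℝ) := by
      have h : intVec m ⬝ᵥ x = w ⬝ᵥ B.mulVec x := by
        rw [hw, Matrix.mulVec_transpose, ← Matrix.dotProduct_mulVec, Matrix.mulVec_mulVec, Matrix.nonsing_inv_mul _ hBu, Matrix.one_mulVec]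
      have h' := congrArg (fun t : ℝ => (t : ℂ)) h
      simpa [dotProduct, intVec] using h'
    rw [this]
    push_cast
    congr 1
    rw [mul_sum]
    exact sum_congr rfl fun i _ => by ring
  rw [funext h1]
  have h2 := GaussianFourier.integral_cexp_neg_mul_sum_add (b := (π : ℂ)) (ι := d) (by simp [pi_pos])
    (fun i => -2 * π * I * w i)
  rw [div_self (by simp [Real.pi_ne_zero]), Complex.one_cpow, one_mul] at h2
  rw [integral_comp_mulVec B hB (fun y : d → ℝ => cexp (-(π:ℂ) * ∑ i, (y i : ℂ) ^ 2 + ∑ i, (-2 * π * I * w i) * y i)), h2, ← hw]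
  rw [Complex.ofReal_exp]
  have h3 : (∑ i, (-2 * (π : ℂ) * I * w i) ^ 2) / (4 * π) = ((-π * ∑ i, w i ^ 2 : ℝ) : ℂ) := by
    push_cast
    rw [mul_sum, Finset.sum_div]
    refine sum_congr rfl fun i _ => ?_
    have hpi : (π : ℂ) ≠ 0 := by simp [Real.pi_ne_zero]
    rw [div_eq_iff (mul_ne_zero (by norm_num) hpi)]
    linear_combination 4 * (π : ℂ) ^ 2 * (w i : ℂ) ^ 2 * Complex.I_sq
  rw [h3]

open scoped MatrixOrder in
/-- Theta inversion for a positive definite quadratic form. -/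
lemma theta_inversion [DecidableEq d] (Q : Matrix d d ℝ) (hQ : Q.PosDef) :
    (Summable fun n : d → ℤ => exp (-π * (intVec n ⬝ᵥ Q.mulVec (intVec n)))) ∧
    ∑' n : d → ℤ, exp (-π * (intVec n ⬝ᵥ Q.mulVec (intVec n))) =
      (sqrt Q.det)⁻¹ * ∑' n : d → ℤ, exp (-π * (intVec n ⬝ᵥ Q⁻¹.mulVec (intVec n))) := by
  have hdec : ∀ P : Matrix d d ℝ, P.PosDef → ∀ k : ℕ, ∃ C : ℝ, ∀ x : d → ℝ, exp (-π * (x ⬝ᵥ P.mulVec x)) ≤ C * ((1 + ‖x‖) ^ k)⁻¹ := by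
    intro P hP k
    obtain ⟨c, hc, hcb⟩ : ∃ c : ℝ, 0 < c ∧ ∀ x : d → ℝ, c * ‖x‖ ^ 2 ≤ x ⬝ᵥ P.mulVec x := by
      rcases isEmpty_or_nonempty d with hd | hd
      · exact ⟨1, one_pos, fun x => by simp [Subsingleton.elim x 0]⟩
      obtain ⟨x0, hx0, hmin⟩ := (isCompact_sphere (0 : d → ℝ) 1).exists_isMinOn (NormedSpace.sphere_nonempty.2 zero_le_one) (f := fun x : d → ℝ => x ⬝ᵥ P.mulVec x) (by unfold dotProduct Matrix.mulVec dotProduct; fun_prop)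
      have hne : x0 ≠ 0 := by rintro rfl; simp at hx0
      have hpos := (Matrix.posDef_iff_dotProduct_mulVec.1 hP).2 hne
      refine ⟨_, by simpa using hpos, fun x => ?_⟩
      by_cases hx : x = 0
      · simp [hx]
      have hxn : ‖x‖ ≠ 0 := norm_ne_zero_iff.2 hx
      have := hmin (a := ‖x‖⁻¹ • x) (by simp [norm_smul, hxn])
      simp only [Matrix.mulVec_smul, smul_dotProduct, dotProduct_smul, smul_eq_mul, Set.mem_ofPred_eq] at this
      calc _ ≤ (‖x‖⁻¹ * (‖x‖⁻¹ * (x ⬝ᵥ P.mulVec x))) * ‖x‖ ^ 2 := by gcongr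
        _ = _ := by field_simp
    obtain ⟨C, hC⟩ := exp_neg_sq_le (π * c) (by positivity) k
    refine ⟨C, fun x => le_trans ?_ (hC ‖x‖ (norm_nonneg x))⟩
    apply exp_le_exp.2
    nlinarith [pi_pos, hcb x, mul_le_mul_of_nonneg_left (hcb x) pi_pos.le]
  have hsum : ∀ P : Matrix d d ℝ, P.PosDef → Summable fun n : d → ℤ => exp (-π * (intVec n ⬝ᵥ P.mulVec (intVec n))) := by
    intro P hP
    obtain ⟨C, hC⟩ := hdec P hP (Fintype.card d + 1)
    exact Summable.of_nonneg_of_le (fun n => (exp_pos _).le) (fun n => hC _) ((summable_one_add_norm_pow _ (Nat.lt_succ_self _)).mul_left C)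
  refine ⟨hsum Q hQ, ?_⟩
  obtain ⟨B, hB⟩ : ∃ B : Matrix d d ℝ, Q = Bᵀ * B := by
    have h1 : CFC.sqrt Q * CFC.sqrt Q = Q := CFC.sqrt_mul_sqrt_self Q hQ.posSemidef.nonneg
    have h2 := (CFC.sqrt_nonneg Q).isSelfAdjoint
    rw [IsSelfAdjoint, Matrix.star_eq_conjTranspose, Matrix.conjTranspose_eq_transpose_of_trivial] at h2
    exact ⟨CFC.sqrt Q, by rw [h2, h1]⟩
  have hdet : Q.det = B.det ^ 2 := by rw [hB, Matrix.det_mul, Matrix.det_transpose, sq]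
  have hBdet : B.det ≠ 0 := by
    intro h; have := hQ.det_pos; rw [hdet, h] at this; simp at this
  have hform : ∀ x : d → ℝ, x ⬝ᵥ Q.mulVec x = ∑ i, (B.mulVec x) i ^ 2 := by
    intro x
    rw [hB, ← Matrix.mulVec_mulVec, Matrix.dotProduct_mulVec, Matrix.vecMul_transpose]
    simp [dotProduct, sq]
  have hform' : ∀ x : d → ℝ, x ⬝ᵥ Q⁻¹.mulVec x = ∑ i, ((B⁻¹)ᵀ.mulVec x) i ^ 2 := by
    intro x
    rw [hB, Matrix.mul_inv_rev, ← Matrix.transpose_nonsing_inv, ← Matrix.mulVec_mulVec, Matrix.dotProduct_mulVec, ← Matrix.mulVec_transpose]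
    simp [dotProduct, sq]
  let f : (d → ℝ) → ℂ := fun x => (exp (-π * (x ⬝ᵥ Q.mulVec x)) : ℂ)
  have hfint : ∀ m : d → ℤ, ∫ x, eKer m x * f x = ((sqrt Q.det)⁻¹ * exp (-π * (intVec m ⬝ᵥ Q⁻¹.mulVec (intVec m))) : ℝ) := by
    intro m
    have := integral_gaussian_mulVec B hBdet m
    simp only [f, hform, hform']
    rw [this, hdet, Real.sqrt_sq_eq_abs]
    push_cast
    rfl
  have hf : ∃ C, ∀ x, ‖f x‖ ≤ C * ((1 + ‖x‖) ^ (Fintype.card d + 1))⁻¹ := by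
    obtain ⟨C, hC⟩ := hdec Q hQ (Fintype.card d + 1)
    refine ⟨C, fun x => ?_⟩
    simp only [f]
    rw [Complex.norm_real, norm_eq_abs, abs_of_pos (exp_pos _)]
    exact hC x
  obtain ⟨C, hC⟩ := hf
  have hfc : Continuous f := by
    simp only [f, dotProduct, Matrix.mulVec]; fun_prop
  have hinv := hsum Q⁻¹ hQ.inv
  have := poisson_of_decay hfc (Nat.lt_succ_self _) hC (by
    simp_rw [hfint]
    exact Complex.summable_ofReal.2 (hinv.mul_left _))
  simp_rw [hfint] at this
  simp only [f] at this
  rw [← Complex.ofReal_tsum, ← Complex.ofReal_tsum, tsum_mul_left] at this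
  exact_mod_cast this

end

section
open MeasureTheory Module NumberField Set
open scoped Matrix

variable {K : Type*} [Field K] [NumberField K]

/-- The weighted sum of logarithmic coordinates. -/
def nu (y : InfinitePlace K → ℝ) : ℝ := ∑ w, (w.mult : ℝ) * y w

/-- The Gaussian in logarithmic coordinates. -/
def gau (y : InfinitePlace K → ℝ) : ℝ :=
  exp (-π * ∑ w : InfinitePlace K, (w.mult : ℝ) * exp (2 * y w))

/-- The logarithmic embedding. -/
def Lg (x : K) : InfinitePlace K → ℝ := fun w => log (w x)

/-- The quadratic form on `K` attached to logarithmic weights `y`. -/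
def qf (y : InfinitePlace K → ℝ) (x : K) : ℝ :=
  ∑ w : InfinitePlace K, (w.mult : ℝ) * (exp (2 * y w) * (w x) ^ 2)

lemma gau_add_Lg (y : InfinitePlace K → ℝ) {x : K} (hx : x ≠ 0) :
    gau (y + Lg x) = exp (-π * qf y x) := by
  unfold gau qf Lg
  congr 2
  refine sum_congr rfl fun w _ => ?_
  have hw : 0 < w x := InfinitePlace.pos_iff.2 hx
  rw [Pi.add_apply, mul_add, exp_add, two_mul (log _), exp_add, exp_log hw, sq]

lemma nu_Lg {x : K} (hx : x ≠ 0) : nu (Lg x) = log |(Algebra.norm ℚ x : ℝ)| := by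
  have h := InfinitePlace.prod_eq_abs_norm x
  have h2 : |(Algebra.norm ℚ x : ℝ)| = ∏ w : InfinitePlace K, w x ^ w.mult := by
    rw [h]; push_cast; rfl
  rw [h2, Real.log_prod (fun w _ => pow_ne_zero _ (InfinitePlace.pos_iff.2 hx).ne')]
  unfold nu Lg
  refine sum_congr rfl fun w _ => ?_
  rw [log_pow]

lemma Lg_mul {x y : K} (hx : x ≠ 0) (hy : y ≠ 0) : Lg (x * y) = Lg x + Lg y := by
  funext w
  simp only [Lg, Pi.add_apply, map_mul]
  exact log_mul (InfinitePlace.pos_iff.2 hx).ne' (InfinitePlace.pos_iff.2 hy).ne'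

lemma Lg_inv (x : K) : Lg x⁻¹ = - Lg x := by
  funext w
  simp [Lg, log_inv]

lemma nu_add (y z : InfinitePlace K → ℝ) : nu (y + z) = nu y + nu z := by
  simp [nu, mul_add, Finset.sum_add_distrib]

lemma nu_neg (y : InfinitePlace K → ℝ) : nu (-y) = - nu y := by
  simp [nu]

section Forms
variable {ι : Type*} [Fintype ι] (e : ι ≃ (K →ₐ[ℚ] ℂ))

/-- The infinite place below an indexed embedding. -/
def plc (j : ι) : InfinitePlace K := InfinitePlace.mk (e j).toRingHom

lemma sum_plc {E : Type*} [AddCommMonoid E] (g : InfinitePlace K → E) :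
    ∑ j, g (plc e j) = ∑ w : InfinitePlace K, w.mult • g w := by
  have h1 : ∑ j, g (plc e j) = ∑ φ : K →+* ℂ, g (InfinitePlace.mk φ) :=
    Fintype.sum_equiv (e.trans (RingHom.equivRatAlgHom K ℂ).symm) _ _ (fun j => rfl)
  rw [h1, ← Finset.sum_fiberwise Finset.univ InfinitePlace.mk]
  refine sum_congr rfl fun w _ => ?_
  rw [sum_congr rfl (g := fun _ => g w), Finset.sum_const, InfinitePlace.card_filter_mk_eq]
  intro φ hφ
  rw [(Finset.mem_filter.mp hφ).2]

lemma exp_sum_plc (y : InfinitePlace K → ℝ) :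
    ∏ j, exp (2 * y (plc e j)) = exp (nu y) ^ 2 := by
  rw [← exp_sum, sum_plc e (fun w => 2 * y w), ← exp_nat_mul, nu, mul_sum]
  congr 1
  refine sum_congr rfl fun w _ => ?_
  simp; ring

variable [DecidableEq ι] (b : Basis ι ℚ K)

/-- The complex Gram matrix. -/
def gramC (y : InfinitePlace K → ℝ) : Matrix ι ι ℂ :=
  Algebra.embeddingsMatrixReindex ℚ ℂ b e *
    Matrix.diagonal (fun j => (exp (2 * y (plc e j)) : ℂ)) *
    (Algebra.embeddingsMatrixReindex ℚ ℂ b e)ᴴ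

/-- The real Gram matrix. -/
def gramR (y : InfinitePlace K → ℝ) : Matrix ι ι ℝ := (gramC e b y).map Complex.re

lemma gramC_apply (y : InfinitePlace K → ℝ) (i j : ι) :
    gramC e b y i j = ∑ k, e k (b i) * (exp (2 * y (plc e k)) : ℂ) *
      starRingEnd ℂ (e k (b j)) := by
  rw [gramC, Matrix.mul_apply]
  refine sum_congr rfl fun k _ => ?_
  rw [Matrix.mul_diagonal]
  rfl

/-- Complex conjugation on indices of embeddings. -/
def cj (j : ι) : ι := e.symm (RingHom.equivRatAlgHom K ℂ
  (ComplexEmbedding.conjugate ((RingHom.equivRatAlgHom K ℂ).symm (e j))))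

lemma e_cj (j : ι) (x : K) : e (cj e j) x = starRingEnd ℂ (e j x) := by
  simp [cj, RingHom.equivRatAlgHom]

lemma plc_cj (j : ι) : plc e (cj e j) = plc e j := by
  have : (e (cj e j)).toRingHom = ComplexEmbedding.conjugate (e j).toRingHom := by
    ext x
    exact e_cj e j x
  rw [plc, this, InfinitePlace.mk_conjugate_eq]; rfl

lemma cj_cj (j : ι) : cj e (cj e j) = j := by
  apply e.injective
  ext x
  rw [e_cj, e_cj]; simp

lemma gramC_star (y : InfinitePlace K → ℝ) (i j : ι) :
    starRingEnd ℂ (gramC e b y i j) = gramC e b y i j := by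
  rw [gramC_apply, map_sum]
  refine Fintype.sum_equiv (Function.Involutive.toPerm (cj e) (cj_cj e)) _ _ fun k => ?_
  change _ = e (cj e k) (b i) * (exp (2 * y (plc e (cj e k))) : ℂ) *
    starRingEnd ℂ (e (cj e k) (b j))
  simp only [e_cj, plc_cj, map_mul, Complex.conj_ofReal]

lemma gramR_map (y : InfinitePlace K → ℝ) :
    (gramR e b y).map (Complex.ofRealHom : ℝ →+* ℂ) = gramC e b y := by
  ext i j
  simp only [gramR, Matrix.map_apply, Complex.ofRealHom_eq_coe]
  exact Complex.conj_eq_iff_re.1 (gramC_star e b y i j)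

lemma gramC_quad (y : InfinitePlace K → ℝ) (v : ι → ℝ) :
    ((v ⬝ᵥ (gramR e b y).mulVec v : ℝ) : ℂ) =
      ∑ k, (exp (2 * y (plc e k)) * ‖∑ i, (v i : ℂ) * e k (b i)‖ ^ 2 : ℝ) := by
  have h : ∀ i j, ((gramR e b y i j : ℝ) : ℂ) = gramC e b y i j := fun i j => by
    rw [← gramR_map]; rfl
  simp only [dotProduct, Matrix.mulVec]
  push_cast
  simp only [h, gramC_apply]
  have : ∀ k, ((‖∑ i, (v i : ℂ) * e k (b i)‖ : ℝ) : ℂ) ^ 2 =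
      (∑ i, (v i : ℂ) * e k (b i)) * ∑ i, (v i : ℂ) * starRingEnd ℂ (e k (b i)) := by
    intro k
    rw [← Complex.mul_conj', map_sum]
    simp
  simp only [this, mul_sum, Finset.sum_mul]
  conv_rhs => rw [Finset.sum_comm]
  rw [Finset.sum_comm]
  refine sum_congr rfl fun i _ => ?_
  conv_rhs => rw [Finset.sum_comm]
  refine sum_congr rfl fun j _ => ?_
  refine sum_congr rfl fun k _ => ?_
  push_cast
  ring

lemma gram_int (y : InfinitePlace K → ℝ) (n : ι → ℤ) :
    intVec n ⬝ᵥ (gramR e b y).mulVec (intVec n) = qf y (∑ i, (n i : K) * b i) := by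
  have h := gramC_quad e b y (intVec n)
  rw [Complex.ofReal_inj.1 h]
  have h2 : ∀ k, ‖∑ i, ((intVec n i : ℝ) : ℂ) * e k (b i)‖ = plc e k (∑ i, (n i : K) * b i) := by
    intro k
    rw [plc, InfinitePlace.apply]
    congr 1
    simp [intVec]
  simp only [h2]
  rw [sum_plc e (fun w => exp (2 * y w) * (w (∑ i, (n i : K) * b i)) ^ 2), qf]
  simp

lemma det_emb_ne_zero : (Algebra.embeddingsMatrixReindex ℚ ℂ b e).det ≠ 0 := by
  intro h
  have := Algebra.discr_eq_det_embeddingsMatrixReindex_pow_two ℚ ℂ (b := b) (e := e)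
  rw [h] at this
  have h2 := Algebra.discr_not_zero_of_basis ℚ b
  apply h2
  have h3 : algebraMap ℚ ℂ (Algebra.discr ℚ b) = algebraMap ℚ ℂ 0 := by
    rw [this]; simp
  exact (algebraMap ℚ ℂ).injective h3

lemma gramR_posDef (y : InfinitePlace K → ℝ) : (gramR e b y).PosDef := by
  refine Matrix.PosDef.of_dotProduct_mulVec_pos ?_ ?_
  · ext i j
    have h : ∀ i j, ((gramR e b y i j : ℝ) : ℂ) = gramC e b y i j := fun i j => by
      rw [← gramR_map]; rfl
    simp only [Matrix.conjTranspose_apply, star_trivial]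
    apply Complex.ofReal_injective
    rw [h, h, ← gramC_star, gramC_apply, gramC_apply, map_sum]
    refine sum_congr rfl fun k _ => ?_
    simp only [map_mul, Complex.conj_ofReal, Complex.conj_conj]
    ring
  · intro v hv
    have h := gramC_quad e b y v
    rw [star_trivial, Complex.ofReal_inj.1 h]
    refine Finset.sum_pos' (fun k _ => by positivity) ?_
    by_contra hcon
    push Not at hcon
    apply hv
    have h3 : (fun i => (v i : ℂ)) ᵥ* Algebra.embeddingsMatrixReindex ℚ ℂ b e = 0 := by
      funext k
      have h4 := hcon k (Finset.mem_univ k)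
      have h5 : ‖∑ i, (v i : ℂ) * e k (b i)‖ ^ 2 ≤ 0 := by
        by_contra h6
        push Not at h6
        have := mul_pos (exp_pos (2 * y (plc e k))) h6
        linarith
      have h6 : ‖∑ i, (v i : ℂ) * e k (b i)‖ = 0 := by
        nlinarith [norm_nonneg (∑ i, (v i : ℂ) * e k (b i))]
      exact norm_eq_zero.1 h6
    have h7 := Matrix.eq_zero_of_vecMul_eq_zero (det_emb_ne_zero e b) h3
    funext i
    exact Complex.ofReal_injective (congrFun h7 i)

lemma gramR_det (y : InfinitePlace K → ℝ) :
    (gramR e b y).det = |(Algebra.discr ℚ b : ℝ)| * exp (nu y) ^ 2 := by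
  apply Complex.ofReal_injective
  have h1 : (((gramR e b y).det : ℝ) : ℂ) = (gramC e b y).det := by
    rw [← gramR_map, ← RingHom.mapMatrix_apply, ← RingHom.map_det]; rfl
  rw [h1, gramC, Matrix.det_mul, Matrix.det_mul, Matrix.det_diagonal, Matrix.det_conjTranspose]
  have h2 := Algebra.discr_eq_det_embeddingsMatrixReindex_pow_two ℚ ℂ (b := b) (e := e)
  have h3 : (|(Algebra.discr ℚ b : ℝ)| : ℝ) =
      ‖(Algebra.embeddingsMatrixReindex ℚ ℂ b e).det‖ ^ 2 := by
    rw [← norm_pow, ← h2]; simp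
  rw [h3, ← exp_sum_plc e]
  push_cast
  rw [← Complex.mul_conj']
  simp only [starRingEnd_apply]
  ring

/-- The trace-dual basis. -/
def trDual : Basis ι ℚ K :=
  (Algebra.traceForm ℚ K).dualBasis (traceForm_nondegenerate ℚ K) b

lemma trDual_trace (i j : ι) :
    Algebra.trace ℚ K (b i * trDual b j) = if i = j then 1 else 0 :=
  LinearMap.BilinForm.apply_dualBasis_right _ (Algebra.traceForm_isSymm ℚ) b i j

lemma emb_mul_dual : Algebra.embeddingsMatrixReindex ℚ ℂ b e *
    (Algebra.embeddingsMatrixReindex ℚ ℂ (trDual b) e)ᵀ = 1 := by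
  ext i j
  rw [Matrix.mul_apply]
  have h := trace_eq_sum_embeddings (K := ℚ) (L := K) ℂ (x := b i * trDual b j)
  rw [trDual_trace] at h
  rw [← e.sum_comp] at h
  have : ∀ k, Algebra.embeddingsMatrixReindex ℚ ℂ b e i k *
      (Algebra.embeddingsMatrixReindex ℚ ℂ (trDual b) e)ᵀ k j = e k (b i * trDual b j) := by
    intro k; rw [map_mul]; rfl
  simp only [this, ← h, Matrix.one_apply]
  split_ifs <;> simp

lemma gramR_inv (y : InfinitePlace K → ℝ) :
    (gramR e b y)⁻¹ = gramR e (trDual b) (-y) := by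
  apply Matrix.inv_eq_right_inv
  have hinj : Injective (fun A : Matrix ι ι ℝ => A.map (Complex.ofRealHom : ℝ →+* ℂ)) := by
    intro A B h
    ext i j
    exact Complex.ofReal_injective (congrFun (congrFun h i) j)
  apply hinj
  beta_reduce
  rw [Matrix.map_mul, gramR_map, gramR_map]
  have hc : gramC e (trDual b) (-y) = ((gramC e (trDual b) (-y))ᴴ)ᵀ := by
    ext i j
    rw [Matrix.transpose_apply, Matrix.conjTranspose_apply]
    exact (gramC_star _ _ _ _ _).symm
  rw [hc]
  set A := Algebra.embeddingsMatrixReindex ℚ ℂ b e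
  set B := Algebra.embeddingsMatrixReindex ℚ ℂ (trDual b) e
  have hAB : A * Bᵀ = 1 := emb_mul_dual e b
  have hBA : Bᵀ * A = 1 := mul_eq_one_comm.1 hAB
  have h1 : Aᴴ * (Bᵀ)ᴴ = 1 := by
    rw [← Matrix.conjTranspose_mul, hBA, Matrix.conjTranspose_one]
  have h2 : ((gramC e (trDual b) (-y))ᴴ)ᵀ = (Bᵀ)ᴴ *
      Matrix.diagonal (fun j => (exp (2 * (-y) (plc e j)) : ℂ)) * Bᵀ := by
    unfold gramC
    simp only [Matrix.conjTranspose_mul, Matrix.transpose_mul, Matrix.conjTranspose_conjTranspose,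
      Matrix.diagonal_conjTranspose, Matrix.diagonal_transpose]
    have h3 : star (fun j => (exp (2 * (-y) (plc e j)) : ℂ)) =
      fun j => (exp (2 * (-y) (plc e j)) : ℂ) := by
      funext j; simp only [Pi.star_apply]; exact Complex.conj_ofReal _
    rw [h3]
    rfl
  have h4 : Matrix.diagonal (fun j => (exp (2 * y (plc e j)) : ℂ)) *
      Matrix.diagonal (fun j => (exp (2 * (-y) (plc e j)) : ℂ)) = 1 := by
    rw [Matrix.diagonal_mul_diagonal, ← Matrix.diagonal_one]
    congr 1
    funext j
    rw [← Complex.ofReal_mul, ← exp_add]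
    simp
  rw [h2, gramC]
  calc _ = A * Matrix.diagonal (fun j => (exp (2 * y (plc e j)) : ℂ)) * (Aᴴ * (Bᵀ)ᴴ) *
        Matrix.diagonal (fun j => (exp (2 * (-y) (plc e j)) : ℂ)) * Bᵀ := by
        simp only [Matrix.mul_assoc]; rfl
    _ = A * (Matrix.diagonal (fun j => (exp (2 * y (plc e j)) : ℂ)) *
        Matrix.diagonal (fun j => (exp (2 * (-y) (plc e j)) : ℂ))) * Bᵀ := by
        rw [h1]; simp only [Matrix.mul_assoc, Matrix.mul_one]
    _ = 1 := by rw [h4, Matrix.mul_one, hAB]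
    _ = _ := by simp

end Forms

lemma theta_basis {ι : Type*} [Fintype ι] [DecidableEq ι] (b : Basis ι ℚ K) (y : InfinitePlace K → ℝ) :
    (Summable fun n : ι → ℤ => exp (-π * qf y (∑ i, (n i : K) * b i))) ∧
    ∑' n : ι → ℤ, exp (-π * qf y (∑ i, (n i : K) * b i)) =
      (sqrt |(Algebra.discr ℚ b : ℝ)| * exp (nu y))⁻¹ *
      ∑' n : ι → ℤ, exp (-π * qf (-y) (∑ i, (n i : K) * trDual b i)) := by
  have hcard : Fintype.card ι = Fintype.card (K →ₐ[ℚ] ℂ) := by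
    rw [AlgHom.card, Module.finrank_eq_card_basis b]
  let e : ι ≃ (K →ₐ[ℚ] ℂ) := Fintype.equivOfCardEq hcard
  have h := theta_inversion (gramR e b y) (gramR_posDef e b y)
  rw [gramR_inv, gramR_det, sqrt_mul (abs_nonneg _), sqrt_sq (exp_pos _).le] at h
  simpa only [gram_int] using h

end

section
open MeasureTheory Module NumberField Set
open scoped Matrix Pointwise

variable {K : Type*} [Field K] [NumberField K]

section Vol
variable {ι : Type*} [Fintype ι] [DecidableEq ι]

/-- The covolume attached to a rational basis. -/
def vol (b : Basis ι ℚ K) : ℝ := sqrt |(Algebra.discr ℚ b : ℝ)|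

lemma vol_pos (b : Basis ι ℚ K) : 0 < vol b :=
  sqrt_pos.2 (abs_pos.2 (by exact_mod_cast Algebra.discr_not_zero_of_basis ℚ b))

lemma discr_change (b b' : Basis ι ℚ K) :
    Algebra.discr ℚ b' = (b.det b') ^ 2 * Algebra.discr ℚ b := by
  rw [Basis.det_apply, ← Algebra.discr_of_matrix_vecMul, Basis.toMatrix_map_vecMul]

lemma vol_change (b b' : Basis ι ℚ K) : vol b' = |((b.det b' : ℚ) : ℝ)| * vol b := by
  rw [vol, discr_change b b', Rat.cast_mul, abs_mul, sqrt_mul (abs_nonneg _), vol]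
  congr 1
  rw [Rat.cast_pow, abs_pow, sqrt_sq (abs_nonneg _)]

lemma vol_of_le (b₁ b₂ : Basis ι ℚ K)
    (h : AddSubgroup.closure (range b₁) ≤ AddSubgroup.closure (range b₂)) :
    vol b₁ = (AddSubgroup.closure (range b₁)).relIndex (AddSubgroup.closure (range b₂)) * vol b₂ := by
  have := AddSubgroup.relIndex_eq_abs_det _ _ h b₁ b₂ rfl rfl
  rw [vol_change b₂ b₁]
  congr 1
  have h2 := congrArg (fun q : ℚ => (q : ℝ)) this
  simp only [Rat.cast_natCast, Rat.cast_abs] at h2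
  exact h2.symm

lemma vol_congr (b₁ b₂ : Basis ι ℚ K)
    (h : AddSubgroup.closure (range b₁) = AddSubgroup.closure (range b₂)) : vol b₁ = vol b₂ := by
  rw [vol_of_le b₁ b₂ h.le, h, AddSubgroup.relIndex_self]; simp

lemma mem_closure_basis (b : Basis ι ℚ K) (x : K) :
    x ∈ AddSubgroup.closure (range b) ↔ ∀ i, ∃ m : ℤ, (m : ℚ) = b.repr x i := by
  have h := Basis.mem_span_iff_repr_mem ℤ b x
  have h2 : x ∈ AddSubgroup.closure (range b) ↔ x ∈ Submodule.span ℤ (range b) := by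
    rw [← Submodule.mem_toAddSubgroup, Submodule.span_int_eq_addSubgroupClosure]
  rw [h2, h]
  rfl

/-- Multiplication of a basis by a nonzero element. -/
def mulBasis (x : Kˣ) (b : Basis ι ℚ K) : Basis ι ℚ K := b.map (DistribMulAction.toLinearEquiv ℚ K x)

lemma mulBasis_apply (x : Kˣ) (b : Basis ι ℚ K) (i : ι) : mulBasis x b i = x * b i := by
  simp [mulBasis, Units.smul_def]

lemma vol_mulBasis (x : Kˣ) (b : Basis ι ℚ K) :
    vol (mulBasis x b) = |(Algebra.norm ℚ (x : K) : ℝ)| * vol b := by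
  rw [vol_change b]
  congr 3
  rw [Basis.det_apply, Algebra.norm_eq_matrix_det b]
  congr 1
  ext i j
  rw [Basis.toMatrix_apply, mulBasis_apply, Algebra.leftMulMatrix_eq_repr_mul]

lemma vol_trDual (b : Basis ι ℚ K) : vol (trDual b) * vol b = 1 := by
  have hcard : Fintype.card ι = Fintype.card (K →ₐ[ℚ] ℂ) := by
    rw [AlgHom.card, Module.finrank_eq_card_basis b]
  let e : ι ≃ (K →ₐ[ℚ] ℂ) := Fintype.equivOfCardEq hcard
  have h1 := emb_mul_dual e b
  have h2 := congrArg Matrix.det h1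
  rw [Matrix.det_mul, Matrix.det_transpose, Matrix.det_one] at h2
  have h3 := Algebra.discr_eq_det_embeddingsMatrixReindex_pow_two ℚ ℂ (b := b) (e := e)
  have h4 := Algebra.discr_eq_det_embeddingsMatrixReindex_pow_two ℚ ℂ (b := trDual b) (e := e)
  have h5 : algebraMap ℚ ℂ (Algebra.discr ℚ (trDual b) * Algebra.discr ℚ b) = 1 := by
    rw [map_mul, h3, h4, ← mul_pow, mul_comm, h2, one_pow]
  have h6 : Algebra.discr ℚ (trDual b) * Algebra.discr ℚ b = 1 := by
    apply (algebraMap ℚ ℂ).injective; rw [h5, map_one]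
  rw [vol, vol, ← sqrt_mul (abs_nonneg _), ← abs_mul, ← Rat.cast_mul, h6]
  simp

lemma repr_eq_trace (b : Basis ι ℚ K) (x : K) (i : ι) :
    b.repr x i = Algebra.trace ℚ K (x * trDual b i) := by
  conv_rhs => rw [← b.sum_repr x, Finset.sum_mul, map_sum]
  simp only [smul_mul_assoc, map_smul, trDual_trace]
  simp

lemma trDual_repr (b : Basis ι ℚ K) (x : K) (i : ι) :
    (trDual b).repr x i = Algebra.trace ℚ K (x * b i) := by
  rw [trDual, LinearMap.BilinForm.dualBasis_repr_apply]; rfl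

end Vol

variable {R : Type*} [CommRing R] [Algebra R K]

/-- `b` is an integral basis of the lattice `J`. -/
def LatBasis (J : Submodule R K) (b : Basis (Fin (finrank ℚ K)) ℚ K) : Prop :=
  J.toAddSubgroup = AddSubgroup.closure (range b)

/-- `J` is a full lattice in `K`. -/
def IsLat (J : Submodule R K) : Prop := ∃ b, LatBasis J b

lemma LatBasis.mem_iff {J : Submodule R K} {b} (h : LatBasis J b) (x : K) :
    x ∈ J ↔ ∀ i, ∃ m : ℤ, (m : ℚ) = b.repr x i := by
  rw [← mem_closure_basis, ← h]; rfl

lemma latBasis_of_mem_iff {J : Submodule R K} {b : Basis (Fin (finrank ℚ K)) ℚ K}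
    (h : ∀ x, x ∈ J ↔ ∀ i, ∃ m : ℤ, (m : ℚ) = b.repr x i) : LatBasis J b := by
  ext x
  rw [mem_closure_basis, ← h]; rfl

/-- Covolume of a lattice. -/
def latVol (J : Submodule R K) : ℝ := if h : IsLat J then vol h.choose else 1

lemma LatBasis.latVol_eq {J : Submodule R K} {b} (h : LatBasis J b) : latVol J = vol b := by
  have hJ : IsLat J := ⟨b, h⟩
  rw [latVol, dif_pos hJ]
  apply vol_congr
  rw [← h, ← hJ.choose_spec]

lemma latVol_pos (J : Submodule R K) : 0 < latVol J := by
  unfold latVol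
  split_ifs with h
  · exact vol_pos _
  · exact one_pos

lemma mem_smul_iff (x : Kˣ) (J : Submodule R K) (z : K) : z ∈ x • J ↔ (x : K)⁻¹ * z ∈ J := by
  rw [Units.smul_def, Submodule.mem_smul_pointwise_iff_exists]
  constructor
  · rintro ⟨w, hw, rfl⟩
    simpa using hw
  · intro h
    exact ⟨_, h, by simp⟩

lemma LatBasis.smul {J : Submodule R K} {b} (h : LatBasis J b) (x : Kˣ) :
    LatBasis (x • J) (mulBasis x b) := by
  apply latBasis_of_mem_iff
  intro z
  rw [mem_smul_iff, h.mem_iff]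
  have : ∀ i, (mulBasis x b).repr z i = b.repr ((x : K)⁻¹ * z) i := by
    intro i
    rw [mulBasis, Basis.map_repr]
    change b.repr ((x⁻¹ : Kˣ) • z) i = _
    rw [Units.smul_def, Units.val_inv_eq_inv_val, smul_eq_mul]
  simp only [this]

lemma IsLat.smul {J : Submodule R K} (h : IsLat J) (x : Kˣ) : IsLat (x • J) :=
  ⟨_, h.choose_spec.smul x⟩

lemma latVol_smul {J : Submodule R K} (h : IsLat J) (x : Kˣ) :
    latVol (x • J) = |(Algebra.norm ℚ (x : K) : ℝ)| * latVol J := by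
  obtain ⟨b, hb⟩ := h
  rw [(hb.smul x).latVol_eq, hb.latVol_eq, vol_mulBasis]

lemma latVol_of_le {J J' : Submodule R K} (h : IsLat J) (h' : IsLat J') (hle : J ≤ J') :
    latVol J = J.toAddSubgroup.relIndex J'.toAddSubgroup * latVol J' := by
  obtain ⟨b, hb⟩ := h
  obtain ⟨b', hb'⟩ := h'
  rw [hb.latVol_eq, hb'.latVol_eq, hb, hb']
  apply vol_of_le
  rw [← hb, ← hb']
  exact hle

/-- The dual lattice with respect to the form `Tr(xy/δ)`. -/
def tau (δ : Kˣ) (J : Submodule R K) : Submodule R K where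
  carrier := {x | ∀ y ∈ J, ∃ m : ℤ, (m : ℚ) = Algebra.trace ℚ K (x * y * (δ : K)⁻¹)}
  zero_mem' := fun y _ => ⟨0, by simp⟩
  add_mem' := by
    intro a b ha hb y hy
    obtain ⟨m, hm⟩ := ha y hy
    obtain ⟨n, hn⟩ := hb y hy
    exact ⟨m + n, by rw [add_mul, add_mul, map_add]; push_cast; rw [hm, hn]⟩
  smul_mem' := by
    intro r x hx y hy
    obtain ⟨m, hm⟩ := hx (r • y) (J.smul_mem r hy)
    exact ⟨m, by rw [hm]; congr 2; simp [Algebra.smul_def]; ring⟩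

lemma mem_tau {δ : Kˣ} {J : Submodule R K} {x : K} : x ∈ tau δ J ↔
    ∀ y ∈ J, ∃ m : ℤ, (m : ℚ) = Algebra.trace ℚ K (x * y * (δ : K)⁻¹) := Iff.rfl

lemma LatBasis.tau {J : Submodule R K} {b} (h : LatBasis J b) (δ : Kˣ) :
    LatBasis (tau δ J) (mulBasis δ (trDual b)) := by
  apply latBasis_of_mem_iff
  intro x
  have hr : ∀ i, (mulBasis δ (trDual b)).repr x i =
      Algebra.trace ℚ K (x * b i * (δ : K)⁻¹) := by
    intro i
    rw [mulBasis, Basis.map_repr]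
    change (trDual b).repr ((δ⁻¹ : Kˣ) • x) i = _
    rw [trDual_repr]
    congr 1
    rw [Units.smul_def, Units.val_inv_eq_inv_val, smul_eq_mul]
    ring
  constructor
  · intro hx i
    rw [hr]
    refine hx (b i) ((h.mem_iff _).2 fun j => ?_)
    rw [Basis.repr_self]
    by_cases hij : i = j
    · exact ⟨1, by simp [hij]⟩
    · exact ⟨0, by simp [Finsupp.single_apply, hij]⟩
  · intro hx y hy
    have hy' := (h.mem_iff y).1 hy
    choose m hm using hx
    choose n hn using hy'
    refine ⟨∑ i, n i * m i, ?_⟩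
    have : x * y * (δ : K)⁻¹ = ∑ i, b.repr y i • (x * b i * (δ : K)⁻¹) := by
      conv_lhs => rw [← b.sum_repr y, mul_sum, Finset.sum_mul]
      simp
    rw [this, map_sum]
    push_cast
    refine sum_congr rfl fun i _ => ?_
    rw [map_smul, ← hr, ← hm, ← hn, smul_eq_mul]

lemma IsLat.tau {J : Submodule R K} (h : IsLat J) (δ : Kˣ) : IsLat (tau δ J) :=
  ⟨_, h.choose_spec.tau δ⟩

lemma latVol_tau {J : Submodule R K} (h : IsLat J) (δ : Kˣ) :
    latVol (tau δ J) * latVol J = |(Algebra.norm ℚ (δ : K) : ℝ)| := by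
  obtain ⟨b, hb⟩ := h
  rw [(hb.tau δ).latVol_eq, hb.latVol_eq, vol_mulBasis, mul_assoc, vol_trDual, mul_one]

lemma tau_tau {J : Submodule R K} (h : IsLat J) (δ : Kˣ) : tau δ (tau δ J) = J := by
  obtain ⟨b, hb⟩ := h
  ext x
  constructor
  · intro hx
    rw [hb.mem_iff]
    intro i
    have hmem : (δ : K) * trDual b i ∈ CubicZeta.tau δ J := by
      rw [(hb.tau δ).mem_iff]
      intro j
      rw [← mulBasis_apply, Basis.repr_self]
      by_cases hij : i = j
      · exact ⟨1, by simp [hij]⟩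
      · exact ⟨0, by simp [Finsupp.single_apply, hij]⟩
    obtain ⟨m, hm⟩ := hx _ hmem
    refine ⟨m, ?_⟩
    rw [hm, repr_eq_trace]
    have h0 := δ.ne_zero
    have : x * ((δ : K) * trDual b i) * (δ : K)⁻¹ = x * trDual b i := by field_simp
    rw [this]
  · intro hx y hy
    obtain ⟨m, hm⟩ := hy x hx
    exact ⟨m, by rw [hm, mul_comm x y]⟩

lemma tau_smul (x δ : Kˣ) (J : Submodule R K) : tau δ (x • J) = x⁻¹ • tau δ J := by
  ext z
  rw [mem_smul_iff, mem_tau, mem_tau]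
  constructor
  · intro h y hy
    obtain ⟨m, hm⟩ := h (x * y) (by rw [mem_smul_iff]; simpa using hy)
    exact ⟨m, by rw [hm]; congr 1; simp; ring⟩
  · intro h y hy
    rw [mem_smul_iff] at hy
    obtain ⟨m, hm⟩ := h _ hy
    exact ⟨m, by rw [hm]; congr 1; simp; field_simp⟩

/-- If `R` is self-dual, the dual of `J` consists of the multipliers of `J` into `R`. -/
lemma mem_tau_iff_smul_le {δ : Kˣ} (hR : tau δ (1 : Submodule R K) = 1) (J : Submodule R K)
    (x : Kˣ) : (x : K) ∈ tau δ J ↔ x • J ≤ 1 := by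
  constructor
  · intro h z hz
    rw [mem_smul_iff] at hz
    rw [← hR]
    intro y hy
    obtain ⟨r, rfl⟩ := Submodule.mem_one.1 hy
    obtain ⟨m, hm⟩ := h _ (J.smul_mem r hz)
    refine ⟨m, ?_⟩
    rw [hm, Algebra.smul_def]
    congr 1
    field_simp
  · intro h y hy
    have hxy : (x : K) * y ∈ (1 : Submodule R K) := h (by rw [mem_smul_iff]; simpa using hy)
    rw [← hR] at hxy
    obtain ⟨m, hm⟩ := hxy 1 (Submodule.mem_one.2 ⟨1, by simp⟩)
    exact ⟨m, by rw [hm, mul_one]⟩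

/-- The theta series of a lattice. -/
lemma theta_lat {J : Submodule R K} (h : IsLat J) (δ : Kˣ) (y : InfinitePlace K → ℝ) :
    (Summable fun x : J => exp (-π * qf y (x : K))) ∧
    ∑' x : J, exp (-π * qf y (x : K)) =
      (latVol J * exp (nu y))⁻¹ *
      ∑' x : tau δ J, exp (-π * qf (-y - Lg (δ : K)) (x : K)) := by
  obtain ⟨b, hb⟩ := h
  have key : ∀ (J : Submodule R K) (b) (_ : LatBasis J b),
      ∃ E : (Fin (finrank ℚ K) → ℤ) ≃ J, ∀ n, (E n : K) = ∑ i, (n i : K) * b i := by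
    intro J b hb
    have hm : ∀ n : Fin (finrank ℚ K) → ℤ, ∑ i, (n i : K) * b i ∈ J := by
      intro n
      have : ∑ i, (n i : K) * b i = ∑ i, (n i : ℚ) • b i := by simp [Algebra.smul_def]
      rw [hb.mem_iff, this]
      intro i
      exact ⟨n i, by rw [Basis.repr_sum_self]⟩
    refine ⟨Equiv.ofBijective (fun n => ⟨∑ i, (n i : K) * b i, hm n⟩) ⟨?_, ?_⟩, fun n => rfl⟩
    · intro n n' hn
      have h1 : ∑ i, (n i : K) * b i = ∑ i, (n' i : K) * b i := congrArg Subtype.val hn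
      have h2 : ∀ n : Fin (finrank ℚ K) → ℤ, ∑ i, (n i : K) * b i = ∑ i, (n i : ℚ) • b i := by
        intro n; simp [Algebra.smul_def]
      rw [h2, h2] at h1
      funext i
      have h3 := congrArg (fun z => b.repr z i) h1
      simp only [Basis.repr_sum_self] at h3
      exact_mod_cast h3
    · rintro ⟨x, hx⟩
      choose m hm using (hb.mem_iff x).1 hx
      refine ⟨m, Subtype.ext ?_⟩
      change ∑ i, (m i : K) * b i = x
      conv_rhs => rw [← b.sum_repr x]
      refine sum_congr rfl fun i _ => ?_
      rw [← hm, Algebra.smul_def]; simp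
  obtain ⟨E, hE⟩ := key J b hb
  obtain ⟨E', hE'⟩ := key _ _ (hb.tau δ)
  have h := theta_basis b y
  rw [← E.summable_iff, ← E.tsum_eq, ← E'.tsum_eq]
  have hq : ∀ z : K, qf (-y - Lg (δ : K)) (δ * z) = qf (-y) z := by
    intro z
    unfold qf
    refine sum_congr rfl fun w _ => ?_
    have hw : 0 < w (δ : K) := InfinitePlace.pos_iff.2 δ.ne_zero
    rw [map_mul, mul_pow]
    have : exp (2 * (-y - Lg (δ : K)) w) = exp (2 * (-y) w) * (w (δ : K) ^ 2)⁻¹ := by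
      rw [Pi.sub_apply, mul_sub, exp_sub, Lg, two_mul (log _), exp_add,
        exp_log hw, sq]; rfl
    rw [this]
    field_simp
  have h2 : ∀ n, qf (-y - Lg (δ : K)) (E' n : K) = qf (-y) (∑ i, (n i : K) * trDual b i) := by
    intro n
    rw [hE', ← hq]
    congr 1
    rw [mul_sum]
    refine sum_congr rfl fun i _ => ?_
    rw [mulBasis_apply]; ring
  have h3 : ((fun x : J => exp (-π * qf y (x : K))) ∘ E) =
      fun n => exp (-π * qf y (∑ i, (n i : K) * b i)) := by
    funext n; simp [hE]
  rw [h3]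
  simp only [h2, hE, hb.latVol_eq]
  exact h

end

section
open MeasureTheory Set

lemma integrable_gau_one {a c : ℝ} (ha : 0 < a) (hc : 0 < c) :
    Integrable fun t : ℝ => exp (a * t) * exp (-c * (exp t) ^ 2) := by
  have hcont : Continuous fun t : ℝ => exp (a * t) * exp (-c * (exp t) ^ 2) := by
    fun_prop
  rw [← integrableOn_univ, ← Iic_union_Ioi (a := (0 : ℝ))]
  refine IntegrableOn.union ?_ ?_
  · refine (integrableOn_exp_mul_Iic ha 0).mono' hcont.aestronglyMeasurable ?_
    refine .of_forall fun t => ?_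
    rw [norm_of_nonneg (by positivity)]
    refine mul_le_of_le_one_right (exp_pos _).le ?_
    rw [Real.exp_le_one_iff]
    have : 0 < exp t ^ 2 := by positivity
    nlinarith
  · obtain ⟨k, hk⟩ := exists_nat_gt (a + 1)
    obtain ⟨C, hC⟩ := exp_neg_sq_le c hc k
    refine integrable_of_isBigO_exp_neg (b := 1) one_pos hcont.continuousOn ?_
    refine Asymptotics.IsBigO.of_bound C ?_
    filter_upwards [Filter.eventually_ge_atTop 0] with t ht
    rw [norm_of_nonneg (by positivity), norm_of_nonneg (by positivity)]
    have h1 := hC (exp t) (exp_pos t).le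
    have hC0 : 0 ≤ C := by
      have := (exp_pos _).le.trans h1
      by_contra hneg
      push Not at hneg
      have : C * ((1 + exp t) ^ k)⁻¹ < 0 := mul_neg_of_neg_of_pos hneg (by positivity)
      linarith
    have h2 : ((1 + exp t) ^ k)⁻¹ ≤ exp (-(k * t)) := by
      rw [exp_neg, exp_nat_mul]
      refine inv_anti₀ (by positivity) (pow_le_pow_left₀ (by positivity) (by linarith) k)
    calc _ ≤ exp (a * t) * (C * exp (-(k * t))) := by
          refine mul_le_mul_of_nonneg_left (h1.trans ?_) (exp_pos _).le
          exact mul_le_mul_of_nonneg_left h2 hC0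
      _ = C * exp (a * t + -(k * t)) := by rw [exp_add]; ring
      _ ≤ _ := by
          refine mul_le_mul_of_nonneg_left (exp_le_exp.2 ?_) hC0
          nlinarith

variable {ι : Type*} [Fintype ι] (n : ι → ℕ) (i₀ : ι)

/-- Weighted coordinate sum. -/
def nuW (y : ι → ℝ) : ℝ := ∑ i, (n i : ℝ) * y i

/-- Weighted Gaussian in logarithmic coordinates. -/
def gauW (y : ι → ℝ) : ℝ := exp (-π * ∑ i, (n i : ℝ) * exp (2 * y i))

/-- The three-scale test function. -/
def psiW (y : ι → ℝ) : ℝ :=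
  3 / 2 * gauW n y - gauW n (y + Pi.single i₀ (log 2)) -
    1 / 2 * gauW n (y - Pi.single i₀ (log 2))

lemma continuous_nuW : Continuous (nuW n) := by unfold nuW; fun_prop
lemma continuous_gauW : Continuous (gauW n) := by unfold gauW; fun_prop
lemma continuous_psiW : Continuous (psiW n i₀) := by
  unfold psiW
  have := continuous_gauW n
  fun_prop

lemma gauW_pos (y : ι → ℝ) : 0 < gauW n y := exp_pos _

lemma nuW_add (y z : ι → ℝ) : nuW n (y + z) = nuW n y + nuW n z := by
  simp [nuW, mul_add, Finset.sum_add_distrib]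

lemma nuW_neg (y : ι → ℝ) : nuW n (-y) = - nuW n y := by simp [nuW]

lemma nuW_sub (y z : ι → ℝ) : nuW n (y - z) = nuW n y - nuW n z := by
  rw [sub_eq_add_neg, nuW_add, nuW_neg]; ring

lemma nuW_single (hn : n i₀ = 1) (c : ℝ) : nuW n (Pi.single i₀ c) = c := by
  rw [nuW, Finset.sum_eq_single i₀]
  · simp [hn]
  · intro j _ hj; simp [hj]
  · simp

lemma integrable_gauW (hn : ∀ i, 0 < n i) {σ : ℝ} (hσ : 0 < σ) :
    Integrable fun y : ι → ℝ => gauW n y * exp (σ * nuW n y) := by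
  have h : (fun y : ι → ℝ => gauW n y * exp (σ * nuW n y)) = fun y => ∏ i,
      (exp (σ * n i * y i) * exp (-(π * n i) * (exp (y i)) ^ 2)) := by
    funext y
    rw [Finset.prod_mul_distrib, ← exp_sum, ← exp_sum, mul_comm, gauW, nuW,
      mul_sum, mul_sum]
    congr 2
    · refine sum_congr rfl fun i _ => by ring
    · refine sum_congr rfl fun i _ => ?_
      rw [← exp_nat_mul]; push_cast; ring
  rw [h]
  refine Integrable.fintype_prod (f := fun i t =>
    exp (σ * n i * t) * exp (-(π * n i) * (exp t) ^ 2)) fun i => ?_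
  have : (0 : ℝ) < n i := by exact_mod_cast hn i
  exact integrable_gau_one (by positivity) (by positivity)

lemma integrable_gauW_shift (hn : ∀ i, 0 < n i) {σ : ℝ} (hσ : 0 < σ) (h : ι → ℝ) :
    Integrable fun y : ι → ℝ => gauW n (y + h) * exp (σ * nuW n y) := by
  have h1 := ((integrable_gauW n hn hσ).comp_add_right h).mul_const (exp (-(σ * nuW n h)))
  refine h1.congr (.of_forall fun y => ?_)
  beta_reduce
  rw [mul_assoc, ← exp_add, nuW_add]
  congr 2; ring

lemma psiW_eq (y : ι → ℝ) : psiW n i₀ y = 3 / 2 * gauW n (y + 0) -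
    gauW n (y + Pi.single i₀ (log 2)) - 1 / 2 * gauW n (y + -Pi.single i₀ (log 2)) := by
  rw [psiW, add_zero, sub_eq_add_neg y]

lemma integrable_psiW (hn : ∀ i, 0 < n i) {σ : ℝ} (hσ : 0 < σ) :
    Integrable fun y : ι → ℝ => psiW n i₀ y * exp (σ * nuW n y) := by
  simp only [psiW_eq, sub_mul, mul_assoc]
  exact (((integrable_gauW_shift n hn hσ _).const_mul _).sub
    (integrable_gauW_shift n hn hσ _)).sub ((integrable_gauW_shift n hn hσ _).const_mul _)

lemma norm_cexp_mul_nu (s : ℂ) (x : ℝ) : ‖cexp (s * x)‖ = exp (s.re * x) := by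
  rw [Complex.norm_exp]; simp

lemma integrable_ofReal_mul_cexp {f : (ι → ℝ) → ℝ} (hf : Continuous f) {s : ℂ}
    (h : Integrable fun y => f y * exp (s.re * nuW n y)) :
    Integrable fun y => (f y : ℂ) * cexp (s * nuW n y) := by
  refine h.mono ?_ (.of_forall fun y => ?_)
  · have := continuous_nuW n
    exact Continuous.aestronglyMeasurable (by fun_prop)
  · rw [norm_mul, norm_cexp_mul_nu, norm_mul, Complex.norm_real, norm_of_nonneg (exp_pos _).le]

/-- Mellin transform of the Gaussian. -/
def mellG (s : ℂ) : ℂ := ∫ y : ι → ℝ, (gauW n y : ℂ) * cexp (s * nuW n y)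

/-- Mellin transform of the test function. -/
def mellPsi (s : ℂ) : ℂ := ∫ y : ι → ℝ, (psiW n i₀ y : ℂ) * cexp (s * nuW n y)

lemma integral_gauW_shift (h : ι → ℝ) (s : ℂ) :
    ∫ y : ι → ℝ, (gauW n (y + h) : ℂ) * cexp (s * nuW n y) =
      cexp (-(s * nuW n h)) * mellG n s := by
  have h1 := integral_add_right_eq_self (μ := (volume : Measure (ι → ℝ)))
    (fun y => (gauW n y : ℂ) * cexp (s * nuW n (y - h))) h
  have h2 : (fun y : ι → ℝ => (gauW n (y + h) : ℂ) * cexp (s * nuW n (y + h - h))) =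
    fun y => (gauW n (y + h) : ℂ) * cexp (s * nuW n y) := by
    funext y; rw [add_sub_cancel_right]
  rw [h2] at h1
  rw [h1, mellG, ← integral_const_mul]
  congr 1
  funext y
  rw [nuW_sub, Complex.ofReal_sub, mul_sub, sub_eq_add_neg, Complex.exp_add]
  ring

lemma mellPsi_eq (hn : ∀ i, 0 < n i) (h1 : n i₀ = 1) {s : ℂ} (hs : 0 < s.re) :
    mellPsi n i₀ s = (3 / 2 - (2 : ℂ) ^ (-s) - 1 / 2 * (2 : ℂ) ^ s) * mellG n s := by
  have hi : ∀ h : ι → ℝ, Integrable fun y : ι → ℝ => (gauW n (y + h) : ℂ) * cexp (s * nuW n y) := by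
    intro h
    have hc := continuous_gauW n
    exact integrable_ofReal_mul_cexp n (f := fun y => gauW n (y + h)) (by fun_prop)
      (integrable_gauW_shift n hn hs h)
  have h2 : ∀ z : ℂ, (2 : ℂ) ^ z = cexp (z * log 2) := by
    intro z
    rw [Complex.cpow_def_of_ne_zero two_ne_zero, mul_comm, Complex.ofReal_log (by norm_num)]
    simp
  have h3 : ∀ y : ι → ℝ, (psiW n i₀ y : ℂ) * cexp (s * nuW n y) =
      3 / 2 * ((gauW n (y + 0) : ℂ) * cexp (s * nuW n y)) -
      ((gauW n (y + Pi.single i₀ (log 2)) : ℂ) * cexp (s * nuW n y)) -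
      1 / 2 * ((gauW n (y + -Pi.single i₀ (log 2)) : ℂ) * cexp (s * nuW n y)) := by
    intro y
    rw [psiW_eq]
    push_cast; ring
  unfold mellPsi
  simp only [h3]
  have hs1 : Integrable fun y : ι → ℝ =>
      3 / 2 * ((gauW n (y + 0) : ℂ) * cexp (s * nuW n y)) -
      ((gauW n (y + Pi.single i₀ (log 2)) : ℂ) * cexp (s * nuW n y)) :=
    ((hi _).const_mul _).sub (hi _)
  rw [integral_sub hs1 ((hi _).const_mul _),
    integral_sub ((hi _).const_mul _) (hi _), integral_const_mul, integral_const_mul,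
    integral_gauW_shift, integral_gauW_shift, integral_gauW_shift, nuW_neg, nuW_single n i₀ h1,
    h2, h2]
  have : nuW n 0 = 0 := by simp [nuW]
  rw [this]
  simp
  ring_nf

lemma mellG_pos (hn : ∀ i, 0 < n i) {σ : ℝ} (hσ : 0 < σ) :
    ∃ r : ℝ, 0 < r ∧ mellG n (σ : ℂ) = r := by
  refine ⟨∫ y : ι → ℝ, gauW n y * exp (σ * nuW n y), ?_, ?_⟩
  · refine (integral_pos_iff_support_of_nonneg (fun y => ?_) (integrable_gauW n hn hσ)).2 ?_
    · exact mul_nonneg (gauW_pos n y).le (exp_pos _).le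
    · have : Function.support (fun y : ι → ℝ => gauW n y * exp (σ * nuW n y)) = univ := by
        ext y
        simp [(gauW_pos n y).ne']
      rw [this]
      exact isOpen_univ.measure_pos _ univ_nonempty
  · rw [mellG, ← integral_complex_ofReal]
    congr 1
    funext y
    push_cast; rfl

lemma mellPsi_one (hn : ∀ i, 0 < n i) (h1 : n i₀ = 1) : mellPsi n i₀ 1 = 0 := by
  rw [mellPsi_eq n i₀ hn h1 (by simp), Complex.cpow_neg, Complex.cpow_one]
  norm_num

lemma mellPsi_half (hn : ∀ i, 0 < n i) (h1 : n i₀ = 1) :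
    ∃ r : ℝ, 0 < r ∧ mellPsi n i₀ (1 / 2) = r := by
  obtain ⟨r, hr, he⟩ := mellG_pos n hn (σ := 1 / 2) (by norm_num)
  refine ⟨(3 / 2 - sqrt 2) * r, mul_pos ?_ hr, ?_⟩
  · have : sqrt 2 < 3 / 2 := by
      rw [Real.sqrt_lt' (by norm_num)]; norm_num
    linarith
  · rw [mellPsi_eq n i₀ hn h1 (by norm_num)]
    have h2 : (1 / 2 : ℂ) = ((1 / 2 : ℝ) : ℂ) := by push_cast; rfl
    rw [h2, he]
    have h3 : (2 : ℂ) ^ ((1 / 2 : ℝ) : ℂ) = (sqrt 2 : ℝ) := by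
      rw [sqrt_eq_rpow, Complex.ofReal_cpow (by norm_num)]; simp
    rw [Complex.cpow_neg, h3, ← Complex.ofReal_inv]
    have h4 : (sqrt 2)⁻¹ = sqrt 2 / 2 := by
      rw [inv_eq_one_div, div_eq_div_iff (by positivity) (by norm_num), ← sq, sq_sqrt (by norm_num)]
      norm_num
    rw [h4]
    push_cast
    ring

end

section
open MeasureTheory Module NumberField Set
open scoped Pointwise

variable {K : Type*} [Field K] [NumberField K] {R : Type*} [CommRing R] [Algebra R K]

lemma countable_units : Countable Kˣ := by
  have : Countable K := (finBasis ℚ K).equivFun.toEquiv.injective.countable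
  exact Units.val_injective.countable

/-- The nonzero elements of a lattice. -/
abbrev nz (J : Submodule R K) : Type _ := {x : Kˣ // (x : K) ∈ J}

lemma hasSum_nz {J : Submodule R K} (h : IsLat J) (y : InfinitePlace K → ℝ) :
    HasSum (fun x : nz J => gau (y + Lg (x.1 : K)))
      ((∑' x : J, exp (-π * qf y (x : K))) - 1) := by
  have hs := (theta_lat h 1 y).1.hasSum
  have h0 := hs.update (0 : J) 0
  have hinj : Injective (fun x : nz J => (⟨x.1, x.2⟩ : J)) := by
    intro a b hab
    exact Subtype.ext (Units.ext (congrArg Subtype.val hab))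
  have hq0 : qf y (0 : K) = 0 := by simp [qf]
  have h1 : (0 - exp (-π * qf y ((0 : J) : K)) +
      ∑' x : J, exp (-π * qf y (x : K))) =
      (∑' x : J, exp (-π * qf y (x : K))) - 1 := by
    rw [ZeroMemClass.coe_zero, hq0]; simp; ring
  rw [h1] at h0
  rw [← hinj.hasSum_iff] at h0
  · refine h0.congr_fun ?_ |> fun h => h
    intro x
    have hx : (⟨x.1, x.2⟩ : J) ≠ 0 := by
      intro h; exact x.1.ne_zero (congrArg Subtype.val h)
    simp only [Function.comp]
    rw [Function.update_of_ne hx, gau_add_Lg _ x.1.ne_zero]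
  · intro x hx
    have : x = 0 := by
      by_contra hne
      exact hx ⟨⟨Units.mk0 (x : K) (fun h => hne (Subtype.ext h)), x.2⟩, rfl⟩
    rw [this, Function.update_self]

lemma nz_nonempty {J : Submodule R K} (h : IsLat J) : Nonempty (nz J) := by
  obtain ⟨b, hb⟩ := h
  have : 0 < finrank ℚ K := finrank_pos
  refine ⟨⟨Units.mk0 (b ⟨0, this⟩) (b.ne_zero _), ?_⟩⟩
  change b _ ∈ J.toAddSubgroup
  rw [hb]
  exact AddSubgroup.subset_closure ⟨_, rfl⟩

lemma summable_gau_nz {J : Submodule R K} (h : IsLat J) (y : InfinitePlace K → ℝ) :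
    Summable fun x : nz J => gau (y + Lg (x.1 : K)) := (hasSum_nz h y).summable

variable (i₀ : InfinitePlace K)

/-- The test function at the places of `K`. -/
abbrev psiK : (InfinitePlace K → ℝ) → ℝ := psiW (fun w : InfinitePlace K => w.mult) i₀

/-- The incomplete Eisenstein type sum. -/
def Esum (J : Submodule R K) (y : InfinitePlace K → ℝ) : ℝ :=
  ∑' x : nz J, psiK i₀ (y + Lg (x.1 : K))

/-- The shift vector at the place `i₀`. -/
def shv : InfinitePlace K → ℝ := Pi.single i₀ (log 2)

lemma psiK_eq (y : InfinitePlace K → ℝ) :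
    psiK i₀ y = 3 / 2 * gau y - gau (y + shv i₀) - 1 / 2 * gau (y - shv i₀) := rfl

lemma hasSum_psi_nz {J : Submodule R K} (h : IsLat J) (y : InfinitePlace K → ℝ) :
    HasSum (fun x : nz J => psiK i₀ (y + Lg (x.1 : K)))
      (3 / 2 * (∑' x : J, exp (-π * qf y (x : K))) -
        (∑' x : J, exp (-π * qf (y + shv i₀) (x : K))) -
        1 / 2 * (∑' x : J, exp (-π * qf (y - shv i₀) (x : K)))) := by
  have h1 := ((hasSum_nz h y).mul_left (3 / 2)).sub (hasSum_nz h (y + shv i₀))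
  have h2 := h1.sub ((hasSum_nz h (y - shv i₀)).mul_left (1 / 2))
  have e1 : (fun x : nz J => psiK i₀ (y + Lg (x.1 : K))) = fun x : nz J =>
      3 / 2 * gau (y + Lg (x.1 : K)) - gau (y + shv i₀ + Lg (x.1 : K)) -
        1 / 2 * gau (y - shv i₀ + Lg (x.1 : K)) := by
    funext x
    rw [psiK_eq, show y + shv i₀ + Lg (x.1 : K) = y + Lg (x.1 : K) + shv i₀ by abel,
      show y - shv i₀ + Lg (x.1 : K) = y + Lg (x.1 : K) - shv i₀ by abel]
  rw [e1]
  refine (congrArg (HasSum _) ?_).mp h2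
  ring

lemma Esum_inversion (hi : i₀.mult = 1) {J : Submodule R K} (h : IsLat J) (δ : Kˣ)
    (y : InfinitePlace K → ℝ) :
    Esum i₀ J y = (latVol J * exp (nu y))⁻¹ * Esum i₀ (tau δ J) (-y - Lg (δ : K)) := by
  have hs : nu (shv i₀) = log 2 :=
    nuW_single (fun w : InfinitePlace K => w.mult) i₀ hi _
  unfold Esum
  rw [(hasSum_psi_nz i₀ h y).tsum_eq, (hasSum_psi_nz i₀ (h.tau δ) _).tsum_eq,
    (theta_lat h δ y).2, (theta_lat h δ (y + shv i₀)).2,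
    (theta_lat h δ (y - shv i₀)).2, sub_eq_add_neg y, nu_add, nu_add, nu_neg, hs,
    exp_add, exp_add, exp_neg, exp_log two_pos]
  rw [show -(y + shv i₀) - Lg (δ : K) = -y - Lg (δ : K) - shv i₀ by abel,
    show -(y + -shv i₀) - Lg (δ : K) = -y - Lg (δ : K) + shv i₀ by abel]
  simp only [mul_inv, inv_inv]
  ring

/-- Splitting an integral along a partition of unity. -/
lemma integral_pou {X U : Type*} [MeasurableSpace X] {μ : Measure X} [Countable U]
    {h : X → ℂ} (hh : Integrable h μ) {q : U → X → ℝ} (hq : ∀ u, Measurable (q u))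
    (h0 : ∀ u x, 0 ≤ q u x) (h1 : ∀ x, HasSum (fun u => q u x) 1) :
    (∀ u, Integrable (fun x => h x * q u x) μ) ∧
    HasSum (fun u => ∫ x, ‖h x * q u x‖ ∂μ) (∫ x, ‖h x‖ ∂μ) ∧
    HasSum (fun u => ∫ x, h x * q u x ∂μ) (∫ x, h x ∂μ) := by
  have hn : ∀ u x, ‖h x * q u x‖ = ‖h x‖ * q u x := fun u x => by
    rw [norm_mul, Complex.norm_real, norm_of_nonneg (h0 u x)]
  have hle : ∀ u x, q u x ≤ 1 := fun u x => le_hasSum (h1 x) u fun v _ => h0 v x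
  have hint : ∀ u, Integrable (fun x => h x * q u x) μ := fun u => by
    refine hh.mono (hh.aestronglyMeasurable.mul
      (Complex.measurable_ofReal.comp (hq u)).aestronglyMeasurable) ?_
    refine .of_forall fun x => ?_
    rw [hn]
    exact mul_le_of_le_one_right (norm_nonneg _) (hle u x)
  have hsum : Summable fun u => ∫ x, ‖h x * q u x‖ ∂μ := by
    refine summable_of_sum_le (fun u => integral_nonneg fun x => norm_nonneg _)
      (c := ∫ x, ‖h x‖ ∂μ) fun s => ?_
    rw [← integral_finsetSum _ fun u _ => (hint u).norm]
    refine integral_mono (integrable_finsetSum _ fun u _ => (hint u).norm) hh.norm fun x => ?_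
    simp only [hn, ← mul_sum]
    exact mul_le_of_le_one_right (norm_nonneg _) (sum_le_hasSum s (fun v _ => h0 v x) (h1 x))
  refine ⟨hint, ?_, ?_⟩
  · have := hasSum_integral_of_summable_integral_norm (F := fun u x => ‖h x * q u x‖)
      (fun u => (hint u).norm) (by simpa only [norm_norm] using hsum)
    refine (congrArg (HasSum _) (congrArg (integral μ) (funext fun x => ?_))).mp this
    simp only [hn, tsum_mul_left, (h1 x).tsum_eq, mul_one]
  · have := hasSum_integral_of_summable_integral_norm hint hsum
    refine (congrArg (HasSum _) (congrArg (integral μ) (funext fun x => ?_))).mp this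
    have h2 : HasSum (fun u => (q u x : ℂ)) 1 := by
      simpa using! Complex.ofRealCLM.hasSum (h1 x)
    rw [tsum_mul_left, h2.tsum_eq, mul_one]

variable (R K) in
/-- The lattices in `K`. -/
abbrev Lat : Type _ := {J : Submodule R K // IsLat J}

variable (R K) in
/-- The integral lattices in `K`. -/
abbrev ILat : Type _ := {J : Submodule R K // IsLat J ∧ J ≤ 1}

/-- An equivariant partition of unity. -/
structure EquivPOU (P : (InfinitePlace K → ℝ) → Submodule R K → ℝ) : Prop where
  meas : ∀ J, Measurable fun y => P y J
  nonneg : ∀ y J, 0 ≤ P y J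
  sum : ∀ y J, IsLat J → HasSum (fun x : Kˣ => P (y + Lg (x : K)) (x • J)) 1

lemma Lg_units_inv (x : Kˣ) : Lg ((x⁻¹ : Kˣ) : K) = - Lg (x : K) := by
  rw [Units.val_inv_eq_inv_val, Lg_inv]

/-- Integral lattices and field elements versus lattices and elements of the dual. -/
def unfoldEquiv {δ : Kˣ} (hR : tau δ (1 : Submodule R K) = 1) :
    ILat K R × Kˣ ≃ Σ J : Lat K R, nz (tau δ J.1) where
  toFun p := ⟨⟨p.2 • p.1.1, p.1.2.1.smul p.2⟩, ⟨p.2⁻¹, by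
    rw [mem_tau_iff_smul_le hR, inv_smul_smul]; exact p.1.2.2⟩⟩
  invFun q := (⟨q.2.1 • q.1.1, q.1.2.smul _, (mem_tau_iff_smul_le hR _ _).1 q.2.2⟩, q.2.1⁻¹)
  left_inv p := by
    refine Prod.ext (Subtype.ext ?_) ?_
    · simp
    · simp
  right_inv q := by
    obtain ⟨⟨J, hJ⟩, ⟨z, hz⟩⟩ := q
    have h1 : z⁻¹ • z • J = J := by simp
    refine Sigma.ext (Subtype.ext ?_) ?_
    · simp
    · dsimp only
      refine (Subtype.heq_iff_coe_eq fun x => ?_).2 ?_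
      · rw [h1]
      · simp

/-- Unfolding a sum over integral lattices. -/
lemma unfold_sum {δ : Kˣ} (hR : tau δ (1 : Submodule R K) = 1)
    {P : (InfinitePlace K → ℝ) → Submodule R K → ℝ} (hP : EquivPOU P)
    {F : (InfinitePlace K → ℝ) → Submodule R K → ℂ}
    (hF : ∀ y J (x : Kˣ), IsLat J → F (y + Lg (x : K)) (x • J) = F y J)
    (hi : ∀ I : ILat K R, Integrable fun y => (psiK i₀ y : ℂ) * F y I.1)
    (hs : Summable fun I : ILat K R => ∫ y, ‖(psiK i₀ y : ℂ) * F y I.1‖) :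
    ∑' I : ILat K R, ∫ y, (psiK i₀ y : ℂ) * F y I.1 =
      ∑' J : Lat K R, ∫ y, F y J.1 * P y J.1 * Esum i₀ (tau δ J.1) y := by
  have := countable_units (K := K)
  have key := fun I : ILat K R => integral_pou (hi I)
    (q := fun (x : Kˣ) y => P (y + Lg (x : K)) (x • I.1))
    (fun x => (hP.meas _).comp (measurable_id.add_const _)) (fun _ _ => hP.nonneg _ _)
    (fun y => hP.sum y I.1 I.2.1)
  set H : (InfinitePlace K → ℝ) → ILat K R × Kˣ → ℂ := fun y p =>
    (psiK i₀ y : ℂ) * F y p.1.1 * P (y + Lg (p.2 : K)) (p.2 • p.1.1) with hH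
  have hsn : Summable fun p : ILat K R × Kˣ => ∫ y, ‖H y p‖ := by
    rw [summable_prod_of_nonneg fun p => integral_nonneg fun y => norm_nonneg _]
    refine ⟨fun I => (key I).2.1.summable, ?_⟩
    simpa only [hH, fun I => (key I).2.1.tsum_eq] using hs
  have hsi : Summable fun p : ILat K R × Kˣ => ∫ y, H y p :=
    Summable.of_norm_bounded hsn fun p => norm_integral_le_integral_norm _
  have e1 : ∑' I : ILat K R, ∫ y, (psiK i₀ y : ℂ) * F y I.1 = ∑' p, ∫ y, H y p := by
    rw [hsi.tsum_prod' fun I => (key I).2.2.summable]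
    exact tsum_congr fun I => (key I).2.2.tsum_eq.symm
  set G : (Σ J : Lat K R, nz (tau δ J.1)) → (InfinitePlace K → ℝ) → ℂ := fun q y =>
    F y q.1.1 * P y q.1.1 * psiK i₀ (y + Lg (q.2.1 : K)) with hG
  have hGH : ∀ p y, H y p = G (unfoldEquiv hR p) (y + Lg (p.2 : K)) := by
    intro p y
    simp only [hG, hH, unfoldEquiv, Equiv.coe_fn_mk, Lg_units_inv, add_neg_cancel_right]
    rw [hF _ _ _ p.1.2.1]; ring
  have hint : ∀ p, Integrable (G (unfoldEquiv hR p)) := by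
    intro p
    have h1 : Integrable fun y => H y p := (key p.1).1 p.2
    simp only [hGH] at h1
    simpa using h1.comp_sub_right (Lg (p.2 : K))
  have e2 : ∀ p, ∫ y, H y p = ∫ y, G (unfoldEquiv hR p) y := by
    intro p
    simp only [hGH]
    exact integral_add_right_eq_self (G (unfoldEquiv hR p)) _
  have e3 : ∀ p, ∫ y, ‖H y p‖ = ∫ y, ‖G (unfoldEquiv hR p) y‖ := by
    intro p
    simp only [hGH]
    exact integral_add_right_eq_self (fun y => ‖G (unfoldEquiv hR p) y‖) _
  have hint' : ∀ q, Integrable (G q) := by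
    intro q
    obtain ⟨p, rfl⟩ := (unfoldEquiv hR).surjective q
    exact hint p
  have hsn' : Summable fun q => ∫ y, ‖G q y‖ := by
    rw [← (unfoldEquiv hR).summable_iff]
    simpa only [Function.comp_def, ← e3] using hsn
  have hsi' : Summable fun q => ∫ y, G q y :=
    Summable.of_norm_bounded hsn' fun p => norm_integral_le_integral_norm _
  rw [e1]
  simp only [e2]
  rw [(unfoldEquiv hR).tsum_eq (fun q => ∫ y, G q y),
    hsi'.tsum_sigma' fun J => hsi'.sigma_factor J]
  refine tsum_congr fun J => ?_
  have : Countable (nz (tau δ J.1)) := inferInstance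
  have h4 := integral_tsum_of_summable_integral_norm (F := fun z : nz (tau δ J.1) => G ⟨J, z⟩)
    (fun z => hint' _) (hsn'.sigma_factor J)
  rw [h4]
  refine integral_congr_ae (.of_forall fun y => ?_)
  simp only [hG]
  rw [tsum_mul_left, Esum, Complex.ofReal_tsum]

/-- The sum of Gaussians over nonzero lattice elements. -/
def gauSum (J : Submodule R K) (y : InfinitePlace K → ℝ) : ℝ :=
  ∑' x : nz J, gau (y + Lg (x.1 : K))

lemma gau_pos (y : InfinitePlace K → ℝ) : 0 < gau y := exp_pos _

lemma measurable_gau : Measurable (gau (K := K)) :=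
  (continuous_gauW (fun w : InfinitePlace K => w.mult)).measurable

lemma gauSum_pos {J : Submodule R K} (h : IsLat J) (y : InfinitePlace K → ℝ) :
    0 < gauSum J y := by
  obtain ⟨x⟩ := nz_nonempty h
  exact (summable_gau_nz h y).tsum_pos (fun _ => (gau_pos _).le) x (gau_pos _)

lemma measurable_gauSum (J : Submodule R K) : Measurable (gauSum J) := by
  have := countable_units (K := K)
  exact Measurable.tsum fun x => measurable_gau.comp (measurable_id.add_const _)

/-- Multiplication by a unit of `K` on nonzero lattice elements. -/
def nzSmul (x : Kˣ) (J : Submodule R K) : nz J ≃ nz (x • J) where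
  toFun z := ⟨x * z.1, by rw [mem_smul_iff]; simpa using z.2⟩
  invFun z := ⟨x⁻¹ * z.1, by simpa [mem_smul_iff] using z.2⟩
  left_inv z := Subtype.ext (by simp)
  right_inv z := Subtype.ext (by simp)

lemma gauSum_smul (x : Kˣ) (J : Submodule R K) (y : InfinitePlace K → ℝ) :
    gauSum (x • J) y = gauSum J (y + Lg (x : K)) := by
  unfold gauSum
  rw [← (nzSmul x J).tsum_eq]
  refine tsum_congr fun z => ?_
  simp only [nzSmul, Equiv.coe_fn_mk, Units.val_mul]
  rw [Lg_mul x.ne_zero z.1.ne_zero, add_assoc]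

lemma exists_equivPOU : ∃ P : (InfinitePlace K → ℝ) → Submodule R K → ℝ, EquivPOU P := by
  refine ⟨fun y J => if (1 : K) ∈ J then gau (-y) / gauSum J (-y) else 0, ?_, ?_, ?_⟩
  · intro J
    split_ifs
    · exact (measurable_gau.comp measurable_neg).div ((measurable_gauSum J).comp measurable_neg)
    · exact measurable_const
  · intro y J
    split_ifs
    · exact div_nonneg (gau_pos _).le (tsum_nonneg fun _ => (gau_pos _).le)
    · exact le_rfl
  · intro y J h
    have h1 := ((summable_gau_nz h (-y)).hasSum.div_const (gauSum J (-y)))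
    have h2 : (∑' x : nz J, gau (-y + Lg (x.1 : K))) / gauSum J (-y) = 1 :=
      div_self (gauSum_pos h _).ne'
    rw [h2] at h1
    have h3 := (hasSum_subtype_iff_indicator (s := {x : Kˣ | (x : K) ∈ J})
      (f := fun x : Kˣ => gau (-y + Lg (x : K)) / gauSum J (-y))).1 h1
    rw [← (Equiv.inv Kˣ).hasSum_iff] at h3
    refine (congrArg (fun f => HasSum f _) (funext fun x => ?_)).mp h3
    simp only [Function.comp, Equiv.inv_apply, indicator, mem_ofPred_eq, mem_smul_iff, mul_one,
      gauSum_smul, Units.val_inv_eq_inv_val, Lg_inv]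
    rw [show -(y + Lg (x : K)) + Lg (x : K) = -y by abel,
      show -y + -Lg (x : K) = -(y + Lg (x : K)) by abel]

lemma EquivPOU.dual {P : (InfinitePlace K → ℝ) → Submodule R K → ℝ} (hP : EquivPOU P) (δ : Kˣ) :
    EquivPOU fun y J => P (-y - Lg (δ : K)) (tau δ J) := by
  refine ⟨fun J => (hP.meas _).comp (measurable_neg.sub_const _), fun _ _ => hP.nonneg _ _, ?_⟩
  intro y J h
  have h1 := hP.sum (-y - Lg (δ : K)) (tau δ J) (h.tau δ)
  rw [← (Equiv.inv Kˣ).hasSum_iff] at h1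
  refine (congrArg (fun f => HasSum f _) (funext fun x => ?_)).mp h1
  simp only [Function.comp, Equiv.inv_apply, Units.val_inv_eq_inv_val, Lg_inv, tau_smul]
  congr 1; abel

/-- Duality on the set of lattices. -/
def tauEquiv (δ : Kˣ) : Lat K R ≃ Lat K R where
  toFun J := ⟨tau δ J.1, J.2.tau δ⟩
  invFun J := ⟨tau δ J.1, J.2.tau δ⟩
  left_inv J := Subtype.ext (tau_tau J.2 δ)
  right_inv J := Subtype.ext (tau_tau J.2 δ)

lemma exp_nu_Lg (x : Kˣ) : exp (nu (Lg (x : K))) = |(Algebra.norm ℚ (x : K) : ℝ)| := by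
  rw [nu_Lg x.ne_zero, exp_log (abs_pos.2 ?_)]
  exact_mod_cast Algebra.norm_ne_zero_iff.2 x.ne_zero

lemma latVol_tau_smul (x δ : Kˣ) {J : Submodule R K} (h : IsLat J) (y : InfinitePlace K → ℝ) :
    latVol (tau δ (x • J)) * exp (nu (y + Lg (x : K))) =
      latVol (tau δ J) * exp (nu y) := by
  rw [tau_smul, latVol_smul (h.tau δ), nu_add, exp_add, exp_nu_Lg, Units.val_inv_eq_inv_val,
    Algebra.norm_inv]
  have : |(Algebra.norm ℚ (x : K) : ℝ)| ≠ 0 := by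
    rw [← exp_nu_Lg]; exact (exp_pos _).ne'
  push_cast
  rw [abs_inv]
  field_simp

/-- The functional equation, in summed form. -/
lemma ideal_sum_symm (hi₀ : i₀.mult = 1) {δ : Kˣ} (hR : tau δ (1 : Submodule R K) = 1) (φ : ℝ → ℂ)
    (hi : ∀ I : ILat K R, Integrable fun y =>
      (psiK i₀ y : ℂ) * φ (latVol (tau δ I.1) * exp (nu y)))
    (hs : Summable fun I : ILat K R => ∫ y,
      ‖(psiK i₀ y : ℂ) * φ (latVol (tau δ I.1) * exp (nu y))‖)
    (hi' : ∀ I : ILat K R, Integrable fun y =>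
      (psiK i₀ y : ℂ) * (φ (latVol (tau δ I.1) * exp (nu y))⁻¹ *
        (latVol (tau δ I.1) * exp (nu y) : ℝ)))
    (hs' : Summable fun I : ILat K R => ∫ y,
      ‖(psiK i₀ y : ℂ) * (φ (latVol (tau δ I.1) * exp (nu y))⁻¹ *
        (latVol (tau δ I.1) * exp (nu y) : ℝ))‖) :
    ∑' I : ILat K R, ∫ y, (psiK i₀ y : ℂ) * φ (latVol (tau δ I.1) * exp (nu y)) =
    ∑' I : ILat K R, ∫ y, (psiK i₀ y : ℂ) * (φ (latVol (tau δ I.1) * exp (nu y))⁻¹ *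
        (latVol (tau δ I.1) * exp (nu y) : ℝ)) := by
  obtain ⟨P, hP⟩ := exists_equivPOU (K := K) (R := R)
  rw [unfold_sum i₀ hR hP (F := fun y J => φ (latVol (tau δ J) * exp (nu y)))
    (fun y J x h => by rw [latVol_tau_smul _ _ h]) hi hs,
    unfold_sum i₀ hR (hP.dual δ) (F := fun y J => φ (latVol (tau δ J) * exp (nu y))⁻¹ *
        (latVol (tau δ J) * exp (nu y) : ℝ))
    (fun y J x h => by rw [latVol_tau_smul _ _ h]) hi' hs', ← (tauEquiv δ).tsum_eq]
  refine tsum_congr fun J => ?_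
  have e1 := fun y => integral_sub_left_eq_self (μ := volume)
    (fun y : InfinitePlace K → ℝ => φ (latVol (tau δ (tauEquiv δ J).1) * exp (nu y)) *
      P y (tauEquiv δ J).1 * Esum i₀ (tau δ (tauEquiv δ J).1) y) y
  rw [← e1 (-Lg (δ : K))]
  refine integral_congr_ae (.of_forall fun y => ?_)
  simp only [tauEquiv, Equiv.coe_fn_mk, tau_tau J.2]
  rw [Esum_inversion i₀ hi₀ J.2 δ, show -(-Lg (δ : K) - y) - Lg (δ : K) = y by abel,
    show -Lg (δ : K) - y = -y - Lg (δ : K) by abel]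
  have h1 : latVol J.1 * exp (nu (-y - Lg (δ : K))) =
      (latVol (tau δ J.1) * exp (nu y))⁻¹ := by
    have h2 := latVol_tau J.2 δ
    have h3 := latVol_pos J.1
    have h4 := latVol_pos (tau δ J.1)
    rw [sub_eq_add_neg, nu_add, nu_neg, nu_neg, exp_add, exp_neg, exp_neg,
      exp_nu_Lg, ← h2]
    field_simp
  rw [h1, inv_inv]
  push_cast
  ring

end

section
open MeasureTheory Module NumberField Set
open scoped Pointwise Topology

/-- A smooth cutoff with `wt u + wt (-u) = 1`. -/
def wt (u : ℝ) : ℝ := smoothTransition (u + 1 / 2)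

lemma wt_nonneg (u : ℝ) : 0 ≤ wt u := smoothTransition.nonneg _
lemma wt_le_one (u : ℝ) : wt u ≤ 1 := smoothTransition.le_one _
lemma wt_zero {u : ℝ} (h : u ≤ -(1 / 2)) : wt u = 0 :=
  smoothTransition.zero_of_nonpos (by linarith)
lemma wt_one {u : ℝ} (h : 1 / 2 ≤ u) : wt u = 1 :=
  smoothTransition.one_of_one_le (by linarith)
lemma contDiff_wt {k : ℕ∞} : ContDiff ℝ k wt :=
  smoothTransition.contDiff.comp (contDiff_id.add contDiff_const)
lemma continuous_wt : Continuous wt := (contDiff_wt (k := 0)).continuous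
lemma wt_add_neg (u : ℝ) : wt u + wt (-u) = 1 := by
  unfold wt smoothTransition
  have h := smoothTransition.pos_denom (u + 1 / 2)
  rw [show 1 - (-u + 1 / 2) = u + 1 / 2 by ring, show -u + 1 / 2 = 1 - (u + 1 / 2) by ring,
    add_comm (expNegInvGlue (1 - (u + 1 / 2))), ← add_div, div_self h.ne']

/-- Holomorphy of two-sided Laplace transforms. -/
lemma differentiableAt_laplace {X : Type*} [MeasurableSpace X] {μ : Measure X}
    {h : X → ℂ} {u : X → ℝ} (hm : AEStronglyMeasurable h μ) (hu : Measurable u) {a b : ℝ}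
    (ha : Integrable (fun x => ‖h x‖ * exp (a * u x)) μ)
    (hb : Integrable (fun x => ‖h x‖ * exp (b * u x)) μ) {s : ℂ} (has : a < s.re)
    (hsb : s.re < b) :
    DifferentiableAt ℂ (fun s => ∫ x, h x * cexp (s * u x) ∂μ) s := by
  obtain ⟨ε, hε, h1, h2⟩ : ∃ ε > 0, a ≤ s.re - 2 * ε ∧ s.re + 2 * ε ≤ b := by
    refine ⟨min (s.re - a) (b - s.re) / 2, ?_, ?_, ?_⟩
    · have := lt_min (sub_pos.2 has) (sub_pos.2 hsb); positivity
    · linarith [min_le_left (s.re - a) (b - s.re)]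
    · linarith [min_le_right (s.re - a) (b - s.re)]
  have hexp : ∀ (t : ℝ) (v : ℝ), a ≤ t → t ≤ b → exp (t * v) ≤
      exp (a * v) + exp (b * v) := by
    intro t v h1 h2
    rcases le_total 0 v with hv | hv
    · have : exp (t * v) ≤ exp (b * v) := exp_le_exp.2 (by nlinarith)
      linarith [exp_pos (a * v)]
    · have : exp (t * v) ≤ exp (a * v) := exp_le_exp.2 (by nlinarith)
      linarith [exp_pos (b * v)]
  have hmeas : ∀ z : ℂ, AEStronglyMeasurable (fun x => h x * cexp (z * u x)) μ := by
    intro z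
    refine hm.mul (Measurable.aestronglyMeasurable ?_)
    fun_prop
  have hbi : Integrable (fun x => ‖h x‖ * exp (a * u x) + ‖h x‖ * exp (b * u x)) μ :=
    ha.add hb
  refine (hasDerivAt_integral_of_dominated_loc_of_deriv_le (𝕜 := ℂ)
    (F' := fun z x => h x * (cexp (z * u x) * u x))
    (bound := fun x => 2 / ε * (‖h x‖ * exp (a * u x) + ‖h x‖ * exp (b * u x)))
    (Metric.ball_mem_nhds s hε) (.of_forall hmeas) ?_ ?_ ?_
    (hbi.const_mul _) ?_).2.differentiableAt
  · refine hbi.mono' (hmeas s) (.of_forall fun x => ?_)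
    rw [norm_mul, norm_cexp_mul_nu, ← mul_add]
    exact mul_le_mul_of_nonneg_left (hexp _ _ has.le hsb.le) (norm_nonneg _)
  · simp only [← mul_assoc]
    exact (hmeas s).mul (by fun_prop)
  · refine .of_forall fun x z hz => ?_
    rw [norm_mul, norm_mul, norm_cexp_mul_nu, Complex.norm_real, ← mul_add, mul_left_comm (2 / ε)]
    refine mul_le_mul_of_nonneg_left ?_ (norm_nonneg _)
    have hre : |z.re - s.re| < ε := by
      have hz' : ‖z - s‖ < ε := by rw [← dist_eq_norm]; exact hz
      have := (Complex.abs_re_le_norm (z - s)).trans_lt hz'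
      simpa using this
    rw [abs_lt] at hre
    have h3 : |u x| ≤ 1 / ε * exp (ε * |u x|) := by
      have := Real.add_one_le_exp (ε * |u x|)
      rw [div_mul_eq_mul_div, one_mul, le_div_iff₀ hε]
      linarith
    have h4 : exp (z.re * u x) * exp (ε * |u x|) ≤
        exp (a * u x) + exp (b * u x) := by
      rw [← exp_add]
      rcases abs_cases (u x) with ⟨h, _⟩ | ⟨h, _⟩
      · rw [h, ← add_mul]; exact hexp _ _ (by linarith) (by linarith)
      · rw [h, show z.re * u x + ε * -u x = (z.re - ε) * u x by ring]
        exact hexp _ _ (by linarith) (by linarith)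
    calc exp (z.re * u x) * ‖u x‖ ≤ exp (z.re * u x) * (1 / ε * exp (ε * |u x|)) :=
          mul_le_mul_of_nonneg_left h3 (exp_pos _).le
      _ = 1 / ε * (exp (z.re * u x) * exp (ε * |u x|)) := by ring
      _ ≤ 1 / ε * (exp (a * u x) + exp (b * u x)) :=
          mul_le_mul_of_nonneg_left h4 (by positivity)
      _ ≤ _ := by
          refine mul_le_mul_of_nonneg_right ?_ (by positivity)
          gcongr; norm_num
  · refine .of_forall fun x z _ => ?_
    have := ((hasDerivAt_id z).mul_const (u x : ℂ)).cexp.const_mul (h x)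
    simpa using this

section Weighted
variable {ι : Type*} [Fintype ι] (n : ι → ℕ) (i₀ : ι)

lemma differentiableAt_mellPsi (hn : ∀ i, 0 < n i) {s : ℂ} (hs : 0 < s.re) :
    DifferentiableAt ℂ (mellPsi n i₀) s := by
  have h := fun σ (hσ : 0 < σ) => (integrable_psiW n i₀ hn (σ := σ) hσ).norm
  simp only [norm_mul, norm_of_nonneg (exp_pos _).le] at h
  refine differentiableAt_laplace (a := s.re / 2) (b := s.re + 1) (u := nuW n)
    (h := fun y => (psiW n i₀ y : ℂ)) ?_ (continuous_nuW n).measurable ?_ ?_ (by linarith)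
    (by linarith)
  · exact (Complex.continuous_ofReal.comp (continuous_psiW n i₀)).aestronglyMeasurable
  · simpa only [Complex.norm_real] using h _ (by linarith)
  · simpa only [Complex.norm_real] using h _ (by linarith)

/-- The integrand of the truncated Mellin transform. -/
def Pint (a : ℝ) (s : ℂ) (y : ι → ℝ) : ℂ :=
  (psiW n i₀ y : ℂ) * (wt (a + nuW n y) * cexp (s * (a + nuW n y : ℝ)))

/-- The truncated Mellin transform. -/
def Pw (a : ℝ) (s : ℂ) : ℂ := ∫ y : ι → ℝ, Pint n i₀ a s y

lemma continuous_Pint (a : ℝ) (s : ℂ) : Continuous (Pint n i₀ a s) := by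
  unfold Pint
  have h1 := continuous_psiW n i₀
  have h2 := continuous_nuW n
  have h3 := continuous_wt
  fun_prop

lemma wt_exp_le {σ₀ σ A u : ℝ} (h0 : σ₀ ≤ σ) (hA : σ ≤ A) :
    wt u * exp (σ * u) ≤ exp ((A - σ₀) / 2) * exp (A * u) := by
  rcases le_total u (-(1 / 2)) with hu | hu
  · rw [wt_zero hu, zero_mul]; positivity
  · refine (mul_le_of_le_one_left (exp_pos _).le (wt_le_one u)).trans ?_
    rw [← exp_add, exp_le_exp]
    nlinarith

lemma norm_Pint_le {σ₀ A : ℝ} {s : ℂ} (h0 : σ₀ ≤ s.re) (hA : s.re ≤ A) (a : ℝ) (y : ι → ℝ) :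
    ‖Pint n i₀ a s y‖ ≤ exp ((A - σ₀) / 2) * exp (A * a) *
      ‖psiW n i₀ y * exp (A * nuW n y)‖ := by
  rw [Pint, norm_mul, norm_mul, norm_cexp_mul_nu, Complex.norm_real, Complex.norm_real,
    norm_of_nonneg (wt_nonneg _), norm_mul, norm_of_nonneg (exp_pos _).le]
  have := wt_exp_le (u := a + nuW n y) h0 hA
  rw [mul_add A, exp_add] at this
  calc _ ≤ _ := mul_le_mul_of_nonneg_left this (norm_nonneg _)
    _ = _ := by ring

lemma integrable_Pint (hn : ∀ i, 0 < n i) (a : ℝ) (s : ℂ) : Integrable (Pint n i₀ a s) := by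
  refine ((integrable_psiW n i₀ hn (σ := max s.re 1) (by positivity)).norm.const_mul _).mono'
    (continuous_Pint n i₀ a s).aestronglyMeasurable
    (.of_forall (norm_Pint_le n i₀ le_rfl (le_max_left _ _) a))

lemma integral_norm_Pint_le (hn : ∀ i, 0 < n i) {σ₀ A : ℝ} {s : ℂ} (h0 : σ₀ ≤ s.re)
    (hA : s.re ≤ A) (hA0 : 0 < A) (a : ℝ) :
    ∫ y, ‖Pint n i₀ a s y‖ ≤ exp ((A - σ₀) / 2) * exp (A * a) *
      ∫ y, ‖psiW n i₀ y * exp (A * nuW n y)‖ := by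
  rw [← integral_const_mul]
  exact integral_mono (integrable_Pint n i₀ hn a s).norm
    ((integrable_psiW n i₀ hn hA0).norm.const_mul _) (norm_Pint_le n i₀ h0 hA a)

lemma norm_Pw_le (hn : ∀ i, 0 < n i) {σ₀ A : ℝ} {s : ℂ} (h0 : σ₀ ≤ s.re)
    (hA : s.re ≤ A) (hA0 : 0 < A) (a : ℝ) :
    ‖Pw n i₀ a s‖ ≤ exp ((A - σ₀) / 2) * exp (A * a) *
      ∫ y, ‖psiW n i₀ y * exp (A * nuW n y)‖ :=
  (norm_integral_le_integral_norm _).trans (integral_norm_Pint_le n i₀ hn h0 hA hA0 a)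

lemma differentiable_Pw (hn : ∀ i, 0 < n i) (a : ℝ) : Differentiable ℂ (Pw n i₀ a) := by
  intro s
  have h := fun σ : ℝ => (integrable_Pint n i₀ hn a σ).norm
  have h2 := fun σ : ℝ => norm_cexp_mul_nu (σ : ℂ)
  simp only [Pint, norm_mul, h2, Complex.ofReal_re] at h
  simp only [← mul_assoc] at h
  have h3 := differentiableAt_laplace (μ := (volume : Measure (ι → ℝ))) (a := s.re - 1)
    (b := s.re + 1) (u := fun y => a + nuW n y)
    (h := fun y => (psiW n i₀ y : ℂ) * (wt (a + nuW n y) : ℂ)) (s := s) ?_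
    ((continuous_nuW n).measurable.const_add a)
    (by simpa only [norm_mul] using h _) (by simpa only [norm_mul] using h _) (by linarith)
    (by linarith)
  · refine h3.congr_of_eventuallyEq (.of_forall fun z => ?_)
    simp only [Pw, Pint, mul_assoc]
  · have h1 := continuous_psiW n i₀
    have h2 := continuous_nuW n
    have h3 := continuous_wt
    exact Continuous.aestronglyMeasurable (by fun_prop)

lemma summable_exp_mono {Θ : Type*} {a : Θ → ℝ} {A B : ℝ} (hA : 0 < A) (hAB : A ≤ B)
    (h : Summable fun θ => exp (A * a θ)) : Summable fun θ => exp (B * a θ) := by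
  set S := ∑' θ, exp (A * a θ)
  have hS : ∀ θ, exp (A * a θ) ≤ S := fun θ => h.le_tsum θ fun _ _ => (exp_pos _).le
  refine Summable.of_nonneg_of_le (fun _ => (exp_pos _).le) (fun θ => ?_)
    (h.mul_left (S ^ ((B - A) / A)))
  have h1 : exp ((B - A) * a θ) = exp (A * a θ) ^ ((B - A) / A) := by
    rw [← exp_mul]; congr 1; field_simp
  rw [show B * a θ = (B - A) * a θ + A * a θ by ring, exp_add, h1]
  exact mul_le_mul_of_nonneg_right (Real.rpow_le_rpow (exp_pos _).le (hS θ)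
    (div_nonneg (by linarith) hA.le)) (exp_pos _).le

lemma summable_integral_Pint (hn : ∀ i, 0 < n i) {Θ : Type*} {a : Θ → ℝ} {A : ℝ} (hA : 0 < A)
    (h : Summable fun θ => exp (A * a θ)) (s : ℂ) :
    Summable fun θ => ∫ y, ‖Pint n i₀ (a θ) s y‖ := by
  refine Summable.of_nonneg_of_le (fun _ => integral_nonneg fun _ => norm_nonneg _)
    (fun θ => integral_norm_Pint_le n i₀ hn le_rfl (le_max_left s.re A)
      (lt_max_of_lt_right hA) (a θ)) ?_
  exact ((summable_exp_mono hA (le_max_right _ _) h).mul_left _).mul_right _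

lemma summable_Pw (hn : ∀ i, 0 < n i) {Θ : Type*} {a : Θ → ℝ} {A : ℝ} (hA : 0 < A)
    (h : Summable fun θ => exp (A * a θ)) (s : ℂ) :
    Summable fun θ => Pw n i₀ (a θ) s :=
  Summable.of_norm_bounded (summable_integral_Pint n i₀ hn hA h s)
    fun _ => norm_integral_le_integral_norm _

lemma differentiable_tsum_Pw (hn : ∀ i, 0 < n i) {Θ : Type*} {a : Θ → ℝ} {A : ℝ} (hA : 0 < A)
    (h : Summable fun θ => exp (A * a θ)) :
    Differentiable ℂ fun s => ∑' θ, Pw n i₀ (a θ) s := by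
  intro s
  set B := max A (s.re + 1)
  have hU : IsOpen {z : ℂ | s.re - 1 < z.re ∧ z.re < s.re + 1} :=
    (isOpen_lt continuous_const Complex.continuous_re).inter
      (isOpen_lt Complex.continuous_re continuous_const)
  have h1 := Complex.differentiableOn_tsum_of_summable_norm (F := fun θ s => Pw n i₀ (a θ) s)
    (((summable_exp_mono hA (le_max_left _ _ : A ≤ B) h).mul_left
      (exp ((B - (s.re - 1)) / 2))).mul_right
        (∫ y, ‖psiW n i₀ y * exp (B * nuW n y)‖))
    (fun θ => (differentiable_Pw n i₀ hn (a θ)).differentiableOn) hU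
    (fun θ z hz => norm_Pw_le n i₀ hn hz.1.le (hz.2.le.trans (le_max_right _ _))
      (lt_max_of_lt_left hA) (a θ))
  exact h1.differentiableAt (hU.mem_nhds ⟨by linarith, by linarith⟩)

end Weighted

section FunctionalEquation
variable {K : Type*} [Field K] [NumberField K] {R : Type*} [CommRing R] [Algebra R K]
variable (i₀ : InfinitePlace K)

/-- The logarithmic size parameter of an integral lattice. -/
def lsz (δ : Kˣ) (I : ILat K R) : ℝ := log (latVol (tau δ I.1))

variable (R) in
/-- Completed smoothed zeta integral. -/
def Lam (δ : Kˣ) (s : ℂ) : ℂ :=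
  ∑' I : ILat K R, Pw (fun w : InfinitePlace K => w.mult) i₀ (lsz δ I) s

lemma mult_pos' (w : InfinitePlace K) : 0 < w.mult := w.mult_pos

lemma differentiable_Lam {δ : Kˣ} {A : ℝ} (hA : 0 < A)
    (h : Summable fun I : ILat K R => exp (A * lsz δ I)) : Differentiable ℂ (Lam R i₀ δ) :=
  differentiable_tsum_Pw _ i₀ mult_pos' hA h

lemma completed_zeta (hi₀ : i₀.mult = 1) {δ : Kˣ} (hR : tau δ (1 : Submodule R K) = 1) {A : ℝ}
    (hA : 0 < A) (h : Summable fun I : ILat K R => exp (A * lsz δ I)) {s : ℂ}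
    (hs : A ≤ s.re) :
    mellPsi (fun w : InfinitePlace K => w.mult) i₀ s * ∑' I : ILat K R, cexp (s * lsz δ I) =
      Lam R i₀ δ s + Lam R i₀ δ (1 - s) := by
  set n := fun w : InfinitePlace K => w.mult
  set φ : ℝ → ℂ := fun t => cexp (s * (log t : ℝ)) * wt (-log t) with hφ
  have hpos := fun I : ILat K R => latVol_pos (tau δ I.1)
  have hlog : ∀ (I : ILat K R) y, log (latVol (tau δ I.1) * exp (nu y)) =
      lsz δ I + nuW n y := fun I y => by
    rw [log_mul (hpos I).ne' (exp_pos _).ne', log_exp]; rfl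
  have e2 : ∀ (I : ILat K R) y, (psiK i₀ y : ℂ) * (φ (latVol (tau δ I.1) * exp (nu y))⁻¹ *
        (latVol (tau δ I.1) * exp (nu y) : ℝ)) = Pint n i₀ (lsz δ I) (1 - s) y := by
    intro I y
    have h1 : (latVol (tau δ I.1) * exp (nu y) : ℝ) = exp (lsz δ I + nuW n y) := by
      rw [← hlog, exp_log (mul_pos (hpos I) (exp_pos _))]
    simp only [hφ, log_inv, hlog, Pint]
    rw [h1, neg_neg, sub_mul, one_mul, sub_eq_add_neg, Complex.exp_add, ← Complex.ofReal_exp,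
      Complex.ofReal_neg, mul_neg]
    ring
  have e1 : ∀ (I : ILat K R) y, (psiK i₀ y : ℂ) * φ (latVol (tau δ I.1) * exp (nu y)) =
      cexp (s * lsz δ I) * ((psiK i₀ y : ℂ) * cexp (s * nuW n y)) -
        Pint n i₀ (lsz δ I) s y := by
    intro I y
    have hw : (wt (-(lsz δ I + nuW n y)) : ℂ) = 1 - wt (lsz δ I + nuW n y) := by
      rw [eq_sub_iff_add_eq, ← Complex.ofReal_add, add_comm, wt_add_neg, Complex.ofReal_one]
    simp only [hφ, hlog, Pint, hw]
    rw [Complex.ofReal_add, mul_add, Complex.exp_add]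
    ring
  have hs0 : 0 < s.re := hA.trans_le hs
  have hψ : Integrable fun y => (psiK i₀ y : ℂ) * cexp (s * nuW n y) :=
    integrable_ofReal_mul_cexp n (continuous_psiW n i₀) (integrable_psiW n i₀ mult_pos' hs0)
  have hmain : Summable fun I : ILat K R => ‖cexp (s * lsz δ I)‖ := by
    simp only [norm_cexp_mul_nu]
    exact summable_exp_mono hA hs h
  have hint1 : ∀ I : ILat K R, Integrable fun y =>
      cexp (s * lsz δ I) * ((psiK i₀ y : ℂ) * cexp (s * nuW n y)) :=
    fun I => hψ.const_mul _
  have hintP := fun (I : ILat K R) (s : ℂ) => integrable_Pint n i₀ mult_pos' (lsz δ I) s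
  have key := ideal_sum_symm i₀ hi₀ hR φ ?_ ?_ ?_ ?_
  · simp only [e2] at key
    have e3 : ∀ I : ILat K R, ∫ y, (psiK i₀ y : ℂ) * φ (latVol (tau δ I.1) * exp (nu y)) =
        cexp (s * lsz δ I) * mellPsi n i₀ s - Pw n i₀ (lsz δ I) s := by
      intro I
      simp only [e1]
      rw [integral_sub (hint1 I) (hintP I s), integral_const_mul]
      rfl
    simp only [e3] at key
    rw [(hmain.of_norm.mul_right _).tsum_sub (summable_Pw n i₀ mult_pos' hA h s), tsum_mul_right]
      at key
    rw [sub_eq_iff_eq_add] at key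
    rw [mul_comm, key]
    exact add_comm _ _
  · intro I
    simp only [e1]
    exact (hint1 I).sub (hintP I s)
  · simp only [e1]
    have h1 := (hmain.mul_right (∫ y, ‖(psiK i₀ y : ℂ) * cexp (s * nuW n y)‖)).add
      (summable_integral_Pint n i₀ mult_pos' hA h s)
    refine Summable.of_nonneg_of_le (fun _ => integral_nonneg fun _ => norm_nonneg _)
      (fun I => ?_) h1
    have h2 : ∫ y, ‖cexp (s * lsz δ I) * ((psiK i₀ y : ℂ) * cexp (s * nuW n y))‖ =
        ‖cexp (s * lsz δ I)‖ * ∫ y, ‖(psiK i₀ y : ℂ) * cexp (s * nuW n y)‖ := by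
      rw [← integral_const_mul]
      simp only [norm_mul]
    rw [← h2, ← integral_add (hint1 I).norm (hintP I s).norm]
    exact integral_mono ((hint1 I).sub (hintP I s)).norm ((hint1 I).norm.add (hintP I s).norm)
      fun y => norm_sub_le _ _
  · intro I
    simp only [e2]
    exact hintP I _
  · simp only [e2]
    exact summable_integral_Pint n i₀ mult_pos' hA h _

end FunctionalEquation

end

/-! ### Counting ideals of given index -/
section IdealCount
variable {A B A' : Type*} [CommRing A] [CommRing B] [CommRing A']

/-- The index of an ideal as an additive subgroup. -/
def idx (I : Ideal A) : ℕ := I.toAddSubgroup.index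

/-- The number of ideals of index `n` (zero for `n = 0`). -/
def aN (A : Type*) [CommRing A] (n : ℕ) : ℕ := Nat.card {I : Ideal A // n ≠ 0 ∧ idx I = n}

lemma idx_mem (I : Ideal A) : ((idx I : ℕ) : A) ∈ I := by
  have h := I.toAddSubgroup.nsmul_index_mem (1 : A)
  simpa [idx] using h

lemma natCast_mem_of_idx {I : Ideal A} {n N : ℕ} (h : idx I = n) (hN : n ∣ N) : (N : A) ∈ I := by
  obtain ⟨k, rfl⟩ := hN
  have := idx_mem I
  rw [h] at this
  push_cast
  exact I.mul_mem_right _ this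

lemma idx_comap {f : A →+* B} (hf : Surjective f) (J : Ideal B) :
    idx (J.comap f) = idx J :=
  AddSubgroup.index_comap_of_surjective J.toAddSubgroup (f := f.toAddMonoidHom) hf

lemma idx_dvd_of_le {I J : Ideal A} (h : I ≤ J) : idx J ∣ idx I :=
  AddSubgroup.index_dvd_of_le h

lemma idx_inf_le (I J : Ideal A) : idx (I ⊓ J) ≤ idx I * idx J :=
  AddSubgroup.index_inf_le (H := I.toAddSubgroup) (K := J.toAddSubgroup)

lemma idx_inf_ne_zero {I J : Ideal A} (h : idx I ≠ 0) (h' : idx J ≠ 0) : idx (I ⊓ J) ≠ 0 :=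
  AddSubgroup.index_inf_ne_zero (H := I.toAddSubgroup) (K := J.toAddSubgroup) h h'

lemma eq_of_le_of_idx {I J : Ideal A} (h : I ≤ J) (hI : idx I ≠ 0) (he : idx I = idx J) : I = J := by
  refine le_antisymm h ?_
  have h1 := AddSubgroup.relIndex_mul_index (H := I.toAddSubgroup) (K := J.toAddSubgroup) h
  have h2 : I.toAddSubgroup.relIndex J.toAddSubgroup = 1 := by
    change _ * idx J = idx I at h1
    rw [he] at h1
    rw [he] at hI
    exact Nat.eq_of_mul_eq_mul_right (Nat.pos_of_ne_zero hI) (by rw [h1, one_mul])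
  exact AddSubgroup.relIndex_eq_one.mp h2

lemma card_ideal_idx_of_surjective {f : A →+* B} (hf : Surjective f) {n N : ℕ}
    (hk : RingHom.ker f = Ideal.span {(N : A)}) (hn : n ∣ N) :
    aN A n = aN B n := by
  refine (Nat.card_congr (Equiv.ofBijective (fun J : {J : Ideal B // n ≠ 0 ∧ idx J = n} =>
    (⟨J.1.comap f, J.2.1, (idx_comap hf _).trans J.2.2⟩ : {I : Ideal A // n ≠ 0 ∧ idx I = n})) ⟨?_, ?_⟩)).symm
  · intro J J' h
    exact Subtype.ext (Ideal.comap_injective_of_surjective f hf (congrArg Subtype.val h))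
  · rintro ⟨I, hn0, hI⟩
    have hle : RingHom.ker f ≤ I := by
      rw [hk, Ideal.span_singleton_le_iff_mem]
      exact natCast_mem_of_idx hI hn
    have hc : (I.map f).comap f = I := by
      rw [Ideal.comap_map_of_surjective f hf, ← RingHom.ker_eq_comap_bot, sup_eq_left.mpr hle]
    refine ⟨⟨I.map f, hn0, ?_⟩, Subtype.ext hc⟩
    rw [← idx_comap hf, hc, hI]

lemma aN_congr {f : A →+* B} (hf : Surjective f) {f' : A' →+* B}
    (hf' : Surjective f') {n N : ℕ}
    (hk : RingHom.ker f = Ideal.span {(N : A)}) (hk' : RingHom.ker f' = Ideal.span {(N : A')})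
    (hn : n ∣ N) : aN A n = aN A' n :=
  (card_ideal_idx_of_surjective hf hk hn).trans (card_ideal_idx_of_surjective hf' hk' hn).symm

lemma idx_eq_one {I : Ideal A} : idx I = 1 ↔ I = ⊤ := by
  rw [idx, AddSubgroup.index_eq_one]
  constructor
  · intro h
    ext x
    have : x ∈ I.toAddSubgroup := h ▸ AddSubgroup.mem_top x
    simpa using this
  · rintro rfl
    rfl

lemma aN_one : aN A 1 = 1 := by
  rw [aN, Nat.card_eq_one_iff_unique]
  refine ⟨⟨fun I J => Subtype.ext ?_⟩, ⟨⟨⊤, one_ne_zero, idx_eq_one.mpr rfl⟩⟩⟩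
  rw [idx_eq_one.mp I.2.2, idx_eq_one.mp J.2.2]

lemma aN_zero : aN A 0 = 0 := by
  rw [aN, Nat.card_eq_zero]
  exact Or.inl ⟨fun I => I.2.1 rfl⟩

lemma idx_sup_span_coprime {I : Ideal A} {a b : ℕ} (h : Nat.Coprime a b) (hI : idx I = a * b)
    (h0 : a * b ≠ 0) : idx (I ⊔ Ideal.span {(a : A)}) ∣ a := by
  set J := I ⊔ Ideal.span {(a : A)}
  have h1 : idx J ∣ a * b := hI ▸ idx_dvd_of_le le_sup_left
  have haJ : (a : A) ∈ J := Ideal.mem_sup_right (Ideal.mem_span_singleton_self _)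
  refine Nat.Coprime.dvd_of_dvd_mul_right ?_ h1
  refine Nat.Coprime.symm (Nat.Coprime.of_dvd_left dvd_rfl ?_)
  rw [Nat.coprime_comm]
  by_contra hnc
  obtain ⟨p, hp, hpJ, hpb⟩ := Nat.Prime.not_coprime_iff_dvd.mp hnc
  have := Fact.mk hp
  have hJ0 : idx J ≠ 0 := fun h' => h0 (Nat.eq_zero_of_zero_dvd (h' ▸ h1))
  have : Finite (A ⧸ J.toAddSubgroup) := by
    apply Nat.finite_of_card_ne_zero
    exact hJ0
  obtain ⟨x, hx⟩ := exists_prime_addOrderOf_dvd_card' (G := A ⧸ J.toAddSubgroup) p hpJ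
  have hax : a • x = 0 := by
    induction x using QuotientAddGroup.induction_on with
    | H z =>
      rw [← QuotientAddGroup.mk_nsmul, QuotientAddGroup.eq_zero_iff]
      have : (a : A) * z ∈ J := J.mul_mem_right _ haJ
      simpa [nsmul_eq_mul] using this
  have : p ∣ a := hx ▸ addOrderOf_dvd_of_nsmul_eq_zero hax
  exact hp.one_lt.ne' (Nat.dvd_one.mp (h ▸ Nat.dvd_gcd this hpb))

lemma sup_inf_sup_coprime (I : Ideal A) {a b : ℕ} (h : Nat.Coprime a b)
    (hab : ((a * b : ℕ) : A) ∈ I) :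
    (I ⊔ Ideal.span {(a : A)}) ⊓ (I ⊔ Ideal.span {(b : A)}) = I := by
  refine le_antisymm ?_ (le_inf le_sup_left le_sup_left)
  rintro x ⟨hx1, hx2⟩
  have key : ∀ (c d : ℕ), ((c * d : ℕ) : A) ∈ I → x ∈ I ⊔ Ideal.span {(c : A)} → (d : A) * x ∈ I := by
    intro c d hcd hx
    obtain ⟨i, hi, z, hz, rfl⟩ := Submodule.mem_sup.mp hx
    obtain ⟨w, rfl⟩ := Ideal.mem_span_singleton'.mp hz
    rw [mul_add]
    refine I.add_mem (I.mul_mem_left _ hi) ?_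
    have : (d : A) * (w * c) = w * ((c * d : ℕ) : A) := by push_cast; ring
    rw [this]
    exact I.mul_mem_left _ hcd
  have ha := key b a (by rwa [mul_comm]) hx2
  have hb := key a b hab hx1
  have hbz : ((a : ℤ) * a.gcdA b + b * a.gcdB b) = 1 := by
    rw [← Nat.gcd_eq_gcd_ab, h]; rfl
  have : x = (a.gcdA b : A) * (a * x) + (a.gcdB b : A) * (b * x) := by
    have h2 := congrArg (Int.cast (R := A)) hbz
    push_cast at h2
    calc x = 1 * x := (one_mul x).symm
      _ = _ := by rw [← h2]; ring
  rw [this]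
  exact I.add_mem (I.mul_mem_left _ ha) (I.mul_mem_left _ hb)

lemma idx_sup_span_coprime_eq {I : Ideal A} {a b : ℕ} (h : Nat.Coprime a b) (hI : idx I = a * b)
    (h0 : a * b ≠ 0) :
    idx (I ⊔ Ideal.span {(a : A)}) = a ∧ idx (I ⊔ Ideal.span {(b : A)}) = b := by
  have h1 := idx_sup_span_coprime h hI h0
  have h2 := idx_sup_span_coprime h.symm (hI.trans (mul_comm a b)) (by rwa [mul_comm])
  have h3 := idx_inf_le (I ⊔ Ideal.span {(a : A)}) (I ⊔ Ideal.span {(b : A)})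
  rw [sup_inf_sup_coprime I h (natCast_mem_of_idx hI dvd_rfl), hI] at h3
  have ha : 0 < a := Nat.pos_of_ne_zero (left_ne_zero_of_mul h0)
  have hb : 0 < b := Nat.pos_of_ne_zero (right_ne_zero_of_mul h0)
  have l1 := Nat.le_of_dvd ha h1
  have l2 := Nat.le_of_dvd hb h2
  constructor <;> nlinarith

lemma idx_inf_coprime {I J : Ideal A} {a b : ℕ} (h : Nat.Coprime a b) (hI : idx I = a)
    (hJ : idx J = b) (h0 : a * b ≠ 0) : idx (I ⊓ J) = a * b := by
  refine le_antisymm (hI ▸ hJ ▸ idx_inf_le I J) ?_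
  refine Nat.le_of_dvd (Nat.pos_of_ne_zero (idx_inf_ne_zero (hI ▸ left_ne_zero_of_mul h0)
    (hJ ▸ right_ne_zero_of_mul h0))) ?_
  exact h.mul_dvd_of_dvd_of_dvd (hI ▸ idx_dvd_of_le inf_le_left) (hJ ▸ idx_dvd_of_le inf_le_right)

lemma aN_mul {a b : ℕ} (h : Nat.Coprime a b) : aN A (a * b) = aN A a * aN A b := by
  by_cases h0 : a * b = 0
  · rcases Nat.mul_eq_zero.mp h0 with rfl | rfl <;> simp [aN_zero]
  rw [aN, aN, aN, ← Nat.card_prod]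
  refine Nat.card_congr ⟨fun I => (⟨I.1 ⊔ Ideal.span {(a : A)}, left_ne_zero_of_mul h0,
    (idx_sup_span_coprime_eq h I.2.2 h0).1⟩, ⟨I.1 ⊔ Ideal.span {(b : A)}, right_ne_zero_of_mul h0,
    (idx_sup_span_coprime_eq h I.2.2 h0).2⟩), fun P => ⟨P.1.1 ⊓ P.2.1, h0,
      idx_inf_coprime h P.1.2.2 P.2.2.2 h0⟩, ?_, ?_⟩
  · intro I
    exact Subtype.ext (sup_inf_sup_coprime I.1 h (natCast_mem_of_idx I.2.2 dvd_rfl))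
  · rintro ⟨⟨I, ha0, hI⟩, ⟨J, hb0, hJ⟩⟩
    have hi := idx_inf_coprime h hI hJ h0
    have h2 := idx_sup_span_coprime_eq h hi h0
    refine Prod.ext (Subtype.ext ?_) (Subtype.ext ?_)
    · exact eq_of_le_of_idx (sup_le inf_le_left ((Ideal.span_singleton_le_iff_mem _).mpr
        (natCast_mem_of_idx hI dvd_rfl))) (by rw [h2.1]; exact ha0) (h2.1.trans hI.symm)
    · exact eq_of_le_of_idx (sup_le inf_le_right ((Ideal.span_singleton_le_iff_mem _).mpr
        (natCast_mem_of_idx hJ dvd_rfl))) (by rw [h2.2]; exact hb0) (h2.2.trans hJ.symm)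

end IdealCount

section Bounds
variable {A : Type*} [CommRing A] [IsDomain A] [CharZero A] {d : ℕ} (b : Module.Basis (Fin d) ℤ A)

lemma ne_bot_of_idx {I : Ideal A} {n : ℕ} (hn : n ≠ 0) (h : idx I = n) : I ≠ ⊥ := by
  rintro rfl
  have := natCast_mem_of_idx h dvd_rfl
  rw [Ideal.mem_bot] at this
  exact hn (by exact_mod_cast this)

/-- Coordinates modulo `n` of a `ℤ`-basis of an ideal. -/
def selfCoord (n : ℕ) (I : {I : Ideal A // n ≠ 0 ∧ idx I = n}) : Fin d → Fin d → ZMod n :=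
  fun i j => ((b.repr (Ideal.selfBasis b I.1 (ne_bot_of_idx I.2.1 I.2.2) i : A) j : ℤ) : ZMod n)

lemma mem_of_coord_eq {I : Ideal A} {n : ℕ} (hI : (n : A) ∈ I) {x y : A} (hx : x ∈ I)
    (h : ∀ j, ((b.repr x j : ℤ) : ZMod n) = ((b.repr y j : ℤ) : ZMod n)) : y ∈ I := by
  have h1 : ∀ j, ∃ c : ℤ, b.repr y j - b.repr x j = n * c := fun j => by
    have := (ZMod.intCast_eq_intCast_iff_dvd_sub _ _ n).mp (h j)
    exact this
  choose c hc using h1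
  have : y = x + n * ∑ j, c j • b j := by
    have e1 : y - x = n * ∑ j, c j • b j := by
      rw [← b.sum_repr (y - x), mul_sum]
      refine sum_congr rfl fun j _ => ?_
      rw [map_sub, Finsupp.sub_apply, hc j]
      simp only [zsmul_eq_mul]
      push_cast
      ring
    rw [← e1]; ring
  rw [this]
  exact I.add_mem hx (I.mul_mem_right _ hI)

lemma le_of_coord {I J : Ideal A} {n : ℕ} (hJ : (n : A) ∈ J) (v : Module.Basis (Fin d) ℤ I)
    (w : Fin d → J)
    (h : ∀ i j, ((b.repr (w i : A) j : ℤ) : ZMod n) = ((b.repr (v i : A) j : ℤ) : ZMod n)) : I ≤ J := by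
  intro x hx
  have h1 := v.sum_repr ⟨x, hx⟩
  have h2 := congrArg (Subtype.val) h1
  simp only [] at h2
  rw [← h2, AddSubmonoidClass.coe_finsetSum]
  refine J.sum_mem fun i _ => ?_
  have : ((v.repr ⟨x, hx⟩ i • v i : I) : A) = ((v.repr ⟨x, hx⟩ i : ℤ) : A) * (v i : A) := by
    simp
  rw [this]
  exact J.mul_mem_left _ (mem_of_coord_eq b hJ (w i).2 (h i))

lemma selfCoord_injective (n : ℕ) : Injective (selfCoord b n) := by
  intro I J h
  have h' : ∀ i j, selfCoord b n I i j = selfCoord b n J i j := fun i j => by rw [h]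
  refine Subtype.ext (le_antisymm ?_ ?_)
  · exact le_of_coord b (natCast_mem_of_idx J.2.2 dvd_rfl) (Ideal.selfBasis b I.1 (ne_bot_of_idx I.2.1 I.2.2))
      (Ideal.selfBasis b J.1 (ne_bot_of_idx J.2.1 J.2.2)) (fun i j => (h' i j).symm)
  · exact le_of_coord b (natCast_mem_of_idx I.2.2 dvd_rfl) (Ideal.selfBasis b J.1 (ne_bot_of_idx J.2.1 J.2.2))
      (Ideal.selfBasis b I.1 (ne_bot_of_idx I.2.1 I.2.2)) (fun i j => (h' i j))

include b in
lemma finite_idx (n : ℕ) : Finite {I : Ideal A // n ≠ 0 ∧ idx I = n} := by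
  by_cases hn : n = 0
  · have : IsEmpty {I : Ideal A // n ≠ 0 ∧ idx I = n} := ⟨fun I => I.2.1 hn⟩
    infer_instance
  have := NeZero.mk hn
  exact Finite.of_injective _ (selfCoord_injective b n)

include b in
lemma aN_le (n : ℕ) : aN A n ≤ n ^ (d * d) := by
  by_cases hn : n = 0
  · subst hn; simp [aN_zero]
  have := NeZero.mk hn
  calc aN A n ≤ Nat.card (Fin d → Fin d → ZMod n) :=
        Nat.card_le_card_of_injective _ (selfCoord_injective b n)
    _ = n ^ (d * d) := by simp [pow_mul]

end Bounds

section Dedekind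
variable {A : Type*} [CommRing A] [IsDedekindDomain A] [CharZero A] [Module.Free ℤ A] [Module.Finite ℤ A]

/-- The multiplicities in `J` of the primes dividing `M`. -/
def multVec (M : ℕ) (J : Ideal A) :
    {P // P ∈ (normalizedFactors (Ideal.span {(M : A)})).toFinset} → ℕ :=
  fun P => (normalizedFactors J).count P.1

lemma multVec_injOn {M N : ℕ} (hM : M ≠ 0) (hMN : ∃ k, N ∣ M ^ k) {I J : Ideal A}
    (hI : (N : A) ∈ I) (hJ : (N : A) ∈ J) (hI0 : I ≠ ⊥) (hJ0 : J ≠ ⊥) (h : multVec M I = multVec M J) :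
    I = J := by
  have key : ∀ {I : Ideal A}, I ≠ ⊥ → (N : A) ∈ I → ∀ P ∈ normalizedFactors I,
      P ∈ (normalizedFactors (Ideal.span {(M : A)})).toFinset := by
    intro I hI0 hI P hP
    have hM' : Ideal.span {(M : A)} ≠ ⊥ := by
      rw [Ne, Ideal.span_singleton_eq_bot]; exact_mod_cast hM
    rw [Multiset.mem_toFinset, Ideal.mem_normalizedFactors_iff hM']
    rw [Ideal.mem_normalizedFactors_iff hI0] at hP
    refine ⟨hP.1, (Ideal.span_singleton_le_iff_mem _).mpr ?_⟩
    obtain ⟨k, c, hk⟩ := hMN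
    have hk' : ((M : A)) ^ k = N * c := by exact_mod_cast hk
    refine hP.1.mem_of_pow_mem k ?_
    rw [hk']
    exact P.mul_mem_right _ (hP.2 hI)
  have hf : normalizedFactors I = normalizedFactors J := by
    ext P
    by_cases hP : P ∈ (normalizedFactors (Ideal.span {(M : A)})).toFinset
    · exact congrFun h ⟨P, hP⟩
    · rw [Multiset.count_eq_zero_of_notMem (fun h' => hP (key hI0 hI P h')),
        Multiset.count_eq_zero_of_notMem (fun h' => hP (key hJ0 hJ P h'))]
  rw [← Ideal.prod_normalizedFactors_eq_self hI0, hf, Ideal.prod_normalizedFactors_eq_self hJ0]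

lemma multVec_le {M N e : ℕ} (hN : N ≤ 2 ^ e) (hN0 : N ≠ 0) {J : Ideal A} (hJ : idx J ∣ N)
    (P) : multVec M J P ≤ e := by
  have hJ0 : idx J ≠ 0 := fun h => hN0 (Nat.eq_zero_of_zero_dvd (h ▸ hJ))
  have hJb : J ≠ ⊥ := ne_bot_of_idx hJ0 rfl
  rw [multVec]
  set v := (normalizedFactors J).count P.1
  rcases Nat.eq_zero_or_pos v with h | h
  · omega
  have hP : P.1 ∈ normalizedFactors J := Multiset.count_pos.mp h
  have hPp := ((Ideal.mem_normalizedFactors_iff hJb).mp hP).1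
  have hdvd : P.1 ^ v ∣ J := by
    rw [← Ideal.prod_normalizedFactors_eq_self hJb]
    have : Multiset.replicate v P.1 ≤ normalizedFactors J :=
      Multiset.le_count_iff_replicate_le.mp le_rfl
    simpa using Multiset.prod_dvd_prod_of_le this
  have h1 : Ideal.absNorm P.1 ^ v ∣ N := by
    rw [← map_pow]
    exact (map_dvd Ideal.absNorm hdvd).trans hJ
  have h2 : 2 ≤ Ideal.absNorm P.1 := by
    have h3 : Ideal.absNorm P.1 ≠ 1 := fun h' => hPp.ne_top (Ideal.absNorm_eq_one_iff.mp h')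
    have h4 : Ideal.absNorm P.1 ≠ 0 := by
      intro h'
      rw [h', zero_pow (by omega)] at h1
      exact hN0 (Nat.eq_zero_of_zero_dvd h1)
    omega
  have h5 : 2 ^ v ≤ 2 ^ e := (Nat.pow_le_pow_left h2 v).trans ((Nat.le_of_dvd (Nat.pos_of_ne_zero hN0) h1).trans hN)
  exact (Nat.pow_le_pow_iff_right (by norm_num)).mp h5

/-- For a subring of finite index of a Dedekind order, ideals are few. -/
lemma aN_pow_le {R : Type*} [CommRing R] (f : R →+* A) (hf : Injective f)
    {m : ℕ} (hm : m ≠ 0) (hmf : ∀ a : A, ∃ r, f r = m * a) (p : ℕ) (hp : p ≠ 0) :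
    ∃ C g : ℕ, ∀ k, aN R (p ^ k) ≤ C * (k + 1) ^ g := by
  set C := (f.toAddMonoidHom.range).index with hC
  let b := Module.finBasis ℤ A
  set d := Module.finrank ℤ A
  set M := C * p with hM
  set S := {P // P ∈ (normalizedFactors (Ideal.span {(M : A)})).toFinset}
  have hC0 : C ≠ 0 := by
    have h1 : (Ideal.span {(m : A)}).toAddSubgroup ≤ f.toAddMonoidHom.range := by
      intro x hx
      obtain ⟨y, rfl⟩ := Ideal.mem_span_singleton'.mp hx
      obtain ⟨r, hr⟩ := hmf y
      exact ⟨r, by rw [mul_comm]; exact hr⟩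
    have h2 : (Ideal.span {(m : A)}).toAddSubgroup.index ≠ 0 := by
      have : Ideal.absNorm (Ideal.span {(m : A)}) ≠ 0 := by
        rw [Ne, Ideal.absNorm_eq_zero_iff, Ideal.span_singleton_eq_bot]
        exact_mod_cast hm
      exact this
    intro h0
    exact h2 (Nat.eq_zero_of_zero_dvd (h0 ▸ AddSubgroup.index_dvd_of_le h1))
  have hM0 : M ≠ 0 := mul_ne_zero hC0 hp
  have hidx : ∀ I : Ideal R, idx (I.map f) ∣ idx I * C := by
    intro I
    have h1 := AddSubgroup.index_map_of_injective I.toAddSubgroup (f := f.toAddMonoidHom) hf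
    change _ ∣ I.toAddSubgroup.index * _
    rw [hC, ← h1, idx]
    refine AddSubgroup.index_dvd_of_le ?_
    rintro _ ⟨x, hx, rfl⟩
    exact Ideal.mem_map_of_mem f hx
  have hmI : ∀ (I : Ideal R) (x : A), x ∈ I.map f → ∀ a : A, ∃ r ∈ I, f r = m * (a * x) := by
    intro I x hx
    induction hx using Submodule.span_induction with
    | mem x h =>
      obtain ⟨r, hr, rfl⟩ := h
      intro a
      obtain ⟨t, ht⟩ := hmf a
      exact ⟨t * r, I.mul_mem_left _ hr, by rw [map_mul, ht]; ring⟩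
    | zero => exact fun a => ⟨0, I.zero_mem, by simp⟩
    | add x y _ _ hx hy =>
      intro a
      obtain ⟨r, hr, h1⟩ := hx a
      obtain ⟨s, hs, h2⟩ := hy a
      exact ⟨r + s, I.add_mem hr hs, by rw [map_add, h1, h2]; ring⟩
    | smul c x _ hx =>
      intro a
      obtain ⟨r, hr, h1⟩ := hx (a * c)
      exact ⟨r, hr, by rw [h1, smul_eq_mul]; ring⟩
  have hCle : ∀ k, C * p ^ k ≤ 2 ^ (C + p * k) := fun k => by
    rw [pow_add, pow_mul]
    exact Nat.mul_le_mul Nat.lt_two_pow_self.le (Nat.pow_le_pow_left Nat.lt_two_pow_self.le k)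
  have hdvd : ∀ {k : ℕ} {I : Ideal R}, idx I = p ^ k → idx (I.map f) ∣ C * p ^ k := by
    intro k I hI
    have := hidx I
    rwa [hI, mul_comm] at this
  have hne : ∀ {k : ℕ} {I : Ideal R}, idx I = p ^ k → I.map f ≠ ⊥ := by
    intro k I hI
    exact ne_bot_of_idx (fun h => mul_ne_zero hC0 (pow_ne_zero k hp)
      (Nat.eq_zero_of_zero_dvd (h ▸ hdvd hI))) rfl
  have := NeZero.mk hm
  let J : ∀ k, {I : Ideal R // p ^ k ≠ 0 ∧ idx I = p ^ k} →
      (S → Fin (C + p * k + 1)) × Set (Fin d → ZMod m) := fun k I =>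
    (fun P => ⟨multVec M (I.1.map f) P, Nat.lt_succ_of_le
      (multVec_le (hCle k) (mul_ne_zero hC0 (pow_ne_zero k hp)) (hdvd I.2.2) P)⟩,
     {c | ∃ r ∈ I.1, f r = ∑ i, ((c i).val : A) * (Ideal.selfBasis b (I.1.map f) (hne I.2.2) i : A)})
  have hJ : ∀ k, Injective (J k) := by
    intro k I I' h
    have h1 : I.1.map f = I'.1.map f := by
      refine multVec_injOn (M := M) (N := C * p ^ k) hM0 ?_
        (natCast_mem_of_idx rfl (hdvd I.2.2)) (natCast_mem_of_idx rfl (hdvd I'.2.2))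
        (hne I.2.2) (hne I'.2.2) ?_
      · refine ⟨k + 1, ?_⟩
        rw [hM, mul_pow]
        exact mul_dvd_mul (dvd_pow_self _ (by omega)) (pow_dvd_pow _ (by omega))
      · funext P
        exact congrArg Fin.val (congrFun (congrArg Prod.fst h) P)
    have h2 := congrArg Prod.snd h
    have main : ∀ I I' : {I : Ideal R // p ^ k ≠ 0 ∧ idx I = p ^ k}, I.1.map f = I'.1.map f →
        (J k I).2 = (J k I').2 → I.1 ≤ I'.1 := by
      rintro ⟨I, hI0, hI⟩ ⟨I', hI0', hI'⟩ h1 h2 x hx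
      have hb : ∀ J (hJ : J ≠ ⊥) (hJ' : I.map f = J) i,
          (Ideal.selfBasis b J hJ i : A) = (Ideal.selfBasis b (I.map f) (hne hI) i : A) := by
        rintro _ hJ rfl i
        rfl
      have h3 : {c : Fin d → ZMod m | ∃ r ∈ I, f r = ∑ i, ((c i).val : A) * (Ideal.selfBasis b (I.map f) (hne hI) i : A)}
        = {c | ∃ r ∈ I', f r = ∑ i, ((c i).val : A) * (Ideal.selfBasis b (I'.map f) (hne hI') i : A)} := h2
      simp only [hb _ (hne hI') h1] at h3
      set v := Ideal.selfBasis b (I.map f) (hne hI)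
      have hx' : f x ∈ I.map f := Ideal.mem_map_of_mem f hx
      have hsum : f x = ∑ i, ((v.repr ⟨f x, hx'⟩ i : ℤ) : A) * (v i : A) := by
        have h4 := congrArg Subtype.val (v.sum_repr ⟨f x, hx'⟩)
        rw [AddSubmonoidClass.coe_finsetSum] at h4
        simpa using h4.symm
      set c : Fin d → ZMod m := fun i => ((v.repr ⟨f x, hx'⟩ i : ℤ) : ZMod m) with hc
      have hcz : ∀ i, ∃ z : ℤ, v.repr ⟨f x, hx'⟩ i = ((c i).val : ℤ) + m * z := by
        intro i
        have h5 : ((v.repr ⟨f x, hx'⟩ i : ℤ) : ZMod m) = (((c i).val : ℤ) : ZMod m) := by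
          simp [hc]
        rw [eq_comm, ZMod.intCast_eq_intCast_iff_dvd_sub] at h5
        obtain ⟨z, hz⟩ := h5
        exact ⟨z, by rw [← hz]; ring⟩
      choose z hz using hcz
      set y : A := ∑ i, (z i : A) * (v i : A) with hy
      have hyI : y ∈ I.map f := (I.map f).sum_mem fun i _ => (I.map f).mul_mem_left _ (v i).2
      have hfx : f x = ∑ i, ((c i).val : A) * (v i : A) + m * y := by
        rw [hsum, hy, mul_sum, ← Finset.sum_add_distrib]
        refine sum_congr rfl fun i _ => ?_
        rw [hz i]
        push_cast
        ring
      obtain ⟨r, hr, hfr⟩ := hmI I y hyI 1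
      obtain ⟨r', hr', hfr'⟩ := hmI I' y (h1 ▸ hyI) 1
      have hcm : c ∈ {c : Fin d → ZMod m | ∃ r ∈ I, f r = ∑ i, ((c i).val : A) * (v i : A)} :=
        ⟨x - r, I.sub_mem hx hr, by rw [map_sub, hfr, hfx]; ring⟩
      rw [h3] at hcm
      obtain ⟨t, ht, hft⟩ := hcm
      have : x = t + r' := hf (by rw [hfx, map_add, hft, hfr']; ring)
      rw [this]
      exact I'.add_mem ht hr'
    exact Subtype.ext (le_antisymm (main I I' h1 h2) (main I' I h1.symm h2.symm))
  refine ⟨2 ^ (m ^ d) * (C + p + 1) ^ Fintype.card S, Fintype.card S, fun k => ?_⟩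
  calc aN R (p ^ k) ≤ Nat.card ((S → Fin (C + p * k + 1)) × Set (Fin d → ZMod m)) :=
        Nat.card_le_card_of_injective _ (hJ k)
    _ = (C + p * k + 1) ^ Fintype.card S * 2 ^ (m ^ d) := by
        rw [Nat.card_prod, Nat.card_eq_fintype_card, Nat.card_eq_fintype_card]
        simp
    _ ≤ ((C + p + 1) * (k + 1)) ^ Fintype.card S * 2 ^ (m ^ d) := by
        gcongr
        nlinarith
    _ = _ := by rw [mul_pow]; ring
end Dedekind

section
open Filter Topology

section Dirichlet
variable (A : Type*) [CommRing A]

/-- Ideals of finite index. -/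
abbrev FI : Type _ := {I : Ideal A // idx I ≠ 0}

lemma card_fiber (n : ℕ) : Nat.card {I : FI A // idx I.1 = n} = aN A n := by
  refine Nat.card_congr ⟨fun I => ⟨I.1.1, fun h => I.1.2 (I.2.trans h), I.2⟩,
    fun I => ⟨⟨I.1, fun h => I.2.1 (I.2.2.symm.trans h)⟩, I.2.2⟩, ?_, ?_⟩
  · intro I; rfl
  · intro I; rfl

lemma hasSum_FI (hfin : ∀ n, Finite {I : Ideal A // n ≠ 0 ∧ idx I = n}) (F : ℕ → ℂ)
    (h : Summable fun n => (aN A n : ℝ) * ‖F n‖) :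
    (Summable fun I : FI A => ‖F (idx I.1)‖) ∧ HasSum (fun I : FI A => F (idx I.1)) (∑' n, (aN A n : ℂ) * F n) := by
  have hfin' : ∀ n, Finite {I : FI A // idx I.1 = n} := fun n => by
    have := hfin n
    exact Finite.of_injective (fun I : {I : FI A // idx I.1 = n} =>
      (⟨I.1.1, fun h => I.1.2 (I.2.trans h), I.2⟩ : {I : Ideal A // n ≠ 0 ∧ idx I = n}))
      fun I J hIJ => Subtype.ext (Subtype.ext (congrArg (fun x => x.1) hIJ))
  let e := Equiv.sigmaFiberEquiv (fun I : FI A => idx I.1)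
  have he : ∀ x : (Σ n, {I : FI A // idx I.1 = n}), idx (e x).1 = x.1 := fun x => x.2.2
  have hs : Summable fun x : (Σ n, {I : FI A // idx I.1 = n}) => ‖F x.1‖ := by
    rw [summable_sigma_of_nonneg (fun _ => norm_nonneg _)]
    refine ⟨fun n => ?_, ?_⟩
    · have := hfin' n
      exact Summable.of_finite
    · refine h.congr fun n => ?_
      rw [← card_fiber, ← nsmul_eq_mul]
      exact (tsum_const _).symm
  have hs' : Summable fun I : FI A => ‖F (idx I.1)‖ := by
    rw [← e.summable_iff]
    exact hs.congr fun x => by simp [he]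
  refine ⟨hs', ?_⟩
  rw [← e.hasSum_iff]
  have h1 : (fun I : FI A => F (idx I.1)) ∘ e = fun x => F x.1 := funext fun x => by simp [he]
  rw [h1]
  have h2 := hs.of_norm.hasSum
  have h3 : ∑' x : (Σ n, {I : FI A // idx I.1 = n}), F x.1 = ∑' n, (aN A n : ℂ) * F n := by
    rw [hs.of_norm.tsum_sigma]
    refine tsum_congr fun n => ?_
    rw [← card_fiber, ← nsmul_eq_mul]
    exact tsum_const (F n)
  rw [← h3]
  exact h2

/-- Dirichlet coefficients of the zeta function of an order. -/
def aF (s : ℂ) (n : ℕ) : ℂ := aN A n * (n : ℂ) ^ (-s)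

lemma norm_aF (s : ℂ) (n : ℕ) : ‖aF A s n‖ = aN A n * (n : ℝ) ^ (-s.re) := by
  rcases Nat.eq_zero_or_pos n with rfl | hn
  · simp [aF, aN_zero]
  · rw [aF, norm_mul, Complex.norm_natCast_cpow_of_pos hn, Complex.norm_natCast, Complex.neg_re]

lemma aF_zero (s : ℂ) : aF A s 0 = 0 := by simp [aF, aN_zero]
lemma aF_one (s : ℂ) : aF A s 1 = 1 := by simp [aF, aN_one]
lemma aF_mul (s : ℂ) {m n : ℕ} (h : Nat.Coprime m n) : aF A s (m * n) = aF A s m * aF A s n := by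
  rw [aF, aF, aF, aN_mul h]
  push_cast
  rw [Complex.natCast_mul_natCast_cpow]
  ring

lemma summable_aF {D : ℕ} (h : ∀ n, aN A n ≤ n ^ D) {s : ℂ} (hs : (D : ℝ) + 1 < s.re) :
    Summable fun n => ‖aF A s n‖ := by
  have h1 : Summable fun n : ℕ => (n : ℝ) ^ ((D : ℝ) - s.re) :=
    Real.summable_nat_rpow.mpr (by linarith)
  refine Summable.of_nonneg_of_le (fun _ => norm_nonneg _) (fun n => ?_) h1
  rw [norm_aF]
  rcases Nat.eq_zero_or_pos n with rfl | hn
  · simp [aN_zero]; positivity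
  rw [sub_eq_add_neg, rpow_add (by exact_mod_cast hn), rpow_natCast]
  gcongr
  exact_mod_cast h n

/-- Polynomial growth on prime powers. -/
def PolyGrowth : Prop := ∀ p : ℕ, p.Prime → ∃ C g : ℕ, ∀ k, aN A (p ^ k) ≤ C * (k + 1) ^ g

variable {A}

lemma PolyGrowth.summable_bound (hA : PolyGrowth A) {p : ℕ} (hp : p.Prime) {σ : ℝ} (hσ : 0 < σ) :
    Summable fun k : ℕ => (aN A (p ^ k) : ℝ) * ((p ^ k : ℕ) : ℝ) ^ (-σ) := by
  obtain ⟨C, g, h⟩ := hA p hp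
  have hr : ‖(p : ℝ) ^ (-σ)‖ < 1 := by
    rw [norm_of_nonneg (by positivity)]
    exact Real.rpow_lt_one_of_one_lt_of_neg (by exact_mod_cast hp.one_lt) (by linarith)
  have hp0 : (0:ℝ) < p := by exact_mod_cast hp.pos
  have h0 : Summable fun k : ℕ => (k : ℝ) ^ g * ((p : ℝ) ^ (-σ)) ^ k :=
    summable_pow_mul_geometric_of_norm_lt_one g hr
  have h1 : Summable fun k : ℕ => ((k + 1 : ℕ) : ℝ) ^ g * ((p : ℝ) ^ (-σ)) ^ (k + 1) :=
    (summable_nat_add_iff 1).mpr h0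
  have hpow : ∀ k : ℕ, ((p ^ k : ℕ) : ℝ) ^ (-σ) = ((p : ℝ) ^ (-σ)) ^ k := fun k => by
    rw [Nat.cast_pow, ← rpow_natCast, ← rpow_natCast, ← rpow_mul hp0.le,
      ← rpow_mul hp0.le, mul_comm]
  have h3 : (p : ℝ) ^ σ * (p : ℝ) ^ (-σ) = 1 := by
    rw [← rpow_add hp0, add_neg_cancel, Real.rpow_zero]
  have hx0 : 0 ≤ (p : ℝ) ^ (-σ) := Real.rpow_nonneg hp0.le _
  simp only [hpow]
  generalize (p : ℝ) ^ (-σ) = x at *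
  generalize (p : ℝ) ^ σ = y at *
  refine Summable.of_nonneg_of_le (fun k => mul_nonneg (Nat.cast_nonneg _) (pow_nonneg hx0 k)) (fun k => ?_)
    (h1.mul_left (C * y))
  have h4 : (aN A (p ^ k) : ℝ) ≤ C * ((k + 1 : ℕ) : ℝ) ^ g := by exact_mod_cast h k
  calc (aN A (p ^ k) : ℝ) * x ^ k ≤ C * ((k + 1 : ℕ) : ℝ) ^ g * x ^ k :=
        mul_le_mul_of_nonneg_right h4 (pow_nonneg hx0 k)
    _ = C * ((k + 1 : ℕ) : ℝ) ^ g * x ^ k * (y * x) := by rw [h3, mul_one]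
    _ = _ := by
      rw [pow_succ]
      ring

/-- The Euler factor at `p`. -/
def EF (A : Type*) [CommRing A] (p : ℕ) (s : ℂ) : ℂ := ∑' k : ℕ, aF A s (p ^ k)

lemma PolyGrowth.summable (hA : PolyGrowth A) {p : ℕ} (hp : p.Prime) {s : ℂ} (hs : 0 < s.re) :
    Summable fun k : ℕ => ‖aF A s (p ^ k)‖ := by
  simpa only [norm_aF] using hA.summable_bound hp hs

lemma PolyGrowth.differentiableOn_EF (hA : PolyGrowth A) {p : ℕ} (hp : p.Prime) :
    DifferentiableOn ℂ (EF A p) {s | 0 < s.re} := by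
  intro s hs
  have hs' : 0 < s.re := hs
  have hU : IsOpen {z : ℂ | s.re / 2 < z.re} := isOpen_lt continuous_const Complex.continuous_re
  have h := Complex.differentiableOn_tsum_of_summable_norm (F := fun k z => aF A z (p ^ k))
    (hA.summable_bound hp (half_pos hs')) (fun k => ?_) hU (fun k z hz => ?_)
  · exact (h.differentiableAt (hU.mem_nhds (show s.re / 2 < s.re by linarith))).differentiableWithinAt
  · refine DifferentiableOn.const_mul ?_ _
    intro z _
    refine DifferentiableAt.differentiableWithinAt ?_
    refine DifferentiableAt.const_cpow (by fun_prop) (Or.inl ?_)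
    exact_mod_cast pow_ne_zero k hp.ne_zero
  · rw [norm_aF]
    have : (1:ℝ) ≤ ((p ^ k : ℕ) : ℝ) := by exact_mod_cast Nat.one_le_pow _ _ hp.pos
    have hz' : s.re / 2 < z.re := hz
    gcongr

lemma PolyGrowth.EF_half (hA : PolyGrowth A) {p : ℕ} (hp : p.Prime) :
    ∃ r : ℝ, 0 < r ∧ EF A p (1 / 2) = r := by
  have h := hA.summable_bound hp (σ := 1 / 2) (by norm_num)
  refine ⟨∑' k : ℕ, (aN A (p ^ k) : ℝ) * ((p ^ k : ℕ) : ℝ) ^ (-(1/2 : ℝ)), ?_, ?_⟩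
  · exact h.tsum_pos (fun k => by positivity) 0 (by simp [aN_one])
  · rw [EF, Complex.ofReal_tsum]
    refine tsum_congr fun k => ?_
    rw [aF]
    push_cast
    rw [Complex.ofReal_cpow (by positivity)]
    push_cast
    rfl

/-- The zeta function of an order as a Dirichlet series. -/
def ZF (A : Type*) [CommRing A] (s : ℂ) : ℂ := ∑' n : ℕ, aF A s n

lemma ZF_mul_eq {B : Type*} [CommRing B] {m : ℕ} {s : ℂ} 
    (hA : Summable fun n => ‖aF A s n‖) (hB : Summable fun n => ‖aF B s n‖)
    (h : ∀ p : ℕ, p.Prime → ¬ p ∣ m → ∀ k, aN A (p ^ k) = aN B (p ^ k)) (hm : m ≠ 0) :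
    ZF A s * ∏ p ∈ m.primeFactors, EF B p s = ZF B s * ∏ p ∈ m.primeFactors, EF A p s := by
  have tA := EulerProduct.eulerProduct (aF_one A s) (aF_mul A s) hA (aF_zero A s)
  have tB := EulerProduct.eulerProduct (aF_one B s) (aF_mul B s) hB (aF_zero B s)
  have t1 := tA.mul_const (∏ p ∈ m.primeFactors, EF B p s)
  have t2 := tB.mul_const (∏ p ∈ m.primeFactors, EF A p s)
  refine tendsto_nhds_unique t1 (t2.congr' ?_)
  filter_upwards [eventually_gt_atTop m] with N hN
  have hsub : m.primeFactors ⊆ N.primesBelow := by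
    intro p hp
    rw [Nat.mem_primesBelow]
    exact ⟨(Nat.le_of_mem_primeFactors hp).trans_lt hN, Nat.prime_of_mem_primeFactors hp⟩
  rw [← Finset.prod_sdiff hsub, ← Finset.prod_sdiff hsub]
  have : ∏ x ∈ N.primesBelow \ m.primeFactors, ∑' e, aF B s (x ^ e) =
      ∏ x ∈ N.primesBelow \ m.primeFactors, ∑' e, aF A s (x ^ e) := by
    refine Finset.prod_congr rfl fun p hp => tsum_congr fun k => ?_
    rw [Finset.mem_sdiff, Nat.mem_primesBelow] at hp
    rw [aF, aF, h p hp.1.2 (fun hd => hp.2 (Nat.mem_primeFactors.mpr ⟨hp.1.2, hd, hm⟩)) k]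
  rw [this]
  simp only [EF]
  ring

lemma PolyGrowth.summable_smooth (hA : PolyGrowth A) (S : Finset ℕ) {σ : ℝ} (hσ : 0 < σ) :
    Summable fun n : Nat.factoredNumbers S => (aN A n : ℝ) * ((n : ℕ) : ℝ) ^ (-σ) := by
  have := (EulerProduct.summable_and_hasSum_factoredNumbers_prod_filter_prime_tsum
    (aF_one A (σ : ℂ)) (aF_mul A (σ : ℂ)) (fun hp => hA.summable hp (by simpa using hσ)) S).1
  simpa only [norm_aF, Complex.ofReal_re] using this

end Dirichlet

open Module NumberField Set

section Lattices
variable {K : Type*} [Field K] [NumberField K] {R : Type*} [CommRing R] [IsDomain R] [CharZero R] [Algebra R K]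
variable (bR : Basis (Fin (finrank ℚ K)) ℤ R) (hinj : Injective (algebraMap R K))

/-- The image of an ideal in the field. -/
def latOf (I : Ideal R) : Submodule R K := Submodule.map (Algebra.linearMap R K) I

include bR hinj in
lemma isLat_latOf {I : Ideal R} (hI : I ≠ ⊥) : IsLat (latOf (K := K) I) := by
  let v := Ideal.selfBasis bR I hI
  have h1 : LinearIndependent ℤ (fun i => algebraMap R K (v i)) := by
    have := v.linearIndependent
    have h2 : LinearIndependent ℤ (((algebraMap R K).toAddMonoidHom.toIntLinearMap ∘ₗ
        (Submodule.subtype I).restrictScalars ℤ) ∘ v) := by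
      refine this.map' _ ?_
      rw [LinearMap.ker_eq_bot]
      exact hinj.comp Subtype.val_injective
    exact h2
  have h2 : LinearIndependent ℚ (fun i => algebraMap R K (v i)) :=
    (LinearIndependent.iff_fractionRing (R := ℤ) (K := ℚ)).mp h1
  have : Nonempty (Fin (finrank ℚ K)) := ⟨⟨0, finrank_pos⟩⟩
  let b := basisOfLinearIndependentOfCardEqFinrank h2 (by simp)
  refine ⟨b, ?_⟩
  have hb : ∀ i, b i = algebraMap R K (v i) := fun i => by
    simp [b]
  refine le_antisymm ?_ ?_
  · rintro x ⟨r, hr, rfl⟩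
    have h4 := congrArg (fun z : I => algebraMap R K z.1) (v.sum_repr ⟨r, hr⟩)
    simp only [AddSubmonoidClass.coe_finsetSum, map_sum] at h4
    change algebraMap R K r ∈ _
    rw [← h4]
    refine AddSubgroup.sum_mem _ fun i _ => ?_
    have : (algebraMap R K) ((v.repr ⟨r, hr⟩ i • v i : I) : R) = v.repr ⟨r, hr⟩ i • b i := by
      rw [hb]; simp
    rw [this]
    exact AddSubgroup.zsmul_mem _ (AddSubgroup.subset_closure (mem_range_self i)) _
  · rw [AddSubgroup.closure_le]
    rintro _ ⟨i, rfl⟩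
    rw [hb]
    exact ⟨v i, (v i).2, rfl⟩

lemma latOf_top : latOf (K := K) (⊤ : Ideal R) = 1 := by
  rw [latOf, Submodule.map_top, Submodule.one_eq_range]

lemma relIndex_latOf (hinj : Injective (algebraMap R K)) (I : Ideal R) :
    (latOf (K := K) I).toAddSubgroup.relIndex (1 : Submodule R K).toAddSubgroup = idx I := by
  rw [← latOf_top]
  have h := AddSubgroup.relIndex_map_map_of_injective (f := (algebraMap R K).toAddMonoidHom)
    I.toAddSubgroup (⊤ : Ideal R).toAddSubgroup hinj
  have h2 : (⊤ : Ideal R).toAddSubgroup = ⊤ := rfl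
  rw [h2, AddSubgroup.relIndex_top_right] at h
  exact h

include bR hinj in
lemma isLat_one : IsLat (1 : Submodule R K) := by
  rw [← latOf_top]
  exact isLat_latOf bR hinj top_ne_bot

include bR hinj in
lemma latVol_latOf {I : Ideal R} (hI : I ≠ ⊥) :
    latVol (latOf (K := K) I) = idx I * latVol (1 : Submodule R K) := by
  rw [latVol_of_le (isLat_latOf bR hinj hI) (isLat_one bR hinj), relIndex_latOf hinj]
  rw [← latOf_top]
  exact Submodule.map_mono le_top

/-- Finite-index ideals versus integral lattices. -/
def latEquiv : FI R ≃ ILat K R where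
  toFun I := ⟨latOf I.1, isLat_latOf bR hinj (ne_bot_of_idx I.2 rfl), by
    rw [← latOf_top]; exact Submodule.map_mono le_top⟩
  invFun J := ⟨J.1.comap (Algebra.linearMap R K), by
    have h1 := latVol_of_le J.2.1 (isLat_one bR hinj) J.2.2
    have h2 : latOf (K := K) (J.1.comap (Algebra.linearMap R K)) = J.1 := by
      rw [latOf, Submodule.map_comap_eq, ← Submodule.one_eq_range]
      exact inf_eq_right.mpr J.2.2
    rw [← relIndex_latOf hinj, h2]
    intro h0
    rw [h0, Nat.cast_zero, zero_mul] at h1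
    exact (latVol_pos J.1).ne' h1⟩
  left_inv I := Subtype.ext (Submodule.comap_map_eq_of_injective hinj I.1)
  right_inv J := by
    refine Subtype.ext ?_
    change Submodule.map _ (Submodule.comap _ J.1) = J.1
    rw [Submodule.map_comap_eq, ← Submodule.one_eq_range]
    exact inf_eq_right.mpr J.2.2

lemma lsz_latEquiv {δ : Kˣ} (hR : tau δ (1 : Submodule R K) = 1) (I : FI R) :
    lsz δ (latEquiv bR hinj I) = log |(Algebra.norm ℚ (δ : K) : ℝ)| / 2 - log (idx I.1) := by
  have h1 := latVol_tau (isLat_one (K := K) bR hinj) δ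
  rw [hR] at h1
  have hI : I.1 ≠ ⊥ := ne_bot_of_idx I.2 rfl
  have h2 := latVol_tau (isLat_latOf (K := K) bR hinj hI) δ
  rw [latVol_latOf bR hinj hI] at h2
  have p1 := latVol_pos (1 : Submodule R K)
  have p3 : (0:ℝ) < idx I.1 := by exact_mod_cast Nat.pos_of_ne_zero I.2
  have h3 : latVol (tau δ (latOf (K := K) I.1)) = latVol (1 : Submodule R K) / idx I.1 := by
    rw [eq_div_iff p3.ne']
    have : latVol (tau δ (latOf (K := K) I.1)) * idx I.1 * latVol (1 : Submodule R K) =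
      latVol (1 : Submodule R K) * latVol (1 : Submodule R K) := by rw [h1, ← h2]; ring
    exact mul_right_cancel₀ p1.ne' this
  change log (latVol (tau δ (latOf I.1))) = _
  rw [h3, log_div p1.ne' p3.ne', ← h1, log_mul p1.ne' p1.ne']
  ring

lemma exp_lsz {δ : Kˣ} (hR : tau δ (1 : Submodule R K) = 1) (I : FI R) (s : ℂ) :
    cexp (s * lsz δ (latEquiv bR hinj I)) =
      cexp (s * (log |(Algebra.norm ℚ (δ : K) : ℝ)| / 2 : ℝ)) * ((idx I.1 : ℕ) : ℂ) ^ (-s) := by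
  rw [lsz_latEquiv bR hinj hR, Complex.cpow_def_of_ne_zero (by exact_mod_cast I.2), ← Complex.exp_add,
    ← Complex.ofReal_natCast, ← Complex.ofReal_log (by positivity)]
  congr 1
  push_cast
  ring

/-- Abscissa used for absolute convergence. -/
def absc (K : Type*) [Field K] [NumberField K] : ℝ := (finrank ℚ K * finrank ℚ K : ℕ) + 2

include bR in
lemma summable_aF_order {s : ℂ} (hs : absc K ≤ s.re) : Summable fun n => ‖aF R s n‖ :=
  summable_aF R (aN_le bR) (by unfold absc at hs; linarith)

include bR in
lemma hasSum_ZF {s : ℂ} (hs : absc K ≤ s.re) :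
    (Summable fun I : FI R => ‖((idx I.1 : ℕ) : ℂ) ^ (-s)‖) ∧
    HasSum (fun I : FI R => ((idx I.1 : ℕ) : ℂ) ^ (-s)) (ZF R s) := by
  refine hasSum_FI R (finite_idx bR) (fun n => (n : ℂ) ^ (-s)) ?_
  refine (summable_aF_order bR hs).congr fun n => ?_
  rw [aF, norm_mul, Complex.norm_natCast]

include bR hinj in
lemma summable_lsz {δ : Kˣ} (hR : tau δ (1 : Submodule R K) = 1) :
    Summable fun I : ILat K R => exp (absc K * lsz δ I) := by
  rw [← (latEquiv bR hinj).summable_iff]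
  have h := (hasSum_ZF (K := K) bR (s := (absc K : ℂ)) (by simp)).1
  refine (h.mul_left (exp (absc K * (log |(Algebra.norm ℚ (δ : K) : ℝ)| / 2)))).congr fun I => ?_
  have h2 := congrArg norm (exp_lsz bR hinj hR I (absc K : ℂ))
  rw [norm_mul, Complex.norm_exp, Complex.norm_exp, ← Complex.ofReal_mul, ← Complex.ofReal_mul,
    Complex.ofReal_re, Complex.ofReal_re] at h2
  exact h2.symm

lemma absc_pos : 0 < absc K := by unfold absc; positivity

include bR hinj in
lemma completed_ZF (i₀ : InfinitePlace K) (hi₀ : i₀.mult = 1) {δ : Kˣ}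
    (hR : tau δ (1 : Submodule R K) = 1) {s : ℂ} (hs : absc K ≤ s.re) :
    mellPsi (fun w : InfinitePlace K => w.mult) i₀ s *
      (cexp (s * (log |(Algebra.norm ℚ (δ : K) : ℝ)| / 2 : ℝ)) * ZF R s) =
      Lam R i₀ δ s + Lam R i₀ δ (1 - s) := by
  rw [← completed_zeta i₀ hi₀ hR absc_pos (summable_lsz bR hinj hR) hs]
  congr 1
  rw [← (latEquiv bR hinj).tsum_eq]
  simp only [exp_lsz bR hinj hR]
  rw [tsum_mul_left, (hasSum_ZF (K := K) bR hs).2.tsum_eq]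

end Lattices

section MaximalOrder
variable {K : Type*} [Field K] [NumberField K] {R : Type*} [CommRing R] [IsDomain R] [CharZero R] [Algebra R K]
variable (bR : Basis (Fin (finrank ℚ K)) ℤ R) (hinj : Injective (algebraMap R K))

include bR in
lemma isIntegral_of_order (r : R) : IsIntegral ℤ (algebraMap R K r) := by
  have : Module.Finite ℤ R := Module.Finite.of_basis bR
  exact (Algebra.IsIntegral.isIntegral (R := ℤ) r).map (algebraMap R K).toIntAlgHom

/-- An order maps into the ring of integers. -/
def toInt : R →+* 𝓞 K :=
  (algebraMap R K).codRestrict (integralClosure ℤ K) (isIntegral_of_order bR)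

include hinj in
lemma toInt_injective : Injective (toInt (K := K) bR) := fun _ _ h =>
  hinj (congrArg (fun x : 𝓞 K => (x : K)) h)

include hinj in
lemma exists_conductor : ∃ m : ℕ, m ≠ 0 ∧ ∀ x : 𝓞 K, ∃ r, toInt bR r = m * x := by
  obtain ⟨b₁, hb₁⟩ := isLat_one (K := K) bR hinj
  let e : Free.ChooseBasisIndex ℤ (𝓞 K) ≃ Fin (finrank ℚ K) :=
    Fintype.equivOfCardEq (by
      rw [Fintype.card_fin, ← finrank_eq_card_chooseBasisIndex, RingOfIntegers.rank])
  let b₂ := (integralBasis K).reindex e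
  have h2 : ∀ x : K, x ∈ AddSubgroup.closure (range b₂) ↔ x ∈ (algebraMap (𝓞 K) K).range := by
    intro x
    rw [← mem_span_integralBasis, ← Submodule.mem_toAddSubgroup, Submodule.span_int_eq_addSubgroupClosure,
      Basis.range_reindex]
  have h1 : AddSubgroup.closure (range b₁) ≤ AddSubgroup.closure (range b₂) := by
    rw [← hb₁]
    rintro x ⟨r, rfl⟩
    rw [h2]
    exact ⟨toInt bR r, (Algebra.algebraMap_eq_smul_one r)⟩
  have h3 := vol_of_le b₁ b₂ h1
  set m := (AddSubgroup.closure (range b₁)).relIndex (AddSubgroup.closure (range b₂))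
  have hm0 : m ≠ 0 := by
    intro h
    rw [h] at h3
    have := vol_pos b₁
    simp [h3] at this
  refine ⟨m, hm0, fun x => ?_⟩
  have hx : (x : K) ∈ AddSubgroup.closure (range b₂) := (h2 _).2 ⟨x, rfl⟩
  have h4 := AddSubgroup.nsmul_index_mem ((AddSubgroup.closure (range b₁)).addSubgroupOf
    (AddSubgroup.closure (range b₂))) ⟨x, hx⟩
  rw [AddSubgroup.mem_addSubgroupOf] at h4
  have h5 : m • (x : K) ∈ AddSubgroup.closure (range b₁) := h4
  rw [← hb₁] at h5
  obtain ⟨r, hr⟩ := h5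
  refine ⟨r, ?_⟩
  apply RingOfIntegers.coe_injective
  have h6 : (toInt bR r : K) = m • (x : K) := (Algebra.algebraMap_eq_smul_one r).trans hr
  simpa using h6

lemma aN_pow_eq_of_coprime {A B : Type*} [CommRing A] [CommRing B] [IsDomain B] [CharZero B] (f : A →+* B)
    (hf : Injective f) {m : ℕ} (hmf : ∀ x, ∃ r, f r = m * x) {N : ℕ} 
    (hN : Nat.Coprime m N) {n : ℕ} (hn : n ∣ N) : aN A n = aN B n := by
  obtain ⟨u, v, huv⟩ : ∃ u v : ℤ, u * m + v * N = 1 := by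
    have := Nat.isCoprime_iff_coprime.mpr hN
    exact this
  have huvB : (u : B) * m + v * N = 1 := by exact_mod_cast congrArg (fun z : ℤ => (z : B)) huv
  have huvA : (u : A) * m + v * N = 1 := by exact_mod_cast congrArg (fun z : ℤ => (z : A)) huv
  refine aN_congr (f := (Ideal.Quotient.mk (Ideal.span {(N : B)})).comp f)
    (f' := Ideal.Quotient.mk (Ideal.span {(N : B)})) ?_ Ideal.Quotient.mk_surjective ?_
    (Ideal.mk_ker) hn
  · intro y
    obtain ⟨x, rfl⟩ := Ideal.Quotient.mk_surjective y
    obtain ⟨r, hr⟩ := hmf (u * x)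
    refine ⟨r, ?_⟩
    rw [RingHom.comp_apply, hr, Ideal.Quotient.eq, Ideal.mem_span_singleton]
    exact ⟨-v * x, by linear_combination x * huvB⟩
  · ext a
    rw [RingHom.mem_ker, RingHom.comp_apply, Ideal.Quotient.eq_zero_iff_mem,
      Ideal.mem_span_singleton, Ideal.mem_span_singleton]
    constructor
    · rintro ⟨x, hx⟩
      obtain ⟨r, hr⟩ := hmf x
      have : (m : A) * a = N * r := hf (by simp only [map_mul, map_natCast, hr, hx]; ring)
      exact ⟨u * r + v * a, by linear_combination (-a) * huvA + u * this⟩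
    · rintro ⟨x, rfl⟩
      exact ⟨f x, by simp⟩

include bR hinj in
lemma polyGrowth_order : PolyGrowth R := fun p hp => by
  obtain ⟨m, hm, h⟩ := exists_conductor bR hinj
  exact aN_pow_le (toInt bR) (toInt_injective bR hinj) hm h p hp.ne_zero

variable (K) in
lemma polyGrowth_ringOfIntegers : PolyGrowth (𝓞 K) := fun p hp => by
  exact aN_pow_le (RingHom.id (𝓞 K)) Function.injective_id one_ne_zero (fun a => ⟨a, by simp⟩) p hp.ne_zero

variable (K) in
lemma dedekindSeries_eq_ZF {s : ℂ} (hs : absc K ≤ s.re) : 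
    (Summable fun n => ‖aF (𝓞 K) s n‖) ∧ dedekindSeries K s = ZF (𝓞 K) s := by
  let e : Free.ChooseBasisIndex ℤ (𝓞 K) ≃ Fin (finrank ℚ K) :=
    Fintype.equivOfCardEq (by
      rw [Fintype.card_fin, ← finrank_eq_card_chooseBasisIndex, RingOfIntegers.rank])
  let b := (RingOfIntegers.basis K).reindex e
  have h := (hasSum_ZF (K := K) b hs).2
  refine ⟨summable_aF_order (K := K) b hs, ?_⟩
  rw [← h.tsum_eq, dedekindSeries]
  rw [← (Equiv.subtypeEquivRight (fun I : Ideal (𝓞 K) => not_congr (Ideal.absNorm_eq_zero_iff (I := I)).symm) :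
    {I : Ideal (𝓞 K) // I ≠ ⊥} ≃ FI (𝓞 K)).tsum_eq]
  rfl

lemma PolyGrowth.differentiableAt_prod {A : Type*} [CommRing A] (hA : PolyGrowth A) (m : ℕ) {s : ℂ}
    (hs : 0 < s.re) : DifferentiableAt ℂ (fun s => ∏ p ∈ m.primeFactors, EF A p s) s := by
  refine DifferentiableAt.fun_finsetProd fun p hp => ?_
  exact (hA.differentiableOn_EF (Nat.prime_of_mem_primeFactors hp)).differentiableAt
    ((isOpen_lt continuous_const Complex.continuous_re).mem_nhds hs)

lemma PolyGrowth.prod_half {A : Type*} [CommRing A] (hA : PolyGrowth A) (m : ℕ) :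
    ∃ r : ℝ, 0 < r ∧ ∏ p ∈ m.primeFactors, EF A p (1 / 2) = r := by
  choose! r hr using fun p (hp : p ∈ m.primeFactors) => hA.EF_half (Nat.prime_of_mem_primeFactors hp)
  refine ⟨∏ p ∈ m.primeFactors, r p, Finset.prod_pos fun p hp => (hr p hp).1, ?_⟩
  rw [Complex.ofReal_prod]
  exact Finset.prod_congr rfl fun p hp => (hr p hp).2

include bR hinj in
/-- The central value of the Dedekind zeta function in terms of an order. -/
lemma central_value_eq {g : ℂ → ℂ} (hg : IsDedekindZeta K g) (i₀ : InfinitePlace K)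
    (hi₀ : i₀.mult = 1) {δ : Kˣ} (hR : tau δ (1 : Submodule R K) = 1) :
    ∃ C : ℝ, 0 < C ∧ g (1 / 2) = C * Lam R i₀ δ (1 / 2) := by
  obtain ⟨m, hm0, hm⟩ := exists_conductor bR hinj
  have hPR := polyGrowth_order bR hinj
  have hPO := polyGrowth_ringOfIntegers K
  set n : InfinitePlace K → ℕ := fun w => w.mult
  set L : ℝ := log |(Algebra.norm ℚ (δ : K) : ℝ)| / 2
  have hΛ : Differentiable ℂ (Lam R i₀ δ) :=
    differentiable_Lam i₀ (absc_pos (K := K)) (summable_lsz bR hinj hR)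
  let G₁ : ℂ → ℂ := fun s => g s * (∏ p ∈ m.primeFactors, EF R p s) *
    (mellPsi n i₀ s * cexp (s * L))
  let G₂ : ℂ → ℂ := fun s => (Lam R i₀ δ s + Lam R i₀ δ (1 - s)) * ∏ p ∈ m.primeFactors, EF (𝓞 K) p s
  have hG₁ : ∀ s : ℂ, 0 < s.re → s ≠ 1 → DifferentiableAt ℂ G₁ s := by
    intro s hs h1
    have hgs : DifferentiableAt ℂ g s := hg.1.differentiableAt (isOpen_compl_singleton.mem_nhds h1)
    exact (hgs.mul (hPR.differentiableAt_prod m hs)).mul ((differentiableAt_mellPsi n i₀ mult_pos' hs).mul (by fun_prop))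
  have hG₂ : ∀ s : ℂ, 0 < s.re → DifferentiableAt ℂ G₂ s := by
    intro s hs
    refine DifferentiableAt.mul ?_ (hPO.differentiableAt_prod m hs)
    exact (hΛ s).add ((hΛ (1 - s)).comp s (by fun_prop))
  have hlarge : ∀ s : ℂ, absc K ≤ s.re → 1 < s.re → G₁ s = G₂ s := by
    intro s hs h1
    have e1 := completed_ZF bR hinj i₀ hi₀ hR hs
    obtain ⟨hso, e2⟩ := dedekindSeries_eq_ZF K hs
    have e3 := ZF_mul_eq (summable_aF_order (K := K) bR hs) hso (m := m) (fun p hp hpm k =>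
      aN_pow_eq_of_coprime (toInt bR) (toInt_injective bR hinj) hm
        (N := p ^ k) (Nat.Coprime.pow_right _ ((Nat.Prime.coprime_iff_not_dvd hp).2 hpm).symm) dvd_rfl) hm0
    simp only [G₁, G₂]
    rw [hg.2 s h1, e2, ← e1, ← e3]
    ring
  let U : Set ℂ := {s | 0 < s.re ∧ 0 < s.im}
  have hUo : IsOpen U := (isOpen_lt continuous_const Complex.continuous_re).inter
    (isOpen_lt continuous_const Complex.continuous_im)
  have hUc : Convex ℝ U := (convex_halfSpace_re_gt 0).inter (convex_halfSpace_im_gt 0)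
  have hU1 : ∀ s ∈ U, s ≠ 1 := by
    rintro s ⟨_, h⟩ rfl
    simp at h
  have hA₁ : AnalyticOnNhd ℂ G₁ U := DifferentiableOn.analyticOnNhd
    (fun s hs => (hG₁ s hs.1 (hU1 s hs)).differentiableWithinAt) hUo
  have hA₂ : AnalyticOnNhd ℂ G₂ U := DifferentiableOn.analyticOnNhd
    (fun s hs => (hG₂ s hs.1).differentiableWithinAt) hUo
  have hpos := absc_pos (K := K)
  have hz : ((absc K + 2 : ℝ) + I : ℂ) ∈ U := by
    constructor
    · simp; linarith
    · simp
  have hEq : EqOn G₁ G₂ U := by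
    refine hA₁.eqOn_of_preconnected_of_eventuallyEq hA₂ hUc.isPreconnected hz ?_
    have : {s : ℂ | absc K + 1 < s.re} ∈ 𝓝 ((absc K + 2 : ℝ) + I : ℂ) :=
      (isOpen_lt continuous_const Complex.continuous_re).mem_nhds (by simp)
    filter_upwards [this] with s hs
    exact hlarge s (by linarith) (by linarith)
  have hcl : (1 / 2 : ℂ) ∈ closure U := by
    refine mem_closure_of_tendsto (f := fun k : ℕ => (1 / 2 : ℂ) + ((1 / ((k : ℝ) + 1) : ℝ) : ℂ) * I)
      (b := atTop) ?_ (Eventually.of_forall fun k => ?_)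
    · have h0 : Tendsto (fun k : ℕ => ((1 / ((k : ℝ) + 1) : ℝ) : ℂ)) atTop (𝓝 ((0 : ℝ) : ℂ)) :=
        (Complex.continuous_ofReal.tendsto 0).comp tendsto_one_div_add_atTop_nhds_zero_nat
      simpa using (h0.mul_const I).const_add (1 / 2 : ℂ)
    · constructor
      · simp
      · rw [Complex.add_im, Complex.im_ofReal_mul]
        simp only [Complex.I_im, mul_one]
        have : (1 / 2 : ℂ).im = 0 := by norm_num
        rw [this, zero_add]
        positivity
  have hhalf : G₁ (1 / 2) = G₂ (1 / 2) := by
    have : (𝓝[U] (1 / 2 : ℂ)).NeBot := mem_closure_iff_nhdsWithin_neBot.1 hcl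
    have hc1 := (hG₁ (1 / 2) (by norm_num) (by norm_num)).continuousAt.continuousWithinAt (s := U)
    have hc2 := (hG₂ (1 / 2) (by norm_num)).continuousAt.continuousWithinAt (s := U)
    refine tendsto_nhds_unique_of_eventuallyEq hc1 hc2 ?_
    filter_upwards [self_mem_nhdsWithin] with s hs using hEq hs
  obtain ⟨r₁, hr₁, e₁⟩ := hPR.prod_half m
  obtain ⟨r₂, hr₂, e₂⟩ := hPO.prod_half m
  obtain ⟨r₃, hr₃, e₃⟩ := mellPsi_half n i₀ mult_pos' hi₀
  have e₄ : cexp ((1 / 2 : ℂ) * L) = (exp (1 / 2 * L) : ℝ) := by push_cast; rfl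
  simp only [G₁, G₂] at hhalf
  rw [e₁, e₂, e₃, e₄, show (1 - 1 / 2 : ℂ) = 1 / 2 by norm_num] at hhalf
  have h1 := exp_pos (1 / 2 * L)
  refine ⟨2 * r₂ / (r₁ * (r₃ * exp (1 / 2 * L))), by positivity, ?_⟩
  have h2 : (r₁ : ℂ) ≠ 0 := by exact_mod_cast hr₁.ne'
  have h3 : (r₃ : ℂ) ≠ 0 := by exact_mod_cast hr₃.ne'
  have h4 : ((exp (1 / 2 * L) : ℝ) : ℂ) ≠ 0 := by exact_mod_cast h1.ne'
  rw [e₄.symm] at h4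
  push_cast
  rw [show (1 / 2 * (L : ℂ)) = 1 / 2 * L from rfl] at e₄
  push_cast at hhalf
  generalize cexp (1 / 2 * (L : ℂ)) = E at hhalf h4 ⊢
  field_simp
  linear_combination hhalf
end MaximalOrder

open MeasureTheory

lemma monotone_wt : Monotone wt := fun _ _ h => smoothTransition.monotone (by linarith)

section SmoothedSum
variable (A : Type*) [CommRing A]

/-- The `n`-th term of the smoothed central sum. -/
def wsTerm (n : ℕ) (u : ℝ) : ℝ := (n : ℝ) ^ (-(1 / 2) : ℝ) * wt (u - log n)

/-- The smoothed central sum of the zeta function of a ring. -/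
def WS (u : ℝ) : ℝ := ∑' n : ℕ, (aN A n : ℝ) * wsTerm n u

lemma wsTerm_nonneg (n : ℕ) (u : ℝ) : 0 ≤ wsTerm n u :=
  mul_nonneg (by positivity) (wt_nonneg _)

variable {A}

lemma aN_mul_wsTerm_le {D : ℕ} (h : ∀ n, aN A n ≤ n ^ D) (n : ℕ) (u : ℝ) :
    (aN A n : ℝ) * wsTerm n u ≤ (exp ((D + 2) / 2) * exp ((D + 2) * u)) * (1 / (n : ℝ) ^ 2) := by
  rcases Nat.eq_zero_or_pos n with rfl | hn
  · simp [aN_zero]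
  have hn' : (1 : ℝ) ≤ n := by exact_mod_cast hn
  have hn0 : (0 : ℝ) < n := by linarith
  have h1 : (n : ℝ) ^ (-(1 / 2) : ℝ) ≤ 1 := Real.rpow_le_one_of_one_le_of_nonpos hn' (by norm_num)
  have h2 := wt_exp_le (u := u - log n) (le_refl (0 : ℝ)) (show (0 : ℝ) ≤ (D : ℝ) + 2 by positivity)
  rw [zero_mul, Real.exp_zero, mul_one, sub_zero, mul_sub, exp_sub, mul_comm _ (log n),
    exp_mul (log n), exp_log hn0, show ((D : ℝ) + 2) = ((D + 2 : ℕ) : ℝ) by push_cast; rfl,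
    rpow_natCast] at h2
  have h3 : (aN A n : ℝ) ≤ (n : ℝ) ^ D := by exact_mod_cast h n
  calc (aN A n : ℝ) * wsTerm n u ≤ (n : ℝ) ^ D * (1 * _) :=
        mul_le_mul h3 (mul_le_mul h1 h2 (wt_nonneg _) (by norm_num)) (wsTerm_nonneg n u) (by positivity)
    _ = _ := by
        push_cast
        rw [pow_add]
        field_simp

lemma summable_wsTerm {D : ℕ} (h : ∀ n, aN A n ≤ n ^ D) (u : ℝ) :
    Summable fun n => (aN A n : ℝ) * wsTerm n u :=
  Summable.of_nonneg_of_le (fun n => mul_nonneg (by positivity) (wsTerm_nonneg n u))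
    (fun n => aN_mul_wsTerm_le h n u)
    ((Real.summable_one_div_nat_pow.mpr (by norm_num)).mul_left _)

lemma WS_nonneg (u : ℝ) : 0 ≤ WS A u :=
  tsum_nonneg fun n => mul_nonneg (by positivity) (wsTerm_nonneg n u)

lemma WS_le {D : ℕ} (h : ∀ n, aN A n ≤ n ^ D) :
    ∃ C, ∀ u, WS A u ≤ C * exp ((D + 2) * u) := by
  refine ⟨exp ((D + 2) / 2) * ∑' n : ℕ, (1 / (n : ℝ) ^ 2), fun u => ?_⟩
  have hs : Summable fun n : ℕ => 1 / (n : ℝ) ^ 2 := Real.summable_one_div_nat_pow.mpr (by norm_num)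
  refine ((summable_wsTerm h u).tsum_le_tsum (fun n => aN_mul_wsTerm_le h n u) (hs.mul_left _)).trans ?_
  rw [tsum_mul_left]
  exact le_of_eq (by ring)

lemma monotone_WS {D : ℕ} (h : ∀ n, aN A n ≤ n ^ D) : Monotone (WS A) := fun u v huv =>
  (summable_wsTerm h u).tsum_le_tsum (fun n => mul_le_mul_of_nonneg_left
    (mul_le_mul_of_nonneg_left (monotone_wt (by linarith)) (by positivity)) (by positivity))
    (summable_wsTerm h v)

lemma integrable_psiW_WS {ι : Type*} [Fintype ι] (n : ι → ℕ) (i₀ : ι) (hn : ∀ i, 0 < n i)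
    {D : ℕ} (h : ∀ n, aN A n ≤ n ^ D) (c : ℝ) :
    Integrable fun y => psiW n i₀ y * (exp (nuW n y / 2) * WS A (c + nuW n y)) := by
  obtain ⟨C, hC⟩ := WS_le h
  have hm := (monotone_WS h).measurable
  have h1 := continuous_psiW n i₀
  have h2 := continuous_nuW n
  refine ((integrable_psiW n i₀ hn (σ := D + 2 + 1 / 2) (by positivity)).norm.const_mul
    (C * exp ((D + 2) * c))).mono' ?_ (Eventually.of_forall fun y => ?_)
  · exact (h1.measurable.mul ((Real.continuous_exp.comp (h2.div_const 2)).measurable.mul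
      (hm.comp (h2.const_add c).measurable))).aestronglyMeasurable
  · rw [norm_mul, norm_mul, norm_mul, norm_of_nonneg (exp_pos _).le,
      norm_of_nonneg (exp_pos _).le, norm_of_nonneg (WS_nonneg _)]
    calc _ ≤ ‖psiW n i₀ y‖ * (exp (nuW n y / 2) * (C * exp ((D + 2) * (c + nuW n y)))) := by
          gcongr; exact hC _
      _ = _ := by
          rw [mul_add, exp_add, add_mul (D + 2 : ℝ), exp_add,
            show nuW n y / 2 = 1 / 2 * nuW n y by ring]
          ring

end SmoothedSum

section CentralValue
variable {K : Type*} [Field K] [NumberField K] {R : Type*} [CommRing R] [IsDomain R] [CharZero R] [Algebra R K]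
variable (bR : Basis (Fin (finrank ℚ K)) ℤ R) (hinj : Injective (algebraMap R K))

include bR hinj in
lemma central_value_integral {g : ℂ → ℂ} (hg : IsDedekindZeta K g) (i₀ : InfinitePlace K)
    (hi₀ : i₀.mult = 1) {δ : Kˣ} (hR : tau δ (1 : Submodule R K) = 1) :
    ∃ C : ℝ, 0 < C ∧ g (1 / 2) = ((C * ∫ y : InfinitePlace K → ℝ, psiW (fun w => w.mult) i₀ y *
      (exp (nuW (fun w => w.mult) y / 2) *
        WS R (log |(Algebra.norm ℚ (δ : K) : ℝ)| / 2 + nuW (fun w => w.mult) y)) : ℝ) : ℂ) := by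
  obtain ⟨C, hC, hgC⟩ := central_value_eq bR hinj hg i₀ hi₀ hR
  set n : InfinitePlace K → ℕ := fun w => w.mult
  set L : ℝ := log |(Algebra.norm ℚ (δ : K) : ℝ)| / 2 with hL
  refine ⟨C * exp (L / 2), by positivity, ?_⟩
  have hsum := summable_lsz bR hinj hR
  have : Countable (ILat K R) := by
    have h := hsum.countable_support
    have hu : Function.support (fun I : ILat K R => exp (absc K * lsz δ I)) = univ := by
      ext I; simp [(exp_pos _).ne']
    rw [hu] at h
    exact countable_univ_iff.mp h
  have h1 : Lam R i₀ δ (1 / 2) = ∫ y, ∑' I : ILat K R, Pint n i₀ (lsz δ I) (1 / 2) y :=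
    integral_tsum_of_summable_integral_norm (fun I => integrable_Pint n i₀ mult_pos' _ _)
      (summable_integral_Pint n i₀ mult_pos' (absc_pos (K := K)) hsum _)
  have h2 : ∀ y, ∑' I : ILat K R, Pint n i₀ (lsz δ I) (1 / 2) y =
      ((exp (L / 2) * (psiW n i₀ y * (exp (nuW n y / 2) * WS R (L + nuW n y))) : ℝ) : ℂ) := by
    intro y
    set c : ℝ := exp (L / 2) * (psiW n i₀ y * exp (nuW n y / 2)) with hc
    let F : ℕ → ℂ := fun k => ((c * wsTerm k (L + nuW n y) : ℝ) : ℂ)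
    have hF := hasSum_FI R (finite_idx bR) F (by
      refine ((summable_wsTerm (aN_le bR) (L + nuW n y)).mul_left |c|).congr fun k => ?_
      simp only [F]
      rw [Complex.norm_real, norm_mul, norm_of_nonneg (wsTerm_nonneg _ _), norm_eq_abs]
      ring)
    rw [← (latEquiv bR hinj).tsum_eq]
    have e : ∀ I : FI R, Pint n i₀ (lsz δ (latEquiv bR hinj I)) (1 / 2) y = F (idx I.1) := by
      intro I
      have hI : (0 : ℝ) < idx I.1 := by exact_mod_cast Nat.pos_of_ne_zero I.2
      rw [lsz_latEquiv bR hinj hR, ← hL, Pint]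
      simp only [F]
      have e1 : cexp (1 / 2 * ((L - log (idx I.1) + nuW n y : ℝ) : ℂ)) =
          ((exp (L / 2) * exp (nuW n y / 2) * ((idx I.1 : ℕ) : ℝ) ^ (-(1 / 2) : ℝ) : ℝ) : ℂ) := by
        rw [Real.rpow_def_of_pos hI, ← exp_add, ← exp_add, Complex.ofReal_exp]
        congr 1
        push_cast
        ring
      rw [e1, wsTerm, hc, show L - log (idx I.1) + nuW n y = L + nuW n y - log (idx I.1) by ring]
      push_cast
      ring
    rw [tsum_congr e, hF.2.tsum_eq]
    simp only [F]
    have e2 : ∀ k, (aN R k : ℂ) * ((c * wsTerm k (L + nuW n y) : ℝ) : ℂ) =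
        ((c * ((aN R k : ℝ) * wsTerm k (L + nuW n y)) : ℝ) : ℂ) := fun k => by push_cast; ring
    rw [tsum_congr e2, ← Complex.ofReal_tsum, tsum_mul_left]
    rw [hc, WS]
    push_cast
    ring
  rw [hgC, h1]
  simp only [h2]
  rw [integral_complex_ofReal, integral_const_mul]
  push_cast
  ring
end CentralValue

section Transport
variable {ι ι' : Type*} [Fintype ι] [Fintype ι']

lemma integral_psiW_reindex (e : ι ≃ ι') (n : ι → ℕ) (n' : ι' → ℕ) (h : ∀ i, n' (e i) = n i) (i₀ : ι)
    (F : ℝ → ℝ) :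
    ∫ y : ι → ℝ, psiW n i₀ y * F (nuW n y) = ∫ y : ι' → ℝ, psiW n' (e i₀) y * F (nuW n' y) := by
  have hm := volume_measurePreserving_piCongrLeft (fun _ : ι' => ℝ) e
  rw [← hm.integral_comp (MeasurableEquiv.measurableEmbedding _)]
  have hap : ∀ (y : ι → ℝ) i, (MeasurableEquiv.piCongrLeft (fun _ : ι' => ℝ) e) y (e i) = y i :=
    fun y i => Equiv.piCongrLeft_apply_apply (fun _ : ι' => ℝ) e y i
  have hnu : ∀ y : ι → ℝ, nuW n' ((MeasurableEquiv.piCongrLeft (fun _ : ι' => ℝ) e) y) = nuW n y := by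
    intro y
    rw [nuW, nuW, ← e.sum_comp]
    simp only [hap, h]
  have hgau : ∀ (y : ι → ℝ) (z : ι' → ℝ), (∀ i, z (e i) = y i) → gauW n' z = gauW n y := by
    intro y z hz
    rw [gauW, gauW, ← e.sum_comp]
    simp only [hz, h]
  refine integral_congr_ae (Eventually.of_forall fun y => ?_)
  beta_reduce
  rw [hnu, psiW, psiW, hgau y _ (hap y), hgau (y + Pi.single i₀ (log 2)),
    hgau (y - Pi.single i₀ (log 2))]
  · intro i
    simp only [Pi.sub_apply, hap, Pi.single_apply, e.injective.eq_iff]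
  · intro i
    simp only [Pi.add_apply, hap, Pi.single_apply, e.injective.eq_iff]
end Transport

end

section
open Module

/-- `A` has `ℤ`-basis `1, θ, θ²` with `θ³ + cθ² + aθ + b = 0`. -/
structure IsCubicOrder (A : Type*) [CommRing A] (θ : A) (c a b : ℤ) : Prop where
  rel : θ ^ 3 + c * θ ^ 2 + a * θ + b = 0
  span : ∀ x : A, ∃ z₀ z₁ z₂ : ℤ, x = z₀ + z₁ * θ + z₂ * θ ^ 2
  ind : ∀ z₀ z₁ z₂ : ℤ, (z₀ + z₁ * θ + z₂ * θ ^ 2 : A) = 0 → z₀ = 0 ∧ z₁ = 0 ∧ z₂ = 0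

/-- The compatibility condition on Hermite data `(k, l, r, t, w)` with the cubic
`x³ + cx² + ax + b`. -/
def CubicCond (c a b : ℤ) (k l r t w : ℕ) : Prop :=
  ∃ u v : ℤ, a = (-c - t - r) * t + (-c - t - r) * r + t * r + k * w + l * u ∧
    b = -((-c - t - r) * t * r) - k * w * (-c - t - r) - l * u * r + l * k * v

/-- Hermite data of ideals of `ℤ[x]/(x³ + cx² + ax + b)`. -/
structure CubicDat (c a b : ℤ) where
  (m k l r t w : ℕ)
  hm : 0 < m
  hk : 0 < k
  hl : 0 < l
  hr : r < k
  ht : t < l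
  hw : w < l
  cond : CubicCond c a b k l r t w

/-- The index of the ideal with given Hermite data. -/
def CubicDat.val {c a b : ℤ} (d : CubicDat c a b) : ℕ := d.m ^ 3 * d.k * d.l ^ 2

section
variable {A : Type*} [CommRing A] {θ : A} {c a b : ℤ}

namespace IsCubicOrder

lemma ext_coord (h : IsCubicOrder A θ c a b) {x₀ x₁ x₂ y₀ y₁ y₂ : ℤ}
    (e : (x₀ + x₁ * θ + x₂ * θ ^ 2 : A) = y₀ + y₁ * θ + y₂ * θ ^ 2) :
    x₀ = y₀ ∧ x₁ = y₁ ∧ x₂ = y₂ := by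
  have := h.ind (x₀ - y₀) (x₁ - y₁) (x₂ - y₂) (by push_cast; linear_combination e)
  omega

/-- The basis `1, θ, θ²`. -/
def basis (h : IsCubicOrder A θ c a b) : Basis (Fin 3) ℤ A :=
  Basis.mk (v := ![1, θ, θ ^ 2])
    (by
      rw [Fintype.linearIndependent_iff]
      intro g hg
      have := h.ind (g 0) (g 1) (g 2) (by simpa [Fin.sum_univ_three] using hg)
      intro i; fin_cases i <;> simp [this])
    (by
      intro x _
      obtain ⟨z₀, z₁, z₂, rfl⟩ := h.span x
      have hs (i : Fin 3) := Submodule.subset_span (R := ℤ) (s := Set.range ![1, θ, θ ^ 2]) ⟨i, rfl⟩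
      simpa using add_mem (add_mem (Submodule.smul_mem _ z₀ (hs 0)) (Submodule.smul_mem _ z₁ (hs 1)))
        (Submodule.smul_mem _ z₂ (hs 2)))

lemma basis_apply (h : IsCubicOrder A θ c a b) : ⇑h.basis = ![1, θ, θ ^ 2] := by
  simp [basis]

lemma basis_repr (h : IsCubicOrder A θ c a b) (z₀ z₁ z₂ : ℤ) :
    ⇑(h.basis.repr (z₀ + z₁ * θ + z₂ * θ ^ 2)) = ![z₀, z₁, z₂] := by
  have e : (z₀ + z₁ * θ + z₂ * θ ^ 2 : A) = ∑ i, (![z₀, z₁, z₂] i) • h.basis i := by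
    simp [Fin.sum_univ_three, h.basis_apply]
  rw [e]
  ext i
  rw [Basis.repr_sum_self]

end IsCubicOrder

namespace CubicDat
variable (h : IsCubicOrder A θ c a b) (d : CubicDat c a b)

/-- The element of the ideal with Hermite coordinates `z`. -/
def elt (θ : A) (d : CubicDat c a b) (z₀ z₁ z₂ : ℤ) : A :=
  d.m * (z₂ * ((θ - d.t) * (θ - d.r) + d.k * d.w) + z₁ * (d.l * (θ - d.r)) + z₀ * (d.l * d.k))

include h in
lemma theta_mul_elt : ∃ u v : ℤ, ∀ z₀ z₁ z₂ : ℤ, θ * elt θ d z₀ z₁ z₂ =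
    elt θ d (d.r * z₀ - d.w * z₁ - v * z₂) (d.k * z₀ + d.t * z₁ - u * z₂)
      (d.l * z₁ + (-c - d.t - d.r) * z₂) := by
  obtain ⟨u, v, ha, hb⟩ := d.cond
  refine ⟨u, v, fun z₀ z₁ z₂ => ?_⟩
  have ha' : (a : A) = _ := congrArg (Int.cast) ha
  have hb' : (b : A) = _ := congrArg (Int.cast) hb
  have := h.rel
  rw [ha', hb'] at this
  push_cast at this
  unfold elt
  push_cast
  linear_combination (d.m * z₂ : A) * this

/-- The ideal with given Hermite data. -/
def ideal : Ideal A where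
  carrier := {x | ∃ z₀ z₁ z₂ : ℤ, x = elt θ d z₀ z₁ z₂}
  zero_mem' := ⟨0, 0, 0, by simp [elt]⟩
  add_mem' := by
    rintro _ _ ⟨x₀, x₁, x₂, rfl⟩ ⟨y₀, y₁, y₂, rfl⟩
    exact ⟨x₀ + y₀, x₁ + y₁, x₂ + y₂, by unfold elt; push_cast; ring⟩
  smul_mem' := by
    obtain ⟨u, v, huv⟩ := theta_mul_elt h d
    have ht x₀ x₁ x₂ : ∃ y₀ y₁ y₂, θ * elt θ d x₀ x₁ x₂ = elt θ d y₀ y₁ y₂ := ⟨_, _, _, huv ..⟩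
    rintro y _ ⟨x₀, x₁, x₂, rfl⟩
    obtain ⟨z₀, z₁, z₂, rfl⟩ := h.span y
    obtain ⟨y₀, y₁, y₂, hy⟩ := ht x₀ x₁ x₂
    obtain ⟨w₀, w₁, w₂, hw⟩ := ht y₀ y₁ y₂
    refine ⟨z₀ * x₀ + z₁ * y₀ + z₂ * w₀, z₀ * x₁ + z₁ * y₁ + z₂ * w₁, z₀ * x₂ + z₁ * y₂ + z₂ * w₂, ?_⟩
    rw [smul_eq_mul, add_mul, add_mul, mul_assoc, sq, mul_assoc, mul_assoc, hy, hw]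
    simp only [elt]; push_cast; ring

lemma mem_ideal {x : A} : x ∈ ideal h d ↔ ∃ z₀ z₁ z₂ : ℤ, x = elt θ d z₀ z₁ z₂ := Iff.rfl

lemma elt_coord (z₀ z₁ z₂ : ℤ) : elt θ d z₀ z₁ z₂ =
    ((d.m * (z₂ * (d.t * d.r + d.k * d.w) - z₁ * (d.l * d.r) + z₀ * (d.l * d.k)) : ℤ) : A) +
      ((d.m * (-z₂ * (d.t + d.r) + z₁ * d.l) : ℤ) : A) * θ + ((d.m * z₂ : ℤ) : A) * θ ^ 2 := by
  unfold elt; push_cast; ring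

lemma idx_ideal : idx (ideal h d) = d.val := by
  have hm := d.hm; have hk := d.hk; have hl := d.hl
  set I := ideal h d
  let v : Fin 3 → I.toAddSubgroup := ![⟨elt θ d 1 0 0, ⟨1, 0, 0, rfl⟩⟩, ⟨elt θ d 0 1 0, ⟨0, 1, 0, rfl⟩⟩,
    ⟨elt θ d 0 0 1, ⟨0, 0, 1, rfl⟩⟩]
  have hv : ∀ g : Fin 3 → ℤ, ((∑ i, g i • v i : I.toAddSubgroup) : A) = elt θ d (g 0) (g 1) (g 2) := by
    intro g
    simp [Fin.sum_univ_three, v, elt]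
    ring
  let bN : Basis (Fin 3) ℤ I.toAddSubgroup := Basis.mk (v := v)
    (by
      rw [Fintype.linearIndependent_iff]
      intro g hg
      have h1 := hv g
      rw [hg, elt_coord] at h1
      obtain ⟨h0, h1, h2⟩ := h.ind _ _ _ h1.symm
      have e2 : g 2 = 0 := by simpa [hm.ne'] using h2
      have e1 : g 1 = 0 := by simpa [hm.ne', hl.ne', e2] using h1
      have e0 : g 0 = 0 := by simpa [hm.ne', hl.ne', hk.ne', e1, e2] using h0
      intro i; fin_cases i <;> assumption)
    (by
      rintro ⟨x, z₀, z₁, z₂, rfl⟩ _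
      have : (⟨elt θ d z₀ z₁ z₂, ⟨z₀, z₁, z₂, rfl⟩⟩ : I.toAddSubgroup) = ∑ i, (![z₀, z₁, z₂] i) • v i := by
        apply Subtype.ext
        rw [hv]; rfl
      rw [this]
      exact Submodule.sum_mem _ fun i _ => Submodule.smul_mem _ _ (Submodule.subset_span ⟨i, rfl⟩))
  have hb : (fun i => (bN i : A)) = ![elt θ d 1 0 0, elt θ d 0 1 0, elt θ d 0 0 1] := by
    funext i
    rw [Basis.mk_apply]
    fin_cases i <;> rfl
  unfold idx
  rw [AddSubgroup.index_eq_natAbs_det h.basis I.toAddSubgroup bN, hb, Basis.det_apply,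
    Matrix.det_fin_three]
  simp only [Basis.toMatrix_apply, Matrix.cons_val_zero, Matrix.cons_val_one, Matrix.cons_val]
  simp only [elt_coord, h.basis_repr]
  simp [val]
  rw [show (d.m : ℤ) * (d.l * d.k) * (d.m * d.l) * d.m = ((d.m ^ 3 * d.k * d.l ^ 2 : ℕ) : ℤ) by
    push_cast; ring]
  exact Int.natAbs_natCast _

end CubicDat
end

section
variable {A : Type*} [CommRing A] {θ : A} {c a b : ℤ}
namespace CubicDat
variable (h : IsCubicOrder A θ c a b)

lemma mem_ideal_coord (d : CubicDat c a b) {x₀ x₁ x₂ : ℤ}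
    (hx : (x₀ + x₁ * θ + x₂ * θ ^ 2 : A) ∈ ideal h d) : ∃ z₀ z₁ z₂ : ℤ,
      x₀ = d.m * (z₂ * (d.t * d.r + d.k * d.w) - z₁ * (d.l * d.r) + z₀ * (d.l * d.k)) ∧
      x₁ = d.m * (-z₂ * (d.t + d.r) + z₁ * d.l) ∧ x₂ = d.m * z₂ := by
  obtain ⟨z₀, z₁, z₂, e⟩ := hx
  rw [elt_coord] at e
  exact ⟨z₀, z₁, z₂, h.ext_coord e⟩

lemma eq_of_dvd_of_lt {k r r' : ℕ} (hr : r < k) (hr' : r' < k) (h : (k : ℤ) ∣ r - r') : r = r' := by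
  have := Nat.ModEq.eq_of_lt_of_lt ((Nat.modEq_iff_dvd (n := k) (a := r') (b := r)).mpr h) hr' hr
  exact this.symm

lemma dvd_of_le (d d' : CubicDat c a b) (hle : ideal h d ≤ ideal h d') :
    d'.m ∣ d.m ∧ d'.m * d'.l ∣ d.m * d.l ∧ d'.m * d'.l * d'.k ∣ d.m * d.l * d.k := by
  have hm' : (d'.m : ℤ) ≠ 0 := by have := d'.hm; omega
  have hl' : (d'.l : ℤ) ≠ 0 := by have := d'.hl; omega
  have key : ∀ z₀ z₁ z₂ : ℤ, _ := fun z₀ z₁ z₂ => mem_ideal_coord h d'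
    (elt_coord (θ := θ) d z₀ z₁ z₂ ▸ hle ⟨z₀, z₁, z₂, rfl⟩)
  zify
  refine ⟨?_, ?_, ?_⟩
  · obtain ⟨z₀, z₁, z₂, h0, h1, h2⟩ := key 0 0 1
    exact ⟨z₂, by linarith⟩
  · obtain ⟨z₀, z₁, z₂, h0, h1, h2⟩ := key 0 1 0
    obtain rfl : z₂ = 0 := mul_left_cancel₀ hm' (by linarith)
    exact ⟨z₁, by linarith⟩
  · obtain ⟨z₀, z₁, z₂, h0, h1, h2⟩ := key 1 0 0
    obtain rfl : z₂ = 0 := mul_left_cancel₀ hm' (by linarith)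
    obtain rfl : z₁ = 0 := mul_left_cancel₀ (mul_ne_zero hm' hl') (by linarith)
    exact ⟨z₀, by linarith⟩

lemma ideal_injective : Injective (ideal h) := by
  intro d d' e
  have A1 := dvd_of_le h d d' e.le
  have A2 := dvd_of_le h d' d e.ge
  have em : d.m = d'.m := Nat.dvd_antisymm A2.1 A1.1
  have hm := d.hm; have hl := d.hl; have hk := d.hk
  have el : d.l = d'.l := by
    have := Nat.dvd_antisymm A2.2.1 A1.2.1
    rw [← em] at this
    exact Nat.eq_of_mul_eq_mul_left hm this
  have ek : d.k = d'.k := by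
    have := Nat.dvd_antisymm A2.2.2 A1.2.2
    rw [← em, ← el] at this
    exact Nat.eq_of_mul_eq_mul_left (Nat.mul_pos hm hl) this
  have hm' : (d.m : ℤ) ≠ 0 := by omega
  have hl' : (d.l : ℤ) ≠ 0 := by omega
  have hk' : (d.k : ℤ) ≠ 0 := by omega
  have key : ∀ z₀ z₁ z₂ : ℤ, _ := fun z₀ z₁ z₂ => mem_ideal_coord h d'
    (elt_coord (θ := θ) d z₀ z₁ z₂ ▸ e.le ⟨z₀, z₁, z₂, rfl⟩)
  simp only [← em, ← el, ← ek] at key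
  have er : d.r = d'.r := by
    obtain ⟨z₀, z₁, z₂, h0, h1, h2⟩ := key 0 1 0
    obtain rfl : z₂ = 0 := mul_left_cancel₀ hm' (by linarith)
    obtain rfl : z₁ = 1 := mul_left_cancel₀ (mul_ne_zero hm' hl') (by linarith)
    exact eq_of_dvd_of_lt d.hr (ek ▸ d'.hr)
      ⟨-z₀, mul_left_cancel₀ (mul_ne_zero hm' hl') (by linarith)⟩
  simp only [← er] at key
  obtain ⟨z₀, z₁, z₂, h0, h1, h2⟩ := key 0 0 1
  obtain rfl : z₂ = 1 := mul_left_cancel₀ hm' (by linarith)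
  have e1 : (d'.t : ℤ) - d.t = d.l * z₁ := mul_left_cancel₀ hm' (by linarith)
  have et : d'.t = d.t := eq_of_dvd_of_lt (el ▸ d'.ht) d.ht ⟨_, e1⟩
  rw [et] at e1 h0
  obtain rfl : z₁ = 0 := mul_left_cancel₀ hl' (by linarith)
  have ew : d.w = d'.w := eq_of_dvd_of_lt d.hw (el ▸ d'.hw)
    ⟨z₀, mul_left_cancel₀ (mul_ne_zero hm' hk') (by linarith)⟩
  cases d; cases d'
  simp_all

lemma int_ideal_gen {S : Ideal ℤ} {N : ℤ} (hN : N ≠ 0) (h : N ∈ S) :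
    ∃ n : ℤ, 0 < n ∧ ∀ x, x ∈ S ↔ n ∣ x := by
  obtain ⟨g, rfl⟩ := (IsPrincipalIdealRing.principal S).principal
  refine ⟨|g|, abs_pos.2 fun h0 => hN (by simpa [h0] using h), fun x => ?_⟩
  rw [abs_dvd]
  exact Ideal.mem_span_singleton

set_option maxHeartbeats 400000 in
lemma ideal_surjective (I : Ideal A) (hI : idx I ≠ 0) : ∃ d : CubicDat c a b, ideal h d = I := by
  set N := idx I with hN
  have hNI : ((N : ℤ) : A) ∈ I := by exact_mod_cast idx_mem I
  have hN0 : (N : ℤ) ≠ 0 := by exact_mod_cast hI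
  let E : ℤ → ℤ → ℤ → A := fun x y z => x + y * θ + z * θ ^ 2
  have hadd : ∀ {x y z x' y' z'}, E x y z ∈ I → E x' y' z' ∈ I → E (x + x') (y + y') (z + z') ∈ I := by
    intro x y z x' y' z' h1 h2
    have := I.add_mem h1 h2
    convert this using 1
    simp only [E]; push_cast; ring
  have hsm : ∀ (n : ℤ) {x y z}, E x y z ∈ I → E (n * x) (n * y) (n * z) ∈ I := by
    intro n x y z h1
    have := I.mul_mem_left (n : A) h1
    convert this using 1
    simp only [E]; push_cast; ring
  have hth : ∀ {x y z}, E x y z ∈ I → E (-b * z) (x - a * z) (y - c * z) ∈ I := by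
    intro x y z h1
    have := I.mul_mem_left θ h1
    convert this using 1
    simp only [E]; push_cast
    linear_combination (-z : A) * h.rel
  -- leading coefficients
  let G2 : Ideal ℤ :=
    { carrier := {z | ∃ x y, E x y z ∈ I}
      zero_mem' := ⟨0, 0, by simp [E]⟩
      add_mem' := by
        rintro _ _ ⟨x, y, h1⟩ ⟨x', y', h2⟩
        exact ⟨_, _, hadd h1 h2⟩
      smul_mem' := by
        rintro n _ ⟨x, y, h1⟩
        exact ⟨_, _, hsm n h1⟩ }
  let G1 : Ideal ℤ :=
    { carrier := {y | ∃ x, E x y 0 ∈ I}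
      zero_mem' := ⟨0, by simp [E]⟩
      add_mem' := by
        rintro _ _ ⟨x, h1⟩ ⟨x', h2⟩
        exact ⟨_, hadd h1 h2⟩
      smul_mem' := by
        rintro n _ ⟨x, h1⟩
        exact ⟨_, by simpa using hsm n h1⟩ }
  let G0 : Ideal ℤ := I.comap (Int.castRingHom A)
  have hNE : E N 0 0 ∈ I := by simpa [E] using hNI
  have hNE1 : E 0 N 0 ∈ I := by simpa using hth hNE
  have hNE2 : E 0 0 N ∈ I := by simpa using hth hNE1
  obtain ⟨m, hm, hm'⟩ := int_ideal_gen (S := G2) hN0 ⟨0, 0, hNE2⟩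
  obtain ⟨L, hL, hL'⟩ := int_ideal_gen (S := G1) hN0 ⟨0, hNE1⟩
  obtain ⟨P, hP, hP'⟩ := int_ideal_gen (S := G0) hN0 hNI
  have mem2 : ∀ {x y z}, E x y z ∈ I → m ∣ z := fun hx => (hm' _).mp ⟨_, _, hx⟩
  have mem1 : ∀ {x y}, E x y 0 ∈ I → L ∣ y := fun hx => (hL' _).mp ⟨_, hx⟩
  have mem0 : ∀ {x}, E x 0 0 ∈ I ↔ P ∣ x := by
    intro x
    rw [← hP', Ideal.mem_comap]
    simp [E]
  -- divisibility of all coordinates by m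
  have div1 : ∀ {x y z}, E x y z ∈ I → m ∣ y := fun {x y z} hx => by
    simpa using dvd_add (mem2 (hth hx)) ((mem2 hx).mul_left c)
  have div0 : ∀ {x y z}, E x y z ∈ I → m ∣ x := fun {x y z} hx => by
    simpa using dvd_add (div1 (hth hx)) ((mem2 hx).mul_left a)
  obtain ⟨x₁, hx₁⟩ : L ∈ G1 := (hL' _).mpr dvd_rfl
  obtain ⟨x₂, y₂, hx₂⟩ : m ∈ G2 := (hm' _).mpr dvd_rfl
  have hE0 : E P 0 0 ∈ I := mem0.mpr dvd_rfl
  obtain ⟨k, rfl⟩ : L ∣ P := mem1 (by simpa using hth hE0 : E 0 P 0 ∈ I)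
  obtain ⟨l, rfl⟩ : m ∣ L := div1 hx₁
  obtain ⟨n₁, rfl⟩ := div0 hx₁
  obtain ⟨p₀, rfl⟩ := div0 hx₂
  obtain ⟨p₁, rfl⟩ := div1 hx₂
  have hl0 : 0 < l := pos_of_mul_pos_right hL hm.le
  have hk0 : 0 < k := pos_of_mul_pos_right hP hL.le
  -- n₁ divisible by l
  obtain ⟨r₀, rfl⟩ : l ∣ n₁ := by
    have h2 : E (-b * 0 + -l * (m * p₀)) (m * (n₁ - l * p₁)) 0 ∈ I := by
      convert hadd (hth hx₁) (hsm (-l) hx₂) using 2 <;> ring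
    simpa using dvd_add ((mul_dvd_mul_iff_left hm.ne').mp (mem1 h2)) (dvd_mul_right l p₁)
  -- normalise
  have red : ∀ x y : ℤ, 0 < y → ∃ s e, 0 ≤ s ∧ s < y ∧ x = s + y * e := fun x y hy =>
    ⟨x % y, x / y, Int.emod_nonneg _ hy.ne', Int.emod_lt_of_pos _ hy,
      (Int.emod_add_mul_ediv x y).symm⟩
  obtain ⟨r, er, hrr, hrk, her⟩ := red (-r₀) k hk0
  obtain ⟨t, et, htt, htl, het⟩ := red (-p₁ - r) l hl0
  obtain rfl : r₀ = -r - k * er := by linarith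
  obtain rfl : p₁ = -r - t - l * et := by linarith
  have hF1 : E (m * (-l * r)) (m * l) 0 ∈ I := by
    convert hadd hx₁ (hsm er hE0) using 2 <;> ring
  obtain ⟨p, hF2⟩ : ∃ p, E (m * p) (m * (-r - t)) m ∈ I := ⟨p₀ - et * l * r, by
    convert hadd hx₂ (hsm et hF1) using 2 <;> ring⟩
  -- k ∣ p - t r
  obtain ⟨w₀, hw₀⟩ : k ∣ p - t * r := by
    have h2 : E (m * l * (t * r - p)) 0 0 ∈ I := by
      convert hadd (hadd (hth hF1) (hsm (-l) hF2)) (hsm (-t) hF1) using 2 <;> ring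
    exact dvd_sub_comm.mp ((mul_dvd_mul_iff_left hL.ne').mp (mem0.mp h2))
  obtain ⟨w, ew, hww, hwl, rfl⟩ := red w₀ l hl0
  obtain rfl : p = t * r + k * (w + l * ew) := by linarith
  have hF3 : E (m * (t * r + k * w)) (m * (-r - t)) m ∈ I := by
    convert hadd hF2 (hsm (-ew) hE0) using 2 <;> ring
  -- condition
  have hG : E (m * (-b - (-c - t - r) * (t * r + k * w)))
      (m * (t * r + k * w - a + (-c - t - r) * (r + t))) 0 ∈ I := by
    convert hadd (hth hF3) (hsm (-(-c - t - r)) hF3) using 2 <;> ring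
  obtain ⟨u, hu⟩ : l ∣ (t * r + k * w - a + (-c - t - r) * (r + t)) :=
    (mul_dvd_mul_iff_left hm.ne').mp (mem1 hG)
  rw [hu] at hG
  have hH : E (m * (-b - (-c - t - r) * (t * r + k * w) + u * l * r)) 0 0 ∈ I := by
    convert hadd hG (hsm (-u) hF1) using 2 <;> ring
  obtain ⟨v, hv⟩ : l * k ∣ (-b - (-c - t - r) * (t * r + k * w) + u * l * r) :=
    (mul_dvd_mul_iff_left hm.ne').mp (mul_assoc m l k ▸ mem0.mp hH)
  lift m to ℕ using hm.le
  lift l to ℕ using hl0.le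
  lift k to ℕ using hk0.le
  lift r to ℕ using hrr
  lift t to ℕ using htt
  lift w to ℕ using hww
  refine ⟨⟨m, k, l, r, t, w, by omega, by omega, by omega, by omega, by omega, by omega,
    ⟨-u, -v, by linarith, by linarith⟩⟩, ?_⟩
  ext x
  rw [mem_ideal]
  constructor
  · rintro ⟨z₀, z₁, z₂, rfl⟩
    rw [elt_coord]
    convert hadd (hadd (hsm z₀ hE0) (hsm z₁ hF1)) (hsm z₂ hF3) using 1
    simp only [E]; push_cast; ring
  · intro hx
    obtain ⟨x, y, z, rfl⟩ := h.span x
    obtain ⟨z₂, rfl⟩ := mem2 hx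
    have hx1 : E (x - z₂ * (m * (t * r + k * w))) (y - z₂ * (m * (-r - t))) 0 ∈ I := by
      convert hadd hx (hsm (-z₂) hF3) using 2 <;> ring
    obtain ⟨z₁, hz₁⟩ := mem1 hx1
    have hx2 : E (x - z₂ * (m * (t * r + k * w)) - z₁ * (m * (-l * r))) 0 0 ∈ I := by
      convert hadd hx1 (hsm (-z₁) hF1) using 2
      · ring
      · rw [hz₁]; ring
      · ring
    obtain ⟨z₀, hz₀⟩ := mem0.mp hx2
    refine ⟨z₀, z₁, z₂, ?_⟩
    rw [elt_coord]
    obtain rfl : x = m * (z₂ * (t * r + k * w) - z₁ * (l * r) + z₀ * (l * k)) := by linarith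
    obtain rfl : y = m * (-z₂ * (t + r) + z₁ * l) := by linarith
    rfl

/-- Ideals of index `n` correspond to Hermite data of value `n`. -/
def idealEquiv (n : ℕ) (hn : n ≠ 0) :
    {d : CubicDat c a b // d.val = n} ≃ {I : Ideal A // n ≠ 0 ∧ idx I = n} :=
  Equiv.ofBijective (fun d => ⟨ideal h d.1, hn, (idx_ideal h d.1).trans d.2⟩) ⟨fun d d' e =>
    Subtype.ext (ideal_injective h (congrArg Subtype.val e)), fun I => by
      obtain ⟨d, hd⟩ := ideal_surjective h I.1 (by rw [I.2.2]; exact hn)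
      exact ⟨⟨d, by rw [← idx_ideal h d, hd, I.2.2]⟩, Subtype.ext hd⟩⟩

include h in
lemma aN_eq (n : ℕ) (hn : n ≠ 0) : aN A n = Nat.card {d : CubicDat c a b // d.val = n} :=
  (Nat.card_congr (idealEquiv h n hn)).symm

end CubicDat
end

open Polynomial

/-- The monic cubic `x³ + cx² + ax + b`. -/
def cubicPoly (c a b : ℤ) : ℤ[X] := X ^ 3 + C c * X ^ 2 + C a * X + C b

lemma natDegree_cubicPoly (c a b : ℤ) : (cubicPoly c a b).natDegree = 3 := by
  unfold cubicPoly; compute_degree!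

lemma monic_cubicPoly (c a b : ℤ) : (cubicPoly c a b).Monic := by
  unfold cubicPoly; monicity!

/-- The order `ℤ[x]/(x³ + cx² + ax + b)`. -/
abbrev CubicOrder (c a b : ℤ) := AdjoinRoot (cubicPoly c a b)

/-- The discriminant of `x³ + cx² + ax + b`. -/
def cubicDisc {R : Type*} [CommRing R] (c a b : R) : R :=
  c ^ 2 * a ^ 2 - 4 * a ^ 3 - 4 * c ^ 3 * b - 27 * b ^ 2 + 18 * c * a * b

lemma isCubicOrder_adjoinRoot (c a b : ℤ) :
    IsCubicOrder (CubicOrder c a b) (AdjoinRoot.root (cubicPoly c a b)) c a b where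
  rel := by
    have h : eval₂ (AdjoinRoot.of (cubicPoly c a b)) (AdjoinRoot.root (cubicPoly c a b))
      (X ^ 3 + C c * X ^ 2 + C a * X + C b) = 0 := AdjoinRoot.eval₂_root (cubicPoly c a b)
    simp only [eval₂_add, eval₂_mul, eval₂_pow, eval₂_X, eval₂_C] at h
    simpa using h
  span := by
    intro x
    obtain ⟨p, rfl⟩ := AdjoinRoot.mk_surjective x
    have h1 := Polynomial.modByMonic_add_div p (cubicPoly c a b)
    have hd : (p %ₘ cubicPoly c a b).natDegree < 3 := by
      have := Polynomial.natDegree_modByMonic_lt p (monic_cubicPoly c a b)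
        (fun h => by have := natDegree_cubicPoly c a b; rw [h] at this; simp at this)
      rwa [natDegree_cubicPoly] at this
    refine ⟨(p %ₘ cubicPoly c a b).coeff 0, (p %ₘ cubicPoly c a b).coeff 1,
      (p %ₘ cubicPoly c a b).coeff 2, ?_⟩
    rw [← h1, map_add, map_mul, AdjoinRoot.mk_self, zero_mul, add_zero, h1]
    conv_lhs => rw [Polynomial.as_sum_range' _ 3 hd]
    simp [Finset.sum_range_succ, ← C_mul_X_pow_eq_monomial]
  ind := by
    intro z₀ z₁ z₂ h
    have h1 : AdjoinRoot.mk (cubicPoly c a b) (C z₀ + C z₁ * X + C z₂ * X ^ 2) = 0 := by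
      simpa using h
    rw [AdjoinRoot.mk_eq_zero] at h1
    have h2 : C z₀ + C z₁ * X + C z₂ * X ^ 2 = 0 := by
      by_contra hne
      have h3 := (monic_cubicPoly c a b).not_dvd_of_natDegree_lt hne
        (lt_of_le_of_lt (b := 2) (by compute_degree) (by rw [natDegree_cubicPoly]; norm_num))
      exact h3 h1
    refine ⟨?_, ?_, ?_⟩
    · simpa [coeff_X, coeff_C, -eq_intCast] using congrArg (coeff · 0) h2
    · simpa [coeff_X, coeff_C, -eq_intCast] using congrArg (coeff · 1) h2
    · simpa [coeff_X, coeff_C, -eq_intCast] using congrArg (coeff · 2) h2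

lemma cubicDisc_bezout {R : Type*} [CommRing R] (c a b x : R) :
    cubicDisc c a b = (x ^ 3 + c * x ^ 2 + a * x + b) *
      (3 * (6 * a - 2 * c ^ 2) * x - 3 * (9 * b - a * c) + 2 * c * (6 * a - 2 * c ^ 2)) -
      (3 * x ^ 2 + 2 * c * x + a) * ((6 * a - 2 * c ^ 2) * x ^ 2 +
        (c * (6 * a - 2 * c ^ 2) - (9 * b - a * c)) * x + (4 * a ^ 2 - a * c ^ 2 - 3 * b * c)) := by
  unfold cubicDisc; ring

/-- Hensel lifting with denominators: a root near an approximate root of a cubic. -/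
lemma exists_root_near {S : Type*} [CommRing S] (c a b x g Δ q' : S) (hΔ : cubicDisc c a b = Δ)
    (hq : IsNilpotent q') (hx : x ^ 3 + c * x ^ 2 + a * x + b = Δ ^ 2 * q' * g) :
    ∃ s, (x + q' * s) ^ 3 + c * (x + q' * s) ^ 2 + a * (x + q' * s) + b = 0 := by
  have hb := cubicDisc_bezout c a b x
  set α := 3 * (6 * a - 2 * c ^ 2) * x - 3 * (9 * b - a * c) + 2 * c * (6 * a - 2 * c ^ 2)
  set β := -((6 * a - 2 * c ^ 2) * x ^ 2 +
        (c * (6 * a - 2 * c ^ 2) - (9 * b - a * c)) * x + (4 * a ^ 2 - a * c ^ 2 - 3 * b * c)) with hβ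
  clear_value α β
  rw [hΔ, hx] at hb
  have hb' : (3 * x ^ 2 + 2 * c * x + a) * β = Δ * (1 - α * Δ * q' * g) := by
    linear_combination -hb + (3 * x ^ 2 + 2 * c * x + a) * hβ
  set υ := 1 - α * Δ * q' * g with hυ
  have hqn : ∀ z, IsNilpotent (q' * z) := fun z => (Commute.all q' z).isNilpotent_mul_right hq
  have hυu : IsUnit υ := by
    rw [hυ, show α * Δ * q' * g = q' * (α * Δ * g) by ring]
    exact (hqn _).isUnit_one_sub
  set P : S[X] := C (q' * g) + C υ * X + C ((3 * x + c) * β ^ 2) * X ^ 2 + C (Δ * β ^ 3) * X ^ 3 with hP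
  obtain ⟨t, ⟨ht1, ht2⟩, -⟩ := Polynomial.existsUnique_nilpotent_sub_and_aeval_eq_zero (x := (0 : S))
    (P := P) (by simpa [hP] using hqn g) (by simpa [hP] using hυu)
  have ht : IsNilpotent t := by simpa using ht1.neg
  have ht3 : q' * g + υ * t + (3 * x + c) * β ^ 2 * t ^ 2 + Δ * β ^ 3 * t ^ 3 = 0 := by
    simpa [hP] using ht2
  have hw : IsUnit (υ + t * ((3 * x + c) * β ^ 2 + Δ * β ^ 3 * t)) := by
    rw [add_comm]
    exact ((Commute.all _ _).isNilpotent_mul_right ht).isUnit_add_right_of_commute hυu (Commute.all _ _)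
  obtain ⟨w, hw⟩ := hw
  have ht4 : t = q' * (-g * ↑w⁻¹) := by
    have : t * w = -(q' * g) := by rw [hw]; linear_combination ht3
    calc t = t * w * ↑w⁻¹ := by simp [mul_assoc]
      _ = _ := by rw [this]; ring
  refine ⟨Δ * β * (-g * ↑w⁻¹), ?_⟩
  rw [show q' * (Δ * β * (-g * ↑w⁻¹)) = Δ * β * t by rw [ht4]; ring]
  linear_combination hx + Δ ^ 2 * ht3 + Δ * t * hb'

lemma IsCubicOrder.idx_span {A : Type*} [CommRing A] {θ : A} {c a b : ℤ} (h : IsCubicOrder A θ c a b)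
    {N : ℕ} (hN : 0 < N) : idx (Ideal.span {(N : A)}) = N ^ 3 := by
  let d : CubicDat c a b := ⟨N, 1, 1, 0, 0, 0, hN, one_pos, one_pos, one_pos, one_pos, one_pos,
    ⟨a, b, by simp, by simp⟩⟩
  have : CubicDat.ideal h d = Ideal.span {(N : A)} := by
    ext x
    rw [CubicDat.mem_ideal, Ideal.mem_span_singleton]
    constructor
    · rintro ⟨z₀, z₁, z₂, rfl⟩
      exact ⟨_, rfl⟩
    · rintro ⟨y, rfl⟩
      obtain ⟨z₀, z₁, z₂, rfl⟩ := h.span y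
      exact ⟨z₀, z₁, z₂, by simp [CubicDat.elt, d]; ring⟩
  rw [← this, CubicDat.idx_ideal]
  simp [d, CubicDat.val]

lemma ker_eq_of_idx {A B : Type*} [CommRing A] [CommRing B] {f : A →+* B} (hf : Surjective f)
    {J : Ideal A} (hJ : J ≤ RingHom.ker f) (h0 : idx J ≠ 0) (h : idx (⊥ : Ideal B) = idx J) :
    RingHom.ker f = J := by
  have h1 : idx (RingHom.ker f) = idx J := by
    rw [← h]; exact idx_comap hf ⊥
  refine le_antisymm ?_ hJ
  have h2 := AddSubgroup.relIndex_mul_index (H := J.toAddSubgroup) (K := (RingHom.ker f).toAddSubgroup) hJ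
  change _ * idx (RingHom.ker f) = idx J at h2
  rw [h1] at h2
  have h3 : J.toAddSubgroup.relIndex (RingHom.ker f).toAddSubgroup = 1 :=
    Nat.eq_of_mul_eq_mul_right (Nat.pos_of_ne_zero h0) (by rw [h2, one_mul])
  exact AddSubgroup.relIndex_eq_one.mp h3

lemma mem_of_nilpotent_approx {S : Type*} [CommRing S] (B : Subring S) (q' : ℕ)
    (hq : IsNilpotent (q' : S)) (h : ∀ z : S, ∃ y ∈ B, ∃ s, z = y + q' * s) (z : S) : z ∈ B := by
  have key : ∀ (k : ℕ) (z : S), ∃ y ∈ B, ∃ s, z = y + (q' : S) ^ k * s := by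
    intro k
    induction k with
    | zero => exact fun z => ⟨0, B.zero_mem, z, by simp⟩
    | succ k ih =>
      intro z
      obtain ⟨y, hy, s, rfl⟩ := ih z
      obtain ⟨y', hy', s', rfl⟩ := h s
      refine ⟨y + (q' : S) ^ k * y', B.add_mem hy (B.mul_mem (B.pow_mem (natCast_mem B q') k) hy'), s', by ring⟩
  obtain ⟨k, hk⟩ := hq
  obtain ⟨y, hy, s, rfl⟩ := key k z
  rw [hk]; simpa using hy

/-- Local constancy of ideal counts in the coefficients of the cubic. -/
lemma IsCubicOrder.aN_congr {A : Type*} [CommRing A] {θ : A} {c a₀ b₀ a b : ℤ}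
    (hA : IsCubicOrder A θ c a b) {Δ : ℤ} (hΔ : cubicDisc c a₀ b₀ = Δ) {q' : ℕ}
    (ha : Δ ^ 2 * q' ∣ a - a₀) (hb : Δ ^ 2 * q' ∣ b - b₀) {N K : ℕ} (hN : N ∣ q' ^ K) (hN0 : 0 < N) :
    aN A N = aN (CubicOrder c a₀ b₀) N := by
  have hA₀ := isCubicOrder_adjoinRoot c a₀ b₀
  let J : Ideal A := Ideal.span {(N : A)}
  let ρ := Ideal.Quotient.mk J
  have hρ : Surjective ρ := Ideal.Quotient.mk_surjective
  have hk : RingHom.ker ρ = Ideal.span {(N : A)} := Ideal.mk_ker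
  have hNz : (N : A ⧸ J) = 0 := by
    rw [← map_natCast ρ]
    exact Ideal.Quotient.eq_zero_iff_mem.mpr (Ideal.mem_span_singleton_self _)
  have hnil : IsNilpotent (q' : A ⧸ J) := ⟨K, by
    obtain ⟨e, he⟩ := hN
    rw [← Nat.cast_pow, he]; push_cast; rw [hNz, zero_mul]⟩
  set x := ρ θ with hx
  obtain ⟨g₁, hg₁⟩ := ha
  obtain ⟨g₂, hg₂⟩ := hb
  have ea : a₀ = a - Δ ^ 2 * q' * g₁ := by linarith
  have eb : b₀ = b - Δ ^ 2 * q' * g₂ := by linarith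
  have hrel : x ^ 3 + c * x ^ 2 + a * x + b = 0 := by
    have := congrArg ρ hA.rel
    simpa using this
  obtain ⟨s, hs⟩ := exists_root_near (c : A ⧸ J) a₀ b₀ x (-(g₁ * x + g₂)) Δ q'
    (by rw [← hΔ]; unfold cubicDisc; push_cast; ring) hnil
    (by rw [ea, eb]; push_cast; linear_combination hrel)
  set y := x + q' * s with hy
  let φ : CubicOrder c a₀ b₀ →+* A ⧸ J := AdjoinRoot.lift (Int.castRingHom (A ⧸ J)) y (by
    simp only [cubicPoly, eval₂_add, eval₂_mul, eval₂_pow, eval₂_X, eval₂_C]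
    simpa using hs)
  have hφy : φ (AdjoinRoot.root (cubicPoly c a₀ b₀)) = y := AdjoinRoot.lift_root _
  have hφ : Surjective φ := by
    intro z
    have : z ∈ φ.range := by
      refine mem_of_nilpotent_approx φ.range q' hnil (fun z => ?_) z
      obtain ⟨z', rfl⟩ := hρ z
      obtain ⟨z₀, z₁, z₂, rfl⟩ := hA.span z'
      refine ⟨z₀ + z₁ * y + z₂ * y ^ 2, ⟨z₀ + z₁ * AdjoinRoot.root (cubicPoly c a₀ b₀) +
        z₂ * AdjoinRoot.root (cubicPoly c a₀ b₀) ^ 2, by simp [hφy]⟩, -(z₁ * s + z₂ * (2 * x + q' * s) * s), ?_⟩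
      simp only [map_add, map_mul, map_pow, map_intCast, ← hx]
      rw [hy]; ring
    exact this
  have hker : RingHom.ker φ = Ideal.span {(N : CubicOrder c a₀ b₀)} := by
    refine ker_eq_of_idx hφ ?_ ?_ ?_
    · rw [Ideal.span_singleton_le_iff_mem, RingHom.mem_ker, map_natCast, hNz]
    · rw [hA₀.idx_span hN0]; positivity
    · rw [hA₀.idx_span hN0, ← hA.idx_span hN0, ← hk]
      exact (idx_comap hρ ⊥).symm
  exact CubicZeta.aN_congr hρ hφ hk hker dvd_rfl

end

section
open Filter MeasureTheory Topology

/-- Partial sums of `∑ 1/√k`. -/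
def invSqrtSum (N : ℕ) : ℝ := ∑ k ∈ Finset.range N, 1 / √((k : ℝ) + 1)

lemma inv_sqrt_bounds (k : ℕ) : 2 * (√((k : ℝ) + 2) - √((k : ℝ) + 1)) ≤ 1 / √((k : ℝ) + 1) ∧
    1 / √((k : ℝ) + 1) ≤ 2 * (√((k : ℝ) + 1) - √(k : ℝ)) := by
  have hk : (0 : ℝ) ≤ k := by positivity
  have e0 := sq_sqrt hk
  have e1 := sq_sqrt (show (0 : ℝ) ≤ (k : ℝ) + 1 by positivity)
  have e2 := sq_sqrt (show (0 : ℝ) ≤ (k : ℝ) + 2 by positivity)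
  have p1 : 0 < √((k : ℝ) + 1) := sqrt_pos.mpr (by positivity)
  constructor
  · rw [le_div_iff₀ p1]
    nlinarith [sq_nonneg (√((k : ℝ) + 2) - √((k : ℝ) + 1))]
  · rw [div_le_iff₀ p1]
    nlinarith [sq_nonneg (√((k : ℝ) + 1) - √(k : ℝ))]

lemma exists_invSqrtSum : ∃ z : ℝ, z ≤ -1 ∧ ∀ N : ℕ,
    |invSqrtSum N - 2 * √(N : ℝ) - z| ≤ 2 * (√((N : ℝ) + 1) - √(N : ℝ)) := by
  set s : ℕ → ℝ := fun N => invSqrtSum N - 2 * √(N : ℝ) with hs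
  set t : ℕ → ℝ := fun N => invSqrtSum N - 2 * √((N : ℝ) + 1) with ht
  have hsa : Antitone s := antitone_nat_of_succ_le fun N => by
    have := (inv_sqrt_bounds N).2
    simp only [hs, invSqrtSum, Finset.sum_range_succ]
    push_cast
    linarith
  have htm : Monotone t := monotone_nat_of_le_succ fun N => by
    have := (inv_sqrt_bounds N).1
    simp only [ht, invSqrtSum, Finset.sum_range_succ]
    push_cast
    rw [show (N : ℝ) + 1 + 1 = N + 2 by ring]
    linarith
  have hts : ∀ N, t N ≤ s N := fun N => by
    have : √(N : ℝ) ≤ √((N : ℝ) + 1) := sqrt_le_sqrt (by linarith)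
    simp only [hs, ht]; linarith
  have hle : ∀ N M, t N ≤ s M := fun N M =>
    (htm (le_max_left N M)).trans ((hts _).trans (hsa (le_max_right N M)))
  have hbdd : BddBelow (Set.range s) := ⟨t 0, by rintro _ ⟨M, rfl⟩; exact hle 0 M⟩
  refine ⟨⨅ N, s N, ?_, fun N => ?_⟩
  · refine (ciInf_le hbdd 1).trans ?_
    simp [hs, invSqrtSum]; norm_num
  · have h1 : ⨅ N, s N ≤ s N := ciInf_le hbdd N
    have h2 : t N ≤ ⨅ N, s N := le_ciInf fun M => hle N M
    change |s N - _| ≤ _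
    rw [abs_le]; constructor <;> linarith

lemma exists_invSqrtSum_exp : ∃ z : ℝ, z ≤ -1 ∧ ∀ x : ℝ,
    |invSqrtSum ⌊exp x⌋₊ - 2 * exp (x / 2) - z| ≤ 4 * exp (-x / 4) := by
  obtain ⟨z, hz, h⟩ := exists_invSqrtSum
  refine ⟨z, hz, fun x => ?_⟩
  set N := ⌊exp x⌋₊
  have h1 := h N
  have hp := exp_pos x
  have hf1 : (N : ℝ) ≤ exp x := Nat.floor_le hp.le
  have hf2 : exp x < N + 1 := Nat.lt_floor_add_one _
  have he : √(exp x) = exp (x / 2) := by rw [Real.exp_half]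
  have s1 : √(N : ℝ) ≤ exp (x / 2) := he ▸ sqrt_le_sqrt hf1
  have s2 : exp (x / 2) ≤ √((N : ℝ) + 1) := he ▸ sqrt_le_sqrt hf2.le
  have h2 : |invSqrtSum N - 2 * exp (x / 2) - z| ≤ 4 * (√((N : ℝ) + 1) - √(N : ℝ)) := by
    rw [abs_le] at h1 ⊢; constructor <;> linarith
  refine h2.trans ?_
  refine mul_le_mul_of_nonneg_left ?_ (by norm_num)
  have e0 := sq_sqrt (show (0 : ℝ) ≤ N by positivity)
  have e1 := sq_sqrt (show (0 : ℝ) ≤ (N : ℝ) + 1 by positivity)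
  have p0 := sqrt_nonneg (N : ℝ)
  rcases le_total 0 x with hx | hx
  · have h3 : √((N : ℝ) + 1) - √(N : ℝ) ≤ exp (-(x / 2)) := by
      rw [exp_neg, le_inv_comm₀ (by nlinarith) (exp_pos _)]
      have : (√((N : ℝ) + 1) - √(N : ℝ))⁻¹ = √((N : ℝ) + 1) + √(N : ℝ) := by
        rw [inv_eq_of_mul_eq_one_right]; nlinarith
      rw [this]; linarith
    exact h3.trans (exp_le_exp.mpr (by linarith))
  · have h4 : (1 : ℝ) ≤ exp (-x / 4) := Real.one_le_exp (by linarith)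
    nlinarith

lemma deriv_wt_nonneg (x : ℝ) : 0 ≤ deriv wt x := monotone_wt.deriv_nonneg

lemma continuous_deriv_wt : Continuous (deriv wt) :=
  (contDiff_wt (k := 1)).continuous_deriv (by norm_num)

lemma wt_eq_integral (x : ℝ) :
    wt x = ∫ v in Set.Ioc (-1 : ℝ) 1, deriv wt v * (if v ≤ x then 1 else 0) := by
  have hd : Differentiable ℝ wt := (contDiff_wt (k := 1)).differentiable (by norm_num)
  have h1 : ∀ v, deriv wt v * (if v ≤ x then 1 else 0) = (Set.Iic x).indicator (deriv wt) v := by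
    intro v; simp [Set.indicator_apply]
  simp_rw [h1]
  rw [setIntegral_indicator measurableSet_Iic, show Set.Ioc (-1 : ℝ) 1 ∩ Set.Iic x = Set.Ioc (-1) (min 1 x) by
    ext v; simp]
  rcases le_total (-1) (min 1 x) with h | h
  · rw [← intervalIntegral.integral_of_le h,
      intervalIntegral.integral_deriv_eq_sub (fun v _ => hd v) (continuous_deriv_wt.intervalIntegrable _ _),
      wt_zero (show (-1 : ℝ) ≤ -(1/2) by norm_num), sub_zero]
    rcases le_total 1 x with h' | h'
    · rw [min_eq_left h', wt_one (by linarith), wt_one (by norm_num)]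
    · rw [min_eq_right h']
  · rw [Set.Ioc_eq_empty (by linarith), Measure.restrict_empty, integral_zero_measure]
    have : x ≤ -1 := by
      rcases min_le_iff.mp h with h | h
      · norm_num at h
      · exact h
    exact wt_zero (by linarith)

lemma wsTerm_eq_zero {n : ℕ} {u : ℝ} (h : u + 1 ≤ log n) : wsTerm n u = 0 := by
  rw [wsTerm, wt_zero (by linarith), mul_zero]

lemma wsTerm_zero (u : ℝ) : wsTerm 0 u = 0 := by simp [wsTerm]

lemma wsTerm_eq_zero_of_floor {n : ℕ} {u : ℝ} (h : ⌊exp (u + 1)⌋₊ ≤ n) : wsTerm n u = 0 ∨ n = ⌊exp (u + 1)⌋₊ := by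
  rcases h.eq_or_lt with h | h
  · exact Or.inr h.symm
  · left
    have h1 : exp (u + 1) < n := (Nat.floor_lt (exp_pos _).le).mp h
    exact wsTerm_eq_zero (by rw [Real.le_log_iff_exp_le ((exp_pos _).trans h1)]; exact h1.le)

/-- Smoothed sum of `k^{-1/2}` over `k` not divisible by the primes in `S`. -/
def PS (S : Finset ℕ) (u : ℝ) : ℝ := ∑' k : ℕ, if ∀ p ∈ S, ¬ p ∣ k then wsTerm k u else 0

lemma wsTerm_support (u : ℝ) {k : ℕ} (hk : k ∉ Finset.range (⌊exp (u + 1)⌋₊ + 1)) : wsTerm k u = 0 := by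
  rw [Finset.mem_range, not_lt] at hk
  rcases wsTerm_eq_zero_of_floor (n := k) (u := u) (by omega) with h | h
  · exact h
  · omega

lemma PS_eq_sum (S : Finset ℕ) (u : ℝ) {N : ℕ} (hN : ⌊exp (u + 1)⌋₊ + 1 ≤ N) :
    PS S u = ∑ k ∈ Finset.range N, if ∀ p ∈ S, ¬ p ∣ k then wsTerm k u else 0 :=
  tsum_eq_sum fun k hk => by
    rw [wsTerm_support u (fun h => hk (Finset.mem_range.mpr ((Finset.mem_range.mp h).trans_le hN))), ite_self]

lemma PS_empty_eq (u : ℝ) : PS ∅ u =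
    ∫ v in Set.Ioc (-1 : ℝ) 1, deriv wt v * invSqrtSum ⌊exp (u - v)⌋₊ := by
  set N := ⌊exp (u + 1)⌋₊ + 1
  rw [PS_eq_sum ∅ u le_rfl]
  simp only [Finset.notMem_empty, false_imp_iff, implies_true, if_true]
  rw [Finset.sum_range_succ']
  rw [wsTerm_zero, add_zero]
  have h1 : ∀ k : ℕ, wsTerm (k + 1) u = ∫ v in Set.Ioc (-1 : ℝ) 1,
      1 / √((k : ℝ) + 1) * (deriv wt v * (if v ≤ u - log (k + 1) then 1 else 0)) := by
    intro k
    rw [integral_const_mul, ← wt_eq_integral, wsTerm]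
    push_cast
    rw [rpow_neg (by positivity), ← sqrt_eq_rpow, one_div]
  simp_rw [h1]
  rw [← integral_finsetSum]
  · refine setIntegral_congr_fun measurableSet_Ioc fun v hv => ?_
    simp_rw [mul_left_comm _ (deriv wt v)]
    rw [← mul_sum, invSqrtSum]
    congr 1
    simp only [mul_ite, mul_one, mul_zero]
    rw [← Finset.sum_filter]
    refine sum_congr ?_ fun _ _ => rfl
    ext k
    simp only [Finset.mem_filter, Finset.mem_range]
    have hk : (0 : ℝ) < (k : ℝ) + 1 := by positivity
    have h2 : v ≤ u - log (k + 1) ↔ k < ⌊exp (u - v)⌋₊ := by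
      rw [Nat.lt_iff_add_one_le, Nat.le_floor_iff (exp_pos _).le, le_sub_comm]
      push_cast
      exact Real.log_le_iff_le_exp hk
    rw [h2]
    refine ⟨fun h => h.2, fun h => ⟨h.trans_le (Nat.floor_mono (exp_le_exp.mpr ?_)), h⟩⟩
    linarith [hv.1]
  · intro k _
    refine Integrable.const_mul ?_ _
    have h3 : ∀ v, deriv wt v * (if v ≤ u - log (k + 1) then 1 else 0) =
        (Set.Iic (u - log (k + 1))).indicator (deriv wt) v := by
      intro v; simp [Set.indicator_apply]
    simp_rw [h3]
    exact (continuous_deriv_wt.integrableOn_Ioc).indicator measurableSet_Iic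

lemma PS_insert {S : Finset ℕ} {p : ℕ} (hp : p.Prime) (hS : ∀ l ∈ S, l.Prime) (hpS : p ∉ S) (u : ℝ) :
    PS (insert p S) u = PS S u - (p : ℝ) ^ (-(1 / 2) : ℝ) * PS S (u - log p) := by
  have hsum : ∀ (S : Finset ℕ) u, Summable fun k : ℕ => if ∀ p ∈ S, ¬ p ∣ k then wsTerm k u else 0 :=
    fun S u => summable_of_ne_finset_zero (s := Finset.range (⌊exp (u + 1)⌋₊ + 1)) fun k hk => by
      rw [wsTerm_support u hk, ite_self]
  have h1 : (p : ℝ) ^ (-(1 / 2) : ℝ) * PS S (u - log p) =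
      ∑' k : ℕ, if p ∣ k ∧ ∀ l ∈ S, ¬ l ∣ k then wsTerm k u else 0 := by
    have hinj : Injective fun k : ℕ => p * k := fun a b h => Nat.eq_of_mul_eq_mul_left hp.pos h
    rw [PS, ← tsum_mul_left]
    rw [← hinj.tsum_eq (f := fun k => if p ∣ k ∧ ∀ l ∈ S, ¬ l ∣ k then wsTerm k u else 0)]
    · refine tsum_congr fun k => ?_
      have h2 : (∀ l ∈ S, ¬ l ∣ p * k) ↔ ∀ l ∈ S, ¬ l ∣ k := by
        refine forall₂_congr fun l hl => not_congr ?_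
        rw [(hS l hl).dvd_mul]
        refine or_iff_right fun h => hpS ?_
        rw [← (Nat.prime_dvd_prime_iff_eq (hS l hl) hp).mp h]; exact hl
      simp only [dvd_mul_right, true_and, h2, mul_ite, mul_zero]
      refine if_congr Iff.rfl ?_ rfl
      rcases Nat.eq_zero_or_pos k with rfl | hk
      · simp [wsTerm_zero]
      rw [wsTerm, wsTerm]
      push_cast
      rw [mul_rpow (by positivity) (by positivity), log_mul (by exact_mod_cast hp.ne_zero) (by positivity),
        mul_assoc, sub_sub]
    · intro k hk
      rw [Function.mem_support] at hk
      have : p ∣ k := by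
        by_contra hcon; exact hk (if_neg fun h => hcon h.1)
      obtain ⟨j, rfl⟩ := this
      exact ⟨j, rfl⟩
  rw [h1, PS, PS, ← Summable.tsum_sub (hsum S u)]
  · refine tsum_congr fun k => ?_
    simp only [Finset.forall_mem_insert]
    by_cases h2 : p ∣ k <;> by_cases h3 : ∀ l ∈ S, ¬ l ∣ k <;> simp [h2, h3]
  · exact summable_of_ne_finset_zero (s := Finset.range (⌊exp (u + 1)⌋₊ + 1)) fun k hk => by
      rw [wsTerm_support u hk, ite_self]

lemma PS_nonneg (S : Finset ℕ) (u : ℝ) : 0 ≤ PS S u :=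
  tsum_nonneg fun k => by split_ifs; exacts [wsTerm_nonneg k u, le_rfl]

lemma wsTerm_le_one (n : ℕ) (u : ℝ) : wsTerm n u ≤ 1 := by
  rcases Nat.eq_zero_or_pos n with rfl | hn
  · simp [wsTerm_zero]
  · exact mul_le_one₀ (Real.rpow_le_one_of_one_le_of_nonpos (by exact_mod_cast hn) (by norm_num))
      (wt_nonneg _) (wt_le_one _)

lemma PS_le (S : Finset ℕ) (u : ℝ) : PS S u ≤ exp 1 * exp u := by
  rw [PS_eq_sum S u le_rfl, Finset.sum_range_succ', wsTerm_zero, ite_self, add_zero, ← exp_add, add_comm 1 u]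
  calc _ ≤ ∑ k ∈ Finset.range ⌊exp (u + 1)⌋₊, (1 : ℝ) := Finset.sum_le_sum fun k _ => by
        split_ifs; exacts [wsTerm_le_one _ _, zero_le_one]
    _ ≤ _ := by simpa using Nat.floor_le (exp_pos _).le

lemma monotone_wsTerm (n : ℕ) : Monotone (wsTerm n) := fun _ _ h =>
  mul_le_mul_of_nonneg_left (monotone_wt (by linarith)) (by positivity)

lemma monotone_PS (S : Finset ℕ) : Monotone (PS S) := by
  intro u v h
  rw [PS_eq_sum S v le_rfl, PS_eq_sum S u (Nat.succ_le_succ (Nat.floor_mono (exp_le_exp.mpr (by linarith : u + 1 ≤ v + 1))))]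
  refine Finset.sum_le_sum fun k _ => ?_
  split_ifs
  exacts [monotone_wsTerm k h, le_rfl]

lemma integral_deriv_wt : ∫ v in Set.Ioc (-1 : ℝ) 1, deriv wt v = 1 := by
  have h := wt_eq_integral 1
  rw [wt_one (by norm_num)] at h
  refine Eq.trans ?_ h.symm
  refine setIntegral_congr_fun measurableSet_Ioc fun v (hv : v ∈ Set.Ioc (-1 : ℝ) 1) => ?_
  simp [hv.2]

lemma PS_empty_asymp : ∃ c z C : ℝ, z < 0 ∧ 0 ≤ C ∧ ∀ u,
    |PS ∅ u - c * exp (u / 2) - z| ≤ C * exp (-u / 4) := by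
  obtain ⟨z, hz, h⟩ := exists_invSqrtSum_exp
  refine ⟨∫ v in Set.Ioc (-1 : ℝ) 1, deriv wt v * (2 * exp (-v / 2)), z, 4 * exp (1 / 4),
    by linarith, by positivity, fun u => ?_⟩
  set E : ℝ → ℝ := fun v => invSqrtSum ⌊exp (u - v)⌋₊ - 2 * exp ((u - v) / 2) - z with hE
  have hEb : ∀ v ∈ Set.Ioc (-1 : ℝ) 1, |deriv wt v * E v| ≤ deriv wt v * (4 * exp (1 / 4) * exp (-u / 4)) := by
    intro v hv
    rw [abs_mul, abs_of_nonneg (deriv_wt_nonneg v)]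
    refine mul_le_mul_of_nonneg_left ((h (u - v)).trans ?_) (deriv_wt_nonneg v)
    rw [mul_assoc, ← exp_add]
    exact mul_le_mul_of_nonneg_left (exp_le_exp.mpr (by linarith [hv.2])) (by norm_num)
  have i0 : IntegrableOn (deriv wt) (Set.Ioc (-1 : ℝ) 1) := continuous_deriv_wt.integrableOn_Ioc
  have i1 : IntegrableOn (fun v => deriv wt v * (4 * exp (1 / 4) * exp (-u / 4))) (Set.Ioc (-1 : ℝ) 1) :=
    i0.mul_const _
  have hEm : Measurable E := by
    refine Measurable.sub_const (Measurable.sub ?_ (by fun_prop)) z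
    exact (measurable_of_countable invSqrtSum).comp (Nat.measurable_floor.comp (by fun_prop))
  have i2 : IntegrableOn (fun v => deriv wt v * E v) (Set.Ioc (-1 : ℝ) 1) :=
    Integrable.mono' i1 (continuous_deriv_wt.measurable.mul hEm).aestronglyMeasurable
      ((ae_restrict_iff' measurableSet_Ioc).mpr (ae_of_all _ fun v hv => hEb v hv))
  have i3 : IntegrableOn (fun v => deriv wt v * (2 * exp (-v / 2))) (Set.Ioc (-1 : ℝ) 1) :=
    (continuous_deriv_wt.mul (by fun_prop)).integrableOn_Ioc
  have e1 : PS ∅ u = (∫ v in Set.Ioc (-1 : ℝ) 1, deriv wt v * E v) +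
      (∫ v in Set.Ioc (-1 : ℝ) 1, deriv wt v * (2 * exp (-v / 2))) * exp (u / 2) + z := by
    have i4 := i3.mul_const (exp (u / 2))
    have i5 := i0.mul_const z
    have e2 : z = ∫ v in Set.Ioc (-1 : ℝ) 1, deriv wt v * z := by
      rw [integral_mul_const, integral_deriv_wt, one_mul]
    conv_rhs => rw [e2]
    rw [PS_empty_eq, ← integral_mul_const, ← integral_add i2 i4]
    refine Eq.trans ?_ (integral_add (i2.add i4) i5)
    refine integral_congr_ae (ae_of_all _ fun v => ?_)
    simp only [hE]
    rw [show (u - v) / 2 = -v / 2 + u / 2 by ring, exp_add]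
    ring
  rw [e1, show ∀ x y : ℝ, x + y + z - y - z = x by intros; ring]
  have := norm_integral_le_of_norm_le (f := fun v => deriv wt v * E v) i1 ((ae_restrict_iff' measurableSet_Ioc).mpr (ae_of_all _ fun v hv => hEb v hv))
  rw [integral_mul_const, integral_deriv_wt, one_mul] at this
  exact this

lemma PS_asymp (S : Finset ℕ) (hS : ∀ l ∈ S, l.Prime) : ∃ c z C : ℝ, z < 0 ∧ 0 ≤ C ∧ ∀ u,
    |PS S u - c * exp (u / 2) - z| ≤ C * exp (-u / 4) := by
  induction S using Finset.induction_on with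
  | empty => exact PS_empty_asymp
  | insert p S hpS ih =>
    obtain ⟨c, z, C, hz, hC, h⟩ := ih fun l hl => hS l (Finset.mem_insert_of_mem hl)
    have hp := hS p (Finset.mem_insert_self _ _)
    set y : ℝ := (p : ℝ) ^ (-(1 / 2) : ℝ)
    have hp1 : (1 : ℝ) < p := by exact_mod_cast hp.one_lt
    have hy0 : 0 < y := by positivity
    have hy1 : y < 1 := Real.rpow_lt_one_of_one_lt_of_neg hp1 (by norm_num)
    set L := log p
    refine ⟨c - y * (c * exp (-L / 2)), z * (1 - y), C + y * (C * exp (L / 4)),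
      mul_neg_of_neg_of_pos hz (by linarith), by positivity, fun u => ?_⟩
    rw [PS_insert hp (fun l hl => hS l (Finset.mem_insert_of_mem hl)) hpS]
    have h1 := h u
    have h2 := h (u - L)
    rw [show (u - L) / 2 = u / 2 + -L / 2 by ring, show -(u - L) / 4 = -u / 4 + L / 4 by ring, exp_add, exp_add] at h2
    rw [abs_le] at h1 h2 ⊢
    constructor <;> nlinarith

section
variable {ι : Type*} [Fintype ι] (n : ι → ℕ) (i₀ : ι)

/-- Absolute exponential moments of the test function. -/
def absMom (σ : ℝ) : ℝ := ∫ y, |psiW n i₀ y| * exp (σ * nuW n y)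

lemma absMom_nonneg (σ : ℝ) : 0 ≤ absMom n i₀ σ := integral_nonneg fun _ => by positivity

lemma integrable_abs_psiW (hn : ∀ i, 0 < n i) {σ : ℝ} (hσ : 0 < σ) :
    Integrable fun y : ι → ℝ => |psiW n i₀ y| * exp (σ * nuW n y) := by
  refine (integrable_psiW n i₀ hn hσ).norm.congr (ae_of_all _ fun y => ?_)
  beta_reduce
  rw [norm_mul, norm_of_nonneg (exp_pos _).le, norm_eq_abs]

lemma integral_psiW_exp (σ : ℝ) :
    ((∫ y, psiW n i₀ y * exp (σ * nuW n y) : ℝ) : ℂ) = mellPsi n i₀ σ := by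
  rw [← integral_complex_ofReal, mellPsi]
  refine integral_congr_ae (ae_of_all _ fun y => ?_)
  push_cast
  rfl

lemma integral_psiW_one (hn : ∀ i, 0 < n i) (h1 : n i₀ = 1) :
    ∫ y, psiW n i₀ y * exp (1 * nuW n y) = 0 := by
  have := integral_psiW_exp n i₀ 1
  rw [Complex.ofReal_one, mellPsi_one n i₀ hn h1] at this
  exact_mod_cast this

lemma integral_psiW_half_pos (hn : ∀ i, 0 < n i) (h1 : n i₀ = 1) :
    0 < ∫ y, psiW n i₀ y * exp (1 / 2 * nuW n y) := by
  have := integral_psiW_exp n i₀ (1 / 2)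
  obtain ⟨r, hr, h⟩ := mellPsi_half n i₀ hn h1
  push_cast at this
  rw [h] at this
  rwa [show ∫ y, psiW n i₀ y * exp (1 / 2 * nuW n y) = r by exact_mod_cast this]

/-- The test function averages of a function of the weighted sum. -/
def psiAvg (F : ℝ → ℝ) (z : ℝ) : ℝ :=
  ∫ y, psiW n i₀ y * (exp (nuW n y / 2) * F (z + nuW n y))

variable {n i₀} in
lemma psiAvg_integrand_le {F : ℝ → ℝ} {C σ : ℝ} (hF : ∀ u, |F u| ≤ C * exp (σ * u)) (z : ℝ) (y : ι → ℝ) :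
    ‖psiW n i₀ y * (exp (nuW n y / 2) * F (z + nuW n y))‖ ≤
      C * exp (σ * z) * (|psiW n i₀ y| * exp ((1 / 2 + σ) * nuW n y)) := by
  rw [norm_mul, norm_mul, norm_of_nonneg (exp_pos _).le, norm_eq_abs, norm_eq_abs]
  calc _ ≤ |psiW n i₀ y| * (exp (nuW n y / 2) * (C * exp (σ * (z + nuW n y)))) := by
        gcongr; exact hF _
    _ = _ := by
        rw [show σ * (z + nuW n y) = σ * z + σ * nuW n y by ring,
          show (1 / 2 + σ) * nuW n y = nuW n y / 2 + σ * nuW n y by ring, exp_add, exp_add]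
        ring

lemma integrable_psiAvg (hn : ∀ i, 0 < n i) {F : ℝ → ℝ} {C σ : ℝ} (hm : Measurable F) (hσ : -(1 / 2) < σ)
    (hF : ∀ u, |F u| ≤ C * exp (σ * u)) (z : ℝ) :
    Integrable fun y => psiW n i₀ y * (exp (nuW n y / 2) * F (z + nuW n y)) := by
  refine ((integrable_abs_psiW n i₀ hn (σ := 1 / 2 + σ) (by linarith)).const_mul _).mono' ?_ (ae_of_all _ (psiAvg_integrand_le hF z))
  have h1 := (continuous_nuW n).measurable
  exact ((continuous_psiW n i₀).measurable.mul ((by fun_prop : Measurable fun y : ι → ℝ => exp (nuW n y / 2)).mul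
    (hm.comp (h1.const_add z)))).aestronglyMeasurable

lemma abs_psiAvg_le (hn : ∀ i, 0 < n i) {F : ℝ → ℝ} {C σ : ℝ} (hσ : -(1 / 2) < σ)
    (hF : ∀ u, |F u| ≤ C * exp (σ * u)) (z : ℝ) :
    |psiAvg n i₀ F z| ≤ C * absMom n i₀ (1 / 2 + σ) * exp (σ * z) := by
  have := norm_integral_le_of_norm_le (f := fun y => psiW n i₀ y * (exp (nuW n y / 2) * F (z + nuW n y)))
    ((integrable_abs_psiW n i₀ hn (σ := 1 / 2 + σ) (by linarith)).const_mul _) (ae_of_all _ (psiAvg_integrand_le hF z))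
  rw [integral_const_mul] at this
  exact this.trans_eq (by rw [absMom]; ring)

lemma abs_PS_le (S : Finset ℕ) (u : ℝ) : |PS S u| ≤ exp 1 * exp (1 * u) := by
  rw [abs_of_nonneg (PS_nonneg S u), one_mul]
  exact PS_le S u

lemma psiAvg_PS_asymp (hn : ∀ i, 0 < n i) (h1 : n i₀ = 1) (S : Finset ℕ) (hS : ∀ l ∈ S, l.Prime) :
    ∃ A C : ℝ, A < 0 ∧ 0 ≤ C ∧ ∀ z, |psiAvg n i₀ (PS S) z| ≤ C * exp (1 * z) ∧
      |psiAvg n i₀ (PS S) z - A| ≤ C * exp (-(1 / 4) * z) := by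
  obtain ⟨c, A, C, hA, hC, h⟩ := PS_asymp S hS
  have hm : Measurable (PS S) := (monotone_PS S).measurable
  set G : ℝ → ℝ := fun u => PS S u - c * exp (u / 2) - A with hG
  have hGb : ∀ u, |G u| ≤ C * exp (-(1 / 4) * u) := fun u => (h u).trans_eq (by ring_nf)
  have hb := abs_psiAvg_le n i₀ hn (by norm_num) (abs_PS_le S)
  have hGa := abs_psiAvg_le n i₀ hn (by norm_num) hGb
  have e : ∀ z, psiAvg n i₀ (PS S) z = psiAvg n i₀ G z + A * ∫ y, psiW n i₀ y * exp (1 / 2 * nuW n y) := by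
    intro z
    have i1 := integrable_psiAvg n i₀ hn (F := G) (by fun_prop) (by norm_num) hGb z
    have i2 := (integrable_psiW n i₀ hn (σ := 1 / 2) (by norm_num)).const_mul A
    have i3 := (integrable_psiW n i₀ hn (σ := 1) (by norm_num)).const_mul (c * exp (z / 2))
    have h0 : ∫ y, (c * exp (z / 2)) * (psiW n i₀ y * exp (1 * nuW n y)) = 0 := by
      rw [integral_const_mul, integral_psiW_one n i₀ hn h1, mul_zero]
    rw [psiAvg, psiAvg, ← integral_const_mul, ← integral_add i1 i2]
    refine Eq.trans ?_ (add_zero _)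
    rw [← h0]
    refine Eq.trans ?_ (integral_add (i1.add i2) i3)
    refine integral_congr_ae (ae_of_all _ fun y => ?_)
    simp only [hG]
    rw [show (z + nuW n y) / 2 = z / 2 + nuW n y / 2 by ring, exp_add, one_mul,
      show nuW n y = nuW n y / 2 + nuW n y / 2 by ring, exp_add]
    ring_nf
  refine ⟨A * ∫ y, psiW n i₀ y * exp (1 / 2 * nuW n y), max (exp 1 * absMom n i₀ (1 / 2 + 1)) (C * absMom n i₀ (1 / 2 + -(1 / 4))),
    mul_neg_of_neg_of_pos hA (integral_psiW_half_pos n i₀ hn h1),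
    le_max_of_le_left (mul_nonneg (exp_pos _).le (absMom_nonneg _ _ _)), fun z => ⟨(hb z).trans ?_, ?_⟩⟩
  · gcongr; exact le_max_left _ _
  · rw [e z, add_sub_cancel_right]
    refine (hGa z).trans ?_
    gcongr; exact le_max_right _ _

end

/-- Positive integers free of the primes in `S`. -/
abbrev Cop (S : Finset ℕ) := {l : ℕ // l ≠ 0 ∧ ∀ p ∈ S, ¬ p ∣ l}

lemma one_mem_Cop {S : Finset ℕ} (hS : ∀ l ∈ S, l.Prime) : (1 : ℕ) ≠ 0 ∧ ∀ p ∈ S, ¬ p ∣ 1 :=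
  ⟨one_ne_zero, fun p hp h => (hS p hp).one_lt.ne' (Nat.dvd_one.mp h)⟩

/-- Uniform bound of a dyadically concentrated harmonic sum. -/
lemma sum_inv_concentrated_le (F : Finset ℕ) (hF : ∀ l ∈ F, 1 ≤ l) {L : ℝ} (hL : 0 < L) :
    ∑ l ∈ F, (l : ℝ)⁻¹ * (if (l : ℝ) ≤ L then √(l / L) else (L / l)) ≤ 4 := by
  have h1 : ∑ l ∈ F with ((l : ℕ) : ℝ) ≤ L, (l : ℝ)⁻¹ * √(l / L) ≤ 2 := by
    have hsub : F.filter (fun l : ℕ => (l : ℝ) ≤ L) ⊆ (Finset.range ⌊L⌋₊).image (· + 1) := by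
      intro l hl
      rw [Finset.mem_filter] at hl
      exact Finset.mem_image.mpr ⟨l - 1, Finset.mem_range.mpr (by have := Nat.le_floor hl.2; have := hF l hl.1; omega), by have := hF l hl.1; omega⟩
    calc _ ≤ ∑ l ∈ (Finset.range ⌊L⌋₊).image (· + 1), ((l : ℕ) : ℝ)⁻¹ * √(l / L) :=
          Finset.sum_le_sum_of_subset_of_nonneg hsub fun _ _ _ => by positivity
      _ = ∑ k ∈ Finset.range ⌊L⌋₊, (1 / √((k : ℝ) + 1)) / √L := by
          rw [Finset.sum_image (fun _ _ _ _ h => by simpa using h)]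
          refine sum_congr rfl fun k _ => ?_
          push_cast
          have : (0 : ℝ) < (k : ℝ) + 1 := by positivity
          rw [Real.sqrt_div this.le]
          have e := Real.mul_self_sqrt this.le
          have := sqrt_pos.mpr this
          have := sqrt_pos.mpr hL
          field_simp
          nlinarith
      _ ≤ ∑ k ∈ Finset.range ⌊L⌋₊, (2 * (√((k : ℝ) + 1) - √(k : ℝ))) / √L := by
          gcongr with k; exact (inv_sqrt_bounds k).2
      _ = 2 * √(⌊L⌋₊ : ℝ) / √L := by
          rw [← Finset.sum_div, ← mul_sum]
          have := Finset.sum_range_sub (fun k : ℕ => √(k : ℝ)) ⌊L⌋₊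
          push_cast at this
          rw [this]; simp
      _ ≤ 2 := by
          rw [div_le_iff₀ (sqrt_pos.mpr hL)]
          gcongr; exact Nat.floor_le hL.le
  have h2 : ∑ l ∈ F with ¬ (((l : ℕ) : ℝ) ≤ L), (l : ℝ)⁻¹ * (L / l) ≤ 2 := by
    obtain ⟨N, hN⟩ := F.exists_nat_subset_range
    have hsub : F.filter (fun l : ℕ => ¬ ((l : ℝ) ≤ L)) ⊆ Finset.Ioo ⌊L⌋₊ N := by
      intro l hl
      rw [Finset.mem_filter, not_le] at hl
      exact Finset.mem_Ioo.mpr ⟨(Nat.floor_lt hL.le).mpr hl.2, Finset.mem_range.mp (hN hl.1)⟩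
    calc _ ≤ ∑ l ∈ Finset.Ioo ⌊L⌋₊ N, ((l : ℕ) : ℝ)⁻¹ * (L / l) :=
          Finset.sum_le_sum_of_subset_of_nonneg hsub fun _ _ _ => by positivity
      _ = L * ∑ l ∈ Finset.Ioo ⌊L⌋₊ N, ((l : ℝ) ^ 2)⁻¹ := by
          rw [mul_sum]; refine sum_congr rfl fun l _ => ?_
          rw [sq, mul_inv]; ring
      _ ≤ L * (2 / (⌊L⌋₊ + 1)) := by gcongr; exact sum_Ioo_inv_sq_le _ _
      _ ≤ 2 := by
          rw [← mul_div_assoc, div_le_iff₀ (by positivity)]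
          nlinarith [Nat.lt_floor_add_one L]
  rw [← Finset.sum_filter_add_sum_filter_not F (fun l : ℕ => (l : ℝ) ≤ L)]
  have e1 : ∑ l ∈ F with ((l : ℕ) : ℝ) ≤ L, (l : ℝ)⁻¹ * (if (l : ℝ) ≤ L then √(l / L) else (L / l)) = ∑ l ∈ F with ((l : ℕ) : ℝ) ≤ L, (l : ℝ)⁻¹ * √(l / L) :=
    sum_congr rfl fun l hl => by rw [if_pos (Finset.mem_filter.mp hl).2]
  have e2 : ∑ l ∈ F with ¬ ((l : ℕ) : ℝ) ≤ L, (l : ℝ)⁻¹ * (if (l : ℝ) ≤ L then √(l / L) else (L / l)) = ∑ l ∈ F with ¬ ((l : ℕ) : ℝ) ≤ L, (l : ℝ)⁻¹ * (L / l) :=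
    sum_congr rfl fun l hl => by rw [if_neg (Finset.mem_filter.mp hl).2]
  rw [e1, e2]; linarith

lemma exists_sum_inv_Cop_ge {S : Finset ℕ} (hS : ∀ l ∈ S, l.Prime) (B : ℝ) :
    ∃ E : Finset (Cop S), B ≤ ∑ l ∈ E, ((l : ℕ) : ℝ)⁻¹ := by
  by_contra! h
  have hs : Summable fun l : Cop S => ((l : ℕ) : ℝ)⁻¹ :=
    summable_of_sum_le (c := B) (fun _ => by positivity) fun E => (h E).le
  have hm : (∏ p ∈ S, p) ≠ 0 := Finset.prod_ne_zero_iff.mpr fun p hp => (hS p hp).ne_zero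
  have : NeZero (∏ p ∈ S, p) := ⟨hm⟩
  refine Real.not_summable_indicator_one_div_natCast hm (1 : ZMod (∏ p ∈ S, p)) ?_
  have h2 : Summable (Set.indicator {l : ℕ | l ≠ 0 ∧ ∀ p ∈ S, ¬ p ∣ l} fun l : ℕ => (l : ℝ)⁻¹) :=
    summable_subtype_iff_indicator.mp hs
  refine h2.of_nonneg_of_le (fun l => Set.indicator_nonneg (fun _ _ => by positivity) _) fun l => ?_
  by_cases h3 : l ∈ {n : ℕ | (n : ZMod (∏ p ∈ S, p)) = 1}
  · rcases eq_or_ne l 0 with rfl | h0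
    · rw [Set.indicator_of_mem h3]
      simp
    rw [Set.indicator_of_mem h3, Set.indicator_of_mem, one_div]
    refine ⟨h0, fun p hp hpl => ?_⟩
    have h4 : (l : ZMod (∏ p ∈ S, p)) = (1 : ℕ) := by simpa using h3
    rw [ZMod.natCast_eq_natCast_iff] at h4
    have h5 := h4.of_dvd (Finset.dvd_prod_of_mem (fun p => p) hp)
    exact (hS p hp).one_lt.ne' (Nat.dvd_one.mp ((h5.dvd_iff dvd_rfl).mp hpl))
  · rw [Set.indicator_of_notMem h3]
    exact Set.indicator_nonneg (fun _ _ => by positivity) _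

/-- Superposition of translates of the partial sums. -/
def superPS {X : Type*} (S : Finset ℕ) (W s : X → ℝ) (z : ℝ) : ℝ := ∑' x, W x * PS S (z - s x)

section
variable {X : Type*} [Countable X] {S : Finset ℕ} {W s : X → ℝ} (hW : ∀ x, 0 ≤ W x) (hWs : Summable fun x => W x * exp (-s x))
include hW hWs

lemma superPS_term_le (z : ℝ) (x : X) : W x * PS S (z - s x) ≤ exp 1 * exp z * (W x * exp (-s x)) := by
  calc _ ≤ W x * (exp 1 * exp (z - s x)) := mul_le_mul_of_nonneg_left (PS_le S _) (hW x)
    _ = _ := by rw [sub_eq_add_neg, exp_add]; ring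

lemma summable_superPS (z : ℝ) : Summable fun x => W x * PS S (z - s x) :=
  (hWs.mul_left (exp 1 * exp z)).of_nonneg_of_le (fun x => mul_nonneg (hW x) (PS_nonneg _ _))
    (superPS_term_le hW hWs z)

lemma superPS_nonneg (z : ℝ) : 0 ≤ superPS S W s z :=
  tsum_nonneg fun x => mul_nonneg (hW x) (PS_nonneg _ _)

lemma monotone_superPS : Monotone (superPS S W s) := fun u v h =>
  Summable.tsum_le_tsum (fun x => mul_le_mul_of_nonneg_left (monotone_PS S (by linarith)) (hW x))
    (summable_superPS hW hWs u) (summable_superPS hW hWs v)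

lemma abs_superPS_le (z : ℝ) : |superPS S W s z| ≤ (exp 1 * ∑' x, W x * exp (-s x)) * exp (1 * z) := by
  rw [abs_of_nonneg (superPS_nonneg hW hWs z), superPS]
  refine (Summable.tsum_le_tsum (superPS_term_le hW hWs z) (summable_superPS hW hWs z) (hWs.mul_left _)).trans_eq ?_
  rw [tsum_mul_left, one_mul]; ring

variable {ι : Type*} [Fintype ι] {n : ι → ℕ} {i₀ : ι}

lemma hasSum_psiAvg_superPS (hn : ∀ i, 0 < n i) (z : ℝ) :
    HasSum (fun x => W x * psiAvg n i₀ (PS S) (z - s x)) (psiAvg n i₀ (superPS S W s) z) := by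
  have hm : Measurable (PS S) := (monotone_PS S).measurable
  set f : X → (ι → ℝ) → ℝ := fun x y => W x * (psiW n i₀ y * (exp (nuW n y / 2) * PS S (z - s x + nuW n y))) with hf
  have hi : ∀ x, Integrable (f x) := fun x =>
    (integrable_psiAvg n i₀ hn hm (by norm_num) (abs_PS_le S) _).const_mul _
  have hs : Summable fun x => ∫ y, ‖f x y‖ := by
    refine ((hWs.mul_left (exp 1 * exp (1 * z))).mul_right (absMom n i₀ (1 / 2 + 1))).of_nonneg_of_le
      (fun x => integral_nonneg fun _ => norm_nonneg _) fun x => ?_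
    rw [absMom, ← integral_const_mul]
    refine integral_mono (hi x).norm ((integrable_abs_psiW n i₀ hn (by norm_num)).const_mul _) fun y => ?_
    rw [hf]; beta_reduce
    rw [norm_mul, norm_of_nonneg (hW x)]
    refine (mul_le_mul_of_nonneg_left (psiAvg_integrand_le (abs_PS_le S) _ _) (hW x)).trans_eq ?_
    rw [show 1 * (z - s x) = 1 * z + -s x by ring, exp_add]; ring
  have := hasSum_integral_of_summable_integral_norm hi hs
  simp only [hf, integral_const_mul] at this
  have e : psiAvg n i₀ (superPS S W s) z = ∫ y, ∑' x, W x * (psiW n i₀ y * (exp (nuW n y / 2) * PS S (z - s x + nuW n y))) := by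
    refine integral_congr_ae (ae_of_all _ fun y => ?_)
    beta_reduce
    rw [superPS, ← tsum_mul_left, ← tsum_mul_left]
    refine tsum_congr fun x => ?_
    rw [show z + nuW n y - s x = z - s x + nuW n y by ring]; ring
  rw [e]
  exact this

end

section
variable {J : Type*} [Countable J] {S : Finset ℕ} (κ : J → ℝ) (N : J → ℕ)

/-- The weight of a pair. -/
def pairW (x : J × Cop S) : ℝ := κ x.1 * (N x.1 : ℝ) ^ (-(1 / 2) : ℝ) * ((x.2 : ℕ) : ℝ)⁻¹

/-- The logarithmic size of a pair. -/
def pairS (x : J × Cop S) : ℝ := log (N x.1) + 2 * log (x.2 : ℕ)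

variable {κ N} (hκ : ∀ j, 0 ≤ κ j) (hN : ∀ j, 1 ≤ N j) (hs : Summable fun j => κ j * (N j : ℝ) ^ (-(1 / 2) : ℝ))
include hκ

lemma pairW_nonneg (x : J × Cop S) : 0 ≤ pairW κ N x := by
  have := hκ x.1
  unfold pairW; positivity

include hN hs

lemma summable_pairW : Summable fun x : J × Cop S => pairW κ N x * exp (-pairS N x) := by
  have h2 : Summable fun l : Cop S => (((l : ℕ) : ℝ) ^ 2)⁻¹ :=
    (Real.summable_nat_pow_inv.mpr one_lt_two).comp_injective Subtype.val_injective
  refine (hs.mul_of_nonneg h2 (fun j => mul_nonneg (hκ j) (by positivity)) fun _ => by positivity).of_nonneg_of_le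
    (fun x => mul_nonneg (pairW_nonneg hκ x) (exp_pos _).le) fun x => ?_
  have hl : (1 : ℝ) ≤ (x.2 : ℕ) := by exact_mod_cast Nat.one_le_iff_ne_zero.mpr x.2.2.1
  have hN1 : (1 : ℝ) ≤ N x.1 := by exact_mod_cast hN x.1
  have e : exp (-pairS N x) ≤ ((x.2 : ℕ) : ℝ)⁻¹ := by
    rw [exp_neg]
    refine inv_anti₀ (by linarith) ?_
    rw [← Real.log_le_iff_le_exp (by linarith), pairS]
    have := log_nonneg hl
    have := log_nonneg hN1
    linarith
  refine (mul_le_mul_of_nonneg_left e (pairW_nonneg hκ x)).trans_eq ?_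
  rw [pairW, sq, mul_inv]; ring

set_option maxHeartbeats 1000000 in
lemma psiAvg_superPS_le {ι : Type*} [Fintype ι] {n : ι → ℕ} {i₀ : ι} (hn : ∀ i, 0 < n i) (h1 : n i₀ = 1)
    (hS : ∀ l ∈ S, l.Prime) {j₀ : J} (hj : 0 < κ j₀) (hNj : N j₀ = 1) (B : ℝ) :
    ∃ Z, ∀ z, Z ≤ z → psiAvg n i₀ (superPS (X := J × Cop S) S (pairW κ N) (pairS N)) z ≤ B := by
  obtain ⟨A, C, hA, hC, h⟩ := psiAvg_PS_asymp n i₀ hn h1 S hS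
  set w : J → ℝ := fun j => κ j * (N j : ℝ) ^ (-(1 / 2) : ℝ) with hw
  have hw0 : ∀ j, 0 ≤ w j := fun j => mul_nonneg (hκ j) (by positivity)
  obtain ⟨E, hE⟩ := exists_sum_inv_Cop_ge hS ((4 * C * ∑' j, w j - B) / (κ j₀ * -A))
  refine ⟨∑ l ∈ E, 2 * log (l : ℕ), fun z hz => ?_⟩
  have hEz : ∀ l ∈ E, 2 * log (l : ℕ) ≤ z := fun l hl => le_trans
    (Finset.single_le_sum (f := fun l : Cop S => 2 * log (l : ℕ)) (fun l _ => by positivity) hl) hz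
  set L : J → ℝ := fun j => exp ((z - log (N j)) / 2) with hL
  set g : J → Cop S → ℝ := fun j l => ((l : ℕ) : ℝ)⁻¹ * (if ((l : ℕ) : ℝ) ≤ L j then √((l : ℕ) / L j) else (L j / (l : ℕ))) with hg
  have hg0 : ∀ j l, 0 ≤ g j l := fun j l => by
    have : 0 < L j := exp_pos _
    rw [hg]; beta_reduce; split_ifs <;> positivity
  have hgs : ∀ j (F : Finset (Cop S)), ∑ l ∈ F, g j l ≤ 4 := by
    intro j F
    have := sum_inv_concentrated_le (F.map (Function.Embedding.subtype _)) (L := L j) (fun l hl => by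
      obtain ⟨x, -, rfl⟩ := Finset.mem_map.mp hl
      exact Nat.one_le_iff_ne_zero.mpr x.2.1) (exp_pos _)
    rwa [Finset.sum_map] at this
  have hgS : ∀ j, Summable (g j) := fun j => summable_of_sum_le (hg0 j) (hgs j)
  have hgT : ∀ j, ∑' l, g j l ≤ 4 := fun j => (hgS j).tsum_le_of_sum_le (hgs j)
  have hpt : ∀ x : J × Cop S, pairW κ N x * psiAvg n i₀ (PS S) (z - pairS N x) ≤
      C * (w x.1 * g x.1 x.2) + (if x ∈ E.map ⟨Prod.mk j₀, Prod.mk_right_injective j₀⟩ then κ j₀ * A * ((x.2 : ℕ) : ℝ)⁻¹ else 0) := by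
    rintro ⟨j, l⟩
    obtain ⟨ha, hb⟩ := h (z - pairS N (j, l))
    have hl : (0 : ℝ) < (l : ℕ) := by exact_mod_cast Nat.pos_of_ne_zero l.2.1
    have hLj : 0 < L j := exp_pos _
    have hexp : ∀ t : ℝ, exp (t * (z - pairS N (j, l))) = (L j / (l : ℕ)) ^ (2 * t) := by
      intro t
      rw [Real.rpow_def_of_pos (by positivity), log_div hLj.ne' hl.ne', hL, log_exp, pairS]
      congr 1; ring
    have hwj := hw0 j
    have hP : psiAvg n i₀ (PS S) (z - pairS N (j, l)) ≤ (if ((l : ℕ) : ℝ) ≤ L j then A else 0) + C * (if ((l : ℕ) : ℝ) ≤ L j then √((l : ℕ) / L j) else (L j / (l : ℕ))) := by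
      split_ifs with hc
      · have : √((l : ℕ) / L j) = exp (-(1 / 4) * (z - pairS N (j, l))) := by
          rw [hexp, show (2 : ℝ) * -(1 / 4) = -(1 / 2) by norm_num, rpow_neg (by positivity), ← Real.inv_rpow (by positivity), inv_div, sqrt_eq_rpow]
        rw [this]
        linarith [(abs_le.mp hb).2]
      · have h2 : exp (1 * (z - pairS N (j, l))) ≤ L j / (l : ℕ) := by
          rw [hexp]
          have : L j / (l : ℕ) ≤ 1 := (div_le_one hl).mpr (not_le.mp hc).le
          calc (L j / (l : ℕ)) ^ (2 * 1 : ℝ) ≤ (L j / (l : ℕ)) ^ (1 : ℝ) :=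
                Real.rpow_le_rpow_of_exponent_ge (by positivity) this (by norm_num)
            _ = _ := Real.rpow_one _
        have := (abs_le.mp ha).2
        have := mul_le_mul_of_nonneg_left h2 hC
        linarith
    have hW : pairW κ N (j, l) = w j * ((l : ℕ) : ℝ)⁻¹ := rfl
    have hgl : g j l = ((l : ℕ) : ℝ)⁻¹ * (if ((l : ℕ) : ℝ) ≤ L j then √((l : ℕ) / L j) else (L j / (l : ℕ))) := rfl
    refine (mul_le_mul_of_nonneg_left hP (pairW_nonneg hκ (j, l))).trans ?_
    calc _ = C * (w j * g j l) + w j * ((l : ℕ) : ℝ)⁻¹ * (if ((l : ℕ) : ℝ) ≤ L j then A else 0) := by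
          rw [hW, hgl]
          generalize (if ((l : ℕ) : ℝ) ≤ L j then √((l : ℕ) / L j) else (L j / (l : ℕ))) = b
          ring
      _ ≤ _ := by
        gcongr
        split_ifs with h3 h4 h5
        · obtain ⟨l', -, hl'⟩ := Finset.mem_map.mp h4
          obtain ⟨rfl, rfl⟩ := Prod.mk.inj hl'
          rw [hw]; beta_reduce
          rw [hNj]; simp only [Nat.cast_one, Real.one_rpow]; apply le_of_eq; ring
        · exact mul_nonpos_of_nonneg_of_nonpos (by positivity) hA.le
        · obtain ⟨l', hl'E, hl'⟩ := Finset.mem_map.mp h5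
          obtain ⟨rfl, rfl⟩ := Prod.mk.inj hl'
          refine absurd ?_ h3
          rw [hL]; beta_reduce
          rw [hNj, Nat.cast_one, Real.log_one, sub_zero, ← Real.log_le_iff_le_exp hl]
          linarith [hEz l' hl'E]
        · rw [mul_zero]
  have hs1 : Summable fun x : J × Cop S => w x.1 * g x.1 x.2 := by
    refine (summable_prod_of_nonneg fun x => mul_nonneg (hw0 _) (hg0 _ _)).mpr ⟨fun j => (hgS j).mul_left (w j), ?_⟩
    refine (hs.mul_right 4).of_nonneg_of_le (fun j => tsum_nonneg fun l => mul_nonneg (hw0 _) (hg0 _ _)) fun j => ?_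
    exact (tsum_mul_left (f := g j) (a := w j)).trans_le (mul_le_mul_of_nonneg_left (hgT j) (hw0 j))
  have ht1 : ∑' x : J × Cop S, w x.1 * g x.1 x.2 ≤ (∑' j, w j) * 4 := by
    rw [hs1.tsum_prod, ← tsum_mul_right]
    refine Summable.tsum_le_tsum (fun j => ?_) hs1.prod (hs.mul_right 4)
    exact (tsum_mul_left (f := g j) (a := w j)).trans_le (mul_le_mul_of_nonneg_left (hgT j) (hw0 j))
  have hs2 : HasSum (fun x : J × Cop S => if x ∈ E.map ⟨Prod.mk j₀, Prod.mk_right_injective j₀⟩ then κ j₀ * A * ((x.2 : ℕ) : ℝ)⁻¹ else 0)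
      (∑ l ∈ E, κ j₀ * A * ((l : ℕ) : ℝ)⁻¹) := by
    have := hasSum_sum_of_ne_finset_zero (L := .unconditional _) (f := fun x : J × Cop S => if x ∈ E.map ⟨Prod.mk j₀, Prod.mk_right_injective j₀⟩ then κ j₀ * A * ((x.2 : ℕ) : ℝ)⁻¹ else 0)
      (s := E.map ⟨Prod.mk j₀, Prod.mk_right_injective j₀⟩) fun x hx => if_neg hx
    rw [Finset.sum_map] at this
    refine (sum_congr rfl fun l hl => ?_ : _ = ∑ l ∈ E, κ j₀ * A * ((l : ℕ) : ℝ)⁻¹) ▸ this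
    exact if_pos (Finset.mem_map_of_mem _ hl)
  have hfin := hasSum_le hpt (hasSum_psiAvg_superPS (n := n) (i₀ := i₀) (pairW_nonneg hκ) (summable_pairW hκ hN hs) hn z)
    ((hs1.hasSum.mul_left C).add hs2)
  rw [← mul_sum] at hfin
  rw [div_le_iff₀ (mul_pos hj (by linarith))] at hE
  have := mul_le_mul_of_nonneg_left ht1 hC
  nlinarith

end

open scoped Matrix

section
variable {d : Type*} [Fintype d]

/-- Fourier transform on coordinate space. -/
def FT (H : (d → ℝ) → ℝ) (ξ : d → ℝ) : ℂ :=
  ∫ x, cexp (-2 * π * I * ((ξ ⬝ᵥ x : ℝ) : ℂ)) * (H x : ℂ)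

lemma integral_eKer_comp [DecidableEq d] {B : Matrix d d ℝ} (hB : B.det ≠ 0) {m : d → ℤ} {ξ : d → ℝ}
    (hξ : Bᵀ *ᵥ ξ = intVec m) (s : d → ℝ) (H : (d → ℝ) → ℝ) :
    ∫ x, eKer m x * (H (B *ᵥ x + s) : ℂ) =
      cexp (2 * π * I * ((ξ ⬝ᵥ s : ℝ) : ℂ)) * (|B.det|⁻¹ * FT H ξ) := by
  have e : ∀ x, eKer m x * (H (B *ᵥ x + s) : ℂ) = cexp (2 * π * I * ((ξ ⬝ᵥ s : ℝ) : ℂ)) *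
      (fun y => cexp (-2 * π * I * ((ξ ⬝ᵥ (y + s) : ℝ) : ℂ)) * (H (y + s) : ℂ)) (B *ᵥ x) := by
    intro x
    beta_reduce
    rw [← mul_assoc, ← Complex.exp_add, eKer]
    congr 2
    have h1 : ∑ i, (m i : ℂ) * x i = ((ξ ⬝ᵥ (B *ᵥ x) : ℝ) : ℂ) := by
      rw [Matrix.dotProduct_mulVec, ← Matrix.mulVec_transpose, hξ]
      simp [dotProduct, intVec]
    rw [h1, dotProduct_add]
    push_cast; ring
  rw [funext e, integral_const_mul]
  refine congrArg (_ * ·) ((integral_comp_mulVec B hB (fun y => cexp (-2 * π * I * ((ξ ⬝ᵥ (y + s) : ℝ) : ℂ)) * (H (y + s) : ℂ))).trans ?_)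
  rw [FT]
  push_cast
  congr 1
  exact integral_add_right_eq_self (μ := volume) (fun y : d → ℝ => cexp (-2 * π * I * ((ξ ⬝ᵥ y : ℝ) : ℂ)) * (H y : ℂ)) s

lemma summable_dual_lattice [DecidableEq d] {B : Matrix d d ℝ} {ξ : (d → ℤ) → (d → ℝ)}
    (hξ : ∀ m, Bᵀ *ᵥ ξ m = intVec m) {k : ℕ} (hk : Fintype.card d < k) :
    Summable fun m => ((1 + ‖ξ m‖) ^ k)⁻¹ := by
  set L := LinearMap.toContinuousLinearMap (Bᵀ.mulVecLin)
  have h1 : ∀ m, 1 + ‖intVec m‖ ≤ (1 + ‖L‖) * (1 + ‖ξ m‖) := fun m => by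
    have h2 : ‖intVec m‖ ≤ ‖L‖ * ‖ξ m‖ := by
      rw [← hξ m]; exact L.le_opNorm (ξ m)
    nlinarith [norm_nonneg L, norm_nonneg (ξ m)]
  refine ((summable_one_add_norm_pow k hk).mul_left ((1 + ‖L‖) ^ k)).of_nonneg_of_le (fun _ => by positivity) fun m => ?_
  rw [← div_eq_mul_inv, le_div_iff₀ (by positivity), inv_mul_le_iff₀ (by positivity), ← mul_pow, mul_comm (1 + ‖ξ m‖)]
  exact pow_le_pow_left₀ (by positivity) (h1 m) k

lemma lattice_sum_error [DecidableEq d] {B : Matrix d d ℝ} (hB : B.det ≠ 0) {ξ : (d → ℤ) → (d → ℝ)}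
    (hξ : ∀ m, Bᵀ *ᵥ ξ m = intVec m) (s : d → ℝ) {k : ℕ} (hk : Fintype.card d < k) {H : (d → ℝ) → ℝ} (hc : Continuous H)
    (hs : HasCompactSupport H) {C : ℝ} (hC : ∀ x, ‖FT H x‖ ≤ C * ((1 + ‖x‖) ^ k)⁻¹) :
    |∑' n : d → ℤ, H (B *ᵥ intVec n + s) - |B.det|⁻¹ * ∫ x, H x| ≤
      |B.det|⁻¹ * (C * ∑' m, if m = 0 then 0 else ((1 + ‖ξ m‖) ^ k)⁻¹) := by
  have hsm := summable_dual_lattice hξ hk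
  have hξ0 : ξ 0 = 0 := by
    have : Injective (Bᵀ).mulVec := Matrix.mulVec_injective_of_isUnit (by
      rw [Matrix.isUnit_iff_isUnit_det, Matrix.det_transpose]; exact hB.isUnit)
    apply this
    rw [hξ 0, Matrix.mulVec_zero]
    ext; simp [intVec]
  have hterm : ∀ m, ‖∫ x, eKer m x * (H (B *ᵥ x + s) : ℂ)‖ ≤ |B.det|⁻¹ * (C * ((1 + ‖ξ m‖) ^ k)⁻¹) := fun m => by
    rw [integral_eKer_comp hB (hξ m), norm_mul, norm_mul]
    rw [show 2 * π * I * ((ξ m ⬝ᵥ s : ℝ) : ℂ) = ((2 * π * (ξ m ⬝ᵥ s) : ℝ) : ℂ) * I by push_cast; ring,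
      Complex.norm_exp_ofReal_mul_I, one_mul]
    simp only [Complex.norm_real, Complex.ofReal_inv, norm_inv, norm_eq_abs, abs_abs]
    gcongr; exact hC _
  have hF : Summable fun m => ∫ x, eKer m x * (H (B *ᵥ x + s) : ℂ) :=
    Summable.of_norm_bounded ((hsm.mul_left C).mul_left _) hterm
  have hc' : Continuous fun x => (H (B *ᵥ x + s) : ℂ) := by fun_prop
  have hcs : HasCompactSupport fun x => ((1 + ‖x‖) ^ k : ℝ) * H (B *ᵥ x + s) := by
    refine HasCompactSupport.mul_left ?_
    let e : (d → ℝ) ≃ₜ (d → ℝ) := ((Matrix.toLinearEquiv' B (B.invertibleOfIsUnitDet hB.isUnit)).toContinuousLinearEquiv.toHomeomorph).trans (Homeomorph.addRight s)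
    exact hs.comp_homeomorph e
  obtain ⟨C', hC'⟩ := hcs.exists_bound_of_continuous (by fun_prop)
  have hP := poisson_of_decay hc' (C := C') hk (fun x => by
    rw [← div_eq_mul_inv, le_div_iff₀ (by positivity), mul_comm]
    refine le_trans (le_of_eq ?_) (hC' x)
    rw [norm_mul, Complex.norm_real, norm_of_nonneg (show 0 ≤ (1 + ‖x‖) ^ k by positivity)]) hF
  have h0 : ∫ x, eKer 0 x * (H (B *ᵥ x + s) : ℂ) = ((|B.det|⁻¹ * ∫ x, H x : ℝ) : ℂ) := by
    rw [integral_eKer_comp hB (hξ 0), hξ0, FT]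
    simp [integral_complex_ofReal]
  rw [hF.tsum_eq_add_tsum_ite 0, h0] at hP
  have hfin : ((∑' n : d → ℤ, H (B *ᵥ intVec n + s) : ℝ) : ℂ) = ∑' n : d → ℤ, (H (B *ᵥ intVec n + s) : ℂ) := Complex.ofReal_tsum _
  have hsum : Summable fun m => if m = 0 then 0 else ((1 + ‖ξ m‖) ^ k)⁻¹ :=
    hsm.of_nonneg_of_le (fun m => by split_ifs <;> positivity) fun m => by split_ifs <;> first | positivity | rfl
  rw [← norm_eq_abs, ← Complex.norm_real, Complex.ofReal_sub, hfin, hP, add_sub_cancel_left]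
  refine tsum_of_norm_bounded ((hsum.hasSum.mul_left C).mul_left _) fun m => ?_
  split_ifs with h
  · simp
  · exact hterm m
end

lemma tsum_shift_inv_sq_le {ρ : ℝ} (hρ : 0 < ρ) (x : ℝ) :
    ∑' N : ℤ, ofReal ((1 + ρ * |N + x|) ^ 2)⁻¹ ≤ ofReal (3 + 4 / ρ) := by
  have key : ∀ M : ℕ, ∑ m ∈ Finset.range M, ((1 + ρ / 2 * (m + 1)) ^ 2)⁻¹ ≤ 2 / ρ - (2 / ρ) * (1 + ρ / 2 * M)⁻¹ := by
    intro M
    induction M with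
    | zero => simp
    | succ M ih =>
      rw [Finset.sum_range_succ]
      have : ((1 + ρ / 2 * (M + 1)) ^ 2)⁻¹ ≤ (2 / ρ) * (1 + ρ / 2 * M)⁻¹ - (2 / ρ) * (1 + ρ / 2 * (M + 1))⁻¹ := by
        have h1 : 0 < 1 + ρ / 2 * M := by positivity
        have h2 : 0 < 1 + ρ / 2 * (M + 1) := by positivity
        rw [← mul_sub, inv_sub_inv h1.ne' h2.ne', show (1 + ρ / 2 * ((M:ℝ) + 1) - (1 + ρ / 2 * M)) = ρ / 2 by ring,
          show 2 / ρ * (ρ / 2 / ((1 + ρ / 2 * M) * (1 + ρ / 2 * (M + 1)))) = ((1 + ρ / 2 * M) * (1 + ρ / 2 * (M + 1)))⁻¹ by field_simp]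
        apply inv_anti₀ (by positivity)
        rw [sq]; gcongr; linarith
      push_cast at *; linarith
  have half : ∑' m : ℕ, ofReal ((1 + ρ / 2 * (m + 1)) ^ 2)⁻¹ ≤ ofReal (2 / ρ) := by
    rw [ENNReal.tsum_eq_iSup_nat]
    refine iSup_le fun M => ?_
    rw [← ENNReal.ofReal_sum_of_nonneg (fun _ _ => by positivity)]
    apply ENNReal.ofReal_le_ofReal
    have : 0 ≤ (2 / ρ) * (1 + ρ / 2 * M)⁻¹ := by positivity
    linarith [key M]
  set f := Int.fract x
  have hx : ∀ N : ℤ, ((N + ⌊x⌋ : ℤ) : ℝ) + f = N + x := fun N => by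
    push_cast; rw [add_assoc, Int.floor_add_fract]
  have e1 : ∑' N : ℤ, ofReal ((1 + ρ * |N + x|) ^ 2)⁻¹ = ∑' M : ℤ, ofReal ((1 + ρ * |M + f|) ^ 2)⁻¹ := by
    rw [← (Equiv.addRight ⌊x⌋).tsum_eq (fun M : ℤ => ofReal ((1 + ρ * |M + f|) ^ 2)⁻¹)]
    refine tsum_congr fun N => ?_
    rw [← hx N]; rfl
  have hf0 : 0 ≤ f := Int.fract_nonneg x
  have hf1 : f < 1 := Int.fract_lt_one x
  have one : ∀ y : ℝ, ofReal ((1 + ρ * |y|) ^ 2)⁻¹ ≤ 1 := fun y => by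
    rw [ENNReal.ofReal_le_one]
    apply inv_le_one_of_one_le₀
    exact one_le_pow₀ (le_add_of_nonneg_right (by positivity))
  have step : ∀ g : ℕ → ℝ, (∀ n : ℕ, (n : ℝ) + 1 ≤ |g (n + 1)|) →
      ∑' n : ℕ, ofReal ((1 + ρ * |g n|) ^ 2)⁻¹ ≤ 1 + ofReal (2 / ρ) := fun g hg => by
    rw [tsum_eq_zero_add' ENNReal.summable]
    refine add_le_add (one _) (le_trans (ENNReal.tsum_le_tsum fun n => ?_) half)
    apply ENNReal.ofReal_le_ofReal
    apply inv_anti₀ (by positivity)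
    have := hg n
    gcongr ?_ ^ 2
    nlinarith [abs_nonneg (g (n + 1))]
  have p1 := step (fun n => (n : ℝ) + f) fun n => by
    push_cast
    exact le_trans (by linarith) (le_abs_self _)
  have p2 := step (fun n => -((n : ℝ) + 1) + f) fun n => by
    push_cast
    exact le_trans (by linarith) (neg_le_abs _)
  have e2 : ∑' M : ℤ, ofReal ((1 + ρ * |M + f|) ^ 2)⁻¹ =
      ∑' n : ℕ, ofReal ((1 + ρ * |(n : ℝ) + f|) ^ 2)⁻¹ +
        ∑' n : ℕ, ofReal ((1 + ρ * |-((n : ℝ) + 1) + f|) ^ 2)⁻¹ := by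
    rw [tsum_of_nat_of_neg_add_one ENNReal.summable ENNReal.summable]
    congr 1
    refine tsum_congr fun n => ?_
    push_cast; rfl
  rw [e1, e2]
  refine (add_le_add p1 p2).trans ?_
  rw [← ENNReal.ofReal_one, ← ENNReal.ofReal_add (by positivity) (by positivity),
    ← ENNReal.ofReal_add (by positivity) (by positivity)]
  apply ENNReal.ofReal_le_ofReal
  have : 4 / ρ = 2 / ρ + 2 / ρ := by ring
  linarith

lemma tsum_arith_le (k : ℕ) (h : ℤ) (hh : h ≠ 0) (F : ℤ → ENNReal) :
    ∑' x : Fin k × ℤ, F (x.2 * k + h * (x.1 : ℕ)) ≤ h.natAbs * ∑' N, F N := by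
  have : NeZero h.natAbs := ⟨by simpa using hh⟩
  let φ : Fin k × ℤ → ℤ × ZMod h.natAbs := fun x => (x.2 * k + h * (x.1 : ℕ), (x.2 : ZMod h.natAbs))
  have hφ : Injective φ := by
    rintro ⟨r, i⟩ ⟨r', i'⟩ hxy
    simp only [φ, Prod.mk.injEq] at hxy
    obtain ⟨h1, h2⟩ := hxy
    rw [ZMod.intCast_eq_intCast_iff_dvd_sub] at h2
    have h3 : (i' - i) * k = h * (((r : ℕ) : ℤ) - (r' : ℕ)) := by linear_combination -h1
    have hii : i' - i = 0 := by
      by_contra hne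
      have h4 : (h.natAbs : ℤ) ≤ |i' - i| := Int.le_of_dvd (abs_pos.2 hne) (by rwa [dvd_abs])
      have h5 : |i' - i| * k = |h| * |((r : ℕ) : ℤ) - (r' : ℕ)| := by
        rw [← abs_mul, ← h3, abs_mul, Nat.abs_cast]
      have h6 : |((r : ℕ) : ℤ) - (r' : ℕ)| < k := by
        rw [abs_lt]; constructor <;> have := r.2 <;> have := r'.2 <;> omega
      rw [Int.natCast_natAbs] at h4
      have h7 : 0 < |h| := abs_pos.2 hh
      nlinarith
    have : i = i' := by omega
    subst this
    have h8 : h * (((r : ℕ) : ℤ) - (r' : ℕ)) = 0 := by rw [← h3]; simp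
    have h9 := (mul_eq_zero.1 h8).resolve_left hh
    ext <;> simp; omega
  calc ∑' x : Fin k × ℤ, F (x.2 * k + h * (x.1 : ℕ)) = ∑' x, (fun y : ℤ × ZMod h.natAbs => F y.1) (φ x) := rfl
    _ ≤ ∑' y : ℤ × ZMod h.natAbs, F y.1 := ENNReal.tsum_comp_le_tsum_of_injective hφ _
    _ = h.natAbs * ∑' N, F N := by
      rw [ENNReal.tsum_prod']
      simp only [tsum_fintype, Finset.sum_const, Finset.card_univ, ZMod.card, nsmul_eq_mul]
      rw [ENNReal.tsum_mul_left]

lemma exists_dual_sum_le : ∃ C : ℝ, 0 ≤ C ∧ ∀ (k : ℕ) (c P Q : ℝ), 0 < P → 0 < Q →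
    ∑' x : Fin k × (Fin 2 → ℤ), ofReal (if x.2 = 0 then 0 else
      ((1 + ‖(![P * (x.2 0 + ((x.1 : ℕ) + c) * x.2 1 / k), Q * x.2 1] : Fin 2 → ℝ)‖) ^ 6)⁻¹) ≤
    ofReal (C * (k * (P ^ 4)⁻¹ + (1 + k / P) * (Q ^ 3)⁻¹)) := by
  have hs4 : Summable fun i : ℤ => (|(i : ℝ)| ^ 4)⁻¹ := by
    have := Real.summable_one_div_int_pow (p := 4)
    refine (this.2 (by norm_num)).congr fun i => ?_
    rw [one_div, Even.pow_abs (by decide)]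
  have hs2 : Summable fun i : ℤ => (|(i : ℝ)| ^ 2)⁻¹ := by
    have := Real.summable_one_div_int_pow (p := 2)
    refine (this.2 (by norm_num)).congr fun i => ?_
    rw [one_div, Even.pow_abs (by decide)]
  set S4 := ∑' i : ℤ, (|(i : ℝ)| ^ 4)⁻¹
  set S2 := ∑' i : ℤ, (|(i : ℝ)| ^ 2)⁻¹
  have h40 : 0 ≤ S4 := tsum_nonneg fun _ => by positivity
  have h20 : 0 ≤ S2 := tsum_nonneg fun _ => by positivity
  refine ⟨S4 + 4 * S2, by positivity, fun k c P Q hP hQ => ?_⟩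
  rcases Nat.eq_zero_or_pos k with rfl | hk
  · simp
  let E : Fin k × (Fin 2 → ℤ) ≃ ℤ × (Fin k × ℤ) :=
    { toFun := fun x => (x.2 1, (x.1, x.2 0)), invFun := fun y => (y.2.1, ![y.2.2, y.1]),
      left_inv := fun x => by
        ext i
        · rfl
        · fin_cases i <;> rfl
      right_inv := fun y => rfl }
  let g : ℤ → Fin k × ℤ → ENNReal := fun h y => ofReal (if (![y.2, h] : Fin 2 → ℤ) = 0 then 0 else
      ((1 + ‖(![P * (y.2 + ((y.1 : ℕ) + c) * h / k), Q * h] : Fin 2 → ℝ)‖) ^ 6)⁻¹)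
  rw [← E.symm.tsum_eq, ENNReal.tsum_prod']
  change ∑' h, ∑' y, g h y ≤ _
  set ρ := P / k with hρ
  have hρ0 : 0 < ρ := by positivity
  have hb : ∀ h : ℤ, ∑' y : Fin k × ℤ, g h y ≤
      (if h = 0 then ofReal (k * (P ^ 4)⁻¹ * S4) else 0) +
        ofReal ((|(h : ℝ)| ^ 2)⁻¹ * ((Q ^ 3)⁻¹ * (3 + 4 / ρ))) := by
    intro h
    by_cases hh : h = 0
    · subst hh
      rw [if_pos rfl]
      refine le_trans ?_ le_self_add
      rw [ENNReal.tsum_prod', mul_assoc, ENNReal.ofReal_mul (by positivity), ENNReal.ofReal_mul (by positivity),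
        ENNReal.ofReal_natCast]
      rw [tsum_fintype, ← ENNReal.ofReal_mul (by positivity)]
      refine (Finset.sum_le_card_nsmul _ _ (ofReal ((P ^ 4)⁻¹ * S4)) fun r _ => ?_).trans (by simp)
      rw [← tsum_mul_left, ENNReal.ofReal_tsum_of_nonneg (fun _ => by positivity) (hs4.mul_left _)]
      refine ENNReal.tsum_le_tsum fun i => ENNReal.ofReal_le_ofReal ?_
      split_ifs with h0
      · positivity
      have hi : i ≠ 0 := by
        rintro rfl; exact h0 (by ext j; fin_cases j <;> rfl)
      rw [← mul_inv, ← mul_pow]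
      have hi' : 0 < |(i:ℝ)| := abs_pos.2 (by exact_mod_cast hi)
      apply inv_anti₀ (by positivity)
      have h1 := norm_le_pi_norm (![P * ((i : ℝ) + ((r : ℕ) + c) * ((0:ℤ) : ℝ) / k), Q * ((0:ℤ) : ℝ)] : Fin 2 → ℝ) 0
      have h2 : ‖(![P * ((i : ℝ) + ((r : ℕ) + c) * ((0:ℤ) : ℝ) / k), Q * ((0:ℤ) : ℝ)] : Fin 2 → ℝ) 0‖ = P * |(i:ℝ)| := by
        simp [abs_of_pos hP]
      rw [h2] at h1
      calc (P * |(i:ℝ)|) ^ 4 ≤ (1 + P * |(i:ℝ)|) ^ 4 := by gcongr; linarith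
        _ ≤ (1 + P * |(i:ℝ)|) ^ 6 := pow_le_pow_right₀ (by nlinarith) (by norm_num)
        _ ≤ _ := by gcongr
    · rw [if_neg hh, zero_add]
      have hpt : ∀ y : Fin k × ℤ, g h y ≤
          ofReal (((Q * |(h : ℝ)|) ^ 3)⁻¹) *
            (fun N : ℤ => ofReal ((1 + ρ * |N + c * h|) ^ 2)⁻¹) (y.2 * k + h * (y.1 : ℕ)) := by
        rintro ⟨r, i⟩
        beta_reduce
        rw [← ENNReal.ofReal_mul (by positivity)]
        apply ENNReal.ofReal_le_ofReal
        split_ifs with h0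
        · positivity
        rw [← mul_inv]
        apply inv_anti₀ (by positivity)
        set v := (![P * ((i : ℝ) + ((r : ℕ) + c) * (h : ℝ) / k), Q * (h : ℝ)] : Fin 2 → ℝ)
        have h1 := norm_le_pi_norm v 0
        have h2 := norm_le_pi_norm v 1
        have h3 : ‖v 0‖ = ρ * |((i * k + h * (r : ℕ) : ℤ) : ℝ) + c * h| := by
          have : v 0 = ρ * (((i * k + h * (r : ℕ) : ℤ) : ℝ) + c * h) := by
            simp only [v, hρ, Matrix.cons_val_zero]; push_cast; field_simp; ring
          rw [this, norm_mul, norm_eq_abs, norm_eq_abs, abs_of_pos hρ0]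
        have h4 : ‖v 1‖ = Q * |(h:ℝ)| := by
          simp [v, abs_of_pos hQ]
        rw [h3] at h1
        rw [h4] at h2
        calc (Q * |(h:ℝ)|) ^ 3 * (1 + ρ * |((i * k + h * (r : ℕ) : ℤ) : ℝ) + c * h|) ^ 2 ≤
              (1 + ‖v‖) ^ 3 * (1 + ‖v‖) ^ 2 := by gcongr; linarith
          _ = (1 + ‖v‖) ^ 5 := by ring
          _ ≤ (1 + ‖v‖) ^ 6 := pow_le_pow_right₀ (by linarith [norm_nonneg v]) (by norm_num)
      refine (ENNReal.tsum_le_tsum hpt).trans ?_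
      rw [ENNReal.tsum_mul_left]
      refine (mul_le_mul' le_rfl (tsum_arith_le k h hh (fun N : ℤ => ofReal ((1 + ρ * |N + c * h|) ^ 2)⁻¹))).trans ?_
      refine (mul_le_mul' le_rfl (mul_le_mul' le_rfl (tsum_shift_inv_sq_le hρ0 _))).trans ?_
      rw [← ENNReal.ofReal_natCast, ← ENNReal.ofReal_mul (by positivity), ← ENNReal.ofReal_mul (by positivity)]
      apply ENNReal.ofReal_le_ofReal
      rw [Nat.cast_natAbs, Int.cast_abs]
      apply le_of_eq
      field_simp
  refine (ENNReal.tsum_le_tsum hb).trans ?_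
  rw [ENNReal.tsum_add, tsum_ite_eq, ← ENNReal.ofReal_tsum_of_nonneg (fun _ => by positivity) (hs2.mul_right _), tsum_mul_right,
    ← ENNReal.ofReal_add (by positivity) (by positivity)]
  apply ENNReal.ofReal_le_ofReal
  change _ * S4 + S2 * _ ≤ _
  have h5 : 4 / ρ = 4 * (k / P) := by rw [hρ]; field_simp
  rw [h5]
  have h6 : 0 ≤ (Q ^ 3)⁻¹ := by positivity
  have h7 : 0 ≤ (k:ℝ) / P := by positivity
  have h8 : 0 ≤ k * (P ^ 4)⁻¹ := by positivity
  nlinarith [mul_nonneg h20 h8, mul_nonneg h40 (mul_nonneg h6 h7), mul_nonneg h40 h6, mul_nonneg h20 h6]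

/-- The number of ideal data with prescribed elementary divisors. -/
def rho (c a b : ℤ) (k l : ℕ) : ℕ :=
  ∑ x : Fin k × Fin l × Fin l, if CubicCond c a b k l (x.1 : ℕ) (x.2.1 : ℕ) (x.2.2 : ℕ) then 1 else 0

/-- Depressed and rescaled coefficients. -/
def cpt (c : ℤ) (T : ℝ) (a b : ℤ) : Fin 2 → ℝ :=
  ![(a - (c:ℝ) ^ 2 / 3) / T ^ 2, (b - a * (c:ℝ) / 3 + 2 * (c:ℝ) ^ 3 / 27) / T ^ 3]

lemma exists_cubicCond_class (c a₀ b₀ : ℤ) {q k l : ℕ} (hq : 0 < q) (hkl : (k * l).Coprime q) (r t w : ℕ) :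
    ∃ u v : ℤ, ∀ u' v' : ℤ, CubicCond c (a₀ + q * u') (b₀ + q * v') k l r t w ↔
      ∃ x y : ℤ, u' = u + l * x ∧ v' = v - l * r * x + l * k * y := by
  have hl : IsCoprime (l : ℤ) (q : ℤ) := Nat.isCoprime_iff_coprime.2 (Nat.Coprime.coprime_mul_left hkl)
  have hlk : IsCoprime ((l : ℤ) * k) (q : ℤ) := by
    rw [mul_comm]; exact_mod_cast Nat.isCoprime_iff_coprime.2 hkl
  obtain ⟨x₁, y₁, h₁⟩ := hl
  obtain ⟨x₂, y₂, h₂⟩ := hlk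
  set α : ℤ := (-c - t - r) * t + (-c - t - r) * r + t * r + k * w with hα
  set β : ℤ := -((-c - t - r) * t * r) - k * w * (-c - t - r) - l * (x₁ * (a₀ - α)) * r with hβ
  refine ⟨-(y₁ * (a₀ - α)), -(y₂ * (b₀ - β)), fun u' v' => ?_⟩
  have ea : α + l * (x₁ * (a₀ - α)) = a₀ + q * (-(y₁ * (a₀ - α))) := by linear_combination (a₀ - α) * h₁
  have eb : β + l * k * (x₂ * (b₀ - β)) = b₀ + q * (-(y₂ * (b₀ - β))) := by linear_combination (b₀ - β) * h₂
  constructor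
  · rintro ⟨U, V, h3, h4⟩
    have h5 : (q : ℤ) * (u' - -(y₁ * (a₀ - α))) = l * (U - x₁ * (a₀ - α)) := by
      rw [← hα] at h3; linear_combination h3 + ea
    have hcl : IsCoprime (l : ℤ) (q : ℤ) := ⟨x₁, y₁, h₁⟩
    obtain ⟨x, hx⟩ := hcl.dvd_of_dvd_mul_left ⟨_, h5⟩
    have hU : U - x₁ * (a₀ - α) = q * x ∨ (l : ℤ) = 0 := by
      rw [hx] at h5
      by_cases h0 : (l : ℤ) = 0
      · exact Or.inr h0
      · left; apply mul_left_cancel₀ h0; linear_combination -h5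
    have hlU : (l : ℤ) * (U - x₁ * (a₀ - α)) = l * (q * x) := by
      rcases hU with h | h <;> rw [h]; simp
    have h6 : (q : ℤ) * (v' - -(y₂ * (b₀ - β)) + l * r * x) = l * k * (V - x₂ * (b₀ - β)) := by
      linear_combination h4 + eb - r * hlU - hβ
    have hcl2 : IsCoprime ((l : ℤ) * k) (q : ℤ) := ⟨x₂, y₂, h₂⟩
    obtain ⟨y, hy⟩ := hcl2.dvd_of_dvd_mul_left ⟨_, h6⟩
    exact ⟨x, y, by linear_combination hx, by linear_combination hy⟩
  · rintro ⟨x, y, rfl, rfl⟩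
    refine ⟨x₁ * (a₀ - α) + q * x, x₂ * (b₀ - β) + q * y, ?_, ?_⟩
    · rw [← hα]; linear_combination -ea
    · linear_combination -eb + hβ

lemma finite_cpt_le (c a₀ b₀ : ℤ) {q : ℕ} (hq : 0 < q) {T : ℝ} (hT : 0 < T) (R : ℝ) :
    {j : ℤ × ℤ | ‖cpt c T (a₀ + q * j.1) (b₀ + q * j.2)‖ ≤ R}.Finite := by
  have key : ∀ (α : ℤ) (M : ℝ), {u : ℤ | |((α + q * u : ℤ) : ℝ)| ≤ M}.Finite := fun α M => by
    refine (Set.finite_Icc (-(|α| + ⌈M⌉)) (|α| + ⌈M⌉)).subset fun u hu => ?_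
    rw [Set.mem_ofPred_eq] at hu
    have h1 : |α + q * u| ≤ ⌈M⌉ := by
      have : ((|α + q * u| : ℤ) : ℝ) ≤ ⌈M⌉ := by
        rw [Int.cast_abs]; exact hu.trans (Int.le_ceil M)
      exact_mod_cast this
    have h2 : |u| ≤ |(q:ℤ) * u| := by
      rw [abs_mul]
      have : (1:ℤ) ≤ |(q:ℤ)| := by rw [Nat.abs_cast]; exact_mod_cast hq
      nlinarith [abs_nonneg u]
    have h3 : |(q:ℤ) * u| ≤ |α + q * u| + |α| := by
      have := abs_sub (α + q * u) α
      simpa using this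
    rw [Set.mem_Icc, ← abs_le]
    omega
  have hfin := (key a₀ (T ^ 2 * R + (c:ℝ) ^ 2 / 3)).prod (key b₀ (T ^ 3 * R + (T ^ 2 * R + (c:ℝ) ^ 2 / 3) * |(c:ℝ)| / 3 + |2 * (c:ℝ) ^ 3 / 27|))
  refine hfin.subset fun j hj => ?_
  rw [Set.mem_ofPred_eq] at hj
  have h0 := (norm_le_pi_norm _ 0).trans hj
  have h1 := (norm_le_pi_norm _ 1).trans hj
  simp only [cpt, Matrix.cons_val_zero, Matrix.cons_val_one, norm_div, norm_eq_abs, abs_pow, abs_of_pos hT] at h0 h1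
  rw [div_le_iff₀ (by positivity)] at h0 h1
  set A : ℝ := ((a₀ + q * j.1 : ℤ) : ℝ)
  set B : ℝ := ((b₀ + q * j.2 : ℤ) : ℝ)
  have hA : |A| ≤ T ^ 2 * R + (c:ℝ) ^ 2 / 3 := by
    have := abs_sub_abs_le_abs_sub A ((c:ℝ) ^ 2 / 3)
    rw [abs_of_nonneg (show 0 ≤ (c:ℝ) ^ 2 / 3 by positivity)] at this
    linarith
  refine ⟨hA, ?_⟩
  have h2 : |B| ≤ |B - A * c / 3 + 2 * (c:ℝ) ^ 3 / 27| + |A * c / 3| + |2 * (c:ℝ) ^ 3 / 27| := by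
    have e : B = (B - A * c / 3 + 2 * (c:ℝ) ^ 3 / 27) + A * c / 3 - 2 * (c:ℝ) ^ 3 / 27 := by ring
    calc |B| = |(B - A * c / 3 + 2 * (c:ℝ) ^ 3 / 27) + A * c / 3 - 2 * (c:ℝ) ^ 3 / 27| := by rw [← e]
      _ ≤ |(B - A * c / 3 + 2 * (c:ℝ) ^ 3 / 27) + A * c / 3| + |2 * (c:ℝ) ^ 3 / 27| := abs_sub _ _
      _ ≤ _ := by gcongr; exact abs_add_le _ _
  have h3 : |A * c / 3| ≤ (T ^ 2 * R + (c:ℝ) ^ 2 / 3) * |(c:ℝ)| / 3 := by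
    rw [abs_div, abs_mul, abs_of_pos (show (0:ℝ) < 3 by norm_num)]
    gcongr
  change |B| ≤ _
  linarith

/-- The rescaled lattice of solutions. -/
def cmat (c : ℤ) (T : ℝ) (q k l r : ℕ) : Matrix (Fin 2) (Fin 2) ℝ :=
  !![l * q / T ^ 2, 0; -(r + (c:ℝ) / 3) * (l * q) / T ^ 3, l * k * q / T ^ 3]

lemma det_cmat (c : ℤ) (T : ℝ) (q k l r : ℕ) : (cmat c T q k l r).det = l ^ 2 * k * q ^ 2 / T ^ 5 := by
  rw [cmat, Matrix.det_fin_two_of]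
  by_cases hT : T = 0
  · simp [hT]
  · field_simp; ring

lemma cmat_transpose_mulVec (c : ℤ) {T : ℝ} {q k l : ℕ} (r : ℕ) (hT : 0 < T) (hq : 0 < q) (hk : 0 < k) (hl : 0 < l)
    (m : Fin 2 → ℤ) : (cmat c T q k l r)ᵀ *ᵥ
      ![T ^ 2 / (l * q) * (m 0 + (r + (c:ℝ) / 3) * m 1 / k), T ^ 3 / (l * k * q) * m 1] = intVec m := by
  have : (0:ℝ) < q := by exact_mod_cast hq
  have : (0:ℝ) < k := by exact_mod_cast hk
  have : (0:ℝ) < l := by exact_mod_cast hl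
  ext i
  fin_cases i
  · simp [cmat, Matrix.mulVec, dotProduct, intVec]; field_simp; ring
  · simp [cmat, Matrix.mulVec, dotProduct, intVec]; field_simp

lemma sum_cubicCond (c a₀ b₀ : ℤ) {q k l : ℕ} (hq : 0 < q) (hk : 0 < k) (hl : 0 < l) (hkl : (k * l).Coprime q) (r t w : ℕ)
    {T : ℝ} (hT : 0 < T) : ∃ s : Fin 2 → ℝ, ∀ H : (Fin 2 → ℝ) → ℝ,
    ∑' j : ℤ × ℤ, (if CubicCond c (a₀ + q * j.1) (b₀ + q * j.2) k l r t w then H (cpt c T (a₀ + q * j.1) (b₀ + q * j.2)) else 0) =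
      ∑' n : Fin 2 → ℤ, H (cmat c T q k l r *ᵥ intVec n + s) := by
  obtain ⟨u, v, huv⟩ := exists_cubicCond_class c a₀ b₀ hq hkl r t w
  refine ⟨cpt c T (a₀ + q * u) (b₀ + q * v), fun H => ?_⟩
  let φ : (Fin 2 → ℤ) → ℤ × ℤ := fun n => (u + l * n 0, v - l * r * n 0 + l * k * n 1)
  have hl' : (l : ℤ) ≠ 0 := by exact_mod_cast hl.ne'
  have hk' : (k : ℤ) ≠ 0 := by exact_mod_cast hk.ne'
  have hφ : Injective φ := by
    intro n n' h
    simp only [φ, Prod.mk.injEq] at h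
    obtain ⟨h1, h2⟩ := h
    have h3 : n 0 = n' 0 := mul_left_cancel₀ hl' (by linarith)
    rw [h3] at h2
    have h4 : n 1 = n' 1 := mul_left_cancel₀ (mul_ne_zero hl' hk') (by linarith)
    ext i; fin_cases i <;> assumption
  rw [← hφ.tsum_eq]
  · refine tsum_congr fun n => ?_
    rw [if_pos ((huv _ _).2 ⟨n 0, n 1, rfl, rfl⟩)]
    congr 1
    ext i
    fin_cases i
    · simp [φ, cpt, cmat, dotProduct, intVec]; field_simp; ring
    · simp [φ, cpt, cmat, dotProduct, intVec]; field_simp; ring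
  · intro j hj
    rw [Function.mem_support] at hj
    have hc : CubicCond c (a₀ + q * j.1) (b₀ + q * j.2) k l r t w := by
      by_contra h; rw [if_neg h] at hj; exact hj rfl
    obtain ⟨x, y, hx, hy⟩ := (huv _ _).1 hc
    exact ⟨![x, y], Prod.ext (by simp [φ, hx]) (by simp [φ, hy])⟩

lemma exists_class_sum_error : ∃ C₀ : ℝ, 0 ≤ C₀ ∧ ∀ (c a₀ b₀ : ℤ) (q k l : ℕ), 0 < q → 0 < k → 0 < l → (k * l).Coprime q →
    ∀ T : ℝ, 0 < T → ∀ (H : (Fin 2 → ℝ) → ℝ), Continuous H → HasCompactSupport H → ∀ C : ℝ,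
    (∀ x, ‖FT H x‖ ≤ C * ((1 + ‖x‖) ^ 6)⁻¹) →
    |∑' j : ℤ × ℤ, rho c (a₀ + q * j.1) (b₀ + q * j.2) k l * H (cpt c T (a₀ + q * j.1) (b₀ + q * j.2)) - T ^ 5 / q ^ 2 * ∫ x, H x| ≤
      T ^ 5 / (k * q ^ 2) * (C * (C₀ * (k * ((T ^ 2 / (l * q)) ^ 4)⁻¹ + (1 + k / (T ^ 2 / (l * q))) * ((T ^ 3 / (l * k * q)) ^ 3)⁻¹))) := by
  obtain ⟨C₀, hC₀, hb⟩ := exists_dual_sum_le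
  refine ⟨C₀, hC₀, fun c a₀ b₀ q k l hq hk hl hkl T hT H hc hs C hC => ?_⟩
  have hC0 : 0 ≤ C := by simpa using (norm_nonneg _).trans (hC 0)
  obtain ⟨R, hR⟩ := hs.isCompact.isBounded.exists_norm_le
  have hfin := finite_cpt_le c a₀ b₀ hq hT R
  have hzero : ∀ j ∉ hfin.toFinset, H (cpt c T (a₀ + q * j.1) (b₀ + q * j.2)) = 0 := fun j hj => by
    by_contra h
    exact hj (hfin.mem_toFinset.2 (hR _ (subset_tsupport _ h)))
  set F : ℕ → ℕ → ℕ → ℤ × ℤ → ℝ := fun r t w j =>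
    if CubicCond c (a₀ + q * j.1) (b₀ + q * j.2) k l r t w then H (cpt c T (a₀ + q * j.1) (b₀ + q * j.2)) else 0
  have hFs : ∀ r t w, Summable (F r t w) := fun r t w =>
    summable_of_ne_finset_zero (s := hfin.toFinset) fun j hj => by simp only [F, hzero j hj, ite_self]
  have e1 : ∑' j : ℤ × ℤ, rho c (a₀ + q * j.1) (b₀ + q * j.2) k l * H (cpt c T (a₀ + q * j.1) (b₀ + q * j.2)) =
      ∑ x : Fin k × Fin l × Fin l, ∑' j, F x.1 x.2.1 x.2.2 j := by
    rw [← Summable.tsum_finsetSum fun x _ => hFs _ _ _]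
    refine tsum_congr fun j => ?_
    rw [rho, Nat.cast_sum, Finset.sum_mul]
    refine sum_congr rfl fun x _ => ?_
    simp only [F]; split_ifs <;> simp
  have hdet : ∀ r, |(cmat c T q k l r).det|⁻¹ = T ^ 5 / (l ^ 2 * k * q ^ 2) := fun r => by
    rw [det_cmat, abs_of_pos (by positivity), inv_div]
  have e2 : T ^ 5 / q ^ 2 * ∫ x, H x = ∑ x : Fin k × Fin l × Fin l, T ^ 5 / (l ^ 2 * k * q ^ 2) * ∫ x, H x := by
    rw [Finset.sum_const, Finset.card_univ, Fintype.card_prod, Fintype.card_prod, Fintype.card_fin, Fintype.card_fin, nsmul_eq_mul]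
    push_cast; field_simp
  set ξ : ℕ → (Fin 2 → ℤ) → (Fin 2 → ℝ) := fun r m =>
    ![T ^ 2 / (l * q) * (m 0 + (r + (c:ℝ) / 3) * m 1 / k), T ^ 3 / (l * k * q) * m 1]
  set G : ℕ → (Fin 2 → ℤ) → ℝ := fun r m => if m = 0 then 0 else ((1 + ‖ξ r m‖) ^ 6)⁻¹
  have hG0 : ∀ r m, 0 ≤ G r m := fun r m => by simp only [G]; split_ifs <;> positivity
  have hGs : ∀ r, Summable (G r) := fun r =>
    (summable_dual_lattice (k := 6) (B := cmat c T q k l r) (cmat_transpose_mulVec c r hT hq hk hl) (by simp)).of_nonneg_of_le (hG0 r)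
      fun m => by simp only [G]; split_ifs <;> first | positivity | rfl
  have hterm : ∀ x : Fin k × Fin l × Fin l, |∑' j, F x.1 x.2.1 x.2.2 j - T ^ 5 / (l ^ 2 * k * q ^ 2) * ∫ x, H x| ≤
      T ^ 5 / (l ^ 2 * k * q ^ 2) * (C * ∑' m, G x.1 m) := fun x => by
    obtain ⟨s, hs'⟩ := sum_cubicCond c a₀ b₀ hq hk hl hkl x.1 x.2.1 x.2.2 hT
    simp only [F, hs', ← hdet x.1]
    exact lattice_sum_error (by rw [det_cmat]; positivity) (cmat_transpose_mulVec c x.1 hT hq hk hl) s (by simp) hc hs hC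
  have hsum : ∑ r : Fin k, ∑' m, G r m ≤ C₀ * (k * ((T ^ 2 / (l * q)) ^ 4)⁻¹ + (1 + k / (T ^ 2 / (l * q))) * ((T ^ 3 / (l * k * q)) ^ 3)⁻¹) := by
    rw [← ENNReal.ofReal_le_ofReal_iff (by positivity), ENNReal.ofReal_sum_of_nonneg fun _ _ => tsum_nonneg (hG0 _)]
    refine le_trans (le_of_eq ?_) (hb k ((c:ℝ) / 3) (T ^ 2 / (l * q)) (T ^ 3 / (l * k * q)) (by positivity) (by positivity))
    rw [ENNReal.tsum_prod', tsum_fintype]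
    refine sum_congr rfl fun r _ => ?_
    rw [ENNReal.ofReal_tsum_of_nonneg (hG0 _) (hGs _)]
  rw [e1, e2, ← Finset.sum_sub_distrib]
  refine (Finset.abs_sum_le_sum_abs _ _).trans ((Finset.sum_le_sum fun x _ => hterm x).trans ?_)
  rw [Fintype.sum_prod_type]
  simp only [Finset.sum_const, Finset.card_univ, Fintype.card_prod, Fintype.card_fin, nsmul_eq_mul]
  rw [← mul_sum, ← mul_sum, ← mul_sum]
  calc _ = T ^ 5 / (k * q ^ 2) * (C * ∑ r : Fin k, ∑' m, G r m) := by push_cast; field_simp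
    _ ≤ _ := by gcongr

open scoped ContDiff

section
variable {d : Type*} [Fintype d]

/-- The dot product as a continuous bilinear form. -/
def dotL (d : Type*) [Fintype d] : (d → ℝ) →L[ℝ] (d → ℝ) →L[ℝ] ℝ :=
  ∑ i : d, (ContinuousLinearMap.mul ℝ ℝ).bilinearComp (ContinuousLinearMap.proj (R := ℝ) (φ := fun _ : d => ℝ) i) (ContinuousLinearMap.proj (R := ℝ) (φ := fun _ : d => ℝ) i)

lemma dotL_apply (x y : d → ℝ) : dotL d x y = y ⬝ᵥ x := by
  simp [dotL, dotProduct, mul_comm]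

lemma norm_FT_mul_le [Nonempty d] {f : (d → ℝ) → ℝ} (hf : ContDiff ℝ ∞ f) (hs : HasCompactSupport f) {n : ℕ} {M : ℝ}
    (hM : ∀ j ≤ n, ∫ x, ‖iteratedFDeriv ℝ j (fun x => (f x : ℂ)) x‖ ≤ M) (ξ : d → ℝ) :
    ‖ξ‖ ^ n * ‖FT f ξ‖ ≤ 2 ^ n * ((n + 1) * M) := by
  set g : (d → ℝ) → ℂ := fun x => (f x : ℂ)
  have hg1 : ContDiff ℝ ∞ g := Complex.ofRealCLM.contDiff.comp hf
  have hgs : HasCompactSupport g := hs.comp_left (g := fun x : ℝ => (x : ℂ)) (by simp)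
  have hI : ∀ k j : ℕ, Integrable fun v => ‖v‖ ^ k * ‖iteratedFDeriv ℝ j g v‖ := fun k j => by
    have hc : Continuous (iteratedFDeriv ℝ j g) := hg1.continuous_iteratedFDeriv (by exact_mod_cast le_top)
    exact Continuous.integrable_of_hasCompactSupport (by fun_prop) ((hgs.iteratedFDeriv j).norm.mul_left)
  have hFT : VectorFourier.fourierIntegral Real.fourierChar volume (dotL d).toLinearMap₁₂ g = FT f := by
    ext ξ
    rw [VectorFourier.fourierIntegral, FT]
    refine integral_congr_ae (ae_of_all _ fun x => ?_)
    beta_reduce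
    rw [Circle.smul_def, Real.fourierChar_apply, smul_eq_mul]
    congr 2
    have : (dotL d).toLinearMap₁₂ x ξ = ξ ⬝ᵥ x := dotL_apply x ξ
    rw [this]; push_cast; ring
  obtain ⟨i, hi⟩ : ∃ i, ‖ξ‖ = |ξ i| := by
    obtain ⟨i, hi⟩ := Finite.exists_max fun i => ‖ξ i‖
    exact ⟨i, le_antisymm ((pi_norm_le_iff_of_nonneg (norm_nonneg _)).2 hi) (norm_le_pi_norm ξ i)⟩
  have h := VectorFourier.pow_mul_norm_iteratedFDeriv_fourierIntegral_le (dotL d) (μ := volume) (K := 0) (N := ⊤) hg1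
    (fun k j _ _ => hI k j) (k := 0) (n := n) le_rfl le_top (Pi.single i 1) ξ
  rw [norm_iteratedFDeriv_zero, hFT, dotL_apply, dotProduct_single, mul_one, ← hi] at h
  refine h.trans ?_
  rw [Pi.norm_single]
  simp only [norm_one, one_pow, pow_zero, one_mul, mul_one, Nat.cast_zero, mul_zero, zero_add, Finset.range_one]
  gcongr
  rw [Finset.sum_product]
  simp only [Finset.sum_singleton, pow_zero, one_mul]
  refine (Finset.sum_le_card_nsmul _ _ M fun j hj => hM j (by simpa [Nat.lt_succ_iff] using hj)).trans ?_
  simp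

lemma norm_iteratedFDeriv_slice_le {F : ℝ × (d → ℝ) → ℂ} (hF : ContDiff ℝ ∞ F) (w : ℝ) (x : d → ℝ) (j : ℕ) :
    ‖iteratedFDeriv ℝ j (fun x => F (w, x)) x‖ ≤ ‖iteratedFDeriv ℝ j F (w, x)‖ := by
  have e : (fun x => F (w, x)) = (fun y => F (y + (w, 0))) ∘ (ContinuousLinearMap.inr ℝ ℝ (d → ℝ)) := by
    ext x; simp
  have hF' : ContDiff ℝ ∞ fun y => F (y + (w, 0)) := hF.comp (contDiff_id.add contDiff_const)
  rw [e, ContinuousLinearMap.iteratedFDeriv_comp_right (n := ∞) _ hF' x (by exact_mod_cast le_top),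
    iteratedFDeriv_comp_add_right]
  refine (ContinuousMultilinearMap.norm_compContinuousLinearMap_le _ _).trans ?_
  rw [Finset.prod_const]
  have h1 : ‖ContinuousLinearMap.inr ℝ ℝ (d → ℝ)‖ ≤ 1 :=
    ContinuousLinearMap.opNorm_le_bound _ zero_le_one fun y => by simp [Prod.norm_def]
  refine (mul_le_of_le_one_right (norm_nonneg _) (pow_le_one₀ (norm_nonneg _) h1)).trans (le_of_eq ?_)
  simp

lemma exists_FT_decay [Nonempty d] {F : ℝ × (d → ℝ) → ℝ} (hF : ContDiff ℝ ∞ F) {K : Set (d → ℝ)} (hK : IsCompact K)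
    (hsupp : ∀ w, ∀ x ∉ K, F (w, x) = 0) {W : Set ℝ} (hW : IsCompact W) (n : ℕ) :
    ∃ C, 0 ≤ C ∧ ∀ w ∈ W, ∀ ξ, ‖FT (fun x => F (w, x)) ξ‖ ≤ C * ((1 + ‖ξ‖) ^ n)⁻¹ := by
  have hFc : ContDiff ℝ ∞ (fun y => (F y : ℂ)) := Complex.ofRealCLM.contDiff.comp hF
  have hb : ∀ j : ℕ, ∃ M, 0 ≤ M ∧ ∀ w ∈ W, ∀ x ∈ K, ‖iteratedFDeriv ℝ j (fun y => (F y : ℂ)) (w, x)‖ ≤ M := fun j => by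
    have hc : Continuous (iteratedFDeriv ℝ j (fun y => (F y : ℂ))) := hFc.continuous_iteratedFDeriv (by exact_mod_cast le_top)
    obtain ⟨M, hM⟩ := (hW.prod hK).exists_bound_of_continuousOn hc.continuousOn
    exact ⟨max M 0, le_max_right _ _, fun w hw x hx => (hM _ ⟨hw, hx⟩).trans (le_max_left _ _)⟩
  choose M hM0 hM using hb
  have hint : ∀ w ∈ W, ∀ j, ∫ x, ‖iteratedFDeriv ℝ j (fun x => (F (w, x) : ℂ)) x‖ ≤ M j * volume.real K := fun w hw j => by
    have hz : ∀ x ∉ K, iteratedFDeriv ℝ j (fun x => (F (w, x) : ℂ)) x = 0 := fun x hx => by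
      by_contra h
      have h1 := support_iteratedFDeriv_subset j (Function.mem_support.2 h)
      refine hx (closure_minimal (fun y hy => ?_) hK.isClosed h1)
      by_contra hyK
      rw [Function.mem_support, hsupp w y hyK] at hy
      exact hy rfl
    rw [← setIntegral_eq_integral_of_forall_compl_eq_zero (s := K) fun x hx => by rw [hz x hx, norm_zero]]
    refine (Real.le_norm_self _).trans (norm_setIntegral_le_of_norm_le_const hK.measure_lt_top fun x hx => ?_)
    rw [norm_norm]
    exact (norm_iteratedFDeriv_slice_le hFc w x j).trans (hM j w hw x hx)
  set A := ∑ j ∈ Finset.range (n + 1), M j * volume.real K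
  have hA0 : ∀ j ≤ n, M j * volume.real K ≤ A := fun j hj =>
    Finset.single_le_sum (f := fun j => M j * volume.real K) (fun j _ => mul_nonneg (hM0 j) measureReal_nonneg) (Finset.mem_range.2 (by omega))
  have hAn : 0 ≤ A := Finset.sum_nonneg fun j _ => mul_nonneg (hM0 j) measureReal_nonneg
  refine ⟨2 ^ n * (2 ^ 0 * ((0 + 1) * A) + 2 ^ n * ((n + 1) * A)), by positivity, fun w hw ξ => ?_⟩
  have hs : HasCompactSupport fun x => F (w, x) := HasCompactSupport.intro hK fun x hx => hsupp w x hx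
  have hf : ContDiff ℝ ∞ fun x => F (w, x) := hF.comp (contDiff_const.prodMk contDiff_id)
  have h0 := norm_FT_mul_le hf hs (n := 0) (M := A) (fun j hj => (hint w hw j).trans (hA0 j (by omega))) ξ
  have hn := norm_FT_mul_le hf hs (n := n) (M := A) (fun j hj => (hint w hw j).trans (hA0 j hj)) ξ
  rw [← div_eq_mul_inv, le_div_iff₀ (by positivity)]
  have h2 : (1 + ‖ξ‖) ^ n ≤ 2 ^ n * (1 + ‖ξ‖ ^ n) := by
    rcases le_total ‖ξ‖ 1 with h | h
    · calc (1 + ‖ξ‖) ^ n ≤ 2 ^ n := by gcongr; linarith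
        _ ≤ _ := le_mul_of_one_le_right (by positivity) (by linarith [pow_nonneg (norm_nonneg ξ) n])
    · calc (1 + ‖ξ‖) ^ n ≤ (2 * ‖ξ‖) ^ n := by gcongr; linarith
        _ = 2 ^ n * ‖ξ‖ ^ n := mul_pow _ _ _
        _ ≤ _ := by gcongr; linarith
  rw [pow_zero, one_mul, Nat.cast_zero] at h0
  calc _ ≤ ‖FT (fun x => F (w, x)) ξ‖ * (2 ^ n * (1 + ‖ξ‖ ^ n)) := by gcongr
    _ = 2 ^ n * (‖FT (fun x => F (w, x)) ξ‖ + ‖ξ‖ ^ n * ‖FT (fun x => F (w, x)) ξ‖) := by ring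
    _ ≤ _ := by gcongr
end

/-- The discriminant of a depressed cubic. -/
def dzero (x : Fin 2 → ℝ) : ℝ := -4 * x 0 ^ 3 - 27 * x 1 ^ 2

lemma cubicDisc_eq_dzero (c a b : ℤ) {T : ℝ} (hT : 0 < T) :
    ((cubicDisc c a b : ℤ) : ℝ) = T ^ 6 * dzero (cpt c T a b) := by
  simp only [cubicDisc, dzero, cpt, Matrix.cons_val_zero, Matrix.cons_val_one]
  push_cast
  field_simp
  ring

/-- A smooth bump supported near a cubic with real roots (`e = 1`) or complex roots (`e = -1`). -/
def cbump (e : ℝ) : ContDiffBump (![-e, 0] : Fin 2 → ℝ) := ⟨1 / 16, 1 / 8, by norm_num, by norm_num⟩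

lemma dzero_bounds {e : ℝ} (he : e = 1 ∨ e = -1) {x : Fin 2 → ℝ} (hx : x ∈ Metric.closedBall (![-e, 0] : Fin 2 → ℝ) (1 / 8)) :
    1 ≤ e * dzero x ∧ e * dzero x ≤ 8 := by
  rw [Metric.mem_closedBall, dist_pi_le_iff (by norm_num)] at hx
  have h0 := hx 0
  have h1 := hx 1
  simp only [Matrix.cons_val_zero, Matrix.cons_val_one, Real.dist_eq] at h0 h1
  rw [abs_le] at h0 h1
  obtain ⟨h0l, h0r⟩ := h0
  obtain ⟨h1l, h1r⟩ := h1
  have h2 : x 1 ^ 2 ≤ 1 / 64 := by nlinarith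
  unfold dzero
  rcases he with rfl | rfl
  · have h4 : (7 / 8 : ℝ) ^ 3 ≤ (-x 0) ^ 3 := pow_le_pow_left₀ (by norm_num) (by linarith) 3
    have h5 : (-x 0) ^ 3 ≤ (9 / 8 : ℝ) ^ 3 := pow_le_pow_left₀ (by linarith) (by linarith) 3
    constructor <;> nlinarith
  · have h4 : (7 / 8 : ℝ) ^ 3 ≤ (x 0) ^ 3 := pow_le_pow_left₀ (by norm_num) (by linarith) 3
    have h5 : (x 0) ^ 3 ≤ (9 / 8 : ℝ) ^ 3 := pow_le_pow_left₀ (by linarith) (by linarith) 3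
    constructor <;> nlinarith

lemma log_dzero_bounds {e : ℝ} (he : e = 1 ∨ e = -1) {x : Fin 2 → ℝ} (hx : x ∈ Metric.closedBall (![-e, 0] : Fin 2 → ℝ) (1 / 8)) :
    dzero x ≠ 0 ∧ 0 ≤ log |dzero x| ∧ log |dzero x| ≤ 3 := by
  obtain ⟨h1, h2⟩ := dzero_bounds he hx
  have h3 : |dzero x| = e * dzero x := by
    rw [← abs_of_pos (lt_of_lt_of_le one_pos h1), abs_mul]
    rcases he with rfl | rfl <;> simp
  refine ⟨fun h => by rw [h, mul_zero] at h1; linarith, log_nonneg (h3 ▸ h1), ?_⟩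
  rw [h3, ← log_exp 3]
  refine Real.log_le_log (by linarith) (h2.trans ?_)
  have := Real.exp_one_gt_d9
  calc (8:ℝ) = 2 ^ 3 := by norm_num
    _ ≤ exp 1 ^ 3 := by gcongr; linarith
    _ = exp 3 := by rw [← exp_nat_mul]; norm_num

/-- The smoothly truncated bump. -/
def cfam (e : ℝ) (y : ℝ × (Fin 2 → ℝ)) : ℝ := cbump e y.2 * wt (y.1 + log |dzero y.2| / 2)

lemma cbump_eq_zero {e : ℝ} {x : Fin 2 → ℝ} (hx : x ∉ Metric.closedBall (![-e, 0] : Fin 2 → ℝ) (1 / 8)) : cbump e x = 0 := by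
  refine (cbump e).zero_of_le_dist ?_
  rw [Metric.mem_closedBall, not_le] at hx
  exact hx.le

lemma contDiff_cfam {e : ℝ} (he : e = 1 ∨ e = -1) : ContDiff ℝ ∞ (cfam e) := by
  rw [contDiff_iff_contDiffAt]
  intro y
  by_cases hy : y.2 ∈ Metric.closedBall (![-e, 0] : Fin 2 → ℝ) (1 / 8)
  · refine ContDiffAt.mul ((cbump e).contDiff.contDiffAt.comp y contDiffAt_snd) ?_
    refine (contDiff_wt (k := ⊤)).contDiffAt.comp y (contDiffAt_fst.add (ContDiffAt.div_const ?_ _))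
    simp only [Real.log_abs]
    refine ContDiffAt.log ?_ (log_dzero_bounds he hy).1
    unfold dzero
    fun_prop
  · have : cfam e =ᶠ[𝓝 y] fun _ => 0 := by
      have ho : IsOpen {z : ℝ × (Fin 2 → ℝ) | z.2 ∉ Metric.closedBall (![-e, 0] : Fin 2 → ℝ) (1 / 8)} :=
        Metric.isClosed_closedBall.isOpen_compl.preimage continuous_snd
      filter_upwards [ho.mem_nhds hy] with z hz
      rw [cfam, cbump_eq_zero hz, zero_mul]
    exact contDiffAt_const.congr_of_eventuallyEq this

lemma exists_FT_cfam {e : ℝ} (he : e = 1 ∨ e = -1) :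
    ∃ C, 0 ≤ C ∧ ∀ w ξ, ‖FT (fun x => cfam e (w, x)) ξ‖ ≤ C * ((1 + ‖ξ‖) ^ 6)⁻¹ := by
  obtain ⟨C, hC, h⟩ := exists_FT_decay (contDiff_cfam he) (isCompact_closedBall (![-e, 0] : Fin 2 → ℝ) (1 / 8))
    (fun w x hx => by rw [cfam, cbump_eq_zero hx, zero_mul]) (isCompact_Icc (a := (-2:ℝ)) (b := 2)) 6
  refine ⟨C, hC, fun w ξ => ?_⟩
  have key : ∃ w' ∈ Set.Icc (-2:ℝ) 2, (fun x => cfam e (w, x)) = fun x => cfam e (w', x) := by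
    rcases le_total w (-2) with h1 | h1
    · refine ⟨-2, by norm_num, funext fun x => ?_⟩
      by_cases hx : x ∈ Metric.closedBall (![-e, 0] : Fin 2 → ℝ) (1 / 8)
      · obtain ⟨-, h2, h3⟩ := log_dzero_bounds he hx
        simp only [cfam]
        rw [wt_zero (by linarith), wt_zero (by linarith)]
      · simp only [cfam, cbump_eq_zero hx, zero_mul]
    rcases le_total w 2 with h2 | h2
    · exact ⟨w, ⟨h1, h2⟩, rfl⟩
    · refine ⟨2, by norm_num, funext fun x => ?_⟩
      by_cases hx : x ∈ Metric.closedBall (![-e, 0] : Fin 2 → ℝ) (1 / 8)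
      · obtain ⟨-, h2, h3⟩ := log_dzero_bounds he hx
        simp only [cfam]
        rw [wt_one (by linarith), wt_one (by linarith)]
      · simp only [cfam, cbump_eq_zero hx, zero_mul]
  obtain ⟨w', hw', e⟩ := key
  rw [e]
  exact h w' hw' ξ

lemma cfam_eq_zero {e : ℝ} (he : e = 1 ∨ e = -1) {w : ℝ} (hw : w ≤ -2) (x : Fin 2 → ℝ) : cfam e (w, x) = 0 := by
  by_cases hx : x ∈ Metric.closedBall (![-e, 0] : Fin 2 → ℝ) (1 / 8)
  · obtain ⟨-, h2, h3⟩ := log_dzero_bounds he hx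
    simp only [cfam]
    rw [wt_zero (by linarith), mul_zero]
  · simp only [cfam, cbump_eq_zero hx, zero_mul]

lemma exp_shape_le {τ κ l u : ℝ} (hκ : 0 ≤ κ) (hl : 0 ≤ l) (hτ : 0 ≤ τ) (h : κ + 2 * l ≤ 2 + u + 3 * τ) :
    exp (-3 * τ + 3 * l - κ / 2) + (exp (-4 * τ + 3 / 2 * κ + 2 * l) + exp (-6 * τ + 5 / 2 * κ + 3 * l)) ≤
      3 * exp 8 * (exp (4.8 * τ) * (1 + exp (4 * u))) * (exp (-1.1 * κ) * exp (-1.1 * l)) := by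
  have hm : ∀ v, v ≤ 8 + 4 * max u 0 + 4.8 * τ + -1.1 * κ + -1.1 * l →
      exp v ≤ exp 8 * (exp (4.8 * τ) * (1 + exp (4 * u))) * (exp (-1.1 * κ) * exp (-1.1 * l)) := by
    intro v hv
    refine (exp_le_exp.mpr hv).trans ?_
    rw [exp_add, exp_add, exp_add, exp_add]
    have : exp (4 * max u 0) ≤ 1 + exp (4 * u) := by
      rcases le_total u 0 with h0 | h0
      · rw [max_eq_right h0]; simp [Real.exp_nonneg]
      · rw [max_eq_left h0]; linarith
    calc _ = exp 8 * (exp (4.8 * τ) * exp (4 * max u 0)) * (exp (-1.1 * κ) * exp (-1.1 * l)) := by ring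
      _ ≤ _ := by gcongr
  have hu : u ≤ max u 0 := le_max_left _ _
  have hu0 : 0 ≤ max u 0 := le_max_right _ _
  have h1 := hm (-3 * τ + 3 * l - κ / 2) (by linarith)
  have h2 := hm (-4 * τ + 3 / 2 * κ + 2 * l) (by linarith)
  have h3 := hm (-6 * τ + 5 / 2 * κ + 3 * l) (by linarith)
  linarith

lemma cbump_mul_wsTerm (e : ℝ) (n : ℕ) (u : ℝ) (x : Fin 2 → ℝ) :
    cbump e x * wsTerm n (u + log |dzero x| / 2) = (n : ℝ) ^ (-(1 / 2) : ℝ) * cfam e (u - log n, x) := by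
  rw [wsTerm, cfam]
  simp only
  rw [show u + log |dzero x| / 2 - log n = u - log n + log |dzero x| / 2 by ring]
  ring

lemma cbump_mul_disc {e : ℝ} (he : e = 1 ∨ e = -1) (c a b : ℤ) {T : ℝ} (hT : 0 < T) (u : ℝ) (F : ℝ → ℝ) :
    cbump e (cpt c T a b) * F (u + log |((cubicDisc c a b : ℤ) : ℝ)| / 2) =
      cbump e (cpt c T a b) * F (u + 3 * log T + log |dzero (cpt c T a b)| / 2) := by
  by_cases hx : cpt c T a b ∈ Metric.closedBall (![-e, 0] : Fin 2 → ℝ) (1 / 8)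
  · rw [cubicDisc_eq_dzero c a b hT, abs_mul, log_mul (by positivity) (abs_ne_zero.mpr (log_dzero_bounds he hx).1),
      abs_of_pos (by positivity), log_pow]
    congr 2
    push_cast
    ring
  · rw [cbump_eq_zero hx, zero_mul, zero_mul]

lemma exists_averaged_term_error (c a₀ b₀ : ℤ) {q : ℕ} (hq : 0 < q) {e : ℝ} (he : e = 1 ∨ e = -1) :
    ∃ C : ℝ, 0 ≤ C ∧ ∀ T : ℝ, 1 ≤ T → ∀ N k l : ℕ, 0 < N → 0 < k → 0 < l → (k * l).Coprime q → ∀ u : ℝ,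
    |∑' j : ℤ × ℤ, rho c (a₀ + q * j.1) (b₀ + q * j.2) k l * (cbump e (cpt c T (a₀ + q * j.1) (b₀ + q * j.2)) *
        wsTerm (N * k * l ^ 2) (u + log |((cubicDisc c (a₀ + q * j.1) (b₀ + q * j.2) : ℤ) : ℝ)| / 2))
      - T ^ 5 / q ^ 2 * ∫ x, cbump e x * wsTerm (N * k * l ^ 2) (u + 3 * log T + log |dzero x| / 2)| ≤
    C * (exp (4.8 * log T) * (1 + exp (4 * u))) *
      ((N : ℝ) ^ (-(1 / 2) : ℝ) * ((k : ℝ) ^ (-1.1 : ℝ) * (l : ℝ) ^ (-1.1 : ℝ))) := by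
  obtain ⟨C₀, hC₀, h⟩ := exists_class_sum_error
  obtain ⟨C, hC, hFT⟩ := exists_FT_cfam he
  refine ⟨C * C₀ * (q : ℝ) ^ 4 * (3 * exp 8), by positivity, fun T hT N k l hN hk hl hkl u => ?_⟩
  have hT0 : 0 < T := by linarith
  have hq1 : (1 : ℝ) ≤ q := by exact_mod_cast hq
  have hk1 : (1 : ℝ) ≤ k := by exact_mod_cast hk
  have hl1 : (1 : ℝ) ≤ l := by exact_mod_cast hl
  have hN1 : (1 : ℝ) ≤ N := by exact_mod_cast hN
  set w := u + 3 * log T - log (N * k * l ^ 2 : ℕ) with hw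
  set P : ℝ := ((N * k * l ^ 2 : ℕ) : ℝ) ^ (-(1 / 2) : ℝ) with hP
  have e1 : ∀ j : ℤ × ℤ, (rho c (a₀ + q * j.1) (b₀ + q * j.2) k l : ℝ) * (cbump e (cpt c T (a₀ + q * j.1) (b₀ + q * j.2)) *
        wsTerm (N * k * l ^ 2) (u + log |((cubicDisc c (a₀ + q * j.1) (b₀ + q * j.2) : ℤ) : ℝ)| / 2)) =
      P * (rho c (a₀ + q * j.1) (b₀ + q * j.2) k l * cfam e (w, cpt c T (a₀ + q * j.1) (b₀ + q * j.2))) := by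
    intro j
    rw [cbump_mul_disc he c _ _ hT0, cbump_mul_wsTerm e]
    ring
  simp_rw [e1, cbump_mul_wsTerm e]
  rw [tsum_mul_left, integral_const_mul, ← hw, ← hP, show T ^ 5 / (q : ℝ) ^ 2 * (P * ∫ x, cfam e (w, x)) =
    P * (T ^ 5 / (q : ℝ) ^ 2 * ∫ x, cfam e (w, x)) by ring, ← mul_sub, abs_mul]
  rcases le_or_gt w (-2) with hw2 | hw2
  · simp only [cfam_eq_zero he hw2, mul_zero, tsum_zero, integral_zero, sub_zero, abs_zero]
    positivity
  have hP0 : 0 < P := Real.rpow_pos_of_pos (by positivity) _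
  have hcont : Continuous fun x => cfam e (w, x) := by
    exact (contDiff_cfam he).continuous.comp (by fun_prop)
  have hsup : HasCompactSupport fun x => cfam e (w, x) :=
    HasCompactSupport.intro (isCompact_closedBall (![-e, 0] : Fin 2 → ℝ) (1 / 8))
      (fun x hx => by rw [cfam, cbump_eq_zero hx, zero_mul])
  have h1 := h c a₀ b₀ q k l hq hk hl hkl T hT0 _ hcont hsup C (hFT w)
  rw [abs_of_pos hP0]
  refine (mul_le_mul_of_nonneg_left h1 hP0.le).trans ?_
  set τ := log T
  set κ := log k
  set lm := log l
  have hT' : T = exp τ := (exp_log hT0).symm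
  have hk' : (k : ℝ) = exp κ := (exp_log (by linarith)).symm
  have hl' : (l : ℝ) = exp lm := (exp_log (by linarith)).symm
  have hτ0 : 0 ≤ τ := log_nonneg hT
  have hκ0 : 0 ≤ κ := log_nonneg hk1
  have hlm0 : 0 ≤ lm := log_nonneg hl1
  have hlogn : log (N * k * l ^ 2 : ℕ) = log N + κ + 2 * lm := by
    push_cast
    rw [log_mul (by positivity) (by positivity), log_mul (by positivity) (by positivity), log_pow]
    push_cast
    rfl
  have hc : κ + 2 * lm ≤ 2 + u + 3 * τ := by
    have := log_nonneg hN1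
    rw [hw, hlogn] at hw2
    linarith
  have hshape := exp_shape_le hκ0 hlm0 hτ0 hc
  have hPe : P = (N : ℝ) ^ (-(1 / 2) : ℝ) * exp (-κ / 2 - lm) := by
    rw [hP]
    push_cast
    rw [mul_rpow (by positivity) (by positivity), mul_rpow (by positivity) (by positivity), mul_assoc, hk', hl',
      ← exp_mul, ← exp_nat_mul, ← exp_mul, ← exp_add]
    congr 2
    push_cast
    ring
  have hk11 : (k : ℝ) ^ (-1.1 : ℝ) = exp (-1.1 * κ) := by rw [hk', ← exp_mul]; ring_nf
  have hl11 : (l : ℝ) ^ (-1.1 : ℝ) = exp (-1.1 * lm) := by rw [hl', ← exp_mul]; ring_nf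
  rw [hk11, hl11]
  have hmain : exp (-κ / 2 - lm) * (T ^ 5 / (k * q ^ 2) * (k * ((T ^ 2 / (l * q)) ^ 4)⁻¹ +
      (1 + k / (T ^ 2 / (l * q))) * ((T ^ 3 / (l * k * q)) ^ 3)⁻¹)) ≤ (q : ℝ) ^ 4 *
      (exp (-3 * τ + 3 * lm - κ / 2) + (exp (-4 * τ + 3 / 2 * κ + 2 * lm) + exp (-6 * τ + 5 / 2 * κ + 3 * lm))) := by
    have t1 : exp (-3 * τ + 3 * lm - κ / 2) = exp (-κ / 2 - lm) * ((l : ℝ) ^ 4 / T ^ 3) := by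
      rw [hT', hl', ← exp_nat_mul, ← exp_nat_mul, ← exp_sub, ← exp_add]; congr 1; push_cast; ring
    have t2 : exp (-4 * τ + 3 / 2 * κ + 2 * lm) = exp (-κ / 2 - lm) * ((k : ℝ) ^ 2 * (l : ℝ) ^ 3 / T ^ 4) := by
      rw [hT', hl', hk', ← exp_nat_mul, ← exp_nat_mul, ← exp_nat_mul, ← exp_add, ← exp_sub, ← exp_add]
      congr 1; push_cast; ring
    have t3 : exp (-6 * τ + 5 / 2 * κ + 3 * lm) = exp (-κ / 2 - lm) * ((k : ℝ) ^ 3 * (l : ℝ) ^ 4 / T ^ 6) := by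
      rw [hT', hl', hk', ← exp_nat_mul, ← exp_nat_mul, ← exp_nat_mul, ← exp_add, ← exp_sub, ← exp_add]
      congr 1; push_cast; ring
    rw [t1, t2, t3, ← mul_add, ← mul_add, mul_left_comm ((q : ℝ) ^ 4)]
    refine mul_le_mul_of_nonneg_left ?_ (Real.exp_nonneg _)
    have : T ^ 5 / (k * (q:ℝ) ^ 2) * (k * ((T ^ 2 / (l * q)) ^ 4)⁻¹ + (1 + k / (T ^ 2 / (l * q))) * ((T ^ 3 / (l * k * q)) ^ 3)⁻¹) =
      (q:ℝ) ^ 2 * ((l : ℝ) ^ 4 / T ^ 3) + (q * ((k : ℝ) ^ 2 * (l : ℝ) ^ 3 / T ^ 4) + (q:ℝ) ^ 2 * ((k : ℝ) ^ 3 * (l : ℝ) ^ 4 / T ^ 6)) := by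
      field_simp
    rw [this, mul_add, mul_add]
    have q2 : (q : ℝ) ^ 2 ≤ q ^ 4 := pow_le_pow_right₀ hq1 (by norm_num)
    have q1 : (q : ℝ) ≤ q ^ 4 := le_self_pow₀ hq1 (by norm_num)
    gcongr
  calc _ = (N : ℝ) ^ (-(1 / 2) : ℝ) * (C * C₀) * (exp (-κ / 2 - lm) * (T ^ 5 / (k * q ^ 2) * (k * ((T ^ 2 / (l * q)) ^ 4)⁻¹ +
      (1 + k / (T ^ 2 / (l * q))) * ((T ^ 3 / (l * k * q)) ^ 3)⁻¹))) := by rw [hPe]; ring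
    _ ≤ (N : ℝ) ^ (-(1 / 2) : ℝ) * (C * C₀) * ((q : ℝ) ^ 4 * (3 * exp 8 * (exp (4.8 * τ) * (1 + exp (4 * u))) *
      (exp (-1.1 * κ) * exp (-1.1 * lm)))) := by
      refine mul_le_mul_of_nonneg_left (hmain.trans ?_) (by positivity)
      exact mul_le_mul_of_nonneg_left hshape (by positivity)
    _ = _ := by ring

open scoped ENNReal

lemma hasSum_of_ofReal {ι : Type*} {f : ι → ℝ} (hf : ∀ i, 0 ≤ f i) {s : ℝ} (hs : 0 ≤ s)
    (h : ofReal s = ∑' i, ofReal (f i)) : HasSum f s := by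
  have h1 : Summable f := by
    have := ENNReal.summable_toReal (f := fun i => ofReal (f i)) (by rw [← h]; exact ENNReal.ofReal_ne_top)
    simpa only [ENNReal.toReal_ofReal (hf _)] using this
  have h2 : s = ∑' i, f i := by
    rwa [← ENNReal.ofReal_tsum_of_nonneg hf h1, ENNReal.ofReal_eq_ofReal_iff hs (tsum_nonneg hf)] at h
  exact h2 ▸ h1.hasSum

lemma Cop.coprime {S : Finset ℕ} (l : Cop S) {n : ℕ} (hn : n ∈ Nat.factoredNumbers S) : Nat.Coprime n l :=
  Nat.Coprime.symm (Nat.coprime_of_dvd fun p hp h1 h2 => l.2.2 p (Nat.mem_factoredNumbers'.mp hn p hp h2) h1)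

lemma exists_factored_mul_Cop {S : Finset ℕ} (hS : ∀ l ∈ S, l.Prime) (n : ℕ) (hn : n ≠ 0) :
    ∃ x : Nat.factoredNumbers S × Cop S, (x.1 : ℕ) * (x.2 : ℕ) = n := by
  induction n using induction_on_primes with
  | zero => exact absurd rfl hn
  | one => exact ⟨(⟨1, Nat.mem_factoredNumbers'.mpr fun p hp h => absurd (Nat.dvd_one.mp h) hp.ne_one⟩, ⟨1, one_mem_Cop hS⟩), one_mul 1⟩
  | prime_mul p a hp ih =>
    obtain ⟨⟨x, y⟩, rfl⟩ := ih (right_ne_zero_of_mul hn)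
    by_cases hpS : p ∈ S
    · refine ⟨(⟨p * x, Nat.mul_mem_factoredNumbers (Nat.mem_factoredNumbers'.mpr fun r hr h => ?_) x.2⟩, y), mul_assoc _ _ _⟩
      rwa [(Nat.prime_dvd_prime_iff_eq hr hp).mp h]
    · refine ⟨(x, ⟨p * y, mul_ne_zero hp.ne_zero y.2.1, fun r hr h => ?_⟩), by simp only; ring⟩
      rcases (hS r hr).dvd_mul.mp h with h | h
      · rw [(Nat.prime_dvd_prime_iff_eq (hS r hr) hp).mp h] at hr
        exact hpS hr
      · exact y.2.2 r hr h

lemma factored_mul_Cop_injective (S : Finset ℕ) :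
    Injective fun x : Nat.factoredNumbers S × Cop S => (x.1 : ℕ) * (x.2 : ℕ) := by
  have key : ∀ x y : Nat.factoredNumbers S × Cop S, (x.1 : ℕ) * (x.2 : ℕ) = (y.1 : ℕ) * (y.2 : ℕ) → (x.1 : ℕ) ∣ (y.1 : ℕ) :=
    fun x y h => (y.2.coprime x.1.2).dvd_of_dvd_mul_right (h ▸ dvd_mul_right _ _)
  intro x y h
  have h1 : (x.1 : ℕ) = y.1 := Nat.dvd_antisymm (key x y h) (key y x h.symm)
  refine Prod.ext (Subtype.ext h1) (Subtype.ext ?_)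
  simp only [h1] at h
  exact Nat.eq_of_mul_eq_mul_left (Nat.pos_of_ne_zero y.1.2.1) h

lemma tsum_factored_mul_Cop {S : Finset ℕ} (hS : ∀ l ∈ S, l.Prime) (f : ℕ → ℝ≥0∞) (h0 : f 0 = 0) :
    ∑' n, f n = ∑' (x : Nat.factoredNumbers S) (y : Cop S), f (x * y) := by
  rw [← ENNReal.tsum_prod (f := fun (x : Nat.factoredNumbers S) (y : Cop S) => f (x * y))]
  refine ((factored_mul_Cop_injective S).tsum_eq fun n hn => ?_).symm
  obtain ⟨x, hx⟩ := exists_factored_mul_Cop hS n (by rintro rfl; exact hn h0)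
  exact ⟨x, hx⟩

lemma Cop.mem_of_mul {S : Finset ℕ} (hS : ∀ l ∈ S, l.Prime) {m k l : ℕ} :
    (m ^ 3 * k * l ^ 2 ≠ 0 ∧ ∀ p ∈ S, ¬ p ∣ m ^ 3 * k * l ^ 2) ↔
      (m ≠ 0 ∧ ∀ p ∈ S, ¬ p ∣ m) ∧ (k ≠ 0 ∧ ∀ p ∈ S, ¬ p ∣ k) ∧ (l ≠ 0 ∧ ∀ p ∈ S, ¬ p ∣ l) := by
  constructor
  · rintro ⟨h1, h2⟩
    refine ⟨⟨by rintro rfl; simp at h1, fun p hp h => h2 p hp ?_⟩, ⟨by rintro rfl; simp at h1, fun p hp h => h2 p hp ?_⟩,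
      ⟨by rintro rfl; simp at h1, fun p hp h => h2 p hp ?_⟩⟩
    · exact ((h.trans (dvd_pow_self m (by norm_num))).mul_right k).mul_right _
    · exact (h.mul_left _).mul_right _
    · exact (h.trans (dvd_pow_self l (by norm_num))).mul_left _
  · rintro ⟨hm, hk, hl⟩
    refine ⟨mul_ne_zero (mul_ne_zero (pow_ne_zero _ hm.1) hk.1) (pow_ne_zero _ hl.1), fun p hp h => ?_⟩
    rcases (hS p hp).dvd_mul.mp h with h | h
    · rcases (hS p hp).dvd_mul.mp h with h | h
      · exact hm.2 p hp ((hS p hp).dvd_of_dvd_pow h)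
      · exact hk.2 p hp h
    · exact hl.2 p hp ((hS p hp).dvd_of_dvd_pow h)

section
variable {A : Type*} [CommRing A] {θ : A} {c a b : ℤ}

/-- Hermite data grouped by index, regrouped by `(m, l, k)`. -/
def datEquiv {S : Finset ℕ} (hS : ∀ l ∈ S, l.Prime) (c a b : ℤ) :
    (Σ y : Cop S, {d : CubicDat c a b // d.val = (y : ℕ)}) ≃
      Σ x : Cop S × Cop S × Cop S, {z : Fin (x.2.2 : ℕ) × Fin (x.2.1 : ℕ) × Fin (x.2.1 : ℕ) //
        CubicCond c a b (x.2.2 : ℕ) (x.2.1 : ℕ) z.1 z.2.1 z.2.2} where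
  toFun y :=
    have h := (Cop.mem_of_mul hS).mp (show y.2.1.m ^ 3 * y.2.1.k * y.2.1.l ^ 2 ≠ 0 ∧ ∀ p ∈ S, ¬ p ∣ y.2.1.m ^ 3 * y.2.1.k * y.2.1.l ^ 2 by
      rw [show y.2.1.m ^ 3 * y.2.1.k * y.2.1.l ^ 2 = (y.1 : ℕ) from y.2.2]; exact y.1.2)
    ⟨(⟨y.2.1.m, h.1⟩, ⟨y.2.1.l, h.2.2⟩, ⟨y.2.1.k, h.2.1⟩),
      ⟨(⟨y.2.1.r, y.2.1.hr⟩, ⟨y.2.1.t, y.2.1.ht⟩, ⟨y.2.1.w, y.2.1.hw⟩), y.2.1.cond⟩⟩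
  invFun x :=
    ⟨⟨(x.1.1 : ℕ) ^ 3 * (x.1.2.2 : ℕ) * (x.1.2.1 : ℕ) ^ 2, (Cop.mem_of_mul hS).mpr ⟨x.1.1.2, x.1.2.2.2, x.1.2.1.2⟩⟩,
      ⟨⟨x.1.1, x.1.2.2, x.1.2.1, x.2.1.1, x.2.1.2.1, x.2.1.2.2, Nat.pos_of_ne_zero x.1.1.2.1, Nat.pos_of_ne_zero x.1.2.2.2.1,
        Nat.pos_of_ne_zero x.1.2.1.2.1, x.2.1.1.2, x.2.1.2.1.2, x.2.1.2.2.2, x.2.2⟩, rfl⟩⟩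
  left_inv := by
    rintro ⟨⟨y, hy⟩, ⟨d, hd⟩⟩
    simp only at hd
    subst hd
    rfl
  right_inv x := rfl

lemma card_cond (k l : ℕ) :
    Nat.card {z : Fin k × Fin l × Fin l // CubicCond c a b k l z.1 z.2.1 z.2.2} = rho c a b k l := by
  rw [Nat.card_eq_fintype_card, Fintype.card_subtype, rho, Finset.card_filter]

lemma tsum_Cop_aN (h : IsCubicOrder A θ c a b) {S : Finset ℕ} (hS : ∀ l ∈ S, l.Prime)
    (hfin : ∀ n : ℕ, n ≠ 0 → Finite {d : CubicDat c a b // d.val = n}) (F : ℕ → ℝ≥0∞) :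
    ∑' y : Cop S, (aN A y : ℝ≥0∞) * F y =
      ∑' x : Cop S × Cop S × Cop S, (rho c a b x.2.2 x.2.1 : ℝ≥0∞) * F ((x.1 : ℕ) ^ 3 * (x.2.2 : ℕ) * (x.2.1 : ℕ) ^ 2) := by
  have e1 : ∀ y : Cop S, (aN A y : ℝ≥0∞) * F y = ∑' _ : {d : CubicDat c a b // d.val = (y : ℕ)}, F y := by
    intro y
    have := hfin y y.2.1
    have := Fintype.ofFinite {d : CubicDat c a b // d.val = (y : ℕ)}
    rw [tsum_fintype, Finset.sum_const, nsmul_eq_mul, Finset.card_univ, ← Nat.card_eq_fintype_card, CubicDat.aN_eq h y y.2.1]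
  have e2 : ∀ x : Cop S × Cop S × Cop S, (rho c a b x.2.2 x.2.1 : ℝ≥0∞) * F ((x.1 : ℕ) ^ 3 * (x.2.2 : ℕ) * (x.2.1 : ℕ) ^ 2) =
      ∑' _ : {z : Fin (x.2.2 : ℕ) × Fin (x.2.1 : ℕ) × Fin (x.2.1 : ℕ) // CubicCond c a b (x.2.2 : ℕ) (x.2.1 : ℕ) z.1 z.2.1 z.2.2},
        F ((x.1 : ℕ) ^ 3 * (x.2.2 : ℕ) * (x.2.1 : ℕ) ^ 2) := by
    intro x
    rw [tsum_fintype, Finset.sum_const, nsmul_eq_mul, Finset.card_univ, ← Nat.card_eq_fintype_card, card_cond]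
  simp_rw [e1, e2]
  rw [← ENNReal.tsum_sigma' (f := fun y : Σ y : Cop S, {d : CubicDat c a b // d.val = (y : ℕ)} => F y.1),
    ← ENNReal.tsum_sigma' (f := fun x : Σ x : Cop S × Cop S × Cop S, {z : Fin (x.2.2 : ℕ) × Fin (x.2.1 : ℕ) × Fin (x.2.1 : ℕ) //
        CubicCond c a b (x.2.2 : ℕ) (x.2.1 : ℕ) z.1 z.2.1 z.2.2} => F ((x.1.1 : ℕ) ^ 3 * (x.1.2.2 : ℕ) * (x.1.2.1 : ℕ) ^ 2)),
    ← (datEquiv hS c a b).symm.tsum_eq]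
  rfl

/-- Decomposition of the smoothed central sum along Hermite data. -/
lemma hasSum_WS [IsDomain A] [CharZero A] (h : IsCubicOrder A θ c a b) {S : Finset ℕ} (hS : ∀ l ∈ S, l.Prime) (u : ℝ) :
    HasSum (fun x : ((Nat.factoredNumbers S × Cop S) × Cop S) × Cop S => (aN A (x.1.1.1 : ℕ) : ℝ) *
      (rho c a b x.2 x.1.2 * wsTerm ((x.1.1.1 : ℕ) * (x.1.1.2 : ℕ) ^ 3 * (x.2 : ℕ) * (x.1.2 : ℕ) ^ 2) u)) (WS A u) := by
  have hfin : ∀ n : ℕ, n ≠ 0 → Finite {d : CubicDat c a b // d.val = n} := fun n hn =>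
    have := finite_idx h.basis n
    Finite.of_equiv _ (CubicDat.idealEquiv h n hn).symm
  refine hasSum_of_ofReal (fun x => mul_nonneg (by positivity) (mul_nonneg (by positivity) (wsTerm_nonneg _ _))) (WS_nonneg u) ?_
  rw [WS, ENNReal.ofReal_tsum_of_nonneg (fun n => mul_nonneg (by positivity) (wsTerm_nonneg _ _)) (summable_wsTerm (aN_le h.basis) u),
    tsum_factored_mul_Cop hS _ (by simp [aN_zero])]
  simp_rw [ENNReal.tsum_prod']
  refine tsum_congr fun n => ?_
  have e1 : ∀ y : Cop S, ofReal ((aN A (n * y) : ℝ) * wsTerm (n * y) u) =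
      (aN A y : ℝ≥0∞) * ((aN A n : ℝ≥0∞) * ofReal (wsTerm (n * y) u)) := by
    intro y
    rw [aN_mul (y.coprime n.2), ENNReal.ofReal_mul (by positivity), ENNReal.ofReal_natCast]
    push_cast
    ring
  simp_rw [e1]
  rw [tsum_Cop_aN h hS hfin (fun y => (aN A n : ℝ≥0∞) * ofReal (wsTerm (n * y) u))]
  simp_rw [ENNReal.tsum_prod']
  refine tsum_congr fun m => tsum_congr fun l => tsum_congr fun k => ?_
  rw [ENNReal.ofReal_mul (by positivity), ENNReal.ofReal_mul (by positivity), ENNReal.ofReal_natCast, ENNReal.ofReal_natCast]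
  rw [mul_left_comm]
  congr 4
  ring

end

lemma inv_mul_wsTerm {N k l : ℕ} (hN : 0 < N) (hk : 0 < k) (hl : 0 < l) (z : ℝ) :
    (N : ℝ) ^ (-(1 / 2) : ℝ) * (l : ℝ)⁻¹ * wsTerm k (z - (log N + 2 * log l)) = wsTerm (N * k * l ^ 2) z := by
  have h1 : ((N * k * l ^ 2 : ℕ) : ℝ) ^ (-(1 / 2) : ℝ) = (N : ℝ) ^ (-(1 / 2) : ℝ) * (k : ℝ) ^ (-(1 / 2) : ℝ) * (l : ℝ)⁻¹ := by
    push_cast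
    rw [mul_rpow (by positivity) (by positivity), mul_rpow (by positivity) (by positivity),
      ← rpow_natCast (l : ℝ), ← rpow_mul (by positivity), ← Real.rpow_neg_one (l : ℝ)]
    norm_num
  have h2 : log ((N * k * l ^ 2 : ℕ) : ℝ) = log N + log k + 2 * log l := by
    push_cast
    rw [log_mul (by positivity) (by positivity), log_mul (by positivity) (by positivity), log_pow]
    norm_num
  rw [wsTerm, wsTerm, h1, h2]
  rw [show z - (log N + 2 * log l) - log k = z - (log N + log k + 2 * log l) by ring]
  ring

lemma ofReal_PS (S : Finset ℕ) (z : ℝ) : ofReal (PS S z) = ∑' k : Cop S, ofReal (wsTerm k z) := by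
  have hs : Summable fun k : ℕ => if ∀ p ∈ S, ¬ p ∣ k then wsTerm k z else 0 :=
    summable_of_ne_finset_zero (s := Finset.range (⌊exp (z + 1)⌋₊ + 1)) fun k hk => by
      rw [wsTerm_support z hk, ite_self]
  rw [PS, ENNReal.ofReal_tsum_of_nonneg (fun n => by split_ifs; exacts [wsTerm_nonneg _ _, le_rfl]) hs]
  refine Eq.trans ?_ (tsum_subtype {l : ℕ | l ≠ 0 ∧ ∀ p ∈ S, ¬ p ∣ l} (fun k => ofReal (wsTerm k z))).symm
  refine tsum_congr fun k => ?_
  rw [Set.indicator_apply]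
  rcases eq_or_ne k 0 with rfl | hk
  · simp [wsTerm_zero]
  · simp only [Set.mem_ofPred_eq, hk, ne_eq, not_false_eq_true, true_and]
    split_ifs <;> simp

lemma ofReal_superPS {J : Type*} [Countable J] {S : Finset ℕ} {κ : J → ℝ} {N : J → ℕ} (hκ : ∀ j, 0 ≤ κ j) (hN : ∀ j, 1 ≤ N j)
    (hs : Summable fun j => κ j * (N j : ℝ) ^ (-(1 / 2) : ℝ)) (z : ℝ) :
    ofReal (superPS (X := J × Cop S) S (pairW κ N) (pairS N) z) =
      ∑' x : (J × Cop S) × Cop S, ofReal (κ x.1.1 * wsTerm (N x.1.1 * (x.2 : ℕ) * (x.1.2 : ℕ) ^ 2) z) := by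
  rw [superPS, ENNReal.ofReal_tsum_of_nonneg (fun x => mul_nonneg (pairW_nonneg hκ x) (PS_nonneg _ _))
    (summable_superPS (pairW_nonneg hκ) (summable_pairW hκ hN hs) z), ENNReal.tsum_prod' (α := J × Cop S)]
  refine tsum_congr fun x => ?_
  rw [ENNReal.ofReal_mul (pairW_nonneg hκ x), ofReal_PS, ← ENNReal.tsum_mul_left]
  refine tsum_congr fun k => ?_
  rw [← ENNReal.ofReal_mul (pairW_nonneg hκ x), ← inv_mul_wsTerm (hN x.1) (Nat.pos_of_ne_zero k.2.1) (Nat.pos_of_ne_zero x.2.2.1), pairW,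
    pairS]
  congr 1
  ring

lemma IsCubicOrder.charZero {A : Type*} [CommRing A] {θ : A} {c a b : ℤ} (h : IsCubicOrder A θ c a b) : CharZero A :=
  charZero_of_inj_zero fun n hn => by
    have := (h.ind n 0 0 (by simpa using hn)).1
    exact_mod_cast this

lemma exists_dvd_pow_of_mem_factoredNumbers {n q : ℕ} (hq : q ≠ 0) (hn : n ∈ Nat.factoredNumbers q.primeFactors) :
    ∃ K, n ∣ q ^ K := by
  refine ⟨n, (Nat.factorization_le_iff_dvd hn.1 (pow_ne_zero _ hq)).mp fun p => ?_⟩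
  rw [Nat.factorization_pow, Finsupp.smul_apply, smul_eq_mul]
  rcases eq_or_ne (n.factorization p) 0 with h0 | h0
  · rw [h0]; exact Nat.zero_le _
  have hp : p ∈ n.primeFactors := by rwa [← Nat.support_factorization, Finsupp.mem_support_iff]
  have h1 : p ∈ q.primeFactors := Nat.primeFactors_subset_of_mem_factoredNumbers hn hp
  have h2 : 1 ≤ q.factorization p := Nat.one_le_iff_ne_zero.mpr (by rwa [← Nat.support_factorization, Finsupp.mem_support_iff] at h1)
  calc n.factorization p ≤ n := (Nat.factorization_lt p hn.1).le
    _ = n * 1 := (mul_one n).symm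
    _ ≤ _ := Nat.mul_le_mul_left n h2

/-- The modulus attached to a reference cubic. -/
def modulus (c a₀ b₀ : ℤ) (q' : ℕ) : ℕ := (cubicDisc c a₀ b₀).natAbs ^ 2 * q'

lemma cast_modulus (c a₀ b₀ : ℤ) (q' : ℕ) : (modulus c a₀ b₀ q' : ℤ) = cubicDisc c a₀ b₀ ^ 2 * q' := by
  simp [modulus]

section
variable {c a₀ b₀ : ℤ} {q' : ℕ} (hq' : q' ≠ 0) (hΔ : cubicDisc c a₀ b₀ ≠ 0) (hd : (cubicDisc c a₀ b₀).natAbs ∣ q')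

lemma aN_class (A : Type*) [CommRing A] {θ : A} {a b : ℤ} (hA : IsCubicOrder A θ c a b)
    (ha : (modulus c a₀ b₀ q' : ℤ) ∣ a - a₀) (hb : (modulus c a₀ b₀ q' : ℤ) ∣ b - b₀) (hq' : q' ≠ 0) {n : ℕ}
    (hn : n ∈ Nat.factoredNumbers q'.primeFactors) : aN A n = aN (CubicOrder c a₀ b₀) n := by
  obtain ⟨K, hK⟩ := exists_dvd_pow_of_mem_factoredNumbers hq' hn
  rw [cast_modulus] at ha hb
  exact hA.aN_congr rfl ha hb hK (Nat.pos_of_ne_zero hn.1)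

include hq' hΔ in
lemma modulus_pos : 0 < modulus c a₀ b₀ q' :=
  Nat.pos_of_ne_zero (mul_ne_zero (pow_ne_zero _ (Int.natAbs_ne_zero.mpr hΔ)) hq')

include hq' hd in
lemma coprime_modulus (k l : Cop q'.primeFactors) : ((k : ℕ) * (l : ℕ)).Coprime (modulus c a₀ b₀ q') := by
  have h1 : q' ∈ Nat.factoredNumbers q'.primeFactors := Nat.mem_factoredNumbers_of_primeFactors_subset hq' subset_rfl
  have h2 : modulus c a₀ b₀ q' ∈ Nat.factoredNumbers q'.primeFactors := by
    have := Nat.mem_factoredNumbers_of_dvd h1 hd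
    rw [modulus, sq]
    exact Nat.mul_mem_factoredNumbers (Nat.mul_mem_factoredNumbers this this) h1
  exact (Nat.Coprime.mul_right (k.coprime h2) (l.coprime h2)).symm

/-- The weight of the smooth part. -/
def locW (c a₀ b₀ : ℤ) (q' : ℕ) (j : Nat.factoredNumbers q'.primeFactors × Cop q'.primeFactors) : ℝ :=
  aN (CubicOrder c a₀ b₀) (j.1 : ℕ)

/-- The size of the smooth part. -/
def locN (q' : ℕ) (j : Nat.factoredNumbers q'.primeFactors × Cop q'.primeFactors) : ℕ := (j.1 : ℕ) * (j.2 : ℕ) ^ 3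

lemma locW_nonneg (j) : 0 ≤ locW c a₀ b₀ q' j := by unfold locW; positivity

lemma one_le_locN (j) : 1 ≤ locN q' j :=
  Nat.one_le_iff_ne_zero.mpr (mul_ne_zero j.1.2.1 (pow_ne_zero _ j.2.2.1))

lemma summable_locW (hPG : PolyGrowth (CubicOrder c a₀ b₀)) :
    Summable fun j => locW c a₀ b₀ q' j * (locN q' j : ℝ) ^ (-(1 / 2) : ℝ) := by
  have h1 := hPG.summable_smooth q'.primeFactors (σ := 1 / 2) (by norm_num)
  have h2 : Summable fun m : Cop q'.primeFactors => ((m : ℕ) : ℝ) ^ (-(3 / 2) : ℝ) :=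
    (Real.summable_nat_rpow.mpr (by norm_num)).comp_injective Subtype.val_injective
  refine (h1.mul_of_nonneg h2 (fun _ => by positivity) fun _ => by positivity).congr fun j => ?_
  rw [locW, locN]
  push_cast
  rw [mul_rpow (by positivity) (by positivity), ← rpow_natCast, ← rpow_mul (by positivity), mul_assoc]
  norm_num

/-- The superposition governing the family average. -/
def locQ (c a₀ b₀ : ℤ) (q' : ℕ) : ℝ → ℝ :=
  superPS (X := (Nat.factoredNumbers q'.primeFactors × Cop q'.primeFactors) × Cop q'.primeFactors) q'.primeFactors
    (pairW (locW c a₀ b₀ q') (locN q')) (pairS (locN q'))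

/-- Index of the Hermite decomposition: smooth part, `m`, `l`, `k`. -/
abbrev HIdx (q' : ℕ) := ((Nat.factoredNumbers q'.primeFactors × Cop q'.primeFactors) × Cop q'.primeFactors) × Cop q'.primeFactors

/-- The index of the ideals in a Hermite class. -/
def HIdx.size {q' : ℕ} (x : HIdx q') : ℕ := locN q' x.1.1 * (x.2 : ℕ) * (x.1.2 : ℕ) ^ 2

lemma hasSum_locQ (hPG : PolyGrowth (CubicOrder c a₀ b₀)) (z : ℝ) :
    HasSum (fun x : HIdx q' => locW c a₀ b₀ q' x.1.1 * wsTerm x.size z) (locQ c a₀ b₀ q' z) :=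
  hasSum_of_ofReal (fun _ => mul_nonneg (locW_nonneg _) (wsTerm_nonneg _ _))
    (superPS_nonneg (pairW_nonneg locW_nonneg) (summable_pairW locW_nonneg one_le_locN (summable_locW hPG)) z)
    (ofReal_superPS locW_nonneg one_le_locN (summable_locW hPG) z)

lemma integrable_cbump_wsTerm {e : ℝ} (he : e = 1 ∨ e = -1) (n : ℕ) (z : ℝ) :
    Integrable fun x => cbump e x * wsTerm n (z + log |dzero x| / 2) := by
  simp_rw [cbump_mul_wsTerm]
  refine (Continuous.integrable_of_hasCompactSupport ((contDiff_cfam he).continuous.comp (by fun_prop)) ?_).const_mul _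
  exact HasCompactSupport.intro (isCompact_closedBall (![-e, 0] : Fin 2 → ℝ) (1 / 8))
      (fun _ hx => by simp only [Function.comp]; rw [cfam, cbump_eq_zero hx, zero_mul])

lemma cbump_mul_mono {e : ℝ} (he : e = 1 ∨ e = -1) {F : ℝ → ℝ} (hF : Monotone F) (z : ℝ) (x : Fin 2 → ℝ) :
    cbump e x * F (z + log |dzero x| / 2) ≤ cbump e x * F (z + 3 / 2) := by
  by_cases hx : x ∈ Metric.closedBall (![-e, 0] : Fin 2 → ℝ) (1 / 8)
  · exact mul_le_mul_of_nonneg_left (hF (by linarith [(log_dzero_bounds he hx).2.2])) (cbump e).nonneg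
  · rw [cbump_eq_zero hx, zero_mul, zero_mul]

lemma hasSum_integral_locQ (hPG : PolyGrowth (CubicOrder c a₀ b₀)) {e : ℝ} (he : e = 1 ∨ e = -1) (z : ℝ) :
    HasSum (fun x : HIdx q' => locW c a₀ b₀ q' x.1.1 * ∫ v, cbump e v * wsTerm x.size (z + log |dzero v| / 2))
      (∫ v, cbump e v * locQ c a₀ b₀ q' (z + log |dzero v| / 2)) := by
  have h := hasSum_integral_of_summable_integral_norm (μ := (volume : Measure (Fin 2 → ℝ)))
    (F := fun (x : HIdx q') v => locW c a₀ b₀ q' x.1.1 * (cbump e v * wsTerm x.size (z + log |dzero v| / 2)))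
    (fun x => (integrable_cbump_wsTerm he _ _).const_mul _) ?_
  · simp only [integral_const_mul] at h
    rw [show (fun v => cbump e v * locQ c a₀ b₀ q' (z + log |dzero v| / 2)) = fun v => ∑' x : HIdx q',
      locW c a₀ b₀ q' x.1.1 * (cbump e v * wsTerm x.size (z + log |dzero v| / 2)) from funext fun v => ?_]
    · exact h
    · rw [← ((hasSum_locQ hPG _).mul_left _).tsum_eq]
      exact tsum_congr fun x => mul_left_comm _ _ _
  · have hi : Integrable fun v => cbump e v := (cbump e).continuous.integrable_of_hasCompactSupport (cbump e).hasCompactSupport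
    refine ((hasSum_locQ (q' := q') hPG (z + 3 / 2)).summable.mul_right (∫ v, cbump e v)).of_nonneg_of_le
      (fun x => integral_nonneg fun _ => norm_nonneg _) fun x => ?_
    rw [mul_assoc, mul_comm (wsTerm _ _), ← integral_mul_const, ← integral_const_mul]
    refine integral_mono ((integrable_cbump_wsTerm he _ _).const_mul _).norm ((hi.mul_const _).const_mul _) fun v => ?_
    have h0 : 0 ≤ locW c a₀ b₀ q' x.1.1 * (cbump e v * wsTerm x.size (z + log |dzero v| / 2)) :=
      mul_nonneg (locW_nonneg _) (mul_nonneg (cbump e).nonneg (wsTerm_nonneg _ _))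
    simp only [norm_of_nonneg h0]
    exact mul_le_mul_of_nonneg_left (cbump_mul_mono he (monotone_wsTerm _) z v) (locW_nonneg _)

/-- The smoothed family sum of truncated central values. -/
def famSum (c a₀ b₀ : ℤ) (q : ℕ) (e T u : ℝ) : ℝ :=
  ∑' j : ℤ × ℤ, cbump e (cpt c T (a₀ + q * j.1) (b₀ + q * j.2)) * WS (CubicOrder c (a₀ + q * j.1) (b₀ + q * j.2))
    (u + log |((cubicDisc c (a₀ + q * j.1) (b₀ + q * j.2) : ℤ) : ℝ)| / 2)

lemma exists_support_finset (c a₀ b₀ : ℤ) {q : ℕ} (hq : 0 < q) {e : ℝ} (he : e = 1 ∨ e = -1) {T : ℝ} (hT : 0 < T) :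
    ∃ E : Finset (ℤ × ℤ), ∀ j ∉ E, cbump e (cpt c T (a₀ + q * j.1) (b₀ + q * j.2)) = 0 := by
  refine ⟨(finite_cpt_le c a₀ b₀ hq hT 2).toFinset, fun j hj => cbump_eq_zero fun h => hj ?_⟩
  rw [Set.Finite.mem_toFinset, Set.mem_ofPred_eq]
  rw [Metric.mem_closedBall, dist_eq_norm] at h
  have h1 : ‖(![-e, 0] : Fin 2 → ℝ)‖ ≤ 1 := by
    rw [pi_norm_le_iff_of_nonneg zero_le_one]
    intro i
    fin_cases i <;> rcases he with rfl | rfl <;> simp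
  linarith [norm_sub_norm_le (cpt c T (a₀ + q * j.1) (b₀ + q * j.2)) ![-e, 0]]

include hq' hΔ hd in
lemma exists_famSum_error (hPG : PolyGrowth (CubicOrder c a₀ b₀)) {e : ℝ} (he : e = 1 ∨ e = -1)
    (hdom : ∀ a b : ℤ, (modulus c a₀ b₀ q' : ℤ) ∣ a - a₀ → (modulus c a₀ b₀ q' : ℤ) ∣ b - b₀ → IsDomain (CubicOrder c a b)) :
    ∃ C : ℝ, 0 ≤ C ∧ ∀ T : ℝ, 1 ≤ T → ∀ u : ℝ, |famSum c a₀ b₀ (modulus c a₀ b₀ q') e T u - T ^ 5 / (modulus c a₀ b₀ q' : ℝ) ^ 2 *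
      ∫ v, cbump e v * locQ c a₀ b₀ q' (u + 3 * log T + log |dzero v| / 2)| ≤
      C * (exp (4.8 * log T) * (1 + exp (4 * u))) := by
  set q := modulus c a₀ b₀ q' with hq
  have hq0 : 0 < q := modulus_pos hq' hΔ
  obtain ⟨C, hC, h⟩ := exists_averaged_term_error c a₀ b₀ hq0 he
  have hsE : Summable fun x : HIdx q' => locW c a₀ b₀ q' x.1.1 * (locN q' x.1.1 : ℝ) ^ (-(1 / 2) : ℝ) * ((x.1.2 : ℕ) : ℝ) ^ (-1.1 : ℝ) *
      ((x.2 : ℕ) : ℝ) ^ (-1.1 : ℝ) := by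
    have h2 : Summable fun m : Cop q'.primeFactors => ((m : ℕ) : ℝ) ^ (-1.1 : ℝ) :=
      (Real.summable_nat_rpow.mpr (by norm_num)).comp_injective Subtype.val_injective
    have h3 := (summable_locW (q' := q') hPG).mul_of_nonneg h2 (fun j => mul_nonneg (locW_nonneg _) (by positivity)) fun _ => by positivity
    exact h3.mul_of_nonneg h2 (fun j => mul_nonneg (mul_nonneg (locW_nonneg _) (by positivity)) (by positivity)) fun _ => by positivity
  refine ⟨C * ∑' x : HIdx q', locW c a₀ b₀ q' x.1.1 * (locN q' x.1.1 : ℝ) ^ (-(1 / 2) : ℝ) * ((x.1.2 : ℕ) : ℝ) ^ (-1.1 : ℝ) *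
      ((x.2 : ℕ) : ℝ) ^ (-1.1 : ℝ), mul_nonneg hC (tsum_nonneg fun x => mul_nonneg (mul_nonneg (mul_nonneg (locW_nonneg _)
      (by positivity)) (by positivity)) (by positivity)), fun T hT u => ?_⟩
  obtain ⟨E, hE⟩ := exists_support_finset c a₀ b₀ hq0 he (T := T) (by linarith)
  have hA : HasSum (fun x : HIdx q' => locW c a₀ b₀ q' x.1.1 * ∑' j : ℤ × ℤ, (rho c (a₀ + q * j.1) (b₀ + q * j.2) x.2 x.1.2 : ℝ) *
      (cbump e (cpt c T (a₀ + q * j.1) (b₀ + q * j.2)) *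
        wsTerm x.size (u + log |((cubicDisc c (a₀ + q * j.1) (b₀ + q * j.2) : ℤ) : ℝ)| / 2)))
      (famSum c a₀ b₀ q e T u) := by
    rw [famSum, tsum_eq_sum (s := E) (fun j hj => by rw [hE j hj, zero_mul])]
    have hj : ∀ j ∈ E, HasSum (fun x : HIdx q' => cbump e (cpt c T (a₀ + q * j.1) (b₀ + q * j.2)) *
        (locW c a₀ b₀ q' x.1.1 * ((rho c (a₀ + q * j.1) (b₀ + q * j.2) x.2 x.1.2 : ℝ) *
        wsTerm x.size (u + log |((cubicDisc c (a₀ + q * j.1) (b₀ + q * j.2) : ℤ) : ℝ)| / 2))))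
        (cbump e (cpt c T (a₀ + q * j.1) (b₀ + q * j.2)) * WS (CubicOrder c (a₀ + q * j.1) (b₀ + q * j.2))
        (u + log |((cubicDisc c (a₀ + q * j.1) (b₀ + q * j.2) : ℤ) : ℝ)| / 2)) := by
      intro j _
      have hO := isCubicOrder_adjoinRoot c (a₀ + q * j.1) (b₀ + q * j.2)
      have := hO.charZero
      have := hdom (a₀ + q * j.1) (b₀ + q * j.2) (by simp) (by simp)
      refine HasSum.mul_left _ ?_
      refine (hasSum_WS hO (S := q'.primeFactors) (fun l hl => Nat.prime_of_mem_primeFactors hl) _).congr_fun fun x => ?_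
      rw [aN_class (a₀ := a₀) (b₀ := b₀) (q' := q') _ hO (by rw [← hq]; simp) (by rw [← hq]; simp) hq' x.1.1.1.2]
      rfl
    refine (hasSum_sum hj).congr_fun fun x => ?_
    rw [tsum_eq_sum (s := E) (fun j hj => by rw [hE j hj, zero_mul, mul_zero]), mul_sum]
    refine sum_congr rfl fun j _ => ?_
    ring
  have hB := (hasSum_integral_locQ (q' := q') hPG he (u + 3 * log T)).mul_left (T ^ 5 / (q : ℝ) ^ 2)
  have hD := hA.sub hB
  rw [← hD.tsum_eq, ← norm_eq_abs]
  refine tsum_of_norm_bounded ((hsE.hasSum.mul_left C).mul_right _) fun x => ?_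
  have hx := h T hT (locN q' x.1.1) (x.2 : ℕ) (x.1.2 : ℕ) (one_le_locN _) (Nat.pos_of_ne_zero x.2.2.1) (Nat.pos_of_ne_zero x.1.2.2.1)
    (coprime_modulus hq' hd _ _) u
  rw [mul_left_comm, ← mul_sub, norm_eq_abs, abs_mul, abs_of_nonneg (locW_nonneg _)]
  refine (mul_le_mul_of_nonneg_left hx (locW_nonneg _)).trans_eq ?_
  ring

end

section
variable {c a₀ b₀ : ℤ} {q' : ℕ}

lemma measurable_log_dzero : Measurable fun v => log |dzero v| / 2 := by
  unfold dzero
  fun_prop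

lemma monotone_locQ (hPG : PolyGrowth (CubicOrder c a₀ b₀)) : Monotone (locQ c a₀ b₀ q') :=
  monotone_superPS (pairW_nonneg locW_nonneg) (summable_pairW locW_nonneg one_le_locN (summable_locW hPG))

lemma exists_abs_locQ_le (hPG : PolyGrowth (CubicOrder c a₀ b₀)) :
    ∃ C, 0 ≤ C ∧ ∀ z, |locQ c a₀ b₀ q' z| ≤ C * exp (1 * z) :=
  ⟨_, mul_nonneg (exp_pos 1).le (tsum_nonneg fun x => mul_nonneg (pairW_nonneg locW_nonneg x) (exp_pos _).le),
    abs_superPS_le (pairW_nonneg locW_nonneg) (summable_pairW locW_nonneg one_le_locN (summable_locW hPG))⟩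

variable {ι : Type*} [Fintype ι] {n : ι → ℕ} {i₀ : ι}

lemma integrable_prod_locQ (hn : ∀ i, 0 < n i) (hPG : PolyGrowth (CubicOrder c a₀ b₀)) {e : ℝ} (he : e = 1 ∨ e = -1) (z : ℝ) :
    Integrable (fun p : (ι → ℝ) × (Fin 2 → ℝ) => psiW n i₀ p.1 * (exp (nuW n p.1 / 2) *
      (cbump e p.2 * locQ c a₀ b₀ q' (nuW n p.1 + z + log |dzero p.2| / 2)))) (volume.prod volume) := by
  obtain ⟨C, hC, hb⟩ := exists_abs_locQ_le (q' := q') hPG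
  have hi : Integrable fun v => cbump e v := (cbump e).continuous.integrable_of_hasCompactSupport (cbump e).hasCompactSupport
  have h1 := (integrable_abs_psiW n i₀ hn (σ := 3 / 2) (by norm_num)).mul_prod (hi.mul_const (C * exp (z + 3 / 2)))
  have hm := (monotone_locQ (q' := q') hPG).measurable
  have hp : Measurable (psiW n i₀) := (continuous_psiW n i₀).measurable
  have hν : Measurable (nuW n) := (continuous_nuW n).measurable
  have hc : Measurable fun v => cbump e v := (cbump e).continuous.measurable
  have hl := measurable_log_dzero
  refine h1.mono' ?_ (ae_of_all _ fun p => ?_)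
  · refine Measurable.aestronglyMeasurable ?_
    refine (hp.comp measurable_fst).mul (((hν.comp measurable_fst).div_const 2).exp.mul ((hc.comp measurable_snd).mul (hm.comp ?_)))
    exact ((hν.comp measurable_fst).add_const z).add (hl.comp measurable_snd)
  · have hQ : cbump e p.2 * |locQ c a₀ b₀ q' (nuW n p.1 + z + log |dzero p.2| / 2)| ≤
        cbump e p.2 * (C * exp (nuW n p.1 + z + 3 / 2)) := by
      refine (mul_le_mul_of_nonneg_left (hb _) (cbump e).nonneg).trans ?_
      rw [one_mul]
      exact cbump_mul_mono he (F := fun t => C * exp t) (fun x y h => by dsimp only; gcongr) (nuW n p.1 + z) p.2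
    rw [norm_mul, norm_mul, norm_mul, norm_eq_abs, norm_eq_abs, norm_eq_abs, norm_eq_abs, abs_of_nonneg (exp_pos _).le,
      abs_of_nonneg (cbump e).nonneg]
    calc _ ≤ |psiW n i₀ p.1| * (exp (nuW n p.1 / 2) * (cbump e p.2 * (C * exp (nuW n p.1 + z + 3 / 2)))) := by gcongr
      _ = _ := by
        rw [show nuW n p.1 + z + 3 / 2 = nuW n p.1 + (z + 3 / 2) by ring, exp_add,
          show (3 / 2 : ℝ) * nuW n p.1 = nuW n p.1 / 2 + nuW n p.1 by ring, exp_add (nuW n p.1 / 2)]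
        ring

lemma integral_swap_locQ (hn : ∀ i, 0 < n i) (hPG : PolyGrowth (CubicOrder c a₀ b₀)) {e : ℝ} (he : e = 1 ∨ e = -1) (z : ℝ) :
    ∫ y, psiW n i₀ y * (exp (nuW n y / 2) * ∫ v, cbump e v * locQ c a₀ b₀ q' (nuW n y + z + log |dzero v| / 2)) =
      ∫ v, cbump e v * psiAvg n i₀ (locQ c a₀ b₀ q') (z + log |dzero v| / 2) := by
  have h := integral_integral_swap (f := fun (y : ι → ℝ) (v : Fin 2 → ℝ) => psiW n i₀ y * (exp (nuW n y / 2) *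
      (cbump e v * locQ c a₀ b₀ q' (nuW n y + z + log |dzero v| / 2)))) (integrable_prod_locQ (q' := q') (i₀ := i₀) hn hPG he z)
  simp_rw [integral_const_mul] at h
  rw [h]
  congr 1
  ext v
  rw [psiAvg, ← integral_const_mul]
  congr 1
  ext y
  rw [show nuW n y + z + log |dzero v| / 2 = z + log |dzero v| / 2 + nuW n y by ring]
  ring

lemma integral_cbump_locQ_le (hn : ∀ i, 0 < n i) (hPG : PolyGrowth (CubicOrder c a₀ b₀)) {e : ℝ} (he : e = 1 ∨ e = -1) {Z z : ℝ}
    (hZ : ∀ z, Z ≤ z → psiAvg n i₀ (locQ c a₀ b₀ q') z ≤ -1) (hz : Z ≤ z) :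
    ∫ v, cbump e v * psiAvg n i₀ (locQ c a₀ b₀ q') (z + log |dzero v| / 2) ≤ -∫ v, cbump e v := by
  have hi : Integrable fun v => cbump e v := (cbump e).continuous.integrable_of_hasCompactSupport (cbump e).hasCompactSupport
  have h1 := (integrable_prod_locQ (q' := q') (i₀ := i₀) hn hPG he z).integral_prod_right
  rw [← integral_neg]
  refine integral_mono (h1.congr (ae_of_all _ fun v => ?_)) hi.neg fun v => ?_
  · simp only
    rw [psiAvg, ← integral_const_mul]
    congr 1
    ext y
    rw [show nuW n y + z + log |dzero v| / 2 = z + log |dzero v| / 2 + nuW n y by ring]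
    ring
  · simp only
    by_cases hx : v ∈ Metric.closedBall (![-e, 0] : Fin 2 → ℝ) (1 / 8)
    · have := mul_le_mul_of_nonneg_left (hZ (z + log |dzero v| / 2) (by linarith [(log_dzero_bounds he hx).2.1]))
        ((cbump e).nonneg (x := v))
      linarith
    · rw [cbump_eq_zero hx, zero_mul, neg_zero]

lemma integral_cbump_pos (e : ℝ) : 0 < ∫ v, cbump e v := (cbump e).integral_pos

lemma exists_integral_famSum_neg (hq' : q' ≠ 0) (hΔ : cubicDisc c a₀ b₀ ≠ 0) (hd : (cubicDisc c a₀ b₀).natAbs ∣ q')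
    (hn : ∀ i, 0 < n i) (h1 : n i₀ = 1) (hPG : PolyGrowth (CubicOrder c a₀ b₀)) {e : ℝ} (he : e = 1 ∨ e = -1)
    (hdom : ∀ a b : ℤ, (modulus c a₀ b₀ q' : ℤ) ∣ a - a₀ → (modulus c a₀ b₀ q' : ℤ) ∣ b - b₀ → IsDomain (CubicOrder c a b))
    (hint : ∀ T : ℝ, 0 < T → Integrable fun y => psiW n i₀ y * (exp (nuW n y / 2) * famSum c a₀ b₀ (modulus c a₀ b₀ q') e T (nuW n y))) :
    ∃ T : ℝ, 0 < T ∧ ∫ y, psiW n i₀ y * (exp (nuW n y / 2) * famSum c a₀ b₀ (modulus c a₀ b₀ q') e T (nuW n y)) < 0 := by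
  obtain ⟨C, hC, h⟩ := exists_famSum_error hq' hΔ hd hPG he hdom
  set q := modulus c a₀ b₀ q'
  have hq0 : 0 < q := modulus_pos hq' hΔ
  obtain ⟨Z, hZ⟩ := psiAvg_superPS_le (κ := locW c a₀ b₀ q') (N := locN q') locW_nonneg one_le_locN (summable_locW hPG) hn h1
    (S := q'.primeFactors) (fun l hl => Nat.prime_of_mem_primeFactors hl)
    (j₀ := (⟨1, Nat.mem_factoredNumbers'.mpr fun p hp h => absurd (Nat.dvd_one.mp h) hp.ne_one⟩,
      ⟨1, one_mem_Cop fun l hl => Nat.prime_of_mem_primeFactors hl⟩)) (by simp [locW, aN_one]) (by simp [locN]) (-1)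
  set c₀ := ∫ v, cbump e v
  have hc₀0 : 0 < c₀ := integral_cbump_pos e
  set M := C * (absMom n i₀ (1 / 2) + absMom n i₀ (9 / 2)) with hM
  have hbound : ∀ T : ℝ, 1 ≤ T → Z ≤ 3 * log T →
      ∫ y, psiW n i₀ y * (exp (nuW n y / 2) * famSum c a₀ b₀ q e T (nuW n y)) ≤
        exp (4.8 * log T) * (M - c₀ / q ^ 2 * exp (0.2 * log T)) := by
    intro T hT hZT
    have hT0 : 0 < T := by linarith
    set g : (ι → ℝ) → ℝ := fun y => psiW n i₀ y * (exp (nuW n y / 2) *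
      ∫ v, cbump e v * locQ c a₀ b₀ q' (nuW n y + 3 * log T + log |dzero v| / 2)) with hg
    have hgi : Integrable g := by
      refine (integrable_prod_locQ (q' := q') (i₀ := i₀) hn hPG he (3 * log T)).integral_prod_left.congr (ae_of_all _ fun y => ?_)
      simp only [hg]
      rw [integral_const_mul, integral_const_mul]
    have hgle : ∫ y, g y ≤ -c₀ := by
      rw [hg, integral_swap_locQ hn hPG he]
      exact integral_cbump_locQ_le hn hPG he hZ hZT
    have herr : ‖∫ y, (psiW n i₀ y * (exp (nuW n y / 2) * famSum c a₀ b₀ q e T (nuW n y)) - T ^ 5 / (q : ℝ) ^ 2 * g y)‖ ≤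
        ∫ y, C * exp (4.8 * log T) * (|psiW n i₀ y| * exp (1 / 2 * nuW n y) + |psiW n i₀ y| * exp (9 / 2 * nuW n y)) := by
      refine norm_integral_le_of_norm_le (f := fun y => psiW n i₀ y * (exp (nuW n y / 2) * famSum c a₀ b₀ q e T (nuW n y)) -
        T ^ 5 / (q : ℝ) ^ 2 * g y) (((integrable_abs_psiW n i₀ hn (by norm_num)).add (integrable_abs_psiW n i₀ hn (by norm_num))).const_mul _)
        (ae_of_all _ fun y => ?_)
      have hy := h T hT (nuW n y)
      calc _ = |psiW n i₀ y| * exp (nuW n y / 2) * |famSum c a₀ b₀ q e T (nuW n y) - T ^ 5 / (q : ℝ) ^ 2 *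
            ∫ v, cbump e v * locQ c a₀ b₀ q' (nuW n y + 3 * log T + log |dzero v| / 2)| := by
            rw [← abs_of_nonneg (exp_pos (nuW n y / 2)).le, ← abs_mul, ← abs_mul, norm_eq_abs,
              abs_of_nonneg (exp_pos (nuW n y / 2)).le]
            congr 1
            simp only [hg]
            ring
        _ ≤ |psiW n i₀ y| * exp (nuW n y / 2) * (C * (exp (4.8 * log T) * (1 + exp (4 * nuW n y)))) := by gcongr
        _ = _ := by
          rw [show (9 / 2 : ℝ) * nuW n y = nuW n y / 2 + 4 * nuW n y by ring, exp_add,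
            show (1 / 2 : ℝ) * nuW n y = nuW n y / 2 by ring]
          ring
    rw [integral_sub (hint T hT0) (hgi.const_mul _), integral_const_mul, integral_const_mul,
      integral_add (integrable_abs_psiW n i₀ hn (by norm_num)) (integrable_abs_psiW n i₀ hn (by norm_num))] at herr
    have h5 : T ^ 5 = exp (4.8 * log T) * exp (0.2 * log T) := by
      rw [← exp_add, ← add_mul, show (4.8 + 0.2 : ℝ) = (5 : ℕ) by norm_num, exp_nat_mul, exp_log hT0]
    have h6 := (le_abs_self _).trans herr
    have h7 : T ^ 5 / (q : ℝ) ^ 2 * ∫ y, g y ≤ T ^ 5 / (q : ℝ) ^ 2 * (-c₀) := mul_le_mul_of_nonneg_left hgle (by positivity)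
    rw [h5] at h6 h7
    change _ ≤ C * exp (4.8 * log T) * (absMom n i₀ (1 / 2) + absMom n i₀ (9 / 2)) at h6
    calc _ ≤ C * exp (4.8 * log T) * (absMom n i₀ (1 / 2) + absMom n i₀ (9 / 2)) +
          exp (4.8 * log T) * exp (0.2 * log T) / (q : ℝ) ^ 2 * (-c₀) := by linarith
      _ = _ := by rw [hM]; ring
  have hlim : Tendsto (fun T : ℝ => c₀ / q ^ 2 * exp (0.2 * log T)) atTop atTop := by
    refine Tendsto.const_mul_atTop (by positivity) (Real.tendsto_exp_atTop.comp ?_)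
    exact Tendsto.const_mul_atTop (by norm_num) Real.tendsto_log_atTop
  have hlim2 : Tendsto (fun T : ℝ => 3 * log T) atTop atTop := Real.tendsto_log_atTop.const_mul_atTop (by norm_num)
  obtain ⟨T, hT1, hT2, hT3⟩ := ((eventually_ge_atTop 1).and ((hlim2.eventually_ge_atTop Z).and (hlim.eventually_gt_atTop M))).exists
  refine ⟨T, by linarith, (hbound T hT1 hT2).trans_lt ?_⟩
  exact mul_neg_of_pos_of_neg (exp_pos _) (by linarith)

/-- Some member of a congruence class of cubics has a negative truncated central integral. -/
lemma exists_negative (hq' : q' ≠ 0) (hΔ : cubicDisc c a₀ b₀ ≠ 0) (hd : (cubicDisc c a₀ b₀).natAbs ∣ q')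
    (hn : ∀ i, 0 < n i) (h1 : n i₀ = 1) (hPG : PolyGrowth (CubicOrder c a₀ b₀)) {e : ℝ} (he : e = 1 ∨ e = -1)
    (hdom : ∀ a b : ℤ, (modulus c a₀ b₀ q' : ℤ) ∣ a - a₀ → (modulus c a₀ b₀ q' : ℤ) ∣ b - b₀ → IsDomain (CubicOrder c a b)) :
    ∃ a b : ℤ, (modulus c a₀ b₀ q' : ℤ) ∣ a - a₀ ∧ (modulus c a₀ b₀ q' : ℤ) ∣ b - b₀ ∧ 0 < e * ((cubicDisc c a b : ℤ) : ℝ) ∧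
      ∫ y, psiW n i₀ y * (exp (nuW n y / 2) * WS (CubicOrder c a b) (log |((cubicDisc c a b : ℤ) : ℝ)| / 2 + nuW n y)) < 0 := by
  have hq0 : 0 < modulus c a₀ b₀ q' := modulus_pos hq' hΔ
  set q := modulus c a₀ b₀ q'
  have hterm : ∀ j : ℤ × ℤ, Integrable fun y => psiW n i₀ y * (exp (nuW n y / 2) * WS (CubicOrder c (a₀ + q * j.1) (b₀ + q * j.2))
      (log |((cubicDisc c (a₀ + q * j.1) (b₀ + q * j.2) : ℤ) : ℝ)| / 2 + nuW n y)) := by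
    intro j
    have hO := isCubicOrder_adjoinRoot c (a₀ + q * j.1) (b₀ + q * j.2)
    have := hO.charZero
    have := hdom (a₀ + q * j.1) (b₀ + q * j.2) (by simp) (by simp)
    exact integrable_psiW_WS n i₀ hn (aN_le hO.basis) _
  have hexp : ∀ T : ℝ, 0 < T → ∃ E : Finset (ℤ × ℤ), ∀ y, psiW n i₀ y * (exp (nuW n y / 2) * famSum c a₀ b₀ q e T (nuW n y)) =
      ∑ j ∈ E, cbump e (cpt c T (a₀ + q * j.1) (b₀ + q * j.2)) *
        (psiW n i₀ y * (exp (nuW n y / 2) * WS (CubicOrder c (a₀ + q * j.1) (b₀ + q * j.2))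
          (log |((cubicDisc c (a₀ + q * j.1) (b₀ + q * j.2) : ℤ) : ℝ)| / 2 + nuW n y))) := by
    intro T hT
    obtain ⟨E, hE⟩ := exists_support_finset c a₀ b₀ hq0 he hT
    refine ⟨E, fun y => ?_⟩
    rw [famSum, tsum_eq_sum (s := E) (fun j hj => by rw [hE j hj, zero_mul]), mul_sum, mul_sum]
    refine sum_congr rfl fun j _ => ?_
    rw [add_comm (nuW n y)]
    ring
  obtain ⟨T, hT, hneg⟩ := exists_integral_famSum_neg hq' hΔ hd hn h1 hPG he hdom fun T hT => by
    obtain ⟨E, hE⟩ := hexp T hT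
    rw [funext hE]
    exact integrable_finsetSum _ fun j _ => (hterm j).const_mul _
  obtain ⟨E, hE⟩ := hexp T hT
  rw [integral_congr_ae (ae_of_all _ hE), integral_finsetSum _ fun j _ => (hterm j).const_mul _] at hneg
  obtain ⟨j, -, hj⟩ := Finset.exists_lt_of_sum_lt (hneg.trans_eq Finset.sum_const_zero.symm)
  rw [integral_const_mul] at hj
  have hcb : 0 ≤ cbump e (cpt c T (a₀ + q * j.1) (b₀ + q * j.2)) := (cbump e).nonneg
  refine ⟨a₀ + q * j.1, b₀ + q * j.2, by simp, by simp, ?_, neg_of_mul_neg_right hj hcb⟩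
  have hx : cpt c T (a₀ + q * j.1) (b₀ + q * j.2) ∈ Metric.closedBall (![-e, 0] : Fin 2 → ℝ) (1 / 8) := by
    by_contra hx
    rw [cbump_eq_zero hx, zero_mul] at hj
    exact lt_irrefl _ hj
  rw [cubicDisc_eq_dzero _ _ _ hT, mul_left_comm]
  have := (dzero_bounds he hx).1
  positivity

end

end

section
open Ideal Module

section PrimesAbove

variable {O : Type*} [CommRing O] [IsDedekindDomain O] [Module.Free ℤ O] [Module.Finite ℤ O]
  [CharZero O] {p : ℕ}

lemma dvd_of_intCast_mem (hp : p.Prime) {P : Ideal O} (hP : P ≠ ⊤) (h : (p : O) ∈ P) {n : ℤ}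
    (hn : (n : O) ∈ P) : (p : ℤ) ∣ n := by
  by_contra h'
  obtain ⟨u, v, e⟩ := (Nat.prime_iff_prime_int.1 hp).irreducible.coprime_iff_not_dvd.2 h'
  apply hP
  rw [Ideal.eq_top_iff_one]
  have := congrArg (Int.cast : ℤ → O) e
  push_cast at this
  rw [← this]
  exact add_mem (P.mul_mem_left _ h) (P.mul_mem_left _ hn)

lemma intCast_mem {P : Ideal O} (h : (p : O) ∈ P) {n : ℤ} (hn : (p : ℤ) ∣ n) : (n : O) ∈ P := by
  obtain ⟨k, rfl⟩ := hn
  push_cast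
  exact P.mul_mem_right _ h

lemma ne_bot_of_mem (hp : p.Prime) {P : Ideal O} (h : (p : O) ∈ P) : P ≠ ⊥ := by
  rintro rfl
  exact hp.ne_zero (by simpa using h)

lemma exists_absNorm_eq_pow (hp : p.Prime) {P : Ideal O} (hP : P.IsPrime) (h : (p : O) ∈ P) :
    ∃ n, 0 < n ∧ absNorm P = p ^ n := by
  have : P.IsMaximal := hP.isMaximal (ne_bot_of_mem hp h)
  obtain ⟨q, n, hn, hq, hqp, e⟩ := exists_prime_and_absNorm_eq_pow P
  have := dvd_of_intCast_mem hp hP.ne_top h (n := q) (by simpa using hq)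
  rw [(Nat.prime_dvd_prime_iff_eq hp hqp).1 (by exact_mod_cast this)]
  exact ⟨n, hn, e⟩

lemma eq_of_dvd_of_absNorm_eq {I J : Ideal O} (h : I ∣ J) (hJ : absNorm J ≠ 0)
    (e : absNorm I = absNorm J) : I = J := by
  obtain ⟨L, rfl⟩ := h
  rw [map_mul] at e hJ
  have : absNorm L = 1 := Nat.eq_of_mul_eq_mul_left (Nat.pos_of_ne_zero (left_ne_zero_of_mul hJ))
    (by rw [← e, mul_one])
  rw [absNorm_eq_one_iff.1 this, Ideal.mul_top]

lemma mul_dvd_of_prime_ne {P Q I : Ideal O} (hP : P.IsPrime) (hQ : Q.IsPrime) (hP0 : P ≠ ⊥)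
    (hQ0 : Q ≠ ⊥) (h : P ≠ Q) (h1 : P ∣ I) (h2 : Q ∣ I) : P * Q ∣ I := by
  obtain ⟨J, rfl⟩ := h1
  refine mul_dvd_mul_left P (((Ideal.prime_of_isPrime hQ0 hQ).dvd_or_dvd h2).resolve_left ?_)
  intro h3
  exact h ((hP.isMaximal hP0).eq_of_le hQ.ne_top (Ideal.dvd_iff_le.1 h3))

lemma isPrime_and_mem (hp : p.Prime) {P : Ideal O} (h : absNorm P = p) :
    P.IsPrime ∧ (p : O) ∈ P :=
  ⟨isPrime_of_irreducible_absNorm (h ▸ hp), h ▸ absNorm_mem P⟩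

lemma sq_dvd_norm {P Q : Ideal O} {α : O} (hP : p ∣ absNorm P) (hQ : p ∣ absNorm Q)
    (h : P * Q ∣ span {α}) : ((p : ℤ) ^ 2) ∣ Algebra.norm ℤ α := by
  have := absNorm_dvd_absNorm_of_le (Ideal.dvd_iff_le.1 h)
  rw [map_mul, absNorm_span_singleton] at this
  rw [← Int.dvd_natAbs]
  exact_mod_cast (pow_two p ▸ mul_dvd_mul hP hQ).trans this

/-- If `p` divides the norm of `α` exactly once, a unique prime above `p` contains `α`. -/
lemma exists_prime_of_norm (hp : p.Prime) {α : O} (h1 : (p : ℤ) ∣ Algebra.norm ℤ α)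
    (h2 : ¬ ((p : ℤ) ^ 2) ∣ Algebra.norm ℤ α) :
    ∃ P : Ideal O, absNorm P = p ∧ α ∈ P ∧
      ∀ Q : Ideal O, Q.IsPrime → (p : O) ∈ Q → α ∈ Q → Q = P := by
  obtain ⟨P, hPm, hPu, hPd⟩ := exists_isMaximal_dvd_of_dvd_absNorm' hp (span {α})
    (by rw [absNorm_span_singleton]; exact_mod_cast Int.dvd_natAbs.2 h1)
  have hpP : (p : O) ∈ P := by
    have : (p : ℤ) ∈ P.under ℤ := hPu ▸ Ideal.mem_span_singleton_self _
    simpa using this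
  obtain ⟨n, hn, hPn⟩ := exists_absNorm_eq_pow hp hPm.isPrime hpP
  have hn1 : n = 1 := by
    by_contra hn1
    apply h2
    have := absNorm_dvd_absNorm_of_le (Ideal.dvd_iff_le.1 hPd)
    rw [hPn, absNorm_span_singleton] at this
    rw [← Int.dvd_natAbs]
    exact_mod_cast (pow_dvd_pow p (by omega : 2 ≤ n)).trans this
  refine ⟨P, by rw [hPn, hn1, pow_one], (Ideal.dvd_span_singleton).1 hPd, fun Q hQ hpQ hα => ?_⟩
  by_contra hne
  obtain ⟨m, hm, hQm⟩ := exists_absNorm_eq_pow hp hQ hpQ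
  exact h2 (sq_dvd_norm (hQm ▸ dvd_pow_self p hm.ne') (hPn ▸ dvd_pow_self p hn.ne')
    (mul_dvd_of_prime_ne hQ hPm.isPrime (ne_bot_of_mem hp hpQ) (ne_bot_of_mem hp hpP) hne
      (Ideal.dvd_span_singleton.2 hα) hPd))

lemma exists_int_sub_mem (hp : p.Prime) {P : Ideal O} (h : absNorm P = p) (x : O) :
    ∃ r : ℤ, x - r ∈ P := by
  obtain ⟨hP, hpP⟩ := isPrime_and_mem hp h
  have hc : Nat.card (O ⧸ P) = p := h
  have := Fact.mk hp
  have : CharP (O ⧸ P) p := by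
    refine ⟨fun n => ?_⟩
    have e : ((n : ℕ) : O ⧸ P) = Ideal.Quotient.mk P (n : O) := by simp
    rw [e, Ideal.Quotient.eq_zero_iff_mem]
    constructor
    · intro hn
      exact_mod_cast dvd_of_intCast_mem hp hP.ne_top hpP (n := n) (by simpa using hn)
    · intro hn
      simpa using intCast_mem hpP (n := n) (by exact_mod_cast hn)
  have : Finite (O ⧸ P) := Nat.finite_of_card_ne_zero (hc ▸ hp.ne_zero)
  have := Fintype.ofFinite (O ⧸ P)
  obtain ⟨z, hz⟩ := ((Fintype.bijective_iff_injective_and_card _).2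
    ⟨(ZMod.castHom (dvd_refl p) (O ⧸ P)).injective, by
      rw [ZMod.card, ← Nat.card_eq_fintype_card, hc]⟩).surjective (Ideal.Quotient.mk P x)
  obtain ⟨r, rfl⟩ := ZMod.intCast_surjective z
  refine ⟨r, (Ideal.Quotient.eq).1 ?_⟩
  rw [← hz]
  simp

end PrimesAbove

/-- `θ` is a root of `X³ + cX² + aX + b`, and this is its characteristic polynomial. -/
structure IsCubicGen {O : Type*} [CommRing O] (θ : O) (c a b : ℤ) : Prop where
  rel : θ ^ 3 + c * θ ^ 2 + a * θ + b = 0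
  norm : ∀ r : ℤ, Algebra.norm ℤ (θ - r) = -(r ^ 3 + c * r ^ 2 + a * r + b)
  finrank : finrank ℤ O = 3

namespace IsCubicGen

variable {O : Type*} [CommRing O] [IsDedekindDomain O] [Module.Free ℤ O] [Module.Finite ℤ O]
  [CharZero O] {p : ℕ} {θ : O} {c a b : ℤ} (h : IsCubicGen θ c a b)
include h

lemma absNorm_span (p : ℕ) : absNorm (span {(p : O)}) = p ^ 3 := by
  rw [absNorm_span_natCast, h.finrank]

/-- A prime of norm `p` contains `θ - r` for some root `r` of the polynomial modulo `p`. -/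
lemma exists_root (hp : p.Prime) {P : Ideal O} (hP : absNorm P = p) :
    ∃ r : ℤ, θ - r ∈ P ∧ (p : ℤ) ∣ r ^ 3 + c * r ^ 2 + a * r + b := by
  obtain ⟨r, hr⟩ := exists_int_sub_mem hp hP θ
  obtain ⟨hP', hpP⟩ := isPrime_and_mem hp hP
  refine ⟨r, hr, dvd_of_intCast_mem hp hP'.ne_top hpP ?_⟩
  push_cast
  have e : (r : O) ^ 3 + c * r ^ 2 + a * r + b
      = -((θ ^ 2 + θ * r + r ^ 2 + c * (θ + r) + a) * (θ - r)) := by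
    linear_combination h.rel
  rw [e]
  exact neg_mem (P.mul_mem_left _ hr)

/-- A prime of norm `p` at a simple root is unramified, if `p` exactly divides the value. -/
lemma not_sq_dvd (hp : p.Prime) {P : Ideal O} (hP : absNorm P = p) {r : ℤ} (hr : θ - r ∈ P)
    (h1 : (p : ℤ) ∣ r ^ 3 + c * r ^ 2 + a * r + b)
    (h2 : ¬ ((p : ℤ) ^ 2) ∣ r ^ 3 + c * r ^ 2 + a * r + b)
    (h3 : ¬ (p : ℤ) ∣ 3 * r ^ 2 + 2 * c * r + a) : ¬ P ^ 2 ∣ span {(p : O)} := by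
  intro hd
  obtain ⟨hP', hpP⟩ := isPrime_and_mem hp hP
  rw [Ideal.dvd_span_singleton] at hd
  have hm := intCast_mem hd h1
  push_cast at hm
  have e : (θ - r) * (θ ^ 2 + θ * r + r ^ 2 + c * (θ + r) + a)
      = -((r : O) ^ 3 + c * r ^ 2 + a * r + b) := by
    linear_combination h.rel
  have h4 : θ ^ 2 + θ * r + r ^ 2 + c * (θ + r) + a ∉ P := by
    intro h5
    apply h3
    refine dvd_of_intCast_mem hp hP'.ne_top hpP ?_
    push_cast
    have := sub_mem h5 (P.mul_mem_left (θ + 2 * r + c) hr)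
    convert this using 1
    ring
  have h5 : θ - r ∈ P ^ 2 := by
    by_contra h5
    exact h4 (Ideal.mem_prime_of_mul_mem_pow (ne_bot_of_mem hp hpP) (i := 1) h5
      (by rw [e]; exact neg_mem hm))
  apply h2
  rw [← dvd_neg, ← h.norm]
  exact sq_dvd_norm hP.symm.dvd hP.symm.dvd (by rwa [← pow_two, Ideal.dvd_span_singleton])

end IsCubicGen

end

section
open Ideal Module

variable {O : Type*} [CommRing O] [IsDedekindDomain O] [Module.Free ℤ O] [Module.Finite ℤ O]
  [CharZero O] {p : ℕ} {θ : O} {c a b : ℤ}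

lemma exists_prime_dvd (hp : p.Prime) {J : Ideal O} {k : ℕ} (hk : k ≠ 0) (hJ : absNorm J = p ^ k) :
    ∃ Q : Ideal O, Q.IsPrime ∧ (p : O) ∈ Q ∧ Q ∣ J ∧ ∃ n, 0 < n ∧ n ≤ k ∧ absNorm Q = p ^ n := by
  obtain ⟨Q, hQm, hQu, hQd⟩ := exists_isMaximal_dvd_of_dvd_absNorm' hp J (hJ ▸ dvd_pow_self p hk)
  have hpQ : (p : O) ∈ Q := by
    have : (p : ℤ) ∈ Q.under ℤ := hQu ▸ Ideal.mem_span_singleton_self _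
    simpa using this
  obtain ⟨n, hn, hQn⟩ := exists_absNorm_eq_pow hp hQm.isPrime hpQ
  refine ⟨Q, hQm.isPrime, hpQ, hQd, n, hn, ?_, hQn⟩
  have := absNorm_dvd_absNorm_of_le (Ideal.dvd_iff_le.1 hQd)
  rwa [hQn, hJ, Nat.pow_dvd_pow_iff_le_right hp.one_lt] at this

lemma exists_cofactor (hp : p.Prime) {P I : Ideal O} {i j : ℕ} (hP : absNorm P = p ^ i)
    (hI : absNorm I = p ^ (i + j)) (hd : P ∣ I) : ∃ J, I = P * J ∧ absNorm J = p ^ j := by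
  obtain ⟨J, rfl⟩ := hd
  refine ⟨J, rfl, ?_⟩
  rw [map_mul, hP, pow_add] at hI
  exact Nat.eq_of_mul_eq_mul_left (pow_pos hp.pos i) hI

namespace IsCubicGen

variable (h : IsCubicGen θ c a b)
include h

lemma exists_prime_at (hp : p.Prime) {r : ℤ} (h1 : (p : ℤ) ∣ r ^ 3 + c * r ^ 2 + a * r + b)
    (h2 : ¬ ((p : ℤ) ^ 2) ∣ r ^ 3 + c * r ^ 2 + a * r + b) :
    ∃ P : Ideal O, absNorm P = p ∧ θ - r ∈ P ∧
      ∀ Q : Ideal O, Q.IsPrime → (p : O) ∈ Q → θ - r ∈ Q → Q = P :=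
  exists_prime_of_norm hp (by rwa [h.norm, dvd_neg]) (by rwa [h.norm, dvd_neg])

lemma split_of_ne (hp : p.Prime) {P₁ P₂ P₃ : Ideal O} (h1 : absNorm P₁ = p) (h2 : absNorm P₂ = p)
    (h3 : absNorm P₃ = p) (h12 : P₁ ≠ P₂) (h13 : P₁ ≠ P₃) (h23 : P₂ ≠ P₃) :
    ∃ P₁ P₂ P₃ : Ideal O, P₁.IsPrime ∧ P₂.IsPrime ∧ P₃.IsPrime ∧ P₁ ≠ P₂ ∧ P₁ ≠ P₃ ∧ P₂ ≠ P₃ ∧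
      absNorm P₁ = p ∧ absNorm P₂ = p ∧ absNorm P₃ = p ∧ span {(p : O)} = P₁ * P₂ * P₃ := by
  obtain ⟨i1, m1⟩ := isPrime_and_mem hp h1
  obtain ⟨i2, m2⟩ := isPrime_and_mem hp h2
  obtain ⟨i3, m3⟩ := isPrime_and_mem hp h3
  have hb := fun {P : Ideal O} (hm : (p : O) ∈ P) => ne_bot_of_mem hp hm
  refine ⟨P₁, P₂, P₃, i1, i2, i3, h12, h13, h23, h1, h2, h3, ?_⟩
  obtain ⟨J, hJ⟩ := mul_dvd_of_prime_ne i1 i2 (hb m1) (hb m2) h12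
    (Ideal.dvd_span_singleton.2 m1) (Ideal.dvd_span_singleton.2 m2)
  have h3J : P₃ ∣ P₁ * P₂ * J := hJ ▸ Ideal.dvd_span_singleton.2 m3
  have hq := Ideal.prime_of_isPrime (hb m3) i3
  symm
  refine eq_of_dvd_of_absNorm_eq ?_ ?_ ?_
  · rw [hJ]
    refine mul_dvd_mul_left _ ((hq.dvd_or_dvd h3J).resolve_left fun h4 => ?_)
    rcases hq.dvd_or_dvd h4 with h4 | h4
    · exact h13 ((i1.isMaximal (hb m1)).eq_of_le i3.ne_top (Ideal.dvd_iff_le.1 h4))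
    · exact h23 ((i2.isMaximal (hb m2)).eq_of_le i3.ne_top (Ideal.dvd_iff_le.1 h4))
  · rw [h.absNorm_span]
    exact pow_ne_zero 3 hp.ne_zero
  · rw [h.absNorm_span, map_mul, map_mul, h1, h2, h3]
    ring

lemma t12 (hp : p.Prime) (h1 : (p : ℤ) ∣ b) (h2 : ¬ ((p : ℤ) ^ 2) ∣ b)
    (h3 : ∀ r : ℤ, ¬ (p : ℤ) ∣ r ^ 2 + c * r + a) :
    ∃ P₁ P₂ : Ideal O, P₁.IsPrime ∧ P₂.IsPrime ∧ P₁ ≠ P₂ ∧ absNorm P₁ = p ∧ absNorm P₂ = p ^ 2 ∧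
      span {(p : O)} = P₁ * P₂ := by
  obtain ⟨P, hP, hθ, hu⟩ := h.exists_prime_at hp (r := 0) (by simpa using h1) (by simpa using h2)
  obtain ⟨hP', hpP⟩ := isPrime_and_mem hp hP
  obtain ⟨J, hJ, hJn⟩ := exists_cofactor hp (i := 1) (j := 2) (by rw [hP, pow_one])
    (h.absNorm_span p) (Ideal.dvd_span_singleton.2 hpP)
  obtain ⟨Q, hQ, hpQ, hQJ, n, hn, hn2, hQn⟩ := exists_prime_dvd hp two_ne_zero hJn
  obtain rfl | rfl : n = 1 ∨ n = 2 := by omega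
  · exfalso
    rw [pow_one] at hQn
    obtain ⟨r, hr, hr'⟩ := h.exists_root hp hQn
    have hr0 : (p : ℤ) ∣ r := by
      have : (p : ℤ) ∣ r * (r ^ 2 + c * r + a) := (dvd_sub hr' h1).trans (dvd_of_eq (by ring))
      exact ((Nat.prime_iff_prime_int.1 hp).dvd_or_dvd this).resolve_right (h3 r)
    have hQP : Q = P := hu Q hQ hpQ (by simpa using add_mem hr (intCast_mem hpQ hr0))
    refine h.not_sq_dvd hp hP hθ (by simpa using h1) (by simpa using h2) (by simpa using h3 0) ?_
    rw [hJ, pow_two]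
    exact mul_dvd_mul_left P (hQP ▸ hQJ)
  · have hQ' := eq_of_dvd_of_absNorm_eq hQJ (hJn ▸ pow_ne_zero 2 hp.ne_zero) (hQn.trans hJn.symm)
    refine ⟨P, J, hP', hQ' ▸ hQ, ?_, hP, hJn, hJ⟩
    rintro rfl
    exact hp.one_lt.ne (Nat.eq_of_mul_eq_mul_left hp.pos (by rw [← pow_two, ← hJn, hP, mul_one]))

lemma t3 (hp : p.Prime) (h3 : ∀ r : ℤ, ¬ (p : ℤ) ∣ r ^ 3 + c * r ^ 2 + a * r + b) :
    ∃ P : Ideal O, P.IsPrime ∧ absNorm P = p ^ 3 ∧ span {(p : O)} = P := by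
  have hno : ∀ P : Ideal O, absNorm P ≠ p ^ 1 := fun P hP => by
    obtain ⟨r, -, hr⟩ := h.exists_root hp (by rwa [pow_one] at hP)
    exact h3 r hr
  obtain ⟨Q, hQ, hpQ, hQJ, n, hn, hn2, hQn⟩ := exists_prime_dvd hp three_ne_zero (h.absNorm_span p)
  obtain rfl | rfl | rfl : n = 1 ∨ n = 2 ∨ n = 3 := by omega
  · exact absurd hQn (hno Q)
  · obtain ⟨J, -, hJ⟩ := exists_cofactor hp (j := 1) hQn (h.absNorm_span p) hQJ
    exact absurd hJ (hno J)
  · exact ⟨Q, hQ, hQn, (eq_of_dvd_of_absNorm_eq hQJ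
      (h.absNorm_span p ▸ pow_ne_zero 3 hp.ne_zero) (hQn.trans (h.absNorm_span p).symm)).symm⟩

lemma t121 (hp : p.Prime) (h1 : (p : ℤ) ∣ b) (h2 : ¬ ((p : ℤ) ^ 2) ∣ b)
    (h3 : (p : ℤ) ∣ 1 + c + a + b) (h4 : ¬ ((p : ℤ) ^ 2) ∣ 1 + c + a + b)
    (h5 : (p : ℤ) ∣ c + 1) (h6 : (p : ℤ) ∣ a) :
    ∃ P₁ P₂ : Ideal O, P₁.IsPrime ∧ P₂.IsPrime ∧ P₁ ≠ P₂ ∧ absNorm P₁ = p ∧ absNorm P₂ = p ∧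
      span {(p : O)} = P₁ ^ 2 * P₂ := by
  obtain ⟨P, hP, hθ, hu⟩ := h.exists_prime_at hp (r := 0) (by simpa using h1) (by simpa using h2)
  obtain ⟨P', hP', hθ', hu'⟩ := h.exists_prime_at hp (r := 1) (by simpa using h3)
    (by simpa using h4)
  obtain ⟨i, hpP⟩ := isPrime_and_mem hp hP
  obtain ⟨i', hpP'⟩ := isPrime_and_mem hp hP'
  have hne : P ≠ P' := by
    rintro rfl
    exact i.ne_top ((Ideal.eq_top_iff_one _).2 (by simpa using sub_mem hθ hθ'))
  have hd := mul_dvd_of_prime_ne i i' (ne_bot_of_mem hp hpP) (ne_bot_of_mem hp hpP') hne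
    (Ideal.dvd_span_singleton.2 hpP) (Ideal.dvd_span_singleton.2 hpP')
  obtain ⟨J, hJ, hJn⟩ := exists_cofactor hp (i := 2) (j := 1) (by rw [map_mul, hP, hP', pow_two])
    (h.absNorm_span p) hd
  rw [pow_one] at hJn
  obtain ⟨iJ, hpJ⟩ := isPrime_and_mem hp hJn
  obtain ⟨r, hr, hr'⟩ := h.exists_root hp hJn
  have hpp := Nat.prime_iff_prime_int.1 hp
  have hr1 : (p : ℤ) ∣ r ^ 2 * (r - 1) :=
    (dvd_sub (dvd_sub (dvd_sub hr' h1) (dvd_mul_of_dvd_left h6 r))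
      (dvd_mul_of_dvd_left h5 (r ^ 2))).trans (dvd_of_eq (by ring))
  refine ⟨P, P', i, i', hne, hP, hP', ?_⟩
  rcases hpp.dvd_or_dvd hr1 with hr1 | hr1
  · have : J = P := hu J iJ hpJ
      (by simpa using add_mem hr (intCast_mem hpJ (hpp.dvd_of_dvd_pow hr1)))
    rw [hJ, this]
    ring
  · have hJP : J = P' := hu' J iJ hpJ (by simpa using add_mem hr (intCast_mem hpJ hr1))
    refine absurd ?_ (h.not_sq_dvd hp hP' hθ' (by simpa using h3) (by simpa using h4) ?_)
    · rw [hJ, hJP, mul_assoc, ← pow_two]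
      exact dvd_mul_left _ _
    · intro h7
      exact hpp.not_dvd_one
        ((dvd_sub (dvd_sub h7 h6) (dvd_mul_of_dvd_right h5 2)).trans (dvd_of_eq (by ring)))

lemma t13 (hp : p.Prime) (h1 : (p : ℤ) ∣ b) (h2 : ¬ ((p : ℤ) ^ 2) ∣ b) (h3 : (p : ℤ) ∣ c)
    (h4 : (p : ℤ) ∣ a) :
    ∃ P : Ideal O, P.IsPrime ∧ absNorm P = p ∧ span {(p : O)} = P ^ 3 := by
  obtain ⟨P, hP, hθ, hu⟩ := h.exists_prime_at hp (r := 0) (by simpa using h1) (by simpa using h2)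
  obtain ⟨i, hpP⟩ := isPrime_and_mem hp hP
  have key : ∀ Q : Ideal O, Q.IsPrime → (p : O) ∈ Q → Q = P := by
    intro Q hQ hpQ
    refine hu Q hQ hpQ ?_
    rw [Int.cast_zero, sub_zero]
    refine hQ.mem_of_pow_mem 3 ?_
    rw [show θ ^ 3 = -((c : O) * θ ^ 2 + a * θ + b) by linear_combination h.rel]
    exact neg_mem (add_mem (add_mem (Q.mul_mem_right _ (intCast_mem hpQ h3))
      (Q.mul_mem_right _ (intCast_mem hpQ h4))) (intCast_mem hpQ h1))
  obtain ⟨J, hJ, hJn⟩ := exists_cofactor hp (i := 1) (j := 2) (by rw [hP, pow_one])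
    (h.absNorm_span p) (Ideal.dvd_span_singleton.2 hpP)
  obtain ⟨Q, hQ, hpQ, hQJ, -⟩ := exists_prime_dvd hp two_ne_zero hJn
  obtain ⟨L, hL, hLn⟩ := exists_cofactor hp (i := 1) (j := 1) (by rw [hP, pow_one]) hJn
    (key Q hQ hpQ ▸ hQJ)
  rw [pow_one] at hLn
  obtain ⟨iL, hpL⟩ := isPrime_and_mem hp hLn
  refine ⟨P, i, hP, ?_⟩
  rw [hJ, hL, key L iL hpL]
  ring

end IsCubicGen

end

section
open Ideal Module

namespace IsCubicGen

variable {O : Type*} [CommRing O] [IsDedekindDomain O] [Module.Free ℤ O] [Module.Finite ℤ O]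
  [CharZero O] {θ : O}

/-- For polynomials modelled on Dedekind's `X³ - X² + 2X + 8`, the element `(θ² - θ)/2` is
integral. -/
lemma exists_half {u v w : ℤ} (h : IsCubicGen θ (4 * u - 1) (4 * v + 2) (8 * w)) :
    ∃ η : O, 2 * η = θ ^ 2 - θ := by
  have h2 : (2 : FractionRing O) ≠ 0 := by
    rw [← map_ofNat (algebraMap O (FractionRing O)) 2]
    simp
  have hint : IsIntegral O ((algebraMap O (FractionRing O) (θ ^ 2 - θ)) / 2) := by
    refine (IsIntegral.tower_top (R := ℤ) ⟨cubicPoly (-(2 * ((4 * u - 1) * u - 2 * v - 1)))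
      ((2 * v + 1) * (2 * v + 2 * u + 1) - 2 * w * (8 * u + 1))
      (-(w * (4 * u + 4 * v + 2 + 8 * w))), monic_cubicPoly _ _ _, ?_⟩)
    have e := congrArg (algebraMap O (FractionRing O)) h.rel
    simp only [map_add, map_mul, map_pow, map_zero, map_intCast] at e
    push_cast at e
    simp only [cubicPoly, Polynomial.eval₂_add, Polynomial.eval₂_mul, Polynomial.eval₂_pow,
      Polynomial.eval₂_X, Polynomial.eval₂_C]
    simp only [map_sub, map_pow, eq_intCast]
    push_cast
    generalize algebraMap O (FractionRing O) θ = t at e ⊢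
    generalize (u : FractionRing O) = u at e ⊢
    generalize (v : FractionRing O) = v at e ⊢
    generalize (w : FractionRing O) = w at e ⊢
    field_simp
    linear_combination (t ^ 3 - (4 * u - 1 + 3) * t ^ 2 + (2 * (4 * u - 1) + (4 * v + 2) + 3) * t
      - (4 * u - 1 + (4 * v + 2) + 8 * w + 1)) * e
  obtain ⟨η, hη⟩ := IsIntegrallyClosed.isIntegral_iff.1 hint
  refine ⟨η, IsFractionRing.injective O (FractionRing O) ?_⟩
  rw [map_mul, hη, map_ofNat]
  field_simp

lemma t111_two {u v w : ℤ} (h : IsCubicGen θ (4 * u - 1) (4 * v + 2) (8 * w)) (hv : Even v)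
    (hw : Odd w) :
    ∃ P₁ P₂ P₃ : Ideal O, P₁.IsPrime ∧ P₂.IsPrime ∧ P₃.IsPrime ∧ P₁ ≠ P₂ ∧ P₁ ≠ P₃ ∧ P₂ ≠ P₃ ∧
      absNorm P₁ = 2 ∧ absNorm P₂ = 2 ∧ absNorm P₃ = 2 ∧
      span {((2 : ℕ) : O)} = P₁ * P₂ * P₃ := by
  obtain ⟨η, hη⟩ := h.exists_half
  have h20 : (2 : O) ≠ 0 := two_ne_zero
  have hmul : η * θ = -(4 * u * η) - (2 * u + 2 * v + 1) * θ - 4 * w := by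
    apply mul_left_cancel₀ h20
    have := h.rel
    push_cast at this
    linear_combination (θ + 4 * u) * hη + this
  have n2 : Algebra.norm ℤ (2 : O) = 8 := by
    have := Algebra.norm_algebraMap (R := ℤ) (S := O) 2
    rwa [h.finrank, map_ofNat] at this
  have n1 := h.norm 1
  have nη : Algebra.norm ℤ η = w * (4 * u + 4 * v + 2 + 8 * w) := by
    have e : (2 : O) * η = (θ - (0 : ℤ)) * (θ - (1 : ℤ)) := by
      push_cast
      linear_combination hη
    have := congrArg (Algebra.norm ℤ) e
    rw [map_mul, map_mul, n2, h.norm, h.norm] at this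
    linarith
  have nζ : Algebra.norm ℤ (η + θ - 1)
      = (2 - 2 * u + v - w) * (-(4 * u + 4 * v + 2 + 8 * w)) := by
    have e : (2 : O) * (η + θ - 1) = (θ - (-2 : ℤ)) * (θ - (1 : ℤ)) := by
      push_cast
      linear_combination hη
    have := congrArg (Algebra.norm ℤ) e
    rw [map_mul, map_mul, n2, h.norm, h.norm] at this
    linarith
  have key : ∀ x y : ℤ, Odd x → 2 ∣ x * (2 * (2 * y + 1)) ∧ ¬ (2 : ℤ) ^ 2 ∣ x * (2 * (2 * y + 1)) := by
    rintro x y ⟨k, rfl⟩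
    refine ⟨⟨(2 * k + 1) * (2 * y + 1), by ring⟩, fun ⟨m, hm⟩ => ?_⟩
    have : 2 * (2 * k * y + k + y - m) = -1 := by linarith
    omega
  have k1 := key (-1) (u + v + 2 * w) (by decide)
  have k2 := key w (u + v + 2 * w) hw
  have k3 := key (-(2 - 2 * u + v - w)) (u + v + 2 * w) (by
    obtain ⟨m, rfl⟩ := hv
    obtain ⟨n, rfl⟩ := hw
    exact ⟨u - m + n - 1, by ring⟩)
  obtain ⟨P₁, hP₁, m₁, -⟩ := exists_prime_of_norm Nat.prime_two (α := θ - (1 : ℤ))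
    (by rw [n1]; convert k1.1 using 1; push_cast; ring)
    (by rw [n1]; convert k1.2 using 2; push_cast; ring)
  obtain ⟨P₂, hP₂, m₂, -⟩ := exists_prime_of_norm Nat.prime_two (α := η)
    (by rw [nη]; convert k2.1 using 1; push_cast; ring)
    (by rw [nη]; convert k2.2 using 2; push_cast; ring)
  obtain ⟨P₃, hP₃, m₃, -⟩ := exists_prime_of_norm Nat.prime_two (α := η + θ - 1)
    (by rw [nζ]; convert k3.1 using 1; push_cast; ring)
    (by rw [nζ]; convert k3.2 using 2; push_cast; ring)
  rw [Int.cast_one] at m₁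
  have hno : ∀ P : Ideal O, absNorm P = 2 → θ - 1 ∈ P → η ∈ P → False := by
    intro P hP hθ hη'
    obtain ⟨i, hm⟩ := isPrime_and_mem Nat.prime_two hP
    have hθ' : θ ∈ P := by
      have e : θ = (-θ - 4 * u) * η - (((2 : ℕ) : O) * ((u + v) * θ + 2 * w)) := by
        push_cast
        linear_combination hmul
      rw [e]
      exact sub_mem (P.mul_mem_left _ hη') (P.mul_mem_right _ hm)
    exact i.ne_top ((Ideal.eq_top_iff_one _).2 (by simpa using sub_mem hθ' hθ))
  refine h.split_of_ne Nat.prime_two hP₁ hP₂ hP₃ ?_ ?_ ?_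
  · rintro rfl
    exact hno _ hP₁ m₁ m₂
  · rintro rfl
    exact hno _ hP₁ m₁ (by convert sub_mem m₃ m₁ using 1; ring)
  · rintro rfl
    exact hno _ hP₂ (by convert sub_mem m₃ m₂ using 1; ring) m₂

end IsCubicGen

lemma exact_dvd {p : ℕ} (hp : p.Prime) {x : ℤ} (h : (p : ℤ) ^ 4 ∣ x - p) :
    (p : ℤ) ∣ x ∧ ¬ (p : ℤ) ^ 2 ∣ x := by
  obtain ⟨k, hk⟩ := h
  refine ⟨⟨1 + p ^ 3 * k, by linear_combination hk⟩, fun ⟨m, hm⟩ => ?_⟩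
  refine (Nat.prime_iff_prime_int.1 hp).not_dvd_one ⟨m - p ^ 2 * k, ?_⟩
  exact mul_left_cancel₀ (Nat.cast_ne_zero.2 hp.ne_zero : (p : ℤ) ≠ 0)
    (by linear_combination -hk + hm)

lemma exists_forall_add_ne {p : ℕ} (hp : p.Prime) (F : ZMod p → ZMod p) {x y : ZMod p}
    (hxy : x ≠ y) (h : F x = F y) : ∃ z : ℤ, ∀ t, F t + z ≠ 0 := by
  have := Fact.mk hp
  have hs : ¬ Surjective F := fun hs => hxy (Finite.injective_iff_surjective.2 hs h)
  obtain ⟨z, hz⟩ := not_forall.1 hs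
  obtain ⟨n, hn⟩ := ZMod.intCast_surjective (-z)
  refine ⟨n, fun t ht => hz ⟨t, ?_⟩⟩
  rw [hn] at ht
  linear_combination ht

/-- Every splitting type at `p` is forced by a congruence on the coefficients modulo `p ^ 4`. -/
lemma exists_local_data {p : ℕ} (hp : p.Prime) (τ : SplitType) : ∃ c₀ a₀ b₀ : ℤ,
    (τ = SplitType.t13 → c₀ = 0 ∧ a₀ = 0 ∧ b₀ = p) ∧ ∀ c a b : ℤ,
    (p : ℤ) ^ 4 ∣ c - c₀ → (p : ℤ) ^ 4 ∣ a - a₀ → (p : ℤ) ^ 4 ∣ b - b₀ →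
    ∀ (K : Type) [Field K] [NumberField K] (θ : 𝓞 K),
      IsCubicGen θ c a b → HasSplitType K p τ := by
  have := Fact.mk hp
  have hpp : (p : ℤ) ∣ (p : ℤ) ^ 4 := dvd_pow_self _ (by norm_num)
  have hz : ∀ {n m : ℤ}, (p : ℤ) ^ 4 ∣ n - m → (n : ZMod p) = m := fun h => by
    rw [← sub_eq_zero, ← Int.cast_sub, ZMod.intCast_zmod_eq_zero_iff_dvd]
    exact hpp.trans h
  cases τ with
  | t111 =>
    by_cases h2 : p = 2
    · subst h2
      refine ⟨-1, 2, 8, nofun, fun c a b hc ha hb K _ _ θ h => ?_⟩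
      obtain ⟨u, rfl⟩ : ∃ u, c = 4 * u - 1 := ⟨(c + 1) / 4, by norm_num at hc; omega⟩
      obtain ⟨v, rfl⟩ : ∃ v, a = 4 * v + 2 := ⟨(a - 2) / 4, by norm_num at ha; omega⟩
      obtain ⟨w, rfl⟩ : ∃ w, b = 8 * w := ⟨b / 8, by norm_num at hb; omega⟩
      exact h.t111_two (by rw [Int.even_iff]; norm_num at ha; omega)
        (by rw [Int.odd_iff]; norm_num at hb; omega)
    · refine ⟨0, -1, p, nofun, fun c a b hc ha hb K _ _ θ h => ?_⟩
      have key : ∀ r : ℤ, r ^ 3 = r → ∃ P : Ideal (𝓞 K),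
          absNorm P = p ∧ θ - r ∈ P := by
        intro r hr
        have e := exact_dvd hp (x := r ^ 3 + c * r ^ 2 + a * r + b) (by
          refine (dvd_add (dvd_add (hc.mul_right (r ^ 2)) (ha.mul_right r)) hb).trans
            (dvd_of_eq ?_)
          linear_combination -hr)
        obtain ⟨P, hP, hθ, -⟩ := h.exists_prime_at hp e.1 e.2
        exact ⟨P, hP, hθ⟩
      obtain ⟨P₁, hP₁, m₁⟩ := key 0 (by norm_num)
      obtain ⟨P₂, hP₂, m₂⟩ := key 1 (by norm_num)
      obtain ⟨P₃, hP₃, m₃⟩ := key (-1) (by norm_num)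
      have hne : ∀ {P Q : Ideal (𝓞 K)} {r s : ℤ}, absNorm P = p →
          θ - r ∈ P → θ - s ∈ Q → (s - r).natAbs ∣ 2 → P ≠ Q := by
        rintro P Q r s hP hr hs hrs rfl
        obtain ⟨i, hm⟩ := isPrime_and_mem hp hP
        have := dvd_of_intCast_mem hp i.ne_top hm (n := s - r) (by
          push_cast
          convert sub_mem hr hs using 1
          ring)
        rw [← Int.dvd_natAbs] at this
        exact h2 ((Nat.prime_dvd_prime_iff_eq hp Nat.prime_two).1
          ((Int.natCast_dvd_natCast.1 this).trans hrs))
      exact h.split_of_ne hp hP₁ hP₂ hP₃ (hne hP₁ m₁ m₂ (by decide)) (hne hP₁ m₁ m₃ (by decide))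
        (hne hP₂ m₂ m₃ (by decide))
  | t12 =>
    obtain ⟨z, hz'⟩ := exists_forall_add_ne hp (fun t => t ^ 2 + t) (x := 0) (y := -1)
      (by simp) (by ring)
    refine ⟨1, z, p, nofun, fun c a b hc ha hb K _ _ θ h => ?_⟩
    refine h.t12 hp (exact_dvd hp hb).1 (exact_dvd hp hb).2 fun r hr => hz' r ?_
    rw [← ZMod.intCast_zmod_eq_zero_iff_dvd] at hr
    push_cast [hz hc, hz ha] at hr
    linear_combination hr
  | t3 =>
    obtain ⟨z, hz'⟩ := exists_forall_add_ne hp (fun t => t ^ 3 - t) (x := 0) (y := 1)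
      (by simp) (by ring)
    refine ⟨0, -1, z, nofun, fun c a b hc ha hb K _ _ θ h => h.t3 hp fun r hr => hz' r ?_⟩
    rw [← ZMod.intCast_zmod_eq_zero_iff_dvd] at hr
    push_cast [hz hc, hz ha, hz hb] at hr
    linear_combination hr
  | t121 =>
    refine ⟨-1, 0, p, nofun, fun c a b hc ha hb K _ _ θ h => ?_⟩
    have e := exact_dvd hp (x := 1 + c + a + b)
      ((dvd_add (dvd_add hc ha) hb).trans (dvd_of_eq (by ring)))
    exact h.t121 hp (exact_dvd hp hb).1 (exact_dvd hp hb).2 e.1 e.2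
      (by simpa using hpp.trans hc) (by simpa using hpp.trans ha)
  | t13 =>
    exact ⟨0, 0, p, fun _ => ⟨rfl, rfl, rfl⟩, fun c a b hc ha hb K _ _ θ h => h.t13 hp
      (exact_dvd hp hb).1
      (exact_dvd hp hb).2 (by simpa using hpp.trans hc) (by simpa using hpp.trans ha)⟩

open NumberField

section
variable {K : Type} [Field K] [NumberField K] {p : ℕ}

lemma dvd_discr_of_t13 (hp : p.Prime) (h : HasSplitType K p SplitType.t13) :
    (p : ℤ) ∣ discr K := by
  obtain ⟨P, hP, hPn, hd⟩ := h
  have hpp := Nat.prime_iff_prime_int.1 hp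
  have : (span {(p : ℤ)}).IsMaximal :=
    ((span_singleton_prime hpp.ne_zero).2 hpp).isMaximal (by simpa using hp.ne_zero)
  have h1 := pow_sub_one_dvd_differentIdeal ℤ (p := span {(p : ℤ)}) P 3 (by simpa using hp.ne_zero)
    (by rw [← hd, Ideal.map_span, Set.image_singleton, map_natCast])
  have h2 := absNorm_dvd_absNorm_of_le (Ideal.dvd_iff_le.1 ((dvd_pow_self P two_ne_zero).trans h1))
  rw [hPn, absNorm_differentIdeal K] at h2
  exact Int.natCast_dvd.2 h2

lemma not_isGalois_of_t12 (hp : p.Prime) (h : HasSplitType K p SplitType.t12) :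
    ¬ IsGalois ℚ K := by
  intro hG
  obtain ⟨P, Q, hP, hQ, -, hPn, hQn, -⟩ := h
  have hpp := Nat.prime_iff_prime_int.1 hp
  have h1 : P.LiesOver (span {(p : ℤ)}) := (liesOver_span_iff hP.ne_top hpp).2
    (by have := absNorm_mem P; rw [hPn] at this; simpa using this)
  have h2 : Q.LiesOver (span {(p : ℤ)}) := (liesOver_span_iff hQ.ne_top hpp).2 (by
    have := absNorm_mem Q
    rw [hQn, Nat.cast_pow] at this
    simpa using hQ.mem_of_pow_mem 2 this)
  have e := inertiaDeg_eq_of_isGaloisGroup (span {(p : ℤ)}) P Q (K ≃ₐ[ℚ] K)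
  have e1 := natAbs_pow_inertiaDeg (p : ℤ) P
  have e2 := natAbs_pow_inertiaDeg (p : ℤ) Q
  rw [hPn] at e1
  rw [hQn, ← e, e1] at e2
  nlinarith [hp.one_lt]

end

lemma irreducible_cubicPoly {p : ℕ} (hp : p.Prime) {c a b : ℤ} (hc : (p : ℤ) ∣ c)
    (ha : (p : ℤ) ∣ a) (hb : (p : ℤ) ∣ b) (hb2 : ¬ (p : ℤ) ^ 2 ∣ b) :
    Irreducible (cubicPoly c a b) := by
  have hpp := Nat.prime_iff_prime_int.1 hp
  have hI := (span_singleton_prime hpp.ne_zero).2 hpp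
  refine Polynomial.IsEisensteinAt.irreducible (𝓟 := span {(p : ℤ)}) ⟨?_, ?_, ?_⟩ hI
    (monic_cubicPoly c a b).isPrimitive (by rw [natDegree_cubicPoly]; norm_num)
  · rw [(monic_cubicPoly c a b).leadingCoeff, mem_span_singleton]
    exact hpp.not_dvd_one
  · intro n hn
    rw [natDegree_cubicPoly] at hn
    rw [mem_span_singleton]
    interval_cases n <;>
      simpa [-eq_intCast, cubicPoly, Polynomial.coeff_X, Polynomial.coeff_C,
        Polynomial.coeff_X_pow]
  · rw [span_singleton_pow, mem_span_singleton]
    simpa [cubicPoly] using hb2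

lemma cubicDisc_ne_zero {p : ℕ} (hp : p.Prime) (h3 : 3 < p) {c a b : ℤ} (hc : (p : ℤ) ^ 4 ∣ c)
    (ha : (p : ℤ) ^ 4 ∣ a) (hb : (p : ℤ) ^ 4 ∣ b - p) : cubicDisc c a b ≠ 0 := by
  obtain ⟨c, rfl⟩ := hc
  obtain ⟨a, rfl⟩ := ha
  obtain ⟨k, hk⟩ := hb
  obtain rfl : b = p + p ^ 4 * k := by linarith
  intro h
  have hp0 : (p : ℤ) ^ 2 ≠ 0 := pow_ne_zero 2 (Nat.cast_ne_zero.2 hp.ne_zero)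
  have : (p : ℤ) ∣ 3 ^ 3 := by
    refine ⟨p ^ 13 * c ^ 2 * a ^ 2 - 4 * p ^ 9 * a ^ 3 - 4 * p ^ 9 * c ^ 3 * (p + p ^ 4 * k)
      - 27 * (2 * p ^ 2 * k + p ^ 5 * k ^ 2) + 18 * p ^ 5 * c * a * (p + p ^ 4 * k),
      mul_left_cancel₀ hp0 ?_⟩
    unfold cubicDisc at h
    linear_combination -h
  have := (Nat.prime_dvd_prime_iff_eq hp Nat.prime_three).1
    (hp.dvd_of_dvd_pow (by exact_mod_cast this))
  omega

lemma exists_int_crt {T : Finset ℕ} (hT : ∀ p ∈ T, p.Prime) (x : ℕ → ℤ) :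
    ∃ k : ℤ, ∀ p ∈ T, (p : ℤ) ^ 4 ∣ k - x p := by
  obtain ⟨k, hk⟩ := Nat.chineseRemainderOfFinset (fun p => (x p % (p : ℤ) ^ 4).toNat)
    (fun p => p ^ 4) T (fun p hp => pow_ne_zero 4 (hT p hp).ne_zero) (fun p hp q hq hpq =>
      ((Nat.coprime_primes (hT p hp) (hT q hq)).2 hpq).pow 4 4)
  refine ⟨k, fun p hp => ?_⟩
  have h1 := (Nat.modEq_iff_dvd.1 (hk p hp))
  have h0 : (0 : ℤ) < (p : ℤ) ^ 4 := pow_pos (by exact_mod_cast (hT p hp).pos) 4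
  rw [Int.toNat_of_nonneg (Int.emod_nonneg _ h0.ne')] at h1
  push_cast at h1
  have h2 := Int.dvd_self_sub_emod (x := x p) (m := (p : ℤ) ^ 4)
  refine (dvd_neg.2 (dvd_add h1 h2)).trans (dvd_of_eq (by ring))

/-- Congruence conditions on the coefficients forcing all the requirements except those on the
sign of the discriminant and on the central value. -/
lemma exists_coefficients (S : Finset ℕ) (hS : ∀ p ∈ S, p.Prime) (σ : ℕ → SplitType) (N : ℕ) :
    ∃ c a₀ b₀ : ℤ, ∃ Q : ℕ, Q ≠ 0 ∧ cubicDisc c a₀ b₀ ≠ 0 ∧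
      ∀ a b : ℤ, (Q : ℤ) ∣ a - a₀ → (Q : ℤ) ∣ b - b₀ → Irreducible (cubicPoly c a b) ∧
        ∀ (K : Type) [Field K] [NumberField K] (θ : 𝓞 K), IsCubicGen θ c a b →
          (∀ p ∈ S, HasSplitType K p (σ p)) ∧ (N : ℤ) < |discr K| ∧ ¬ IsGalois ℚ K := by
  obtain ⟨q₁, hq₁, hp₁⟩ := Nat.exists_infinite_primes (N + S.sup id + 4)
  obtain ⟨q₂, hq₂, hp₂⟩ := Nat.exists_infinite_primes (q₁ + 1)
  have hlt : ∀ p ∈ S, p < q₁ := fun p hp => by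
    have : p ≤ S.sup id := Finset.le_sup (f := id) hp
    omega
  have hT : ∀ p ∈ insert q₁ (insert q₂ S), p.Prime := by
    intro p hp
    simp only [Finset.mem_insert] at hp
    rcases hp with rfl | rfl | hp
    exacts [hp₁, hp₂, hS p hp]
  have hσ : ∃ σ' : ℕ → SplitType, σ' q₁ = SplitType.t13 ∧ σ' q₂ = SplitType.t12 ∧
      ∀ p ∈ S, σ' p = σ p := by
    refine ⟨fun p => if p = q₁ then SplitType.t13 else if p = q₂ then SplitType.t12 else σ p,
      by simp, by simp [show q₂ ≠ q₁ by omega], fun p hp => ?_⟩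
    have := hlt p hp
    simp [show p ≠ q₁ by omega, show p ≠ q₂ by omega]
  obtain ⟨σ', h13, h12, hσ'⟩ := hσ
  have hloc : ∀ p, ∃ x : ℤ × ℤ × ℤ, p.Prime →
      (σ' p = SplitType.t13 → x = (0, 0, (p : ℤ))) ∧ ∀ c a b : ℤ,
      (p : ℤ) ^ 4 ∣ c - x.1 → (p : ℤ) ^ 4 ∣ a - x.2.1 → (p : ℤ) ^ 4 ∣ b - x.2.2 →
      ∀ (K : Type) [Field K] [NumberField K] (θ : 𝓞 K),
        IsCubicGen θ c a b → HasSplitType K p (σ' p) := by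
    intro p
    by_cases hp : p.Prime
    · obtain ⟨c, a, b, h1, h2⟩ := exists_local_data hp (σ' p)
      exact ⟨(c, a, b), fun _ => ⟨fun h => by obtain ⟨rfl, rfl, rfl⟩ := h1 h; rfl, h2⟩⟩
    · exact ⟨0, fun h => absurd h hp⟩
  choose x hx using hloc
  obtain ⟨c, hc⟩ := exists_int_crt hT fun p => (x p).1
  obtain ⟨a₀, ha₀⟩ := exists_int_crt hT fun p => (x p).2.1
  obtain ⟨b₀, hb₀⟩ := exists_int_crt hT fun p => (x p).2.2
  set T := insert q₁ (insert q₂ S) with hTdef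
  have m₁ : q₁ ∈ T := by simp [hTdef]
  have m₂ : q₂ ∈ T := by simp [hTdef]
  have hx₁ := (hx q₁ hp₁).1 h13
  have hdvd : ∀ p ∈ T, (p : ℤ) ^ 4 ∣ ((∏ p ∈ T, p ^ 4 : ℕ) : ℤ) := fun p hp => by
    exact_mod_cast Finset.dvd_prod_of_mem (fun p => p ^ 4) hp
  have hc₁ := hc q₁ m₁
  have ha₁ := ha₀ q₁ m₁
  have hb₁ := hb₀ q₁ m₁
  simp only [hx₁, sub_zero] at hc₁ ha₁ hb₁
  refine ⟨c, a₀, b₀, ∏ p ∈ T, p ^ 4,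
    Finset.prod_ne_zero_iff.2 fun p hp => pow_ne_zero 4 (hT p hp).ne_zero,
    cubicDisc_ne_zero hp₁ (by omega) hc₁ ha₁ hb₁, fun a b ha hb => ?_⟩
  have ha' : ∀ p ∈ T, (p : ℤ) ^ 4 ∣ a - (x p).2.1 := fun p hp =>
    (dvd_add ((hdvd p hp).trans ha) (ha₀ p hp)).trans (dvd_of_eq (by ring))
  have hb' : ∀ p ∈ T, (p : ℤ) ^ 4 ∣ b - (x p).2.2 := fun p hp =>
    (dvd_add ((hdvd p hp).trans hb) (hb₀ p hp)).trans (dvd_of_eq (by ring))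
  constructor
  · have ha₂ := ha' q₁ m₁
    have hb₂ := hb' q₁ m₁
    simp only [hx₁, sub_zero] at ha₂ hb₂
    have hd : (q₁ : ℤ) ∣ (q₁ : ℤ) ^ 4 := dvd_pow_self _ (by norm_num)
    exact irreducible_cubicPoly hp₁ (hd.trans hc₁) (hd.trans ha₂) (exact_dvd hp₁ hb₂).1
      (exact_dvd hp₁ hb₂).2
  · intro K _ _ θ h
    have hK : ∀ p ∈ T, HasSplitType K p (σ' p) := fun p hp =>
      (hx p (hT p hp)).2 c a b (hc p hp) (ha' p hp) (hb' p hp) K θ h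
    refine ⟨fun p hp => hσ' p hp ▸ hK p (by simp [hTdef, hp]), ?_,
      not_isGalois_of_t12 hp₂ (h12 ▸ hK q₂ m₂)⟩
    have := Int.le_of_dvd (abs_pos.2 (discr_ne_zero K))
      ((dvd_abs _ _).2 (dvd_discr_of_t13 hp₁ (h13 ▸ hK q₁ m₁)))
    omega

end

section
open Module NumberField Polynomial

lemma eval₂_cubicPoly {A : Type*} [CommRing A] (φ : ℤ →+* A) (x : A) (c a b : ℤ) :
    eval₂ φ x (cubicPoly c a b) = x ^ 3 + c * x ^ 2 + a * x + b := by
  simp only [cubicPoly, eval₂_add, eval₂_mul, eval₂_pow, eval₂_X, eval₂_C, eq_intCast φ]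

lemma exists_numberField_root {c a b : ℤ} (hf : Irreducible (cubicPoly c a b)) :
    ∃ (K : Type) (_ : Field K) (_ : NumberField K) (x : K), finrank ℚ K = 3 ∧
      x ^ 3 + c * x ^ 2 + a * x + b = 0 ∧
      minpoly ℚ x = (cubicPoly c a b).map (Int.castRingHom ℚ) := by
  have hm := monic_cubicPoly c a b
  have hg : Irreducible ((cubicPoly c a b).map (Int.castRingHom ℚ)) :=
    (hm.irreducible_iff_irreducible_map_fraction_map (K := ℚ)).1 hf
  have hgm : ((cubicPoly c a b).map (Int.castRingHom ℚ)).Monic := hm.map _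
  have : Fact (Irreducible ((cubicPoly c a b).map (Int.castRingHom ℚ))) := ⟨hg⟩
  have hfin : Module.Finite ℚ (AdjoinRoot ((cubicPoly c a b).map (Int.castRingHom ℚ))) :=
    (AdjoinRoot.powerBasis hgm.ne_zero).finite
  have : CharZero (AdjoinRoot ((cubicPoly c a b).map (Int.castRingHom ℚ))) :=
    algebraRat.charZero _
  have hnf : NumberField (AdjoinRoot ((cubicPoly c a b).map (Int.castRingHom ℚ))) :=
    { to_charZero := inferInstance
      to_finiteDimensional := by convert hfin }
  have hrel := AdjoinRoot.eval₂_root ((cubicPoly c a b).map (Int.castRingHom ℚ))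
  rw [eval₂_map, eval₂_cubicPoly] at hrel
  refine ⟨AdjoinRoot ((cubicPoly c a b).map (Int.castRingHom ℚ)), inferInstance, hnf,
    AdjoinRoot.root _, ?_, ?_, ?_⟩
  · have := (AdjoinRoot.powerBasis hgm.ne_zero).finrank
    rw [AdjoinRoot.powerBasis_dim, hm.natDegree_map, natDegree_cubicPoly] at this
    convert this
  · exact hrel
  · refine (minpoly.eq_of_irreducible_of_monic hg ?_ hgm).symm
    rw [aeval_def, eval₂_map, eval₂_cubicPoly, hrel]

section
variable {K : Type} [Field K] [NumberField K] {c a b : ℤ} {x : K}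

lemma exists_powerBasis (h3 : finrank ℚ K = 3)
    (hm : minpoly ℚ x = (cubicPoly c a b).map (Int.castRingHom ℚ)) :
    ∃ B : Basis (Fin 3) ℚ K, ∀ i, B i = x ^ (i : ℕ) := by
  have hd : (minpoly ℚ x).natDegree = 3 := by
    rw [hm, (monic_cubicPoly c a b).natDegree_map, natDegree_cubicPoly]
  have hli := linearIndependent_pow (K := ℚ) x
  rw [hd] at hli
  refine ⟨basisOfLinearIndependentOfCardEqFinrank hli (by simp [h3]), fun i => ?_⟩
  simp

variable (B : Basis (Fin 3) ℚ K) (hB : ∀ i, B i = x ^ (i : ℕ))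
  (hx : x ^ 3 + c * x ^ 2 + a * x + b = 0)
include hB hx

lemma leftMulMatrix_root :
    Algebra.leftMulMatrix B x = !![0, 0, -(b : ℚ); 1, 0, -(a : ℚ); 0, 1, -(c : ℚ)] := by
  have e0 : x * B 0 = B 1 := by simp [hB]
  have e1 : x * B 1 = B 2 := by simp [hB, pow_two]
  have e2 : x * B 2 = (-(b : ℚ)) • B 0 + (-(a : ℚ)) • B 1 + (-(c : ℚ)) • B 2 := by
    simp only [hB, Algebra.smul_def]
    simp
    linear_combination hx
  ext i j
  rw [Algebra.leftMulMatrix_eq_repr_mul]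
  fin_cases j
  · simp only [Fin.zero_eta, e0, Basis.repr_self]
    fin_cases i <;> simp
  · simp only [Fin.mk_one, e1, Basis.repr_self]
    fin_cases i <;> simp
  · simp only [Fin.reduceFinMk, e2, map_add, map_smul, Basis.repr_self]
    fin_cases i <;> simp

lemma norm_root_sub (r : ℤ) :
    Algebra.norm ℚ (x - r) = -((r : ℚ) ^ 3 + c * r ^ 2 + a * r + b) := by
  rw [Algebra.norm_eq_matrix_det B, map_sub, leftMulMatrix_root B hB hx, map_intCast,
    Matrix.det_fin_three]
  simp [Matrix.intCast_apply]
  ring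

lemma norm_derivative :
    Algebra.norm ℚ (3 * x ^ 2 + 2 * c * x + a) = -(cubicDisc (c : ℚ) a b) := by
  rw [Algebra.norm_eq_matrix_det B, map_add, map_add, map_mul, map_mul, map_mul, map_pow,
    leftMulMatrix_root B hB hx, map_intCast, map_intCast, map_ofNat, map_ofNat,
    Matrix.det_fin_three]
  simp [Matrix.intCast_apply, Matrix.ofNat_apply, pow_two, Matrix.mul_apply, cubicDisc]
  ring

lemma exists_cubicDisc_eq (hm : minpoly ℚ x = (cubicPoly c a b).map (Int.castRingHom ℚ)) :
    ∃ d : ℚ, ((cubicDisc c a b : ℤ) : ℚ) = d ^ 2 * discr K := by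
  let pb : PowerBasis ℚ K := ⟨x, 3, B, hB⟩
  have h1 : Algebra.discr ℚ B = (cubicDisc c a b : ℤ) := by
    have h := Algebra.discr_powerBasis_eq_norm ℚ pb
    have hfin : finrank ℚ K = 3 := pb.finrank
    have h' : aeval pb.gen (derivative (minpoly ℚ pb.gen)) = 3 * x ^ 2 + 2 * c * x + a := by
      change aeval x (derivative (minpoly ℚ x)) = _
      rw [hm]
      simp [cubicPoly]
      ring
    rw [h', norm_derivative B hB hx, hfin] at h
    change Algebra.discr ℚ B = _ at h
    rw [h]
    simp [cubicDisc]
    norm_num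
  let e : Free.ChooseBasisIndex ℤ (𝓞 K) ≃ Fin 3 := (integralBasis K).indexEquiv B
  let B' := (integralBasis K).reindex e
  have h2 : Algebra.discr ℚ B' = discr K := by
    rw [coe_discr, Basis.coe_reindex, Algebra.discr_reindex]
  refine ⟨(B'.toMatrix B).det, ?_⟩
  rw [← h1, ← h2, ← Algebra.discr_of_matrix_vecMul, Basis.toMatrix_map_vecMul]

omit hB hx in
lemma derivative_root_ne_zero (hm : minpoly ℚ x = (cubicPoly c a b).map (Int.castRingHom ℚ)) :
    (3 * x ^ 2 + 2 * c * x + a) ≠ 0 := by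
  intro h
  have h' : aeval x (derivative (minpoly ℚ x)) = 0 := by
    rw [hm, ← h]
    simp [cubicPoly]
    ring
  exact (Algebra.IsSeparable.isSeparable ℚ x).aeval_derivative_ne_zero (minpoly.aeval ℚ x) h'

end

section
variable {K : Type} [Field K] [NumberField K] {c a b : ℤ} {x : K}

lemma exists_isCubicGen (B : Basis (Fin 3) ℚ K) (hB : ∀ i, B i = x ^ (i : ℕ))
    (hx : x ^ 3 + c * x ^ 2 + a * x + b = 0) : ∃ θ : 𝓞 K, IsCubicGen θ c a b := by
  have hint : IsIntegral ℤ x := ⟨cubicPoly c a b, monic_cubicPoly c a b, by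
    rw [eval₂_cubicPoly]; exact hx⟩
  obtain ⟨θ, rfl⟩ : ∃ θ : 𝓞 K, (θ : K) = x := ⟨⟨x, (mem_integralClosure_iff ℤ K).2 hint⟩, rfl⟩
  refine ⟨θ, ?_, fun r => ?_, ?_⟩
  · apply RingOfIntegers.ext
    simpa using hx
  · have h : ((Algebra.norm ℤ (θ - r) : ℤ) : ℚ) =
        ((-(r ^ 3 + c * r ^ 2 + a * r + b) : ℤ) : ℚ) := by
      rw [Algebra.coe_norm_int]
      push_cast
      exact norm_root_sub B hB hx r
    exact_mod_cast h
  · rw [RingOfIntegers.rank, finrank_eq_card_basis B, Fintype.card_fin]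

/-- The embedding of a cubic order determined by a root. -/
abbrev rootAlgebra (hx : x ^ 3 + c * x ^ 2 + a * x + b = 0) : Algebra (CubicOrder c a b) K :=
  (AdjoinRoot.lift (Int.castRingHom K) x (by rw [eval₂_cubicPoly]; exact hx)).toAlgebra

variable (B : Basis (Fin 3) ℚ K) (hB : ∀ i, B i = x ^ (i : ℕ))
  (hx : x ^ 3 + c * x ^ 2 + a * x + b = 0)

lemma rootAlgebra_map (z₀ z₁ z₂ : ℤ) : letI := rootAlgebra hx
    algebraMap (CubicOrder c a b) K
      (z₀ + z₁ * AdjoinRoot.root (cubicPoly c a b) + z₂ * AdjoinRoot.root (cubicPoly c a b) ^ 2) =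
        z₀ + z₁ * x + z₂ * x ^ 2 := by
  letI := rootAlgebra hx
  have h : algebraMap (CubicOrder c a b) K (AdjoinRoot.root _) = x := AdjoinRoot.lift_root _
  simp only [map_add, map_mul, map_pow, map_intCast, h]

include hB in
lemma rootAlgebra_injective : letI := rootAlgebra hx
    Injective (algebraMap (CubicOrder c a b) K) := by
  letI := rootAlgebra hx
  rw [injective_iff_map_eq_zero]
  intro y hy
  obtain ⟨z₀, z₁, z₂, rfl⟩ := (isCubicOrder_adjoinRoot c a b).span y
  rw [rootAlgebra_map] at hy
  have h := Fintype.linearIndependent_iff.1 B.linearIndependent ![(z₀ : ℚ), z₁, z₂] (by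
    simp only [Fin.sum_univ_three, hB, Algebra.smul_def]
    simpa using hy)
  have h0 := h 0
  have h1 := h 1
  have h2 := h 2
  simp only [Matrix.cons_val, Int.cast_eq_zero] at h0 h1 h2
  simp [h0, h1, h2]

/-- The power basis of a cubic order, indexed by the degree of its field. -/
def orderBasis (c a b : ℤ) (B : Basis (Fin 3) ℚ K) :
    Basis (Fin (finrank ℚ K)) ℤ (CubicOrder c a b) :=
  (isCubicOrder_adjoinRoot c a b).basis.reindex
    (finCongr (by rw [finrank_eq_card_basis B, Fintype.card_fin]))

lemma polyGrowth_cubicOrder [IsDomain (CubicOrder c a b)] (B : Basis (Fin 3) ℚ K)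
    (hB : ∀ i, B i = x ^ (i : ℕ)) (hx : x ^ 3 + c * x ^ 2 + a * x + b = 0) :
    PolyGrowth (CubicOrder c a b) := by
  letI := rootAlgebra hx
  have := (isCubicOrder_adjoinRoot c a b).charZero
  exact polyGrowth_order (K := K) (orderBasis c a b B) (rootAlgebra_injective B hB hx)

lemma mem_one_iff (y : K) : letI := rootAlgebra hx
    y ∈ (1 : Submodule (CubicOrder c a b) K) ↔
      y ∈ Subalgebra.toSubmodule (Algebra.adjoin ℤ {x}) := by
  letI := rootAlgebra hx
  have hroot : algebraMap (CubicOrder c a b) K (AdjoinRoot.root _) = x := AdjoinRoot.lift_root _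
  rw [Submodule.mem_one, Subalgebra.mem_toSubmodule]
  constructor
  · rintro ⟨r, rfl⟩
    obtain ⟨z₀, z₁, z₂, rfl⟩ := (isCubicOrder_adjoinRoot c a b).span r
    rw [rootAlgebra_map]
    have hm : x ∈ Algebra.adjoin ℤ {x} := Algebra.subset_adjoin (Set.mem_singleton x)
    have hz : ∀ z : ℤ, (z : K) ∈ Algebra.adjoin ℤ {x} := fun z => _root_.intCast_mem _ z
    exact add_mem (add_mem (hz _) (mul_mem (hz _) hm)) (mul_mem (hz _) (pow_mem hm 2))
  · intro h
    induction h using Algebra.adjoin_induction with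
    | mem z hz => exact ⟨AdjoinRoot.root _, by rw [hroot, Set.mem_singleton_iff.1 hz]⟩
    | algebraMap r => exact ⟨r, by simp⟩
    | add _ _ _ _ h1 h2 =>
      obtain ⟨r, rfl⟩ := h1
      obtain ⟨s, rfl⟩ := h2
      exact ⟨r + s, map_add _ _ _⟩
    | mul _ _ _ _ h1 h2 =>
      obtain ⟨r, rfl⟩ := h1
      obtain ⟨s, rfl⟩ := h2
      exact ⟨r * s, map_mul _ _ _⟩

include hB in
lemma tau_derivative (hm : minpoly ℚ x = (cubicPoly c a b).map (Int.castRingHom ℚ)) (δ : Kˣ)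
    (hδ : (δ : K) = 3 * x ^ 2 + 2 * c * x + a) : letI := rootAlgebra hx
    tau δ (1 : Submodule (CubicOrder c a b) K) = 1 := by
  letI := rootAlgebra hx
  have hint : IsIntegral ℤ x := ⟨cubicPoly c a b, monic_cubicPoly c a b, by
    rw [eval₂_cubicPoly]; exact hx⟩
  have hadj : Algebra.adjoin ℚ {x} = ⊤ := by
    rw [← Algebra.toSubmodule_eq_top, eq_top_iff, ← B.span_eq, Submodule.span_le]
    rintro _ ⟨i, rfl⟩
    rw [hB]
    exact pow_mem (Algebra.subset_adjoin (Set.mem_singleton x)) _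
  have hd : aeval x (derivative (minpoly ℚ x)) = δ := by
    rw [hm, hδ]
    simp [cubicPoly]
    ring
  have key := traceForm_dualSubmodule_adjoin (A := ℤ) (K := ℚ) hadj hint
  rw [hd] at key
  ext y
  have h1 : y ∈ tau δ (1 : Submodule (CubicOrder c a b) K) ↔
      y * (δ : K)⁻¹ ∈ (Algebra.traceForm ℚ K).dualSubmodule
        (Subalgebra.toSubmodule (Algebra.adjoin ℤ {x})) := by
    change (∀ z ∈ (1 : Submodule (CubicOrder c a b) K), ∃ m : ℤ, (m : ℚ) = _) ↔ _
    rw [LinearMap.BilinForm.mem_dualSubmodule]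
    refine forall_congr' fun z => ?_
    rw [mem_one_iff hx, Submodule.mem_one, Algebra.traceForm_apply,
      mul_right_comm y z]
    rfl
  rw [h1, key, mem_one_iff hx, mul_comm, ← smul_eq_mul]
  constructor
  · intro h
    obtain ⟨z, hz, hzy⟩ := h
    have : z = y := by
      have h2 : (δ : K)⁻¹ * z = (δ : K)⁻¹ * y := hzy
      exact mul_left_cancel₀ (inv_ne_zero δ.ne_zero) h2
    rwa [← this]
  · exact fun h => Submodule.smul_mem_pointwise_smul _ _ _ h

lemma central_value_cubicOrder [IsDomain (CubicOrder c a b)] (B : Basis (Fin 3) ℚ K)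
    (hB : ∀ i, B i = x ^ (i : ℕ)) (hx : x ^ 3 + c * x ^ 2 + a * x + b = 0)
    (hm : minpoly ℚ x = (cubicPoly c a b).map (Int.castRingHom ℚ))
    {g : ℂ → ℂ} (hg : IsDedekindZeta K g) (w₀ : InfinitePlace K) (hw₀ : w₀.mult = 1)
    {ι : Type*} [Fintype ι] (n : ι → ℕ) (f : InfinitePlace K ≃ ι) (hf : ∀ w, n (f w) = w.mult) :
    ∃ C : ℝ, 0 < C ∧ g (1 / 2) = ((C * ∫ y : ι → ℝ, psiW n (f w₀) y *
      (exp (nuW n y / 2) * WS (CubicOrder c a b)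
        (log |((cubicDisc c a b : ℤ) : ℝ)| / 2 + nuW n y)) : ℝ) : ℂ) := by
  letI := rootAlgebra hx
  have := (isCubicOrder_adjoinRoot c a b).charZero
  let δ : Kˣ := Units.mk0 _ (derivative_root_ne_zero hm)
  obtain ⟨C, hC, h⟩ := central_value_integral (orderBasis c a b B)
    (rootAlgebra_injective B hB hx) hg w₀ hw₀ (tau_derivative B hB hx hm δ rfl)
  refine ⟨C, hC, ?_⟩
  have hn : |((Algebra.norm ℚ (δ : K) : ℚ) : ℝ)| = |((cubicDisc c a b : ℤ) : ℝ)| := by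
    have : Algebra.norm ℚ (δ : K) = -(cubicDisc (c : ℚ) a b) := norm_derivative B hB hx
    rw [this, Rat.cast_neg, abs_neg]
    simp [cubicDisc]
  rw [h, hn, integral_psiW_reindex f _ n hf w₀ fun u => exp (u / 2) * WS (CubicOrder c a b)
    (log |((cubicDisc c a b : ℤ) : ℝ)| / 2 + u)]

end

/-- Multiplicities of `r` real and `s` complex places. -/
def placeMult (r s : ℕ) : Fin r ⊕ Fin s → ℕ := Sum.elim (fun _ => 1) (fun _ => 2)

lemma exists_placeEquiv (K : Type) [Field K] [NumberField K] {r s : ℕ}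
    (hr : InfinitePlace.nrRealPlaces K = r) (hs : InfinitePlace.nrComplexPlaces K = s) :
    ∃ f : InfinitePlace K ≃ Fin r ⊕ Fin s, ∀ w, placeMult r s (f w) = w.mult := by
  let e₁ : {w : InfinitePlace K // w.IsReal} ≃ Fin r := Fintype.equivFinOfCardEq hr
  let e₂ : {w : InfinitePlace K // ¬ w.IsReal} ≃ Fin s :=
    (Equiv.subtypeEquivRight fun w => InfinitePlace.not_isReal_iff_isComplex).trans
      (Fintype.equivFinOfCardEq hs)
  refine ⟨(Equiv.sumCompl fun w : InfinitePlace K => w.IsReal).symm.trans (e₁.sumCongr e₂),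
    fun w => ?_⟩
  by_cases hw : w.IsReal
  · simp [placeMult, Equiv.sumCompl_symm_apply_of_pos hw, hw.mult_eq_one]
  · simp [placeMult, Equiv.sumCompl_symm_apply_of_neg hw,
      (InfinitePlace.not_isReal_iff_isComplex.1 hw).mult_eq_two]

lemma exists_signature {e : ℤ} (he : e = 1 ∨ e = -1) : ∃ r s : ℕ,
    ∀ (K : Type) [Field K] [NumberField K], finrank ℚ K = 3 → 0 < e * discr K →
      InfinitePlace.nrRealPlaces K = r + 1 ∧ InfinitePlace.nrComplexPlaces K = s := by
  rcases he with rfl | rfl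
  · refine ⟨2, 0, fun K _ _ h3 hd => ?_⟩
    have h := InfinitePlace.card_add_two_mul_card_eq_rank K
    have hsgn := sign_discr (K := K)
    rw [Int.sign_eq_one_of_pos (by linarith)] at hsgn
    have hc : InfinitePlace.nrComplexPlaces K ≠ 1 := by
      intro h1
      rw [h1] at hsgn
      norm_num at hsgn
    omega
  · refine ⟨0, 1, fun K _ _ h3 hd => ?_⟩
    have h := InfinitePlace.card_add_two_mul_card_eq_rank K
    have hsgn := sign_discr (K := K)
    rw [Int.sign_eq_neg_one_of_neg (by linarith)] at hsgn
    have hc : InfinitePlace.nrComplexPlaces K ≠ 0 := by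
      intro h1
      rw [h1] at hsgn
      norm_num at hsgn
    omega

lemma isDomain_cubicOrder {c a b : ℤ} (hf : Irreducible (cubicPoly c a b)) :
    IsDomain (CubicOrder c a b) :=
  AdjoinRoot.isDomain_of_prime hf.prime

end

end CubicZeta

open CubicZeta in
/-- For any choice of sign `e = ±1`, any finite set `S` of primes and any prescription of
splitting types `σ p` at the primes `p ∈ S`, there are infinitely many non-Galois cubic
fields `K` with `e·Δ(K) > 0`, splitting type `σ p` at each `p ∈ S`, and `ζ_K(1/2) < 0`. -/
theorem negative_central_value_with_local_specifications
    (e : ℤ) (he : e = 1 ∨ e = -1)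
    (S : Finset ℕ) (hS : ∀ p ∈ S, p.Prime) (σ : ℕ → SplitType) :
    ∀ B : ℝ, ∃ (K : Type) (_ : Field K) (_ : NumberField K),
      Module.finrank ℚ K = 3 ∧
      B < |(NumberField.discr K : ℝ)| ∧
      0 < e * NumberField.discr K ∧
      (∀ p ∈ S, HasSplitType K p (σ p)) ∧
      ¬ IsGalois ℚ K ∧
      ∀ g : ℂ → ℂ, IsDedekindZeta K g →
        ∃ r : ℝ, r < 0 ∧ g (1 / 2) = (r : ℂ) := by
  intro B
  obtain ⟨N, hN⟩ := exists_nat_ge B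
  obtain ⟨c, a₀, b₀, Q, hQ, hΔ, hloc⟩ := exists_coefficients S hS σ N
  have hdom : ∀ a b : ℤ, (Q : ℤ) ∣ a - a₀ → (Q : ℤ) ∣ b - b₀ → IsDomain (CubicOrder c a b) :=
    fun a b ha hb => isDomain_cubicOrder (hloc a b ha hb).1
  have hQd : (Q : ℤ) ∣ (modulus c a₀ b₀ (Q * (cubicDisc c a₀ b₀).natAbs) : ℤ) :=
    Int.natCast_dvd_natCast.2 ((dvd_mul_right _ _).trans (dvd_mul_left _ _))
  have hPG : PolyGrowth (CubicOrder c a₀ b₀) := by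
    have := hdom a₀ b₀ (by simp) (by simp)
    obtain ⟨K, _, _, x, h3, hx, hm⟩ :=
      exists_numberField_root (hloc a₀ b₀ (by simp) (by simp)).1
    obtain ⟨b, hb⟩ := exists_powerBasis h3 hm
    exact polyGrowth_cubicOrder b hb hx
  obtain ⟨r, s, hrs⟩ := exists_signature he
  have he' : (e : ℝ) = 1 ∨ (e : ℝ) = -1 := by
    rcases he with rfl | rfl <;> simp
  obtain ⟨a, b, ha, hb, hsign, hneg⟩ := exists_negative (n := placeMult (r + 1) s)
    (i₀ := Sum.inl 0) (mul_ne_zero hQ (Int.natAbs_ne_zero.2 hΔ)) hΔ (dvd_mul_left _ _)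
    (by rintro (i | i) <;> simp [placeMult]) (by simp [placeMult]) hPG he'
    (fun a b ha hb => hdom a b (hQd.trans ha) (hQd.trans hb))
  obtain ⟨hirr, hK⟩ := hloc a b (hQd.trans ha) (hQd.trans hb)
  have := isDomain_cubicOrder hirr
  obtain ⟨K, _, _, x, h3, hx, hm⟩ := exists_numberField_root hirr
  obtain ⟨P, hP⟩ := exists_powerBasis h3 hm
  obtain ⟨θ, hθ⟩ := exists_isCubicGen P hP hx
  obtain ⟨hsplit, hlarge, hgal⟩ := hK K θ hθ
  have hdisc : 0 < e * NumberField.discr K := by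
    obtain ⟨d, hd⟩ := exists_cubicDisc_eq P hP hx hm
    have h1 : 0 < e * cubicDisc c a b := by exact_mod_cast hsign
    have h2 : (0 : ℚ) < e * (cubicDisc c a b : ℤ) := by exact_mod_cast h1
    rw [hd, mul_left_comm] at h2
    have h4 : (0 : ℚ) < e * NumberField.discr K := pos_of_mul_pos_right h2 (sq_nonneg d)
    exact_mod_cast h4
  refine ⟨K, _, _, h3, hN.trans_lt (by exact_mod_cast hlarge), hdisc, hsplit, hgal,
    fun g hg => ?_⟩
  obtain ⟨hr, hs⟩ := hrs K h3 hdisc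
  obtain ⟨f, hf⟩ := exists_placeEquiv K hr hs
  obtain ⟨C, hC, hval⟩ := central_value_cubicOrder P hP hx hm hg (f.symm (Sum.inl 0))
    (by rw [← hf]; simp [placeMult]) (placeMult (r + 1) s) f hf
  rw [f.apply_symm_apply] at hval
  exact ⟨_, mul_neg_of_pos_of_neg hC hneg, hval⟩
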